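/- Loop-complexity of surfaces is not subadditive under connected sum: the Klein bottle K satisfies K = RP² # RP², lc(K) = 1, and lc(RP²) = 0, so lc(RP² # RP²) > lc(RP²) + lc(RP²). -/

import Mathlib

open Set Topology unitInterval

noncomputable section

/-! ### Basic model spaces -/

abbrev R3 : Type := Fin 3 → ℝ
abbrev R2 : Type := Fin 2 → ℝ
abbrev EuclSp (n : ℕ) : Type := EuclideanSpace ℝ (Fin n)

/-- The union of the first `k` coordinate planes in `ℝ³`:
the local models for simple (`k = 1`), double (`k = 2`) and triple (`k = 3`) points. -/
def coordPlanes (k : ℕ) : Set R3 := {x | ∃ i : Fin 3, (i : ℕ) < k ∧ x i = 0}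

abbrev Sphere3 : Type := ↥(Metric.sphere (0 : EuclSp 4) 1)
abbrev Sphere2 : Type := ↥(Metric.sphere (0 : EuclSp 3) 1)
abbrev Circle1 : Type := ↥(Metric.sphere (0 : EuclSp 2) 1)

/-- The antipodal relation on the `n`-sphere. -/
def antipodalRel (n : ℕ) (x y : Metric.sphere (0 : EuclSp (n + 1)) 1) : Prop :=
  (y : EuclSp (n + 1)) = -(x : EuclSp (n + 1))

/-- Real projective `n`-space, as the quotient of the `n`-sphere by the antipodal map. -/
abbrev RP (n : ℕ) : Type := Quot (antipodalRel n)

/-- The unit sphere of `ℂ²`, i.e. the 3-sphere. -/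
abbrev SphereC : Type := Metric.sphere (0 : EuclideanSpace ℂ (Fin 2)) 1

/-- The relation on `S³ ⊆ ℂ²` generating the lens space `L(p,q)`:
`(z₀, z₁) ∼ (ζ z₀, ζ^q z₁)` for `ζ` a `p`-th root of unity. -/
def lensRel (p q : ℕ) (x y : SphereC) : Prop :=
  ∃ k : ℕ,
    (y : EuclideanSpace ℂ (Fin 2)) 0 =
      Complex.exp (2 * Real.pi * Complex.I * k / p) * (x : EuclideanSpace ℂ (Fin 2)) 0 ∧
    (y : EuclideanSpace ℂ (Fin 2)) 1 =
      Complex.exp (2 * Real.pi * Complex.I * (k * q) / p) * (x : EuclideanSpace ℂ (Fin 2)) 1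

/-- The lens space `L(p,q)`. -/
abbrev Lens (p q : ℕ) : Type := Quot (lensRel p q)

/-- The relation generating the twisted bundle `S² ×~ S¹` as a mapping torus of the
antipodal map of `S²`. -/
def twistRel (a b : ↥(Metric.sphere (0 : EuclSp 3) 1) × ℝ) : Prop :=
  ((b.1 : EuclSp 3) = -(a.1 : EuclSp 3)) ∧ b.2 = a.2 + 1

/-- The twisted 2-sphere bundle over the circle, `S² ×~ S¹`. -/
abbrev TwistedS2S1 : Type := Quot twistRel

/-! ### Dehn surfaces -/

/-- `x` has a neighbourhood `U` in `M` in which `Sg` looks like the union of the first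
`k` coordinate planes of `ℝ³`, with `x` corresponding to the origin.  This is the local
model of a point of a Dehn surface with `k` sheets (transversality). -/
def LocalSheets (M : Type) [TopologicalSpace M] (Sg : Set M) (k : ℕ) (x : M) : Prop :=
  ∃ (U : Set M) (_ : IsOpen U) (hx : x ∈ U) (φ : ↥U ≃ₜ R3),
    φ ⟨x, hx⟩ = 0 ∧ (Subtype.val ⁻¹' Sg : Set U) = ⇑φ ⁻¹' coordPlanes k

/-- A Dehn surface in `M`: the image of a transverse immersion of a (possibly disconnected)
closed surface, described via its local models: every point is simple, double or triple. -/
def IsDehnSurface (M : Type) [TopologicalSpace M] (Sg : Set M) : Prop :=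
  IsClosed Sg ∧ Sg.Nonempty ∧ ∀ x ∈ Sg, ∃ k, 1 ≤ k ∧ k ≤ 3 ∧ LocalSheets M Sg k x

/-- The set of triple points of a Dehn surface. -/
def triplePoints (M : Type) [TopologicalSpace M] (Sg : Set M) : Set M :=
  {x | x ∈ Sg ∧ LocalSheets M Sg 3 x}

/-- The set of simple (non-singular) points of a Dehn surface. -/
def simplePoints (M : Type) [TopologicalSpace M] (Sg : Set M) : Set M :=
  {x | x ∈ Sg ∧ LocalSheets M Sg 1 x}

/-- The singular set `S(Σ)` of a Dehn surface: its non-simple points. -/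
def singularSet (M : Type) [TopologicalSpace M] (Sg : Set M) : Set M :=
  Sg \ simplePoints M Sg

/-- Every connected component of `s` is homeomorphic to the model space `T`. -/
def ComponentsHomeo (M : Type) [TopologicalSpace M] (s : Set M) (T : Type)
    [TopologicalSpace T] : Prop :=
  ∀ x ∈ s, Nonempty (↥(connectedComponentIn s x) ≃ₜ T)

/-- A quasi-filling Dehn surface: a Dehn surface whose complement is made up of
(open) balls. -/
def QuasiFilling (M : Type) [TopologicalSpace M] (Sg : Set M) : Prop :=
  IsDehnSurface M Sg ∧ ComponentsHomeo M Sgᶜ R3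

/-- A filling Dehn surface: its singularities induce a cell decomposition of `M`. -/
def Filling (M : Type) [TopologicalSpace M] (Sg : Set M) : Prop :=
  QuasiFilling M Sg ∧ (triplePoints M Sg).Nonempty ∧
  ComponentsHomeo M (singularSet M Sg \ triplePoints M Sg) ℝ ∧
  ComponentsHomeo M (Sg \ singularSet M Sg) R2

/-- The surface-complexity: the minimal number of triple points of a quasi-filling
Dehn surface of `M`. -/
def sc (M : Type) [TopologicalSpace M] : ℕ :=
  sInf {n | ∃ Sg : Set M, QuasiFilling M Sg ∧ (triplePoints M Sg).ncard = n}

/-! ### Embedded surfaces and `P²`-irreducibility -/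

/-- An embedded closed surface in `M` (a Dehn surface all of whose points are simple). -/
def IsEmbeddedClosedSurface (M : Type) [TopologicalSpace M] (F : Set M) : Prop :=
  IsClosed F ∧ F.Nonempty ∧ ∀ x ∈ F, LocalSheets M F 1 x

/-- The surface `F` bounds a ball in `M`. -/
def BoundsABall (M : Type) [TopologicalSpace M] (F : Set M) : Prop :=
  ∃ B : Set M, IsClosed B ∧ frontier B = F ∧
    Nonempty (↥B ≃ₜ ↥(Metric.closedBall (0 : EuclSp 3) 1))

/-- The surface `F` is two-sided in `M` (it has a product neighbourhood). -/
def TwoSided (M : Type) [TopologicalSpace M] (F : Set M) : Prop :=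
  ∃ U : Set M, IsOpen U ∧ F ⊆ U ∧ Nonempty (↥U ≃ₜ ↥F × ℝ)

/-- `M` is `P²`-irreducible: every embedded 2-sphere bounds a ball and `M` contains no
two-sided embedded projective plane. -/
def P2Irreducible (M : Type) [TopologicalSpace M] : Prop :=
  (∀ F : Set M, IsEmbeddedClosedSurface M F → Nonempty (↥F ≃ₜ Sphere2) → BoundsABall M F) ∧
  (∀ F : Set M, IsEmbeddedClosedSurface M F → TwoSided M F → ¬ Nonempty (↥F ≃ₜ RP 2))

end
/-! ### Bubble moves -/

noncomputable section

/-- The local model of the result of a bubble-move: a plane together with a small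
sphere centred at one of its points, meeting it in one circle. -/
def bubbleModel : Set R3 := coordPlanes 1 ∪ Metric.sphere (0 : R3) 1

/-- `Sg'` is obtained from `Sg` by a bubble-move performed inside the open set `U`:
inside `U` a small disc around a simple point is replaced by the bubble model, and
nothing changes outside `U`. -/
def BubbleMoveIn (M : Type) [TopologicalSpace M] (U : Set M) (Sg Sg' : Set M) : Prop :=
  ∃ (_ : IsOpen U) (φ : ↥U ≃ₜ R3),
    (Subtype.val ⁻¹' Sg : Set U) = ⇑φ ⁻¹' coordPlanes 1 ∧
    (Subtype.val ⁻¹' Sg' : Set U) = ⇑φ ⁻¹' bubbleModel ∧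
    Sg' \ U = Sg \ U

/-- `Sg'` is obtained from `Sg` by one bubble-move. -/
def BubbleMove (M : Type) [TopologicalSpace M] (Sg Sg' : Set M) : Prop :=
  ∃ U : Set M, BubbleMoveIn M U Sg Sg'

/-- `Sg` is derived from `Sg₀` by a finite sequence of bubble-moves. -/
def DerivedFrom (M : Type) [TopologicalSpace M] (Sg₀ Sg : Set M) : Prop :=
  Relation.ReflTransGen (BubbleMove M) Sg₀ Sg

/-- A bubble-move avoiding (not involving) the set `D`. -/
def BubbleMoveAvoiding (M : Type) [TopologicalSpace M] (D : Set M) (Sg Sg' : Set M) : Prop :=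
  ∃ U : Set M, Disjoint U D ∧ BubbleMoveIn M U Sg Sg'

/-- `Sg` is derived from `Sg₀` by finitely many bubble-moves, none of which involves `D`. -/
def DerivedFromAvoiding (M : Type) [TopologicalSpace M] (D Sg₀ Sg : Set M) : Prop :=
  Relation.ReflTransGen (BubbleMoveAvoiding M D) Sg₀ Sg

/-! ### Connected sums -/

/-- `N` is a connected sum of `M₁` and `M₂`: it is covered by two closed pieces, glued
along a 2-sphere, respectively homeomorphic to the complements of open balls in `M₁`
and in `M₂`. -/
def IsConnSum (N : Type) [TopologicalSpace N] (M₁ : Type) [TopologicalSpace M₁]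
    (M₂ : Type) [TopologicalSpace M₂] : Prop :=
  ∃ (B₁ : Set M₁) (B₂ : Set M₂) (A₁ A₂ : Set N),
    Nonempty (↥B₁ ≃ₜ ↥(Metric.closedBall (0 : EuclSp 3) 1)) ∧
    Nonempty (↥B₂ ≃ₜ ↥(Metric.closedBall (0 : EuclSp 3) 1)) ∧
    IsClosed A₁ ∧ IsClosed A₂ ∧ A₁ ∪ A₂ = Set.univ ∧
    A₁ ∩ A₂ = frontier A₁ ∧ A₁ ∩ A₂ = frontier A₂ ∧
    Nonempty (↥(A₁ ∩ A₂) ≃ₜ Sphere2) ∧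
    Nonempty (↥A₁ ≃ₜ ↥((interior B₁)ᶜ : Set M₁)) ∧
    Nonempty (↥A₂ ≃ₜ ↥((interior B₂)ᶜ : Set M₂))

/-- `N` is the connected sum of the manifolds `Ms 0, …, Ms n`. -/
def IsConnSumMulti : (n : ℕ) → (Ms : Fin (n + 1) → Type) →
    (tms : ∀ i, TopologicalSpace (Ms i)) → (N : Type) → TopologicalSpace N → Prop
  | 0, Ms, tms, N, tN => Nonempty (@Homeomorph N (Ms 0) tN (tms 0))
  | (n + 1), Ms, tms, N, tN =>
    ∃ (P : Type) (tP : TopologicalSpace P),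
      IsConnSumMulti n (fun i => Ms i.castSucc) (fun i => tms i.castSucc) P tP ∧
      @IsConnSum N tN P tP (Ms (Fin.last (n + 1))) (tms (Fin.last (n + 1)))

end
/-! ### Cubulations and triangulations -/

noncomputable section

abbrev ICube : Type := Fin 3 → ↥unitInterval
abbrev ISquare : Type := Fin 2 → ↥unitInterval
abbrev ISeg : Type := Fin 1 → ↥unitInterval

/-- The open `n`-cube inside the closed one. -/
def openCell (n : ℕ) : Set (Fin n → ↥unitInterval) := {x | ∀ i, x i ≠ 0 ∧ x i ≠ 1}

/-- A cubulation of `M`: a cell decomposition whose 3-cells are cubes, each glued along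
6 faces arranged like the boundary of a cube, each face being glued along 4 edges
(self-adjacencies and multiple adjacencies are allowed).  Cells are given by
characteristic maps which are injective on the open cells, the open cells partition `M`,
and the boundary of every cell is attached through cells of lower dimension. -/
structure Cubulation (M : Type) [TopologicalSpace M] where
  nc : ℕ
  nf : ℕ
  ne : ℕ
  nv : ℕ
  cmap : Fin nc → C(ICube, M)
  fmap : Fin nf → C(ISquare, M)
  emap : Fin ne → C(ISeg, M)
  vmap : Fin nv → M
  cube_injOn : ∀ i, Set.InjOn (cmap i) (openCell 3)
  face_injOn : ∀ i, Set.InjOn (fmap i) (openCell 2)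
  edge_injOn : ∀ i, Set.InjOn (emap i) (openCell 1)
  vert_inj : Function.Injective vmap
  cells_cover : ∀ x : M, (∃ i, x ∈ cmap i '' openCell 3) ∨ (∃ i, x ∈ fmap i '' openCell 2) ∨
      (∃ i, x ∈ emap i '' openCell 1) ∨ (∃ i, x = vmap i)
  cube_disj : ∀ i j, i ≠ j → Disjoint (cmap i '' openCell 3) (cmap j '' openCell 3)
  face_disj : ∀ i j, i ≠ j → Disjoint (fmap i '' openCell 2) (fmap j '' openCell 2)
  edge_disj : ∀ i j, i ≠ j → Disjoint (emap i '' openCell 1) (emap j '' openCell 1)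
  cube_face_disj : ∀ i j, Disjoint (cmap i '' openCell 3) (fmap j '' openCell 2)
  cube_edge_disj : ∀ i j, Disjoint (cmap i '' openCell 3) (emap j '' openCell 1)
  cube_vert_disj : ∀ i j, vmap j ∉ cmap i '' openCell 3
  face_edge_disj : ∀ i j, Disjoint (fmap i '' openCell 2) (emap j '' openCell 1)
  face_vert_disj : ∀ i j, vmap j ∉ fmap i '' openCell 2
  edge_vert_disj : ∀ i j, vmap j ∉ emap i '' openCell 1
  cube_open : ∀ i, IsOpen (cmap i '' openCell 3)
  face_of_cube : ∀ (i : Fin nc) (d : Fin 3) (ε : Bool),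
      ∃ (j : Fin nf) (h : ISquare ≃ₜ ISquare),
        ∀ x : ISquare, cmap i (d.insertNth (if ε then 1 else 0) x) = fmap j (h x)
  edge_of_face : ∀ (i : Fin nf) (d : Fin 2) (ε : Bool),
      ∃ (j : Fin ne) (h : ISeg ≃ₜ ISeg),
        ∀ x : ISeg, fmap i (d.insertNth (if ε then 1 else 0) x) = emap j (h x)
  vert_of_edge : ∀ (i : Fin ne) (ε : Bool), ∃ j : Fin nv,
      emap i (fun _ => if ε then 1 else 0) = vmap j

/-- The interior of the standard simplex. -/
def simplexInt (n : ℕ) : Set ↥(stdSimplex ℝ (Fin n)) := {x | ∀ i, (x : Fin n → ℝ) i ≠ 0}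

/-- A triangulation of a closed 3-manifold `M`, by characteristic maps of tetrahedra,
triangles, edges and vertices: maps are injective on open cells, open cells partition `M`,
and each face of each cell is a cell of lower dimension. -/
structure Triangulation (M : Type) [TopologicalSpace M] where
  nt : ℕ
  nf : ℕ
  ne : ℕ
  nv : ℕ
  tmap : Fin nt → C(↥(stdSimplex ℝ (Fin 4)), M)
  fmap : Fin nf → C(↥(stdSimplex ℝ (Fin 3)), M)
  emap : Fin ne → C(↥(stdSimplex ℝ (Fin 2)), M)
  vmap : Fin nv → M
  t_injOn : ∀ i, Set.InjOn (tmap i) (simplexInt 4)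
  f_injOn : ∀ i, Set.InjOn (fmap i) (simplexInt 3)
  e_injOn : ∀ i, Set.InjOn (emap i) (simplexInt 2)
  v_inj : Function.Injective vmap
  cells_cover : ∀ x : M, (∃ i, x ∈ tmap i '' simplexInt 4) ∨ (∃ i, x ∈ fmap i '' simplexInt 3) ∨
      (∃ i, x ∈ emap i '' simplexInt 2) ∨ (∃ i, x = vmap i)
  t_disj : ∀ i j, i ≠ j → Disjoint (tmap i '' simplexInt 4) (tmap j '' simplexInt 4)
  f_disj : ∀ i j, i ≠ j → Disjoint (fmap i '' simplexInt 3) (fmap j '' simplexInt 3)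
  e_disj : ∀ i j, i ≠ j → Disjoint (emap i '' simplexInt 2) (emap j '' simplexInt 2)
  tf_disj : ∀ i j, Disjoint (tmap i '' simplexInt 4) (fmap j '' simplexInt 3)
  te_disj : ∀ i j, Disjoint (tmap i '' simplexInt 4) (emap j '' simplexInt 2)
  tv_disj : ∀ i j, vmap j ∉ tmap i '' simplexInt 4
  fe_disj : ∀ i j, Disjoint (fmap i '' simplexInt 3) (emap j '' simplexInt 2)
  fv_disj : ∀ i j, vmap j ∉ fmap i '' simplexInt 3
  ev_disj : ∀ i j, vmap j ∉ emap i '' simplexInt 2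
  t_open : ∀ i, IsOpen (tmap i '' simplexInt 4)
  face_t : ∀ (i : Fin nt) (d : Fin 4), ∃ j : Fin nf,
      tmap i '' {x | (x : Fin 4 → ℝ) d = 0} = Set.range (fmap j)
  face_f : ∀ (i : Fin nf) (d : Fin 3), ∃ j : Fin ne,
      fmap i '' {x | (x : Fin 3 → ℝ) d = 0} = Set.range (emap j)
  face_e : ∀ (i : Fin ne) (d : Fin 2), ∃ j : Fin nv,
      emap i '' {x | (x : Fin 2 → ℝ) d = 0} = {vmap j}

end
/-! ### Simple spines and Matveev complexity -/

noncomputable section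

/-- Local model: a plane. -/
def planeModel : Set R3 := {x | x 0 = 0}

/-- Local model: a line. -/
def lineModel : Set R3 := {x | x 0 = 0 ∧ x 1 = 0}

/-- Local model: a point. -/
def pointModel : Set R3 := {(0 : R3)}

/-- Local model: a triple line (three half-planes meeting along a line). -/
def tripleLineModel : Set R3 :=
  {x | (0 ≤ x 0 ∧ x 1 = 0) ∨ (x 0 ≤ 0 ∧ x 1 = x 0) ∨ (x 0 ≤ 0 ∧ x 1 = -x 0)}

/-- The vertices of a regular tetrahedron. -/
def tetraVert : Fin 4 → R3 := ![![1, 1, 1], ![1, -1, -1], ![-1, 1, -1], ![-1, -1, 1]]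

/-- Local model of a vertex of a simple polyhedron: the cone over the 1-skeleton of a
tetrahedron. -/
def spineVertexModel : Set R3 :=
  {x | ∃ i j : Fin 4, i ≠ j ∧ ∃ t : ℝ, 0 ≤ t ∧
    ∃ y ∈ segment ℝ (tetraVert i) (tetraVert j), x = t • y}

/-- `P` looks like the model set `model ⊆ ℝ³` near `x`. -/
def LocalSpineModel (M : Type) [TopologicalSpace M] (P : Set M) (model : Set R3)
    (x : M) : Prop :=
  ∃ (U : Set M) (_ : IsOpen U) (hx : x ∈ U) (φ : ↥U ≃ₜ R3),
    φ ⟨x, hx⟩ = 0 ∧ (Subtype.val ⁻¹' P : Set U) = ⇑φ ⁻¹' model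

/-- A simple polyhedron: the link of every point embeds in the 1-skeleton of the
tetrahedron; equivalently every point has one of the standard local models. -/
def IsSimplePolyhedron (M : Type) [TopologicalSpace M] (P : Set M) : Prop :=
  IsClosed P ∧ P.Nonempty ∧ ∀ x ∈ P,
    LocalSpineModel M P planeModel x ∨ LocalSpineModel M P tripleLineModel x ∨
    LocalSpineModel M P spineVertexModel x ∨ LocalSpineModel M P lineModel x ∨
    LocalSpineModel M P pointModel x

/-- A simple spine of a closed manifold `M`: a simple polyhedron whose complement is
one open ball. -/
def IsSimpleSpine (M : Type) [TopologicalSpace M] (P : Set M) : Prop :=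
  IsSimplePolyhedron M P ∧ IsConnected Pᶜ ∧ ComponentsHomeo M Pᶜ R3

/-- The vertices of a simple polyhedron. -/
def spineVertices (M : Type) [TopologicalSpace M] (P : Set M) : Set M :=
  {x | x ∈ P ∧ LocalSpineModel M P spineVertexModel x}

/-- The Matveev complexity: the minimal number of vertices of a simple spine of `M`. -/
def matveevComplexity (M : Type) [TopologicalSpace M] : ℕ :=
  sInf {n | ∃ P : Set M, IsSimpleSpine M P ∧ (spineVertices M P).ncard = n}

/-! ### Dehn loops on surfaces and loop-complexity -/

/-- The union of the first `k` coordinate lines in `ℝ²`. -/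
def coordLines (k : ℕ) : Set R2 := {x | ∃ i : Fin 2, (i : ℕ) < k ∧ x i = 0}

/-- Local model of a point of a Dehn loop with `k` strands. -/
def LocalStrands (S : Type) [TopologicalSpace S] (G : Set S) (k : ℕ) (x : S) : Prop :=
  ∃ (U : Set S) (_ : IsOpen U) (hx : x ∈ U) (φ : ↥U ≃ₜ R2),
    φ ⟨x, hx⟩ = 0 ∧ (Subtype.val ⁻¹' G : Set U) = ⇑φ ⁻¹' coordLines k

/-- A Dehn loop in the surface `S`: the image of a transverse immersion of a disjoint
union of circles; every point is smooth or a crossing point. -/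
def IsDehnLoop (S : Type) [TopologicalSpace S] (G : Set S) : Prop :=
  IsClosed G ∧ G.Nonempty ∧ ∀ x ∈ G, ∃ k, 1 ≤ k ∧ k ≤ 2 ∧ LocalStrands S G k x

/-- The crossing points of a Dehn loop. -/
def crossingPoints (S : Type) [TopologicalSpace S] (G : Set S) : Set S :=
  {x | x ∈ G ∧ LocalStrands S G 2 x}

/-- A quasi-filling Dehn loop: its complement consists of open discs. -/
def QuasiFillingLoop (S : Type) [TopologicalSpace S] (G : Set S) : Prop :=
  IsDehnLoop S G ∧ ComponentsHomeo S Gᶜ R2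

/-- The loop-complexity of a surface: the minimal number of crossing points of a
quasi-filling Dehn loop. -/
def lc (S : Type) [TopologicalSpace S] : ℕ :=
  sInf {n | ∃ G : Set S, QuasiFillingLoop S G ∧ (crossingPoints S G).ncard = n}

/-- Connected sum of surfaces. -/
def IsConnSum2 (N : Type) [TopologicalSpace N] (M₁ : Type) [TopologicalSpace M₁]
    (M₂ : Type) [TopologicalSpace M₂] : Prop :=
  ∃ (B₁ : Set M₁) (B₂ : Set M₂) (A₁ A₂ : Set N),
    Nonempty (↥B₁ ≃ₜ ↥(Metric.closedBall (0 : EuclSp 2) 1)) ∧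
    Nonempty (↥B₂ ≃ₜ ↥(Metric.closedBall (0 : EuclSp 2) 1)) ∧
    IsClosed A₁ ∧ IsClosed A₂ ∧ A₁ ∪ A₂ = Set.univ ∧
    A₁ ∩ A₂ = frontier A₁ ∧ A₁ ∩ A₂ = frontier A₂ ∧
    Nonempty (↥(A₁ ∩ A₂) ≃ₜ Circle1) ∧
    Nonempty (↥A₁ ≃ₜ ↥((interior B₁)ᶜ : Set M₁)) ∧
    Nonempty (↥A₂ ≃ₜ ↥((interior B₂)ᶜ : Set M₂))

/-- The 2-torus. -/
abbrev Torus2 : Type := Circle1 × Circle1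

/-- `S` is the closed orientable surface of genus `g` (a connected sum of `g` tori). -/
def IsOrientableSurfaceOfGenus : (g : ℕ) → (S : Type) → TopologicalSpace S → Prop
  | 0, S, tS => Nonempty (@Homeomorph S Sphere2 tS _)
  | (g + 1), S, tS =>
    ∃ (P : Type) (tP : TopologicalSpace P),
      IsOrientableSurfaceOfGenus g P tP ∧ @IsConnSum2 S tS P tP Torus2 _

/-- `S` is the closed non-orientable surface of genus `g ≥ 1` (a connected sum of `g`
projective planes). -/
def IsNonorientableSurfaceOfGenus : (g : ℕ) → (S : Type) → TopologicalSpace S → Prop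
  | 0, _, _ => False
  | 1, S, tS => Nonempty (@Homeomorph S (RP 2) tS _)
  | (g + 2), S, tS =>
    ∃ (P : Type) (tP : TopologicalSpace P),
      IsNonorientableSurfaceOfGenus (g + 1) P tP ∧ @IsConnSum2 S tS P tP (RP 2) _

end
/-! ### Special quasi-filling Dehn surfaces -/

noncomputable section

/-- `Sg` is a double projective plane: two embedded projective planes intersecting
along a loop which is non-contractible in both of them. -/
def IsDoubleRP2 (M : Type) [TopologicalSpace M] (Sg : Set M) : Prop :=
  ∃ P₁ P₂ : Set M, Sg = P₁ ∪ P₂ ∧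
    Nonempty (↥P₁ ≃ₜ RP 2) ∧ Nonempty (↥P₂ ≃ₜ RP 2) ∧
    Nonempty (↥(P₁ ∩ P₂) ≃ₜ Circle1) ∧
    (¬ ∃ y : ↥P₁, (⟨Set.inclusion Set.inter_subset_left,
        continuous_inclusion Set.inter_subset_left⟩ : C(↥(P₁ ∩ P₂), ↥P₁)).Homotopic
      (ContinuousMap.const _ y)) ∧
    (¬ ∃ y : ↥P₂, (⟨Set.inclusion Set.inter_subset_right,
        continuous_inclusion Set.inter_subset_right⟩ : C(↥(P₁ ∩ P₂), ↥P₂)).Homotopic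
      (ContinuousMap.const _ y))

/-- `Sg` is a quadruple hat: the image of a disc whose boundary is glued four times
along an embedded circle. -/
def IsQuadrupleHat (M : Type) [TopologicalSpace M] (Sg : Set M) : Prop :=
  ∃ (g : C(↥(Metric.closedBall (0 : ℂ) 1), M)) (h : C(↥(Metric.sphere (0 : ℂ) 1), M)),
    Sg = Set.range g ∧ Function.Injective h ∧
    Set.InjOn g {z : ↥(Metric.closedBall (0 : ℂ) 1) | ‖(z : ℂ)‖ < 1} ∧
    ∀ (z : ℂ) (hz : z ∈ Metric.closedBall (0 : ℂ) 1) (h1 : ‖z‖ = 1),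
      g ⟨z, hz⟩ = h ⟨z ^ 4, by simp [mem_sphere_zero_iff_norm, norm_pow, h1]⟩

/-! ### Heegaard splittings -/

/-- A Heegaard splitting of `M` of genus `g`, together with systems of meridian discs
for both handlebodies: cutting the interior of each handlebody along its meridian discs
gives an open ball. -/
structure HeegaardSplitting (M : Type) [TopologicalSpace M] where
  A : Fin 2 → Set M
  g : ℕ
  D : Fin 2 → Fin g → Set M
  closedA : ∀ j, IsClosed (A j)
  coverA : A 0 ∪ A 1 = Set.univ
  interA0 : A 0 ∩ A 1 = frontier (A 0)
  interA1 : A 0 ∩ A 1 = frontier (A 1)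
  discSub : ∀ j i, D j i ⊆ A j
  discClosed : ∀ j i, IsClosed (D j i)
  discHomeo : ∀ j i, Nonempty (↥(D j i) ≃ₜ ↥(Metric.closedBall (0 : EuclSp 2) 1))
  discDisj : ∀ j, ∀ i i', i ≠ i' → Disjoint (D j i) (D j i')
  meridianCircle : ∀ j i, Nonempty (↥(D j i ∩ (A 0 ∩ A 1)) ≃ₜ Circle1)
  cutBall : ∀ j, Nonempty (↥(interior (A j) \ ⋃ i, D j i) ≃ₜ R3)

/-- The meridian curves of a Heegaard splitting. -/
def HeegaardSplitting.meridian {M : Type} [TopologicalSpace M] (H : HeegaardSplitting M)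
    (j : Fin 2) (i : Fin H.g) : Set M :=
  H.D j i ∩ (H.A 0 ∩ H.A 1)

/-! ### Link diagrams and Dehn surgery -/

/-- Projection to the first two coordinates. -/
def prj (p : R3) : R2 := fun k => p k.castSucc

/-- `u` and `v` are linearly independent in the plane. -/
def det2 (u v : R2) : ℝ := u 0 * v 1 - u 1 * v 0

/-- A link in `ℝ³ ⊆ S³` in regular position with respect to the vertical projection:
`c` components, parametrised periodically and injectively, with regular projection,
at most double points, and transverse crossings. -/
structure LinkDiagram (c : ℕ) where
  γ : Fin c → ℝ → R3
  smooth : ∀ i, ContDiff ℝ 1 (γ i)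
  periodic : ∀ i t, γ i (t + 1) = γ i t
  inj : ∀ i j s t, s ∈ Set.Ico (0 : ℝ) 1 → t ∈ Set.Ico (0 : ℝ) 1 → γ i s = γ j t →
      i = j ∧ s = t
  regular : ∀ i t, prj (deriv (γ i) t) ≠ 0
  atMostTwo : ∀ q : R2,
      {p : Fin c × ℝ | p.2 ∈ Set.Ico (0 : ℝ) 1 ∧ prj (γ p.1 p.2) = q}.ncard ≤ 2
  transverse : ∀ i s j t, s ∈ Set.Ico (0 : ℝ) 1 → t ∈ Set.Ico (0 : ℝ) 1 →
      (i, s) ≠ (j, t) → prj (γ i s) = prj (γ j t) →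
      det2 (prj (deriv (γ i) s)) (prj (deriv (γ j) t)) ≠ 0

/-- The crossing points of the projection of a link diagram. -/
def LinkDiagram.crossings {c : ℕ} (L : LinkDiagram c) : Set R2 :=
  {q | ∃ i s j t, s ∈ Set.Ico (0 : ℝ) 1 ∧ t ∈ Set.Ico (0 : ℝ) 1 ∧
    ((i, s) : Fin c × ℝ) ≠ (j, t) ∧ prj (L.γ i s) = q ∧ prj (L.γ j t) = q}

/-- The component `i` contains an overpass: at some crossing it is the over-strand. -/
def LinkDiagram.hasOverpass {c : ℕ} (L : LinkDiagram c) (i : Fin c) : Prop :=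
  ∃ s j t, s ∈ Set.Ico (0 : ℝ) 1 ∧ t ∈ Set.Ico (0 : ℝ) 1 ∧
    ((i, s) : Fin c × ℝ) ≠ (j, t) ∧ prj (L.γ i s) = prj (L.γ j t) ∧
    L.γ j t 2 < L.γ i s 2

/-- The writhe (blackboard framing) of component `i`: the algebraic count of its
self-crossings. -/
def LinkDiagram.writhe {c : ℕ} (L : LinkDiagram c) (i : Fin c) : ℤ :=
  ({st : ℝ × ℝ | st.1 ∈ Set.Ico (0 : ℝ) 1 ∧ st.2 ∈ Set.Ico (0 : ℝ) 1 ∧ st.1 ≠ st.2 ∧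
      prj (L.γ i st.1) = prj (L.γ i st.2) ∧ L.γ i st.2 2 < L.γ i st.1 2 ∧
      0 < det2 (prj (deriv (L.γ i) st.1)) (prj (deriv (L.γ i) st.2))}.ncard : ℤ) -
  ({st : ℝ × ℝ | st.1 ∈ Set.Ico (0 : ℝ) 1 ∧ st.2 ∈ Set.Ico (0 : ℝ) 1 ∧ st.1 ≠ st.2 ∧
      prj (L.γ i st.1) = prj (L.γ i st.2) ∧ L.γ i st.2 2 < L.γ i st.1 2 ∧
      det2 (prj (deriv (L.γ i) st.1)) (prj (deriv (L.γ i) st.2)) < 0}.ncard : ℤ)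

/-- A point of the boundary circle of the unit disc of `ℂ`. -/
def discBoundaryPt (z : ↥(Metric.sphere (0 : ℂ) 1)) : ↥(Metric.closedBall (0 : ℂ) 1) :=
  ⟨(z : ℂ), Metric.sphere_subset_closedBall z.2⟩

/-- `M` is obtained from `S³ = ℝ³ ∪ {∞}` by Dehn surgery along the link `L`, the
meridian of the `i`-th filling solid torus being glued to the curve `κ i` on the
boundary of a tubular neighbourhood `N i` of the `i`-th component. -/
def SurgeredManifold (M : Type) [TopologicalSpace M] {c : ℕ} (L : LinkDiagram c)
    (κ : Fin c → Set (OnePoint R3)) : Prop :=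
  ∃ N : Fin c → Set (OnePoint R3),
    (∀ i, IsClosed (N i)) ∧
    (∀ i j, i ≠ j → Disjoint (N i) (N j)) ∧
    (∀ i, Nonempty (↥(N i) ≃ₜ ↥(Metric.closedBall (0 : ℂ) 1) × ↥(Metric.sphere (0 : ℂ) 1))) ∧
    (∀ i, (Set.range fun s : ℝ => (OnePoint.some (L.γ i s))) ⊆ interior (N i)) ∧
    (∀ i, κ i ⊆ frontier (N i)) ∧
    ∃ (X : Set M) (V : Fin c → Set M)
      (φ : ↥X ≃ₜ ↥((⋃ i, interior (N i))ᶜ : Set (OnePoint R3))),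
      IsClosed X ∧ (∀ i, IsClosed (V i)) ∧ (X ∪ ⋃ i, V i) = Set.univ ∧
      (∀ i j, i ≠ j → Disjoint (V i) (V j)) ∧ (∀ i, X ∩ V i = frontier (V i)) ∧
      ∀ i, ∃ (ψ : ↥(V i) ≃ₜ ↥(Metric.closedBall (0 : ℂ) 1) × ↥(Metric.sphere (0 : ℂ) 1))
          (u : ↥(Metric.sphere (0 : ℂ) 1))
          (hmer : ∀ z, ((ψ.symm (discBoundaryPt z, u)) : M) ∈ X),
        (Subtype.val '' (⇑φ ''
          (Set.range fun z => (⟨(ψ.symm (discBoundaryPt z, u) : M), hmer z⟩ : ↥X)))) = κ i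

/-- The vertical push-off, realising the blackboard framing. -/
def vertPush (δ : ℝ) (p : R3) : R3 := fun k => if k = 2 then p k + δ else p k

/-- The push-off of the `i`-th component twisted `k` additional times with respect to the
blackboard framing. -/
def framedPush {c : ℕ} (L : LinkDiagram c) (i : Fin c) (k : ℤ) (δ : ℝ) (s : ℝ) : R3 :=
  fun j => L.γ i s j +
    δ * (Real.cos (2 * Real.pi * k * s) * (if j = 2 then 1 else 0) +
      Real.sin (2 * Real.pi * k * s) *
        (if j = 0 then
            -(prj (deriv (L.γ i) s) 1) /
              Real.sqrt (prj (deriv (L.γ i) s) 0 ^ 2 + prj (deriv (L.γ i) s) 1 ^ 2)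
          else if j = 1 then
            prj (deriv (L.γ i) s) 0 /
              Real.sqrt (prj (deriv (L.γ i) s) 0 ^ 2 + prj (deriv (L.γ i) s) 1 ^ 2)
          else 0))

end

section
open Set Topology unitInterval

/-- `f` has a continuous logarithm on `X`. -/
def HasLog {α : Type*} [TopologicalSpace α] (f : α → ℂ) (X : Set α) : Prop :=
  ∃ g : α → ℂ, ContinuousOn g X ∧ ∀ x ∈ X, Complex.exp (g x) = f x

section HasLogBasics
variable {α β : Type*} [TopologicalSpace α] [TopologicalSpace β] {f f' : α → ℂ} {X Y : Set α}

theorem HasLog.mono (h : HasLog f X) (hY : Y ⊆ X) : HasLog f Y := by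
  obtain ⟨g, hg, hgf⟩ := h
  exact ⟨g, hg.mono hY, fun x hx => hgf x (hY hx)⟩

theorem HasLog.congr (h : HasLog f X) (hY : ∀ x ∈ X, f' x = f x) : HasLog f' X := by
  obtain ⟨g, hg, hgf⟩ := h
  exact ⟨g, hg, fun x hx => by rw [hgf x hx, hY x hx]⟩

theorem HasLog.mul (h : HasLog f X) (h' : HasLog f' X) : HasLog (fun x => f x * f' x) X := by
  obtain ⟨g, hg, hgf⟩ := h
  obtain ⟨g', hg', hgf'⟩ := h'
  exact ⟨fun x => g x + g' x, hg.add hg', fun x hx => by rw [Complex.exp_add, hgf x hx, hgf' x hx]⟩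

theorem HasLog.inv (h : HasLog f X) : HasLog (fun x => (f x)⁻¹) X := by
  obtain ⟨g, hg, hgf⟩ := h
  exact ⟨fun x => - g x, hg.neg, fun x hx => by rw [Complex.exp_neg, hgf x hx]⟩

theorem HasLog.div (h : HasLog f X) (h' : HasLog f' X) : HasLog (fun x => f x / f' x) X := by
  simpa [div_eq_mul_inv] using h.mul h'.inv

theorem HasLog.zpow (h : HasLog f X) (n : ℤ) : HasLog (fun x => (f x) ^ n) X := by
  obtain ⟨g, hg, hgf⟩ := h
  exact ⟨fun x => n * g x, continuousOn_const.mul hg, fun x hx => by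
    rw [Complex.exp_int_mul, hgf x hx]⟩

theorem HasLog.ne_zero (h : HasLog f X) {x : α} (hx : x ∈ X) : f x ≠ 0 := by
  obtain ⟨g, hg, hgf⟩ := h
  rw [← hgf x hx]; exact Complex.exp_ne_zero _

theorem HasLog.continuousOn (h : HasLog f X) : ContinuousOn f X := by
  obtain ⟨g, hg, hgf⟩ := h
  exact (Complex.continuous_exp.comp_continuousOn hg).congr (fun x hx => (hgf x hx).symm)

theorem HasLog.comp (h : HasLog f X) {φ : β → α} {Z : Set β} (hφ : ContinuousOn φ Z)
    (hm : MapsTo φ Z X) : HasLog (fun z => f (φ z)) Z := by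
  obtain ⟨g, hg, hgf⟩ := h
  exact ⟨fun z => g (φ z), hg.comp hφ hm, fun z hz => hgf _ (hm hz)⟩

theorem hasLog_const {c : ℂ} (hc : c ≠ 0) : HasLog (fun _ : α => c) X :=
  ⟨fun _ => Complex.log c, continuousOn_const, fun _ _ => Complex.exp_log hc⟩

theorem hasLog_of_slitPlane (hf : ContinuousOn f X) (h : ∀ x ∈ X, f x ∈ Complex.slitPlane) :
    HasLog f X :=
  ⟨fun x => Complex.log (f x), hf.clog h, fun x hx => Complex.exp_log (Complex.slitPlane_ne_zero (h x hx))⟩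

theorem hasLog_of_ball (hf : ContinuousOn f X) {c : ℂ} (h : ∀ x ∈ X, ‖f x - c‖ < ‖c‖) :
    HasLog f X := by
  rcases X.eq_empty_or_nonempty with rfl | ⟨x0, hx0⟩
  · exact ⟨fun _ => 0, continuousOn_empty _, by simp⟩
  have hc : c ≠ 0 := by
    rintro rfl
    have := h x0 hx0
    simp at this
    exact absurd this (not_lt.2 (norm_nonneg _))
  have h1 : HasLog (fun x => f x / c) X := by
    refine hasLog_of_slitPlane (hf.div_const c) fun x hx => ?_
    have h2 : ‖f x / c - 1‖ < 1 := by
      have : f x / c - 1 = (f x - c) / c := by field_simp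
      rw [this, norm_div, div_lt_one (norm_pos_iff.2 hc)]
      exact h x hx
    have := Complex.mem_slitPlane_of_norm_lt_one h2
    simpa using this
  exact (h1.mul (hasLog_const hc)).congr (fun x hx => by field_simp)

theorem hasLog_of_close {f f' : α → ℂ} (h : HasLog f X) (hf : ContinuousOn f' X)
    (hc : ∀ x ∈ X, ‖f' x - f x‖ < ‖f x‖) : HasLog f' X := by
  have h1 : HasLog (fun x => f' x / f x) X := by
    refine hasLog_of_ball (c := 1) (hf.div h.continuousOn fun x hx => h.ne_zero hx) fun x hx => ?_
    have h0 := h.ne_zero hx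
    have : f' x / f x - 1 = (f' x - f x) / f x := by field_simp
    rw [this, norm_div, norm_one, div_lt_one (norm_pos_iff.2 h0)]
    exact hc x hx
  exact (h1.mul h).congr (fun x hx => by have := h.ne_zero hx; field_simp)

/-- Two logarithms of the same function on a preconnected set differ by a constant. -/
theorem log_diff_const {g g' : α → ℂ} (hX : IsPreconnected X) (hg : ContinuousOn g X)
    (hg' : ContinuousOn g' X) (h : ∀ x ∈ X, Complex.exp (g x) = Complex.exp (g' x)) {x y : α}
    (hx : x ∈ X) (hy : y ∈ X) : g x - g' x = g y - g' y := by
  have hd : ∀ z ∈ X, ∃ n : ℤ, g z - g' z = n * (2 * Real.pi * Complex.I) := by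
    intro z hz
    obtain ⟨n, hn⟩ := Complex.exp_eq_exp_iff_exists_int.1 (h z hz)
    exact ⟨n, by rw [hn]; ring⟩
  have hc : ContinuousOn (fun z => ((g z - g' z) / (2 * Real.pi * Complex.I)).re) X :=
    Complex.continuous_re.comp_continuousOn ((hg.sub hg').div_const _)
  have hpi : (2 * Real.pi * Complex.I : ℂ) ≠ 0 := by
    simp [Real.pi_ne_zero]
  have hre : ∀ z ∈ X, ∃ n : ℤ, ((g z - g' z) / (2 * Real.pi * Complex.I)).re = n ∧
      g z - g' z = n * (2 * Real.pi * Complex.I) := by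
    intro z hz
    obtain ⟨n, hn⟩ := hd z hz
    refine ⟨n, ?_, hn⟩
    rw [hn, mul_div_cancel_right₀ _ hpi]; simp
  have key : ∀ z ∈ X, ∀ w ∈ X, ((g z - g' z) / (2 * Real.pi * Complex.I)).re
      ≤ ((g w - g' w) / (2 * Real.pi * Complex.I)).re := by
    intro z hz w hw
    by_contra! hlt
    obtain ⟨n, hn, -⟩ := hre z hz
    obtain ⟨m, hm, -⟩ := hre w hw
    have hmn : (m : ℝ) < n := by rw [← hn, ← hm]; exact hlt
    have hmn' : m + 1 ≤ n := by exact_mod_cast hmn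
    have hmn'' : (m : ℝ) + 1 ≤ n := by exact_mod_cast hmn'
    have := hX.intermediate_value hw hz hc
    obtain ⟨v, hv, hv2⟩ := this (show (m : ℝ) + 1/2 ∈ _ from ⟨by
      show ((g w - g' w) / (2 * Real.pi * Complex.I)).re ≤ _
      rw [hm]; linarith, by
      show _ ≤ ((g z - g' z) / (2 * Real.pi * Complex.I)).re
      rw [hn]; linarith⟩)
    obtain ⟨k, hk, -⟩ := hre v hv
    simp only at hv2
    rw [hk] at hv2
    have e : (2 * k : ℝ) = 2 * m + 1 := by linarith
    have : (2 * k : ℤ) = 2 * m + 1 := by exact_mod_cast e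
    omega
  obtain ⟨n, hn, hn'⟩ := hre x hx
  obtain ⟨m, hm, hm'⟩ := hre y hy
  have e := le_antisymm (key x hx y hy) (key y hy x hx)
  rw [hn, hm] at e
  rw [hn', hm']
  have : (n : ℂ) = m := by exact_mod_cast e
  rw [this]

/-- Gluing logarithms along a preconnected intersection. -/
theorem HasLog.union (hX : IsClosed X) (hY : IsClosed Y) (hXY : IsPreconnected (X ∩ Y))
    (h : HasLog f X) (h' : HasLog f Y) : HasLog f (X ∪ Y) := by
  classical
  obtain ⟨g, hg, hgf⟩ := h
  obtain ⟨g', hg', hgf'⟩ := h'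
  have : ∃ c : ℂ, Complex.exp c = 1 ∧ ∀ x ∈ X ∩ Y, g x = g' x + c := by
    rcases (X ∩ Y).eq_empty_or_nonempty with he | ⟨x0, hx0⟩
    · exact ⟨0, by simp, by simp [he]⟩
    · refine ⟨g x0 - g' x0, ?_, fun x hx => ?_⟩
      · rw [Complex.exp_sub, hgf x0 hx0.1, hgf' x0 hx0.2, div_self]
        rw [← hgf x0 hx0.1]; exact Complex.exp_ne_zero _
      · have := log_diff_const hXY (hg.mono inter_subset_left) (hg'.mono inter_subset_right)
          (fun x hx => by rw [hgf x hx.1, hgf' x hx.2]) hx hx0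
        rw [← this]; ring
  obtain ⟨c, hc, hgg⟩ := this
  refine ⟨X.piecewise g (fun x => g' x + c), ?_, ?_⟩
  · have h1 : ContinuousOn (X.piecewise g (fun x => g' x + c)) X :=
      hg.congr (fun x hx => piecewise_eq_of_mem _ _ _ hx)
    have h2 : ContinuousOn (X.piecewise g (fun x => g' x + c)) Y := by
      refine (hg'.add (continuousOn_const (c := c))).congr (fun x hx => ?_)
      by_cases hxX : x ∈ X
      · rw [piecewise_eq_of_mem _ _ _ hxX]; exact hgg x ⟨hxX, hx⟩
      · exact piecewise_eq_of_notMem _ _ _ hxX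
    exact h1.union_of_isClosed h2 hX hY
  · intro x hx
    by_cases hxX : x ∈ X
    · rw [piecewise_eq_of_mem _ _ _ hxX]; exact hgf x hxX
    · rw [piecewise_eq_of_notMem _ _ _ hxX, Complex.exp_add, hc, mul_one]
      exact hgf' x (hx.resolve_left hxX)

end HasLogBasics

theorem hasLog_univ {E : Type*} [NormedAddCommGroup E] [NormedSpace ℝ E] {f : E → ℂ}
    (hf : Continuous f) (h0 : ∀ x, f x ≠ 0) : HasLog f univ := by
  obtain ⟨F, ⟨-, hF⟩, -⟩ := Complex.isCoveringMapOn_exp.existsUnique_continuousMap_lifts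
    (⟨f, hf⟩ : C(E, ℂ)) (a₀ := 0) (e₀ := Complex.log (f 0)) (Complex.exp_log (h0 0)) (fun a => h0 a)
  exact ⟨F, F.continuous.continuousOn, fun x _ => congrFun hF x⟩

/-- radial retraction onto a closed ball -/
noncomputable def retr (z : ℂ) : ℂ := ((max 1 ‖z‖)⁻¹ : ℝ) • z

theorem retr_cont : Continuous retr := by
  unfold retr
  have h1 : Continuous fun z : ℂ => (max 1 ‖z‖ : ℝ) := by fun_prop
  exact (h1.inv₀ fun z => by positivity).smul continuous_id

theorem retr_norm (z : ℂ) : ‖retr z‖ ≤ 1 := by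
  unfold retr
  rw [norm_smul, norm_inv, Real.norm_of_nonneg (by positivity), inv_mul_le_one₀ (by positivity)]
  exact le_max_right _ _

theorem retr_eq {z : ℂ} (h : ‖z‖ ≤ 1) : retr z = z := by
  unfold retr
  rw [max_eq_left h]; simp

theorem hasLog_closedBall {f : ℂ → ℂ} {c : ℂ} {r : ℝ} (hf : ContinuousOn f (Metric.closedBall c r))
    (h0 : ∀ x ∈ Metric.closedBall c r, f x ≠ 0) : HasLog f (Metric.closedBall c r) := by
  rcases lt_trichotomy r 0 with hr | rfl | hr
  · rw [Metric.closedBall_eq_empty.2 hr]; exact ⟨0, continuousOn_empty _, by simp⟩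
  · rw [Metric.closedBall_zero] at *
    exact (hasLog_const (h0 c rfl)).congr (fun x hx => by rw [mem_singleton_iff.1 hx])
  have hm : ∀ z : ℂ, c + r * retr ((z - c) / r) ∈ Metric.closedBall c r := by
    intro z
    rw [Metric.mem_closedBall, dist_eq_norm, add_sub_cancel_left, norm_mul, Complex.norm_real,
      Real.norm_of_nonneg hr.le]
    have := retr_norm ((z - c) / r)
    nlinarith
  have h1 : HasLog (fun z => f (c + r * retr ((z - c) / r))) univ := by
    refine hasLog_univ ?_ fun z => h0 _ (hm z)
    have h2 : Continuous fun z : ℂ => c + r * retr ((z - c) / r) := by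
      have := retr_cont
      fun_prop
    exact hf.comp_continuous h2 hm
  refine (h1.mono (subset_univ _)).congr fun z hz => ?_
  rw [retr_eq]
  · have : (r : ℂ) ≠ 0 := by exact_mod_cast hr.ne'
    congr 1; field_simp; ring
  · rw [norm_div, Complex.norm_real, Real.norm_of_nonneg hr.le, div_le_one hr]
    simpa [dist_eq_norm] using hz

/-- The identity on a circle has no logarithm. -/
theorem not_hasLog_circle {w : ℂ} {r : ℝ} (hr : 0 < r) :
    ¬ HasLog (fun z => z - w) (Metric.sphere w r) := by
  rintro ⟨g, hg, hgf⟩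
  have hm : ∀ t : ℝ, w + r * Complex.exp (t * Complex.I) ∈ Metric.sphere w r := by
    intro t
    rw [mem_sphere_iff_norm, add_sub_cancel_left, norm_mul, Complex.norm_exp_ofReal_mul_I,
      Complex.norm_real, Real.norm_of_nonneg hr.le, mul_one]
  have hr' : (r : ℂ) ≠ 0 := by exact_mod_cast hr.ne'
  have h1 : Continuous fun t : ℝ => g (w + r * Complex.exp (t * Complex.I)) :=
    hg.comp_continuous (by fun_prop) hm
  have := log_diff_const (X := univ) (g := fun t : ℝ => g (w + r * Complex.exp (t * Complex.I)))
    (g' := fun t : ℝ => Complex.log r + t * Complex.I) isPreconnected_univ h1.continuousOn (by fun_prop)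
    (fun t _ => by
      rw [hgf _ (hm t), Complex.exp_add, Complex.exp_log hr']; ring) (mem_univ 0)
      (mem_univ (2 * Real.pi))
  have e : Complex.exp ((2 * Real.pi : ℝ) * Complex.I) = 1 := by
    have := Complex.exp_two_pi_mul_I
    push_cast; exact this
  rw [e] at this
  simp at this
end

section
open Set Topology unitInterval

theorem frontier_comp_subset {X : Set ℂ} (hX : IsClosed X) (w : ℂ) :
    frontier (connectedComponentIn Xᶜ w) ⊆ X := by
  intro z hz
  by_contra hzX
  have hop : IsOpen (connectedComponentIn Xᶜ w) := hX.isOpen_compl.connectedComponentIn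
  have hop' : IsOpen (connectedComponentIn Xᶜ z) := hX.isOpen_compl.connectedComponentIn
  have hzV : z ∉ connectedComponentIn Xᶜ w := by
    rw [hop.frontier_eq] at hz; exact hz.2
  have hz' : z ∈ connectedComponentIn Xᶜ z := mem_connectedComponentIn hzX
  obtain ⟨y, hy1, hy2⟩ := mem_closure_iff.1 (frontier_subset_closure hz) _ hop' hz'
  exact hzV (by rw [connectedComponentIn_eq hy2, ← connectedComponentIn_eq hy1]; exact hz')

theorem tietze_C {X : Set ℂ} (hX : IsClosed X) {g : ℂ → ℂ} (hg : ContinuousOn g X) :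
    ∃ G : ℂ → ℂ, Continuous G ∧ ∀ x ∈ X, G x = g x := by
  obtain ⟨G, hG⟩ := ContinuousMap.exists_restrict_eq hX (⟨X.domRestrict g, hg.domRestrict⟩ : C(X, ℂ))
  refine ⟨G, G.continuous, fun x hx => ?_⟩
  have := DFunLike.congr_fun hG ⟨x, hx⟩
  exact this

/-- Borsuk separation criterion, one direction. -/
theorem borsuk_unbounded {X : Set ℂ} (hX : IsClosed X) {w : ℂ} (hw : w ∉ X)
    (h : HasLog (fun z => z - w) X) : ¬ Bornology.IsBounded (connectedComponentIn Xᶜ w) := by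
  classical
  intro hb
  obtain ⟨g, hg, hgf⟩ := h
  obtain ⟨G, hG, hGg⟩ := tietze_C hX hg
  set V := connectedComponentIn Xᶜ w with hV
  have hVo : IsOpen V := hX.isOpen_compl.connectedComponentIn
  have hwV : w ∈ V := mem_connectedComponentIn hw
  have hH : Continuous (fun z => if z ∈ V then Complex.exp (G z) else z - w) := by
    refine Continuous.if ?_ (by fun_prop) (by fun_prop)
    intro a ha
    have haX : a ∈ X := frontier_comp_subset hX w ha
    rw [hGg a haX, hgf a haX]
  have h1 := hasLog_univ hH (fun z => by
    by_cases hz : z ∈ V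
    · simp only [hz, if_true]; exact Complex.exp_ne_zero _
    · simp only [hz, if_false]
      intro h; rw [sub_eq_zero.1 h] at hz; exact hz hwV)
  obtain ⟨R, hR⟩ := hb.subset_ball w
  have hRpos : 0 < R := by simpa using hR hwV
  refine not_hasLog_circle (w := w) hRpos ((h1.mono (subset_univ _)).congr fun z hz => ?_)
  have : z ∉ V := fun hzV => by
    have := hR hzV
    rw [Metric.mem_ball] at this; rw [Metric.mem_sphere] at hz; linarith
  simp [this]

theorem borsuk_hasLog {X : Set ℂ} (hX : IsCompact X) {w : ℂ}
    (hb : ¬ Bornology.IsBounded (connectedComponentIn Xᶜ w)) : HasLog (fun z => z - w) X := by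
  have hw : w ∉ X := by
    intro h
    rw [connectedComponentIn_eq_empty (by simpa using h)] at hb
    exact hb Bornology.isBounded_empty
  obtain ⟨R, hR⟩ := hX.isBounded.subset_ball 0
  obtain ⟨a, haV, haR⟩ : ∃ a ∈ connectedComponentIn Xᶜ w, R ≤ ‖a‖ := by
    by_contra! hcon
    exact hb ((Metric.isBounded_ball (x := (0:ℂ)) (r := R)).subset fun a ha => by simpa using hcon a ha)
  have hfar : HasLog (fun z => z - a) X := by
    refine hasLog_of_ball (c := -a) (by fun_prop) fun z hz => ?_
    have : ‖z‖ < R := by simpa using hR hz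
    simp; linarith
  have hwV : w ∈ connectedComponentIn Xᶜ w := mem_connectedComponentIn hw
  have key := isPreconnected_connectedComponentIn.induction₂ (s := connectedComponentIn Xᶜ w)
    (fun a b => (HasLog (fun z => z - a) X ↔ HasLog (fun z => z - b) X)) (fun x hx => ?_)
    (fun x y z _ _ _ h1 h2 => h1.trans h2) (fun x y _ _ h => h.symm) haV hwV
  · exact key.1 hfar
  · have hxX : x ∈ Xᶜ := connectedComponentIn_subset _ _ hx
    obtain ⟨ε, hε, hball⟩ := Metric.isOpen_iff.1 hX.isClosed.isOpen_compl x hxX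
    filter_upwards [nhdsWithin_le_nhds (Metric.ball_mem_nhds x (half_pos hε))] with y hy
    have hd : ∀ z ∈ X, ε ≤ ‖z - x‖ := by
      intro z hz
      by_contra! hlt
      exact hball (show z ∈ Metric.ball x ε by rwa [Metric.mem_ball, dist_eq_norm]) hz
    rw [Metric.mem_ball, dist_eq_norm] at hy
    have hd' : ∀ z ∈ X, ε / 2 < ‖z - y‖ := by
      intro z hz
      have h1 := hd z hz
      have h2 : ‖z - x‖ ≤ ‖z - y‖ + ‖y - x‖ := by
        have := norm_add_le (z - y) (y - x); simpa using this
      linarith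
    constructor
    · intro h
      refine hasLog_of_close h (by fun_prop) fun z hz => ?_
      have e : z - y - (z - x) = -(y - x) := by ring
      rw [e, norm_neg]; linarith [hd z hz]
    · intro h
      refine hasLog_of_close h (by fun_prop) fun z hz => ?_
      have e : z - x - (z - y) = (y - x) := by ring
      rw [e]; linarith [hd' z hz]

theorem compl_unbounded {X : Set ℂ} (hX : Bornology.IsBounded X) : ¬ Bornology.IsBounded Xᶜ := by
  intro h
  have := hX.union h
  rw [union_compl_self] at this
  exact (NormedSpace.noncompactSpace ℝ ℂ).noncompact_univ (Metric.isCompact_of_isClosed_isBounded isClosed_univ this)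

theorem borsuk_hasLog_of_conn {X : Set ℂ} (hX : IsCompact X) (hc : IsPreconnected Xᶜ) {w : ℂ}
    (hw : w ∉ X) : HasLog (fun z => z - w) X := by
  refine borsuk_hasLog hX ?_
  rw [hc.connectedComponentIn hw]
  exact compl_unbounded hX.isBounded

/-- A zero at which the function looks like a power. -/
def GoodZero (F : ℂ → ℂ) (z₀ : ℂ) : Prop :=
  ∃ n : ℤ, ∃ r > 0, HasLog (fun z => F z * (z - z₀) ^ n) (Metric.closedBall z₀ r \ {z₀})

theorem GoodZero.eventually {F : ℂ → ℂ} {z₀ : ℂ} (h : GoodZero F z₀) : ∀ᶠ z in 𝓝[≠] z₀, F z ≠ 0 := by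
  obtain ⟨n, r, hr, h⟩ := h
  rw [eventually_nhdsWithin_iff]
  filter_upwards [Metric.closedBall_mem_nhds z₀ hr] with z hz hne
  have := h.ne_zero ⟨hz, hne⟩
  exact left_ne_zero_of_mul this

theorem goodZero_of_fderiv {F : ℂ → ℂ} (hF : Continuous F) {z₀ : ℂ} (h0 : F z₀ = 0) {A : ℂ →L[ℝ] ℂ}
    (hA : HasFDerivAt F A z₀) (hdet : A.det ≠ 0) : GoodZero F z₀ := by
  set α : ℂ := (A 1 - Complex.I * A Complex.I) / 2 with hα
  set β : ℂ := (A 1 + Complex.I * A Complex.I) / 2 with hβ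
  have hAv : ∀ v : ℂ, A v = α * v + β * (starRingEnd ℂ) v := by
    intro v
    have h1 : v = v.re • (1 : ℂ) + v.im • Complex.I := by
      simp [Complex.re_add_im]
    have h2 : A v = v.re * A 1 + v.im * A Complex.I := by
      conv_lhs => rw [h1]
      rw [map_add, map_smul, map_smul]; simp
    have h3 : (starRingEnd ℂ) v = v.re - v.im * Complex.I := by
      apply Complex.ext <;> simp
    rw [h2, h3]
    conv_rhs => rw [← Complex.re_add_im v]
    simp only [Complex.add_re, Complex.ofReal_re, Complex.mul_re, Complex.I_re, mul_zero, Complex.ofReal_im,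
      Complex.I_im, mul_one, sub_self, add_zero, Complex.add_im, Complex.mul_im, zero_add]
    rw [hα, hβ]
    ring_nf
    rw [Complex.I_sq]; ring
  have hinj : ∀ v : ℂ, A v = 0 → v = 0 := by
    intro v hv
    have hu : IsUnit (A : ℂ →ₗ[ℝ] ℂ) := by
      rw [LinearMap.isUnit_iff_isUnit_det]; exact isUnit_iff_ne_zero.2 hdet
    have := (LinearMap.isUnit_iff_ker_eq_bot _).1 hu
    exact (LinearMap.ker_eq_bot'.1 this) v hv
  have hne : ‖α‖ ≠ ‖β‖ := by
    intro he
    have hα0 : α ≠ 0 := by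
      intro h
      rw [h, norm_zero] at he
      have hβ0 : β = 0 := norm_eq_zero.1 he.symm
      have := hinj 1 (by rw [hAv, h, hβ0]; simp)
      exact one_ne_zero this
    obtain ⟨s, hs⟩ := IsAlgClosed.exists_pow_nat_eq (-β / α) (n := 2) (by norm_num)
    have hs1 : ‖s‖ = 1 := by
      have : ‖s‖ ^ 2 = 1 := by
        rw [← norm_pow, hs, norm_div, norm_neg, he, div_self]
        rw [← he]; exact norm_ne_zero_iff.2 hα0
      exact (pow_eq_one_iff_of_nonneg (norm_nonneg _) two_ne_zero).1 this
    have hs0 : s ≠ 0 := by intro h; rw [h] at hs1; simp at hs1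
    have hconj : s * (starRingEnd ℂ) s = 1 := by
      rw [Complex.mul_conj, Complex.normSq_eq_norm_sq, hs1]; simp
    refine hs0 (hinj s ?_)
    have : s * A s = 0 := by
      rw [hAv]
      calc s * (α * s + β * (starRingEnd ℂ) s) = α * s ^ 2 + β * (s * (starRingEnd ℂ) s) := by ring
        _ = 0 := by rw [hconj, hs]; field_simp; ring
    exact (mul_eq_zero.1 this).resolve_left hs0
  have hlit := hA.isLittleO
  have hest : ∀ ε > 0, ∃ r > 0, ∀ z ∈ Metric.closedBall z₀ r,
      ‖F z - (α * (z - z₀) + β * (starRingEnd ℂ) (z - z₀))‖ ≤ ε * ‖z - z₀‖ := by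
    intro ε hε
    obtain ⟨r, hr, h⟩ := Metric.nhds_basis_closedBall.mem_iff.1 (hlit.def hε)
    refine ⟨r, hr, fun z hz => ?_⟩
    have := h hz
    simp only [mem_ofPred_eq, h0, sub_zero, hAv] at this
    exact this
  rcases lt_or_gt_of_ne hne with hlt | hlt
  · obtain ⟨r, hr, hr2⟩ := hest ((‖β‖ - ‖α‖) / 2) (by linarith)
    refine ⟨1, r, hr, ?_⟩
    have hpos : HasLog (fun z => ((‖z - z₀‖ ^ 2 : ℝ) : ℂ)) (Metric.closedBall z₀ r \ {z₀}) := by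
      refine hasLog_of_slitPlane (by fun_prop) fun z hz => ?_
      have : 0 < ‖z - z₀‖ := norm_pos_iff.2 (sub_ne_zero.2 hz.2)
      exact Complex.ofReal_mem_slitPlane.2 (by positivity)
    have h2 : HasLog (fun z => F z * (z - z₀) / ((‖z - z₀‖ ^ 2 : ℝ) : ℂ)) (Metric.closedBall z₀ r \ {z₀}) := by
      refine hasLog_of_ball (c := β) ?_ fun z hz => ?_
      · refine ContinuousOn.div (by fun_prop) (by fun_prop) fun z hz => hpos.ne_zero hz
      · have hv : z - z₀ ≠ 0 := sub_ne_zero.2 hz.2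
        have hvp : 0 < ‖z - z₀‖ := norm_pos_iff.2 hv
        have hmc : ((‖z - z₀‖ ^ 2 : ℝ) : ℂ) = (z - z₀) * (starRingEnd ℂ) (z - z₀) := by
          rw [Complex.mul_conj, Complex.normSq_eq_norm_sq]
        have hc0 : (starRingEnd ℂ) (z - z₀) ≠ 0 := (map_ne_zero _).2 hv
        have e : F z * (z - z₀) / ((‖z - z₀‖ ^ 2 : ℝ) : ℂ) - β
            = (F z - (α * (z - z₀) + β * (starRingEnd ℂ) (z - z₀)) + α * (z - z₀)) / (starRingEnd ℂ) (z - z₀) := by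
          rw [hmc]; field_simp; ring
        rw [e, norm_div, RCLike.norm_conj, div_lt_iff₀ hvp]
        refine (norm_add_le _ _).trans_lt ?_
        rw [norm_mul]
        have := hr2 z hz.1
        nlinarith
    exact (h2.mul hpos).congr fun z hz => by
      have := hpos.ne_zero hz
      field_simp
  · obtain ⟨r, hr, hr2⟩ := hest ((‖α‖ - ‖β‖) / 2) (by linarith)
    refine ⟨-1, r, hr, ?_⟩
    refine hasLog_of_ball (c := α) ?_ fun z hz => ?_
    · refine hF.continuousOn.mul (ContinuousOn.zpow₀ (by fun_prop) _ fun z hz => Or.inl (sub_ne_zero.2 hz.2))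
    · have hv : z - z₀ ≠ 0 := sub_ne_zero.2 hz.2
      have hvp : 0 < ‖z - z₀‖ := norm_pos_iff.2 hv
      have e : F z * (z - z₀) ^ (-1 : ℤ) - α
            = (F z - (α * (z - z₀) + β * (starRingEnd ℂ) (z - z₀)) + β * (starRingEnd ℂ) (z - z₀)) / (z - z₀) := by
        rw [zpow_neg_one]; field_simp; ring
      rw [e, norm_div, div_lt_iff₀ hvp]
      refine (norm_add_le _ _).trans_lt ?_
      rw [norm_mul, RCLike.norm_conj]
      have := hr2 z hz.1
      nlinarith
end

section
open Set Topology unitInterval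

theorem hasLog_of_goodZeros {X : Set ℂ} {R : ℝ} (hX : IsCompact X) (hXR : X ⊆ Metric.closedBall 0 R)
    (hlog : ∀ a ∉ X, HasLog (fun z => z - a) X) (Z : Finset ℂ) :
    ∀ F : ℂ → ℂ, Continuous F → (∀ z ∈ Metric.closedBall (0:ℂ) R, F z = 0 → z ∈ Z) → (∀ z ∈ Z, z ∉ X) →
    (∀ z ∈ Z, GoodZero F z) → HasLog F X := by
  classical
  induction Z using Finset.induction_on with
  | empty =>
    intro F hF h0 _ _
    exact (hasLog_closedBall hF.continuousOn (fun z hz h => by simpa using h0 z hz h)).mono hXR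
  | insert a Z haZ ih =>
    intro F hF h0 hZX hgood
    obtain ⟨n, r₀, hr₀, hn⟩ := hgood a (Finset.mem_insert_self _ _)
    have haX : a ∉ X := hZX a (Finset.mem_insert_self _ _)
    have hcl : IsClosed (X ∪ (Z : Set ℂ)) := hX.isClosed.union Z.finite_toSet.isClosed
    have hacl : a ∈ (X ∪ (Z : Set ℂ))ᶜ := by simp [haX, haZ]
    obtain ⟨r₁, hr₁, hball⟩ := Metric.nhds_basis_closedBall.mem_iff.1 (hcl.isOpen_compl.mem_nhds hacl)
    set r := min r₀ r₁ with hr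
    have hrpos : 0 < r := lt_min hr₀ hr₁
    have hsub : Metric.sphere a r ⊆ Metric.closedBall a r₀ \ {a} := by
      intro z hz
      rw [Metric.mem_sphere] at hz
      refine ⟨by rw [Metric.mem_closedBall, hz]; exact min_le_left _ _, ?_⟩
      rintro rfl
      rw [dist_self] at hz; linarith
    obtain ⟨g, hg, hgf⟩ := hn.mono hsub
    obtain ⟨G, hG, hGg⟩ := tietze_C Metric.isClosed_sphere hg
    set F' : ℂ → ℂ := fun z => if z ∈ Metric.closedBall a r then Complex.exp (G z) else F z * (z - a) ^ n with hF'
    have hcont : Continuous F' := by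
      refine continuous_if' ?_ ?_ ?_ ?_
      · intro x hx
        have hxs : x ∈ Metric.sphere a r := by
          change x ∈ frontier (Metric.closedBall a r) at hx
          rwa [frontier_closedBall _ hrpos.ne'] at hx
        have : (if x ∈ Metric.closedBall a r then Complex.exp (G x) else F x * (x - a) ^ n) = Complex.exp (G x) := by
          rw [if_pos (Metric.sphere_subset_closedBall hxs)]
        rw [this]
        exact (Complex.continuous_exp.comp hG).continuousAt.continuousWithinAt
      · intro x hx
        have hxs : x ∈ Metric.sphere a r := by
          change x ∈ frontier (Metric.closedBall a r) at hx
          rwa [frontier_closedBall _ hrpos.ne'] at hx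
        have : (if x ∈ Metric.closedBall a r then Complex.exp (G x) else F x * (x - a) ^ n) = F x * (x - a) ^ n := by
          rw [if_pos (Metric.sphere_subset_closedBall hxs), hGg x hxs, hgf x hxs]
        rw [this]
        have hxa : x - a ≠ 0 := sub_ne_zero.2 (hsub hxs).2
        have : ContinuousAt (fun x => F x * (x - a) ^ n) x :=
          hF.continuousAt.mul (ContinuousAt.zpow₀ (by fun_prop) _ (Or.inl hxa))
        exact this.continuousWithinAt
      · exact (Complex.continuous_exp.comp hG).continuousOn
      · refine hF.continuousOn.mul (ContinuousOn.zpow₀ (by fun_prop) _ fun x hx => Or.inl (sub_ne_zero.2 ?_))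
        rintro rfl
        exact hx (Metric.mem_closedBall_self hrpos.le)
    have hout : ∀ z ∈ (X ∪ (Z : Set ℂ)), z ∉ Metric.closedBall a r := fun z hz hz2 =>
      hball (Metric.closedBall_subset_closedBall (min_le_right _ _) hz2) hz
    have hne : ∀ z ∉ Metric.closedBall a r, z - a ≠ 0 := by
      intro z hz
      refine sub_ne_zero.2 ?_
      rintro rfl
      exact hz (Metric.mem_closedBall_self hrpos.le)
    have h1 := ih F' hcont ?_ (fun z hz => hZX z (Finset.mem_insert_of_mem hz)) ?_
    · have h2 := h1.mul ((hlog a haX).zpow (-n))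
      refine h2.congr fun z hz => ?_
      have hzo := hout z (Or.inl hz)
      have := hne z hzo
      simp only [hF', if_neg hzo, zpow_neg]
      field_simp
    · intro z hz hz0
      by_cases hzb : z ∈ Metric.closedBall a r
      · simp only [hF', if_pos hzb] at hz0
        exact absurd hz0 (Complex.exp_ne_zero _)
      · simp only [hF', if_neg hzb] at hz0
        have h3 : F z = 0 := (mul_eq_zero.1 hz0).resolve_right (zpow_ne_zero _ (hne z hzb))
        have h4 := h0 z hz h3
        rcases Finset.mem_insert.1 h4 with rfl | h5
        · exact absurd (Metric.mem_closedBall_self hrpos.le) hzb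
        · exact h5
    · intro z hz
      obtain ⟨m, s, hs, hm⟩ := hgood z (Finset.mem_insert_of_mem hz)
      have hzo := hout z (Or.inr hz)
      obtain ⟨t, ht, hball2⟩ := Metric.nhds_basis_closedBall.mem_iff.1
        (Metric.isClosed_closedBall.isOpen_compl.mem_nhds hzo)
      refine ⟨m, min s t, lt_min hs ht, ?_⟩
      have hb1 : Metric.closedBall z (min s t) \ {z} ⊆ Metric.closedBall z s \ {z} :=
        diff_subset_diff_left (Metric.closedBall_subset_closedBall (min_le_left _ _))
      have hb2 : Metric.closedBall z (min s t) ⊆ Metric.closedBall z t :=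
        (Metric.closedBall_subset_closedBall (min_le_right _ _))
      have hl : HasLog (fun w => w - a) (Metric.closedBall z t) :=
        hasLog_closedBall (by fun_prop) fun w hw => hne w (hball2 hw)
      refine ((hm.mono hb1).mul ((hl.mono hb2).zpow n |>.mono diff_subset)).congr fun w hw => ?_
      have : w ∉ Metric.closedBall a r := hball2 (hb2 hw.1)
      simp only [hF', if_neg this]; ring

/-- Eilenberg: if all `z - a`, `a ∉ X`, have a log on `X` then every nonvanishing map has. -/
theorem eilenberg {X : Set ℂ} (hX : IsCompact X)
    (hlog : ∀ a ∉ X, HasLog (fun z => z - a) X) {f : ℂ → ℂ} (hf : ContinuousOn f X)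
    (hf0 : ∀ z ∈ X, f z ≠ 0) : HasLog f X := by
  classical
  rcases X.eq_empty_or_nonempty with rfl | hne
  · exact ⟨f, continuousOn_empty _, by simp⟩
  obtain ⟨F₀, hF₀, hF₀f⟩ := tietze_C hX.isClosed hf
  obtain ⟨x₀, hx₀, hmin⟩ := hX.exists_isMinOn hne hf.norm
  set m := ‖f x₀‖ with hm
  have hmpos : 0 < m := norm_pos_iff.2 (hf0 x₀ hx₀)
  have hmle : ∀ x ∈ X, m ≤ ‖f x‖ := fun x hx => hmin hx
  obtain ⟨F₁, hF₁, hF₁d, -⟩ := hF₀.exists_contDiff_approx 1 (ε := fun _ => m / 4) continuous_const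
    (fun _ => by positivity)
  have hdiff : Differentiable ℝ F₁ := hF₁.differentiable (by norm_num)
  have hsard : MeasureTheory.volume (F₁ '' {z | (fderiv ℝ F₁ z).det = 0}) = 0 :=
    MeasureTheory.addHaar_image_eq_zero_of_det_fderivWithin_eq_zero _
      (fun x _ => (hdiff x).hasFDerivAt.hasFDerivWithinAt) (fun x hx => hx)
  obtain ⟨c, hc, hc2⟩ : ∃ c ∈ Metric.ball (0:ℂ) (m/4), c ∉ F₁ '' {z | (fderiv ℝ F₁ z).det = 0} := by
    by_contra! hcon
    have := MeasureTheory.measure_mono_null (show Metric.ball (0:ℂ) (m/4) ⊆ _ from hcon) hsard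
    exact absurd this (Metric.measure_ball_pos _ _ (by positivity)).ne'
  have hcn : ‖c‖ < m / 4 := by simpa using hc
  set F : ℂ → ℂ := fun z => F₁ z - c with hFdef
  have hFc : Continuous F := by have := hF₁.continuous; fun_prop
  have hgood : ∀ z, F z = 0 → GoodZero F z := by
    intro z hz
    refine goodZero_of_fderiv hFc hz ((hdiff z).hasFDerivAt.sub_const c) ?_
    intro hdet
    exact hc2 ⟨z, hdet, sub_eq_zero.1 hz⟩
  obtain ⟨R, hR⟩ := hX.isBounded.subset_closedBall 0
  have hfin : ({z | z ∈ Metric.closedBall (0:ℂ) R ∧ F z = 0}).Finite := by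
    by_contra hinf
    obtain ⟨x, hx, hacc⟩ := Set.Infinite.exists_accPt_of_subset_isCompact hinf
      (isCompact_closedBall (0:ℂ) R) (fun z hz => hz.1)
    have hcl : IsClosed {z | F z = 0} := isClosed_eq hFc continuous_const
    have hx0 : F x = 0 := by
      have : x ∈ closure {z | F z = 0} := by
        have := hacc.clusterPt
        rw [← mem_closure_iff_clusterPt] at this
        exact closure_mono (fun z hz => hz.2) this
      rwa [hcl.closure_eq] at this
    have hev := (hgood x hx0).eventually
    rw [accPt_iff_frequently] at hacc
    rw [eventually_nhdsWithin_iff] at hev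
    obtain ⟨y, hy1, hy2⟩ := (hacc.and_eventually hev).exists
    exact hy2 hy1.1 hy1.2.2
  have hclose : ∀ x ∈ X, ‖f x - F x‖ < m / 2 := by
    intro x hx
    have h1 := hF₁d x
    rw [hF₀f x hx, dist_eq_norm, ← norm_neg, neg_sub] at h1
    have e : f x - F x = (f x - F₁ x) + c := by simp [hFdef]; ring
    rw [e]
    linarith [norm_add_le (f x - F₁ x) c]
  have hFbig : ∀ x ∈ X, m / 2 < ‖F x‖ := by
    intro x hx
    have h1 := hclose x hx
    have h2 := hmle x hx
    have h3 : ‖f x‖ ≤ ‖f x - F x‖ + ‖F x‖ := by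
      have := norm_add_le (f x - F x) (F x); simpa using this
    linarith
  have hFlog : HasLog F X := by
    refine hasLog_of_goodZeros hX hR hlog hfin.toFinset F hFc (fun z hz h => ?_) (fun z hz hzX => ?_) fun z hz => ?_
    · simpa using ⟨by simpa using hz, h⟩
    · have : F z = 0 := ((Set.Finite.mem_toFinset _).1 hz).2
      have h2 := hFbig z hzX
      rw [this, norm_zero] at h2; linarith
    · exact hgood z ((Set.Finite.mem_toFinset _).1 hz).2
  exact hasLog_of_close hFlog hf fun x hx => (hclose x hx).trans (hFbig x hx)

theorem eilenberg_conn {X : Set ℂ} (hX : IsCompact X) (hc : IsPreconnected Xᶜ)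
    {f : ℂ → ℂ} (hf : ContinuousOn f X) (hf0 : ∀ z ∈ X, f z ≠ 0) : HasLog f X :=
  eilenberg hX (fun _ ha => borsuk_hasLog_of_conn hX hc ha) hf hf0
end

section
open Set Topology unitInterval

theorem annulus_preconn {t : Set ℝ} (ht : t.OrdConnected) (h0 : t ⊆ Ioi 0) :
    IsPreconnected {z : ℂ | ‖z‖ ∈ t} := by
  have h1 : Convex ℝ {w : ℂ | Real.exp w.re ∈ t} := by
    have : (Real.exp ⁻¹' t).OrdConnected := ht.preimage_mono Real.exp_monotone
    exact this.convex.linear_preimage Complex.reLm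
  have h2 := h1.isPreconnected.image Complex.exp Complex.continuous_exp.continuousOn
  convert h2 using 1
  ext z
  constructor
  · intro hz
    have hz0 : z ≠ 0 := by rintro rfl; simpa using h0 hz
    exact ⟨Complex.log z, by
      show Real.exp _ ∈ t
      rw [Complex.log_re, Real.exp_log (norm_pos_iff.2 hz0)]; exact hz, Complex.exp_log hz0⟩
  · rintro ⟨w, hw, rfl⟩
    show ‖_‖ ∈ t
    rw [Complex.norm_exp]; exact hw

theorem compl_preconn_of_unbounded {X : Set ℂ} (hX : Bornology.IsBounded X)
    (h : ∀ w ∉ X, ¬ Bornology.IsBounded (connectedComponentIn Xᶜ w)) : IsPreconnected Xᶜ := by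
  obtain ⟨R, hR0, hR⟩ := hX.subset_closedBall_lt 0 0
  have hA : IsPreconnected {z : ℂ | ‖z‖ ∈ Ioi R} :=
    annulus_preconn ordConnected_Ioi fun x hx => hR0.trans hx
  have hAX : {z : ℂ | ‖z‖ ∈ Ioi R} ⊆ Xᶜ := by
    intro z hz hzX
    have h1 := hR hzX
    simp at h1
    exact absurd h1 (not_le.2 hz)
  have hex : ∀ w ∉ X, ∃ a ∈ connectedComponentIn Xᶜ w, a ∈ {z : ℂ | ‖z‖ ∈ Ioi R} := by
    intro w hw
    by_contra! hcon
    refine h w hw ((Metric.isBounded_closedBall (x := (0:ℂ)) (r := R)).subset fun a ha => ?_)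
    have := hcon a ha
    simpa using this
  have hsub : ∀ w ∉ X, {z : ℂ | ‖z‖ ∈ Ioi R} ⊆ connectedComponentIn Xᶜ w := by
    intro w hw
    obtain ⟨a, ha, haA⟩ := hex w hw
    rw [connectedComponentIn_eq ha]
    exact hA.subset_connectedComponentIn haA hAX
  refine isPreconnected_of_forall_pair fun x hx y hy => ?_
  obtain ⟨a, ha, haA⟩ := hex y hy
  have e : connectedComponentIn Xᶜ x = connectedComponentIn Xᶜ y := by
    rw [connectedComponentIn_eq (hsub x hx haA), connectedComponentIn_eq ha]
  exact ⟨connectedComponentIn Xᶜ x, connectedComponentIn_subset _ _, mem_connectedComponentIn hx,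
    by rw [e]; exact mem_connectedComponentIn hy, isPreconnected_connectedComponentIn⟩

theorem exists_cont_inv {α β : Type*} [TopologicalSpace α] [TopologicalSpace β] [T2Space β] [Nonempty α]
    {X : Set α} (hX : IsCompact X) {h : α → β} (hc : ContinuousOn h X) (hi : InjOn h X) :
    ∃ k : β → α, ContinuousOn k (h '' X) ∧ ∀ x ∈ X, k (h x) = x := by
  refine ⟨Function.invFunOn h X, ?_, fun x hx => hi.leftInvOn_invFunOn hx⟩
  rw [continuousOn_iff_isClosed]
  intro t ht
  have hcp : IsCompact (h '' (X ∩ t)) := (hX.inter_right ht).image_of_continuousOn (hc.mono inter_subset_left)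
  refine ⟨h '' (X ∩ t), hcp.isClosed, ?_⟩
  ext y
  constructor
  · rintro ⟨hy, x, hx, rfl⟩
    refine ⟨⟨x, ⟨hx, ?_⟩, rfl⟩, x, hx, rfl⟩
    rw [mem_preimage, hi.leftInvOn_invFunOn hx] at hy
    exact hy
  · rintro ⟨⟨x, hx, rfl⟩, hy⟩
    refine ⟨?_, hy⟩
    rw [mem_preimage, hi.leftInvOn_invFunOn hx.1]
    exact hx.2

/-- the homeomorphic image of a compact set on which all maps have logs has connected complement -/
theorem compl_preconn_of_hasLog {X : Set ℂ} (hX : IsCompact X)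
    (h : ∀ w ∉ X, HasLog (fun z => z - w) X) : IsPreconnected Xᶜ :=
  compl_preconn_of_unbounded hX.isBounded fun w hw => borsuk_unbounded hX.isClosed hw (h w hw)

theorem hasLog_image_disc {h : ℂ → ℂ} (hc : ContinuousOn h (Metric.closedBall 0 1))
    (hi : InjOn h (Metric.closedBall 0 1)) {f : ℂ → ℂ} (hf : ContinuousOn f (h '' Metric.closedBall 0 1))
    (hf0 : ∀ z ∈ h '' Metric.closedBall 0 1, f z ≠ 0) : HasLog f (h '' Metric.closedBall 0 1) := by
  obtain ⟨k, hk, hkh⟩ := exists_cont_inv (isCompact_closedBall (0:ℂ) 1) hc hi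
  have h1 : HasLog (fun z => f (h z)) (Metric.closedBall 0 1) :=
    hasLog_closedBall (hf.comp hc (mapsTo_image _ _)) fun x hx => hf0 _ (mem_image_of_mem _ hx)
  refine (h1.comp hk ?_).congr ?_
  · rintro _ ⟨x, hx, rfl⟩; rw [hkh x hx]; exact hx
  · rintro _ ⟨x, hx, rfl⟩; rw [hkh x hx]

theorem disc_compl_preconn {h : ℂ → ℂ} (hc : ContinuousOn h (Metric.closedBall 0 1))
    (hi : InjOn h (Metric.closedBall 0 1)) : IsPreconnected (h '' Metric.closedBall 0 1)ᶜ :=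
  compl_preconn_of_hasLog ((isCompact_closedBall _ _).image_of_continuousOn hc) fun w hw =>
    hasLog_image_disc hc hi (by fun_prop) fun z hz => sub_ne_zero.2 (by rintro rfl; exact hw hz)

theorem disc_interior_open {h : ℂ → ℂ} (hc : ContinuousOn h (Metric.closedBall 0 1))
    (hi : InjOn h (Metric.closedBall 0 1)) : IsOpen (h '' Metric.ball 0 1) := by
  have hSD : Metric.sphere (0:ℂ) 1 ⊆ Metric.closedBall 0 1 := Metric.sphere_subset_closedBall
  have hJ : IsCompact (h '' Metric.sphere 0 1) :=
    (isCompact_sphere _ _).image_of_continuousOn (hc.mono hSD)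
  have hnot : ¬ IsPreconnected (h '' Metric.sphere 0 1)ᶜ := by
    intro hcon
    obtain ⟨k, hk, hkh⟩ := exists_cont_inv (isCompact_sphere (0:ℂ) 1) (hc.mono hSD) (hi.mono hSD)
    have h1 : HasLog k (h '' Metric.sphere 0 1) := eilenberg_conn hJ hcon hk (by
      rintro _ ⟨x, hx, rfl⟩
      rw [hkh x hx]
      rintro rfl
      simp at hx)
    refine not_hasLog_circle (w := 0) one_pos ((h1.comp (hc.mono hSD) (mapsTo_image _ _)).congr fun x hx => ?_)
    rw [hkh x hx, sub_zero]
  have hcup : (h '' Metric.sphere 0 1)ᶜ = h '' Metric.ball 0 1 ∪ (h '' Metric.closedBall 0 1)ᶜ := by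
    have e : Metric.closedBall (0:ℂ) 1 = Metric.ball 0 1 ∪ Metric.sphere 0 1 := Metric.ball_union_sphere.symm
    ext y
    constructor
    · intro hy
      by_cases hyB : y ∈ h '' Metric.closedBall 0 1
      · rw [e, image_union] at hyB
        exact Or.inl (hyB.resolve_right hy)
      · exact Or.inr hyB
    · rintro (⟨x, hx, rfl⟩ | hy)
      · rintro ⟨y, hy, hxy⟩
        have := hi (hSD hy) (Metric.ball_subset_closedBall hx) hxy
        subst this
        rw [Metric.mem_sphere] at hy; rw [Metric.mem_ball] at hx; linarith
      · exact fun hy' => hy (image_mono hSD hy')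
  have hpD : IsPreconnected (h '' Metric.ball 0 1) :=
    ((convex_ball (0:ℂ) 1).isPreconnected).image h (hc.mono Metric.ball_subset_closedBall)
  have hpB := disc_compl_preconn hc hi
  rw [isOpen_iff_mem_nhds]
  intro x hx
  have hxJ : x ∈ (h '' Metric.sphere 0 1)ᶜ := by rw [hcup]; exact Or.inl hx
  have hVo : IsOpen (connectedComponentIn (h '' Metric.sphere 0 1)ᶜ x) :=
    hJ.isClosed.isOpen_compl.connectedComponentIn
  refine Filter.mem_of_superset (hVo.mem_nhds (mem_connectedComponentIn hxJ)) ?_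
  intro y hy
  by_contra hyD
  apply hnot
  have hyB : y ∈ (h '' Metric.closedBall 0 1)ᶜ := by
    have := connectedComponentIn_subset _ _ hy
    rw [hcup] at this
    exact this.resolve_left hyD
  have h1 : (h '' Metric.sphere 0 1)ᶜ ⊆ connectedComponentIn (h '' Metric.sphere 0 1)ᶜ x := by
    conv_lhs => rw [hcup]
    refine union_subset ?_ ?_
    · exact hpD.subset_connectedComponentIn hx (by rw [hcup]; exact subset_union_left)
    · rw [connectedComponentIn_eq hy]
      exact hpB.subset_connectedComponentIn hyB (by rw [hcup]; exact subset_union_right)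
  rw [h1.antisymm (connectedComponentIn_subset _ _)]
  exact isPreconnected_connectedComponentIn

/-- Invariance of domain in the plane. -/
theorem invariance_of_domain {U : Set ℂ} (hU : IsOpen U) {h : ℂ → ℂ} (hc : ContinuousOn h U)
    (hi : InjOn h U) : IsOpen (h '' U) := by
  rw [isOpen_iff_mem_nhds]
  rintro _ ⟨x, hx, rfl⟩
  obtain ⟨r, hr, hball⟩ := Metric.nhds_basis_closedBall.mem_iff.1 (hU.mem_nhds hx)
  have hr' : (r : ℂ) ≠ 0 := by exact_mod_cast hr.ne'
  have hm : ∀ z ∈ Metric.closedBall (0:ℂ) 1, x + r * z ∈ U := by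
    intro z hz
    apply hball
    rw [Metric.mem_closedBall, dist_eq_norm, add_sub_cancel_left, norm_mul, Complex.norm_real, Real.norm_of_nonneg hr.le]
    have : ‖z‖ ≤ 1 := by simpa using hz
    nlinarith
  have ho := disc_interior_open (h := fun z => h (x + r * z)) (hc.comp (by fun_prop) hm) (by
    intro z hz w hw hzw
    have := hi (hm z hz) (hm w hw) hzw
    simpa [hr'] using this)
  refine Filter.mem_of_superset (ho.mem_nhds ⟨0, by simp, by simp⟩) ?_
  rintro _ ⟨z, hz, rfl⟩
  exact ⟨_, hm z (Metric.ball_subset_closedBall hz), rfl⟩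
end

section
open Set Topology unitInterval

theorem log_differentiableOn {O : Set ℂ} (hO : IsOpen O) {f L : ℂ → ℂ} (hf : DifferentiableOn ℂ f O)
    (hL : ContinuousOn L O) (h : ∀ z ∈ O, Complex.exp (L z) = f z) : DifferentiableOn ℂ L O := by
  intro z hz
  have hzn := hO.mem_nhds hz
  have hfz : f z ≠ 0 := by rw [← h z hz]; exact Complex.exp_ne_zero _
  have hd : DifferentiableAt ℂ (fun w => L z + Complex.log (f w / f z)) z := by
    refine DifferentiableAt.const_add _ (DifferentiableAt.clog ?_ ?_)
    · exact (hf.differentiableAt hzn).div_const _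
    · rw [div_self hfz]; exact Complex.one_mem_slitPlane
  have hev : ∀ᶠ w in 𝓝 z, L w = L z + Complex.log (f w / f z) := by
    have hc : ContinuousAt L z := hL.continuousAt hzn
    have h2 : ∀ᶠ w in 𝓝 z, ‖L w - L z‖ < 1 := by
      have := hc (Metric.ball_mem_nhds (L z) one_pos)
      filter_upwards [this] with w hw
      simpa [dist_eq_norm] using hw
    filter_upwards [h2, hzn] with w hw hwO
    have hpi := Real.pi_gt_three
    have him := (Complex.abs_im_le_norm (L w - L z))
    have := abs_lt.1 (him.trans_lt hw)
    rw [← h w hwO, ← h z hz, ← Complex.exp_sub, Complex.log_exp (by linarith) (by linarith)]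
    ring
  exact (hd.congr_of_eventuallyEq hev).differentiableWithinAt

theorem hurwitz_local {O : Set ℂ} (hO : IsOpen O) {ι : Type*} {l : Filter ι} [l.NeBot] {F : ι → ℂ → ℂ} {f : ℂ → ℂ}
    (hF : ∀ i, DifferentiableOn ℂ (F i) O) (hlim : TendstoLocallyUniformlyOn F f l O)
    (h0 : ∀ i, ∀ z ∈ O, F i z ≠ 0) {b : ℂ} (hb : b ∈ O) (hfb : f b = 0) : ∀ᶠ z in 𝓝 b, f z = 0 := by
  have hfd : DifferentiableOn ℂ f O := hlim.differentiableOn (Filter.Eventually.of_forall hF) hO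
  have han : AnalyticAt ℂ f b := hfd.analyticAt (hO.mem_nhds hb)
  rcases han.eventually_eq_zero_or_eventually_ne_zero with h | h
  · exact h
  exfalso
  rw [eventually_nhdsWithin_iff] at h
  obtain ⟨r, hr, hball⟩ := Metric.nhds_basis_closedBall.mem_iff.1 (Filter.inter_mem h (hO.mem_nhds hb))
  have hfs : ∀ z ∈ Metric.sphere b r, f z ≠ 0 := fun z hz =>
    (hball (Metric.sphere_subset_closedBall hz)).1 (by rintro rfl; simp at hz; exact hr.ne hz)
  have hsO : Metric.sphere b r ⊆ O := fun z hz => (hball (Metric.sphere_subset_closedBall hz)).2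
  obtain ⟨x, hx, hmin⟩ := (isCompact_sphere b r).exists_isMinOn (NormedSpace.sphere_nonempty.2 hr.le)
    ((hfd.continuousOn.mono hsO).norm)
  set m := ‖f x‖ with hm
  have hmpos : 0 < m := norm_pos_iff.2 (hfs x hx)
  have hK := (tendstoLocallyUniformlyOn_iff_forall_isCompact hO).1 hlim (Metric.closedBall b r)
    (fun z hz => (hball hz).2) (isCompact_closedBall _ _)
  rw [Metric.tendstoUniformlyOn_iff] at hK
  obtain ⟨i, hi⟩ := (hK (m / 4) (by positivity)).exists
  have hcb : ∀ z ∈ Metric.closedBall b r, DifferentiableAt ℂ (fun z => (F i z)⁻¹) z := fun z hz =>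
    ((hF i).differentiableAt (hO.mem_nhds (hball hz).2)).inv (h0 i z (hball hz).2)
  have h1 : ‖(F i b)⁻¹‖ ≤ (m * (3/4))⁻¹ := by
    refine Complex.norm_le_of_forall_mem_frontier_norm_le (U := Metric.ball b r) (f := fun z => (F i z)⁻¹)
      Metric.isBounded_ball ?_ ?_ (subset_closure (Metric.mem_ball_self hr))
    · refine ⟨fun z hz => (hcb z (Metric.ball_subset_closedBall hz)).differentiableWithinAt, ?_⟩
      rw [closure_ball _ hr.ne']
      exact fun z hz => (hcb z hz).continuousAt.continuousWithinAt
    · intro z hz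
      rw [frontier_ball _ hr.ne'] at hz
      have h2 := hi z (Metric.sphere_subset_closedBall hz)
      have h3 : m ≤ ‖f z‖ := hmin hz
      rw [dist_eq_norm] at h2
      have h4 : ‖f z‖ ≤ ‖f z - F i z‖ + ‖F i z‖ := by
        have := norm_add_le (f z - F i z) (F i z); simpa using this
      show ‖(F i z)⁻¹‖ ≤ _
      rw [norm_inv]
      exact inv_anti₀ (by positivity) (by linarith)
  have h2 := hi b (Metric.mem_closedBall_self hr.le)
  rw [hfb, dist_eq_norm, zero_sub, norm_neg] at h2
  rw [norm_inv, inv_le_inv₀ (norm_pos_iff.2 (h0 i b hb)) (by positivity)] at h1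
  linarith

/-- Bounded holomorphic functions: ultrafilter limits are locally uniform. -/
theorem montel_ultra {O : Set ℂ} (hO : IsOpen O) {F : ℕ → ℂ → ℂ}
    (hF : ∀ i, DifferentiableOn ℂ (F i) O) (hm : ∀ i, MapsTo (F i) O (Metric.ball 0 1)) (l : Ultrafilter ℕ) :
    ∃ f : ℂ → ℂ, TendstoLocallyUniformlyOn F f l O ∧ ∀ z ∈ O, ‖f z‖ ≤ 1 := by
  have hex : ∀ z : ℂ, ∃ w : ℂ, z ∈ O → ‖w‖ ≤ 1 ∧ Filter.Tendsto (fun n => F n z) l (𝓝 w) := by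
    intro z
    by_cases hz : z ∈ O
    · obtain ⟨w, hw, hlim⟩ := (isCompact_closedBall (0:ℂ) 1).ultrafilter_le_nhds (l.map (fun n => F n z)) (by
        rw [Filter.le_principal_iff]
        exact Filter.Eventually.of_forall (f := (l : Filter ℕ)) fun n => Metric.ball_subset_closedBall (hm n hz))
      exact ⟨w, fun _ => ⟨by simpa using hw, hlim⟩⟩
    · exact ⟨0, fun h => absurd h hz⟩
  choose f hf using hex
  refine ⟨f, ?_, fun z hz => (hf z hz).1⟩
  rw [Metric.tendstoLocallyUniformlyOn_iff]
  intro ε hε x hx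
  obtain ⟨r, hr, hball⟩ := Metric.isOpen_iff.1 hO x hx
  have hlip : ∀ n, ∀ y ∈ Metric.ball x r, dist (F n y) (F n x) ≤ 2 / r * dist y x := by
    intro n y hy
    refine Complex.dist_le_div_mul_dist_of_mapsTo_ball ((hF n).mono hball) ?_ hy
    intro z hz
    have h1 := hm n (hball hz)
    have h2 := hm n hx
    rw [Metric.mem_ball] at h1 h2
    rw [Metric.mem_closedBall]
    have := dist_triangle_right (F n z) (F n x) 0
    linarith
  have hlip' : ∀ y ∈ Metric.ball x r, dist (f y) (f x) ≤ 2 / r * dist y x := by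
    intro y hy
    exact le_of_tendsto ((hf y (hball hy)).2.dist (hf x hx).2) (Filter.Eventually.of_forall fun n => hlip n y hy)
  set δ := min r (ε * r / 6) with hδ
  have hδpos : 0 < δ := lt_min hr (by positivity)
  refine ⟨Metric.ball x δ, mem_nhdsWithin_of_mem_nhds (Metric.ball_mem_nhds x hδpos), ?_⟩
  have hev := (hf x hx).2 (Metric.ball_mem_nhds (f x) (show 0 < ε / 3 by positivity))
  filter_upwards [hev] with n hn y hy
  have hyr : y ∈ Metric.ball x r := Metric.ball_subset_ball (min_le_left _ _) hy
  have hyδ : dist y x < ε * r / 6 := lt_of_lt_of_le hy (min_le_right _ _)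
  have hb : 2 / r * dist y x < ε / 3 := by
    calc 2 / r * dist y x < 2 / r * (ε * r / 6) := by gcongr
      _ = ε / 3 := by field_simp; norm_num
  have h1 := hlip n y hyr
  have h2 := hlip' y hyr
  have h3 : dist (F n x) (f x) < ε / 3 := hn
  have := dist_triangle4 (f y) (f x) (F n x) (F n y)
  rw [dist_comm (f x) (F n x), dist_comm (F n x) (F n y)] at this
  linarith

/-- disc automorphism -/
noncomputable def mob (c z : ℂ) : ℂ := (z - c) / (1 - (starRingEnd ℂ) c * z)

theorem mob_den {c z : ℂ} (hc : ‖c‖ < 1) (hz : ‖z‖ < 1) : 1 - (starRingEnd ℂ) c * z ≠ 0 := by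
  intro h
  have : (starRingEnd ℂ) c * z = 1 := (sub_eq_zero.1 h).symm
  have h2 : ‖c‖ * ‖z‖ = 1 := by rw [← RCLike.norm_conj c, ← norm_mul, this, norm_one]
  nlinarith [norm_nonneg c, norm_nonneg z]

theorem mob_norm {c z : ℂ} (hc : ‖c‖ < 1) (hz : ‖z‖ < 1) : ‖mob c z‖ < 1 := by
  have hd := mob_den hc hz
  unfold mob
  rw [norm_div, div_lt_one (norm_pos_iff.2 hd)]
  apply lt_of_pow_lt_pow_left₀ 2 (norm_nonneg _)
  have e : ‖1 - (starRingEnd ℂ) c * z‖ ^ 2 - ‖z - c‖ ^ 2 = (1 - ‖c‖ ^ 2) * (1 - ‖z‖ ^ 2) := by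
    rw [← Complex.normSq_eq_norm_sq, ← Complex.normSq_eq_norm_sq, ← Complex.normSq_eq_norm_sq,
      ← Complex.normSq_eq_norm_sq]
    simp [Complex.normSq_apply]; ring
  have h1 : 0 < (1 - ‖c‖ ^ 2) * (1 - ‖z‖ ^ 2) := by
    apply mul_pos <;> nlinarith [norm_nonneg c, norm_nonneg z]
  linarith

theorem mob_hasDeriv {c z : ℂ} (hc : ‖c‖ < 1) (hz : ‖z‖ < 1) :
    HasDerivAt (mob c) ((1 - (starRingEnd ℂ) c * c) / (1 - (starRingEnd ℂ) c * z) ^ 2) z := by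
  have hd := mob_den hc hz
  have h1 : HasDerivAt (fun z => z - c) 1 z := (hasDerivAt_id z).sub_const c
  have h2 : HasDerivAt (fun z => 1 - (starRingEnd ℂ) c * z) (-((starRingEnd ℂ) c * 1)) z :=
    ((hasDerivAt_id z).const_mul _).const_sub 1
  convert! h1.div h2 hd using 1
  ring

theorem mob_inj {c z w : ℂ} (hc : ‖c‖ < 1) (hz : ‖z‖ < 1) (hw : ‖w‖ < 1) (h : mob c z = mob c w) : z = w := by
  have h1 := mob_den hc hz
  have h2 := mob_den hc hw
  have h3 := mob_den hc hc
  unfold mob at h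
  rw [div_eq_div_iff h1 h2] at h
  have : (z - w) * (1 - (starRingEnd ℂ) c * c) = 0 := by linear_combination h
  exact sub_eq_zero.1 ((mul_eq_zero.1 this).resolve_right h3)

theorem mob_zero_iff {c z : ℂ} (hc : ‖c‖ < 1) (hz : ‖z‖ < 1) : mob c z = 0 ↔ z = c := by
  unfold mob
  rw [div_eq_zero_iff, or_iff_left (mob_den hc hz), sub_eq_zero]
end

section
open Set Topology unitInterval

structure RFam (Ω : Set ℂ) (ψ : ℂ → ℂ) : Prop where
  diff : DifferentiableOn ℂ ψ Ω
  inj : InjOn ψ Ω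
  maps : MapsTo ψ Ω (Metric.ball 0 1)
  zero : ψ 0 = 0
  dne : ∀ z ∈ Ω, deriv ψ z ≠ 0

/-- Koebe's trick: a non-surjective element is not extremal. -/
theorem koebe_step {Ω : Set ℂ} (hO : IsOpen Ω) (h0 : (0:ℂ) ∈ Ω)
    (hlog : ∀ f : ℂ → ℂ, DifferentiableOn ℂ f Ω → (∀ z ∈ Ω, f z ≠ 0) → HasLog f Ω)
    {ψ : ℂ → ℂ} (hψ : RFam Ω ψ) {c : ℂ} (hc : ‖c‖ < 1) (hcn : ∀ z ∈ Ω, ψ z ≠ c) :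
    ∃ ψ' : ℂ → ℂ, RFam Ω ψ' ∧ ‖deriv ψ 0‖ < ‖deriv ψ' 0‖ := by
  have hn : ∀ z ∈ Ω, ‖ψ z‖ < 1 := fun z hz => by simpa using hψ.maps hz
  have hdψ : ∀ z ∈ Ω, HasDerivAt ψ (deriv ψ z) z := fun z hz =>
    (hψ.diff.differentiableAt (hO.mem_nhds hz)).hasDerivAt
  set f : ℂ → ℂ := fun z => mob c (ψ z) with hf
  have hdf : ∀ z ∈ Ω, HasDerivAt f ((1 - (starRingEnd ℂ) c * c) / (1 - (starRingEnd ℂ) c * ψ z) ^ 2 * deriv ψ z) z :=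
    fun z hz => (mob_hasDeriv hc (hn z hz)).comp z (hdψ z hz)
  have hfd : DifferentiableOn ℂ f Ω := fun z hz => (hdf z hz).differentiableAt.differentiableWithinAt
  have hf0 : ∀ z ∈ Ω, f z ≠ 0 := fun z hz h => hcn z hz ((mob_zero_iff hc (hn z hz)).1 h)
  obtain ⟨L, hL, hLf⟩ := hlog f hfd hf0
  have hLd := log_differentiableOn hO hfd hL hLf
  set g : ℂ → ℂ := fun z => Complex.exp (L z / 2) with hg
  have hgg : ∀ z ∈ Ω, g z ^ 2 = f z := by
    intro z hz
    rw [hg, ← hLf z hz, ← Complex.exp_nat_mul]; congr 1; push_cast; ring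
  have hgne : ∀ z, g z ≠ 0 := fun z => Complex.exp_ne_zero _
  have hgd : ∀ z ∈ Ω, DifferentiableAt ℂ g z := by
    intro z hz
    have := (hLd.differentiableAt (hO.mem_nhds hz))
    exact (this.div_const 2).cexp
  have hgn : ∀ z ∈ Ω, ‖g z‖ < 1 := by
    intro z hz
    have : ‖g z‖ ^ 2 < 1 := by
      rw [← norm_pow, hgg z hz]; exact mob_norm hc (hn z hz)
    nlinarith [norm_nonneg (g z)]
  have hgder : ∀ z ∈ Ω, 2 * g z * deriv g z =
      (1 - (starRingEnd ℂ) c * c) / (1 - (starRingEnd ℂ) c * ψ z) ^ 2 * deriv ψ z := by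
    intro z hz
    have h1 : HasDerivAt (fun z => g z ^ 2) (2 * g z * deriv g z) z := by
      convert! (hgd z hz).hasDerivAt.pow 2 using 1
      simp
    have h2 : HasDerivAt (fun z => g z ^ 2) _ z := (hdf z hz).congr_of_eventuallyEq (by
      filter_upwards [hO.mem_nhds hz] with w hw using hgg w hw)
    exact h1.unique h2
  set d := g 0 with hd
  have hd1 : ‖d‖ < 1 := hgn 0 h0
  refine ⟨fun z => mob d (g z), ⟨?_, ?_, ?_, ?_, ?_⟩, ?_⟩
  · exact fun z hz => ((mob_hasDeriv hd1 (hgn z hz)).comp z (hgd z hz).hasDerivAt).differentiableAt.differentiableWithinAt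
  · intro z hz w hw hzw
    have h1 := mob_inj hd1 (hgn z hz) (hgn w hw) hzw
    have h2 : f z = f w := by rw [← hgg z hz, ← hgg w hw, h1]
    exact hψ.inj hz hw (mob_inj hc (hn z hz) (hn w hw) h2)
  · intro z hz
    simpa using mob_norm hd1 (hgn z hz)
  · show mob d (g 0) = 0
    rw [mob_zero_iff hd1 (hgn 0 h0)]
  · intro z hz
    have h1 := ((mob_hasDeriv hd1 (hgn z hz)).comp z (hgd z hz).hasDerivAt).deriv
    have h1' : deriv (fun z => mob d (g z)) z = _ := h1
    rw [h1']
    refine mul_ne_zero (div_ne_zero (mob_den hd1 hd1) (pow_ne_zero _ (mob_den hd1 (hgn z hz)))) ?_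
    have h2 := hgder z hz
    intro h3
    rw [h3, mul_zero] at h2
    exact (mul_ne_zero (div_ne_zero (mob_den hc hc) (pow_ne_zero _ (mob_den hc (hn z hz)))) (hψ.dne z hz)) h2.symm
  · have h1 : deriv (fun z => mob d (g z)) 0 = _ := ((mob_hasDeriv hd1 (hgn 0 h0)).comp 0 (hgd 0 h0).hasDerivAt).deriv
    rw [h1]
    have h2 := hgder 0 h0
    have hcd : d ^ 2 = -c := by
      rw [hd, hgg 0 h0, hf]; simp [mob, hψ.zero]
    have hcd' : ‖c‖ = ‖d‖ ^ 2 := by rw [← norm_pow, hcd, norm_neg]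
    have hdpos : 0 < ‖d‖ := norm_pos_iff.2 (hgne 0)
    have e1 : ∀ a : ℂ, ‖a‖ < 1 → ‖1 - (starRingEnd ℂ) a * a‖ = 1 - ‖a‖ ^ 2 := by
      intro a ha
      have : (1 - (starRingEnd ℂ) a * a) = ((1 - ‖a‖ ^ 2 : ℝ) : ℂ) := by
        rw [mul_comm, Complex.mul_conj, Complex.normSq_eq_norm_sq]; push_cast; ring
      rw [this, Complex.norm_real, Real.norm_of_nonneg]
      nlinarith [norm_nonneg a]
    have h3 := congrArg norm h2
    rw [norm_mul, norm_mul, norm_mul, norm_div, norm_pow, hψ.zero, e1 c hc, hcd'] at h3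
    simp only [mul_zero, sub_zero, norm_one, one_pow, div_one, Complex.norm_ofNat] at h3
    rw [norm_mul, norm_div, norm_pow, ← hd, e1 d hd1]
    rw [← hd] at h3
    have hM : 0 < ‖deriv ψ 0‖ := norm_pos_iff.2 (hψ.dne 0 h0)
    have hs : 0 < 1 - ‖d‖ ^ 2 := by nlinarith
    have h4 : ‖deriv g 0‖ = (1 - (‖d‖ ^ 2) ^ 2) * ‖deriv ψ 0‖ / (2 * ‖d‖) := by
      field_simp; linarith
    rw [h4]
    have h5 : (1 - ‖d‖ ^ 2) / (1 - ‖d‖ ^ 2) ^ 2 * ((1 - (‖d‖ ^ 2) ^ 2) * ‖deriv ψ 0‖ / (2 * ‖d‖)) =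
        (1 + ‖d‖ ^ 2) / (2 * ‖d‖) * ‖deriv ψ 0‖ := by
      have : (1 - (‖d‖ ^ 2) ^ 2) = (1 - ‖d‖ ^ 2) * (1 + ‖d‖ ^ 2) := by ring
      rw [this]; field_simp
    rw [h5]
    have h6 : 1 < (1 + ‖d‖ ^ 2) / (2 * ‖d‖) := by
      rw [lt_div_iff₀ (by positivity)]
      nlinarith [sq_nonneg (1 - ‖d‖), mul_pos (sub_pos.2 hd1) (sub_pos.2 hd1)]
    nlinarith

theorem riemann_mapping {Ω : Set ℂ} (hO : IsOpen Ω) (hconn : IsPreconnected Ω)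
    (hbd : Bornology.IsBounded Ω) (h0 : (0:ℂ) ∈ Ω)
    (hlog : ∀ f : ℂ → ℂ, DifferentiableOn ℂ f Ω → (∀ z ∈ Ω, f z ≠ 0) → HasLog f Ω) :
    ∃ ψ : ℂ → ℂ, RFam Ω ψ ∧ ψ '' Ω = Metric.ball 0 1 := by
  obtain ⟨R, hR0, hR⟩ := hbd.subset_ball_lt 0 0
  have hR0' : (R : ℂ) ≠ 0 := by exact_mod_cast hR0.ne'
  have hfam0 : RFam Ω (fun z => z / R) := by
    refine ⟨by fun_prop, fun z _ w _ h => ?_, fun z hz => ?_, by simp, fun z _ => ?_⟩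
    · exact (div_left_inj' hR0').1 h
    · have : ‖z‖ < R := by simpa using hR hz
      simp only [Metric.mem_ball, dist_zero_right, norm_div, Complex.norm_real]
      rw [Real.norm_of_nonneg hR0.le, div_lt_one hR0]; exact this
    · have : HasDerivAt (fun z : ℂ => z / R) (1 / R) z := (hasDerivAt_id z).div_const _
      rw [this.deriv]; exact one_div_ne_zero hR0'
  obtain ⟨r, hr, hball⟩ := Metric.isOpen_iff.1 hO 0 h0
  set S : Set ℝ := {t | ∃ ψ, RFam Ω ψ ∧ t = ‖deriv ψ 0‖} with hS
  have hSne : S.Nonempty := ⟨_, _, hfam0, rfl⟩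
  have hSbd : BddAbove S := by
    refine ⟨1 / r, ?_⟩
    rintro _ ⟨ψ, hψ, rfl⟩
    refine Complex.norm_deriv_le_div_of_mapsTo_ball (hψ.diff.mono hball) ?_ hr
    intro z hz
    have h1 := hψ.maps (hball hz)
    rw [hψ.zero]
    exact Metric.ball_subset_closedBall h1
  obtain ⟨u, -, hu, huS⟩ := exists_seq_tendsto_sSup hSne hSbd
  choose Ψ hΨ hΨu using huS
  set l : Ultrafilter ℕ := Filter.hyperfilter ℕ with hl
  have hl_le : (l : Filter ℕ) ≤ Filter.atTop := by
    rw [← Nat.cofinite_eq_atTop]; exact Filter.hyperfilter_le_cofinite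
  obtain ⟨ψ, hlim, hψ1⟩ := montel_ultra hO (fun i => (hΨ i).diff) (fun i => (hΨ i).maps) l
  have hψd : DifferentiableOn ℂ ψ Ω := hlim.differentiableOn (Filter.Eventually.of_forall fun i => (hΨ i).diff) hO
  have hlim' : TendstoLocallyUniformlyOn (deriv ∘ Ψ) (deriv ψ) l Ω :=
    hlim.deriv (Filter.Eventually.of_forall fun i => (hΨ i).diff) hO
  have hder : ‖deriv ψ 0‖ = sSup S := by
    have h1 : Filter.Tendsto (fun n => ‖deriv (Ψ n) 0‖) l (𝓝 ‖deriv ψ 0‖) := (hlim'.tendsto_at h0).norm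
    have h2 : Filter.Tendsto (fun n => ‖deriv (Ψ n) 0‖) l (𝓝 (sSup S)) := by
      have : (fun n => ‖deriv (Ψ n) 0‖) = u := by ext n; exact (hΨu n).symm
      rw [this]; exact hu.mono_left hl_le
    exact tendsto_nhds_unique h1 h2
  have hderne : deriv ψ 0 ≠ 0 := by
    rw [← norm_pos_iff, hder]
    exact lt_of_lt_of_le (norm_pos_iff.2 (hfam0.dne 0 h0)) (le_csSup hSbd ⟨_, hfam0, rfl⟩)
  have hψan : AnalyticOnNhd ℂ ψ Ω := hψd.analyticOnNhd hO
  have hψ0 : ψ 0 = 0 := by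
    have h1 := hlim.tendsto_at h0
    have : (fun n => Ψ n 0) = fun _ => 0 := by ext n; exact (hΨ n).zero
    rw [this] at h1
    exact (tendsto_nhds_unique h1 tendsto_const_nhds)
  have hdne : ∀ z ∈ Ω, deriv ψ z ≠ 0 := by
    intro b hb hb0
    have hev := hurwitz_local hO (F := deriv ∘ Ψ) (fun i => (hΨ i).diff.deriv hO) hlim'
      (fun i z hz => (hΨ i).dne z hz) hb hb0
    have := hψan.deriv.eqOn_of_preconnected_of_eventuallyEq (g := fun _ => 0) analyticOnNhd_const hconn hb hev
    exact hderne (this h0)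
  have hinj : InjOn ψ Ω := by
    intro a ha b hb hab
    by_contra hne
    have hO' : IsOpen (Ω \ {a}) := hO.sdiff isClosed_singleton
    have hbO : b ∈ Ω \ {a} := ⟨hb, fun h => hne h.symm⟩
    have hlim2 : TendstoLocallyUniformlyOn (fun n z => Ψ n z - Ψ n a) (fun z => ψ z - ψ a) l (Ω \ {a}) := by
      have h1 := hlim.mono (s' := Ω \ {a}) sdiff_subset
      have h2 : TendstoLocallyUniformlyOn (fun n (_ : ℂ) => Ψ n a) (fun _ => ψ a) l (Ω \ {a}) := by
        rw [Metric.tendstoLocallyUniformlyOn_iff]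
        intro ε hε x hx
        refine ⟨univ, Filter.univ_mem, ?_⟩
        filter_upwards [(hlim.tendsto_at ha) (Metric.ball_mem_nhds _ hε)] with n hn y _
        rw [dist_comm]; exact hn
      exact h1.sub h2
    have hev := hurwitz_local hO' (F := fun n z => Ψ n z - Ψ n a) (fun i => ((hΨ i).diff.mono sdiff_subset).sub_const _)
      hlim2 (fun i z hz h => hz.2 ((hΨ i).inj hz.1 ha (sub_eq_zero.1 h))) hbO (sub_eq_zero.2 hab.symm)
    have hev' : ψ =ᶠ[𝓝 b] fun _ => ψ a := by
      filter_upwards [hev] with z hz using sub_eq_zero.1 hz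
    have h3 := hψan.eqOn_of_preconnected_of_eventuallyEq (g := fun _ => ψ a) analyticOnNhd_const hconn hb hev'
    have h4 : ψ =ᶠ[𝓝 0] fun _ => ψ a := by
      filter_upwards [hO.mem_nhds h0] with z hz using h3 hz
    exact hderne (by rw [h4.deriv_eq]; simp)
  have hmaps : MapsTo ψ Ω (Metric.ball 0 1) := by
    have ho := invariance_of_domain hO hψd.continuousOn hinj
    have hsub : ψ '' Ω ⊆ interior (Metric.closedBall 0 1) := by
      refine interior_maximal ?_ ho
      rintro _ ⟨z, hz, rfl⟩
      simpa using hψ1 z hz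
    rw [interior_closedBall _ one_ne_zero] at hsub
    exact fun z hz => hsub (mem_image_of_mem _ hz)
  have hψ : RFam Ω ψ := ⟨hψd, hinj, hmaps, hψ0, hdne⟩
  refine ⟨ψ, hψ, Subset.antisymm (image_subset_iff.2 hmaps) ?_⟩
  intro c hc
  by_contra hcn
  obtain ⟨ψ', hψ', hlt⟩ := koebe_step hO h0 hlog hψ (c := c) (by simpa using hc) (fun z hz h => hcn ⟨z, hz, h⟩)
  rw [hder] at hlt
  exact absurd (le_csSup hSbd ⟨ψ', hψ', rfl⟩) (not_le.2 hlt)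
end

section
open Set Topology unitInterval

theorem hasLog_of_compl_preconn {Ω : Set ℂ} (hO : IsOpen Ω) (hconn : IsPreconnected Ω)
    (hbd : Bornology.IsBounded Ω) (h0 : (0:ℂ) ∈ Ω) (hcc : IsPreconnected Ωᶜ) {f : ℂ → ℂ}
    (hf : ContinuousOn f Ω) (hf0 : ∀ z ∈ Ω, f z ≠ 0) : HasLog f Ω := by
  classical
  set K : ℕ → Set ℂ := fun n => (Metric.thickening (1 / ((n:ℝ) + 1)) Ωᶜ)ᶜ with hK
  have hKΩ : ∀ n, K n ⊆ Ω := by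
    intro n z hz
    by_contra hzΩ
    exact hz (Metric.self_subset_thickening (by positivity) _ hzΩ)
  have hKc : ∀ n, IsCompact (K n) := fun n =>
    Metric.isCompact_of_isClosed_isBounded Metric.isOpen_thickening.isClosed_compl (hbd.subset (hKΩ n))
  have hKp : ∀ n, IsPreconnected (K n)ᶜ := by
    intro n
    rw [hK]
    simp only [compl_compl]
    refine isPreconnected_of_forall_pair fun x hx y hy => ?_
    rw [Metric.mem_thickening_iff] at hx hy
    obtain ⟨a, ha, hax⟩ := hx
    obtain ⟨c, hc, hcy⟩ := hy
    have hpos : (0:ℝ) < 1 / ((n:ℝ) + 1) := by positivity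
    refine ⟨Metric.ball a (1 / ((n:ℝ) + 1)) ∪ (Ωᶜ ∪ Metric.ball c (1 / ((n:ℝ) + 1))), ?_, Or.inl hax,
      Or.inr (Or.inr hcy), ?_⟩
    · refine union_subset (Metric.ball_subset_thickening ha _) (union_subset
        (Metric.self_subset_thickening hpos _) (Metric.ball_subset_thickening hc _))
    · refine IsPreconnected.union a (Metric.mem_ball_self hpos) (Or.inl ha) (convex_ball _ _).isPreconnected ?_
      exact IsPreconnected.union c hc (Metric.mem_ball_self hpos) hcc (convex_ball _ _).isPreconnected
  have hKmono : ∀ m n, m ≤ n → K m ⊆ K n := by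
    intro m n hmn
    refine compl_subset_compl.2 (Metric.thickening_mono ?_ _)
    exact one_div_le_one_div_of_le (by positivity) (by have : (m:ℝ) ≤ n := by exact_mod_cast hmn
                                                       linarith)
  have hKlog : ∀ n, ∃ L : ℂ → ℂ, ContinuousOn L (K n) ∧ (∀ z ∈ K n, Complex.exp (L z) = f z) ∧ L 0 = Complex.log (f 0) := by
    intro n
    obtain ⟨L, hL, hLf⟩ := eilenberg_conn (hKc n) (hKp n) (hf.mono (hKΩ n)) (fun z hz => hf0 z (hKΩ n hz))
    by_cases h0n : (0:ℂ) ∈ K n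
    · refine ⟨fun z => L z + (Complex.log (f 0) - L 0), hL.add continuousOn_const, fun z hz => ?_, by ring⟩
      rw [Complex.exp_add, hLf z hz, Complex.exp_sub, Complex.exp_log (hf0 0 h0), hLf 0 h0n, div_self (hf0 0 h0), mul_one]
    · refine ⟨Function.update L 0 (Complex.log (f 0)), ?_, ?_, by simp⟩
      · exact hL.congr fun z hz => Function.update_of_ne (by rintro rfl; exact h0n hz) _ _
      · intro z hz
        rw [Function.update_of_ne (by rintro rfl; exact h0n hz)]; exact hLf z hz
  choose L hL hLf hL0 using hKlog
  set C : ℕ → Set ℂ := fun n => connectedComponentIn (K n) 0 with hC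
  -- every closed ball in Ω is inside some K n
  have hballK : ∀ x ∈ Ω, ∃ r > 0, ∃ n, ∀ m, n ≤ m → Metric.ball x r ⊆ K m := by
    intro x hx
    obtain ⟨r, hr, hb⟩ := Metric.isOpen_iff.1 hO x hx
    obtain ⟨n, hn⟩ := exists_nat_one_div_lt (half_pos hr)
    refine ⟨r / 2, half_pos hr, n, fun m hm => Subset.trans ?_ (hKmono n m hm)⟩
    intro y hy hyt
    rw [Metric.mem_thickening_iff] at hyt
    obtain ⟨a, ha, hay⟩ := hyt
    refine ha (hb ?_)
    rw [Metric.mem_ball] at hy ⊢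
    have := dist_triangle_left a x y
    linarith
  have hstep : ∀ x ∈ Ω, ∃ r > 0, ∀ y ∈ Metric.ball x r, ∀ m, y ∈ C m → ∃ N, Metric.ball x r ⊆ C N := by
    intro x hx
    obtain ⟨r, hr, n, hn⟩ := hballK x hx
    refine ⟨r, hr, fun y hy m hym => ⟨max m n, ?_⟩⟩
    have h0m : (0:ℂ) ∈ K m := by
      by_contra h
      rw [hC] at hym; simp only at hym
      rw [connectedComponentIn_eq_empty h] at hym; exact hym
    have hp : IsPreconnected (C m ∪ Metric.ball x r) :=
      IsPreconnected.union y hym hy isPreconnected_connectedComponentIn (convex_ball _ _).isPreconnected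
    refine subset_trans subset_union_right (hp.subset_connectedComponentIn (Or.inl (mem_connectedComponentIn h0m)) ?_)
    exact union_subset ((connectedComponentIn_subset _ _).trans (hKmono _ _ (le_max_left _ _))) (hn _ (le_max_right _ _))
  have hall : ∀ z ∈ Ω, ∃ n, z ∈ C n := by
    intro z hz
    have key := hconn.induction₂ (fun a b => ((∃ n, a ∈ C n) ↔ ∃ n, b ∈ C n)) (fun x hx => ?_)
      (fun x y z _ _ _ h1 h2 => h1.trans h2) (fun x y _ _ h => h.symm) h0 hz
    · refine key.1 ?_
      obtain ⟨r, hr, n, hn⟩ := hballK 0 h0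
      exact ⟨n, mem_connectedComponentIn (hn n le_rfl (Metric.mem_ball_self hr))⟩
    · obtain ⟨r, hr, hst⟩ := hstep x hx
      filter_upwards [nhdsWithin_le_nhds (Metric.ball_mem_nhds x hr)] with y hy
      constructor
      · rintro ⟨m, hm⟩
        obtain ⟨N, hN⟩ := hst x (Metric.mem_ball_self hr) m hm
        exact ⟨N, hN hy⟩
      · rintro ⟨m, hm⟩
        obtain ⟨N, hN⟩ := hst y hy m hm
        exact ⟨N, hN (Metric.mem_ball_self hr)⟩
  choose! idx hidx using hall
  have hagree : ∀ m n z, m ≤ n → z ∈ C m → L m z = L n z := by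
    intro m n z hmn hz
    have h0m : (0:ℂ) ∈ K m := by
      by_contra h
      rw [hC] at hz; simp only at hz
      rw [connectedComponentIn_eq_empty h] at hz; exact hz
    have hsub : C m ⊆ K m := connectedComponentIn_subset _ _
    have := log_diff_const (X := C m) (g := L m) (g' := L n) isPreconnected_connectedComponentIn
      ((hL m).mono hsub) ((hL n).mono (hsub.trans (hKmono m n hmn)))
      (fun x hx => by rw [hLf m x (hsub hx), hLf n x (hKmono m n hmn (hsub hx))]) hz (mem_connectedComponentIn h0m)
    rw [hL0, hL0, sub_self] at this
    exact sub_eq_zero.1 this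
  have hagree' : ∀ m n z, z ∈ C m → z ∈ C n → L m z = L n z := by
    intro m n z h1 h2
    rcases le_total m n with h | h
    · exact hagree m n z h h1
    · exact (hagree n m z h h2).symm
  refine ⟨fun z => L (idx z) z, ?_, ?_⟩
  · intro x hx
    obtain ⟨r, hr, hst⟩ := hstep x hx
    obtain ⟨N, hN⟩ := hst x (Metric.mem_ball_self hr) _ (hidx x hx)
    have hnb : K N ∈ 𝓝 x := Filter.mem_of_superset (Metric.ball_mem_nhds x hr)
      (hN.trans (connectedComponentIn_subset _ _))
    have hcN : ContinuousAt (L N) x := (hL N).continuousAt hnb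
    refine (hcN.congr ?_).continuousWithinAt
    filter_upwards [Metric.ball_mem_nhds x hr, hO.mem_nhds hx] with y hy hyΩ
    exact hagree' _ _ _ (hN hy) (hidx y hyΩ)
  · intro z hz
    exact hLf _ z (connectedComponentIn_subset _ _ (hidx z hz))

/-- Riemann map from the disc. -/
theorem riemann_mapping' {Ω : Set ℂ} (hO : IsOpen Ω) (hconn : IsPreconnected Ω)
    (hbd : Bornology.IsBounded Ω) (h0 : (0:ℂ) ∈ Ω) (hcc : IsPreconnected Ωᶜ) :
    ∃ φ : ℂ → ℂ, DifferentiableOn ℂ φ (Metric.ball 0 1) ∧ InjOn φ (Metric.ball 0 1) ∧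
      φ '' Metric.ball 0 1 = Ω ∧ φ 0 = 0 ∧ deriv φ 0 ≠ 0 := by
  obtain ⟨ψ, hψ, him⟩ := riemann_mapping hO hconn hbd h0
    (fun f hf hf0 => hasLog_of_compl_preconn hO hconn hbd h0 hcc hf.continuousOn hf0)
  set φ := Function.invFunOn ψ Ω with hφ
  have hl : ∀ z ∈ Ω, φ (ψ z) = z := fun z hz => hψ.inj.leftInvOn_invFunOn hz
  have hb0 : (0:ℂ) ∈ Metric.ball (0:ℂ) 1 := by simp
  have hcont : ∀ z ∈ Ω, ContinuousAt φ (ψ z) := by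
    intro z hz
    intro V hV
    rw [hl z hz] at hV
    obtain ⟨W, hWV, hWo, hzW⟩ := mem_nhds_iff.1 hV
    have ho := invariance_of_domain (hWo.inter hO) (hψ.diff.continuousOn.mono inter_subset_right) (hψ.inj.mono inter_subset_right)
    rw [Filter.mem_map]
    refine Filter.mem_of_superset (ho.mem_nhds ⟨z, ⟨hzW, hz⟩, rfl⟩) ?_
    rintro _ ⟨w, hw, rfl⟩
    rw [mem_preimage, hl w hw.2]
    exact hWV hw.1
  have hright : ∀ w ∈ Metric.ball (0:ℂ) 1, ψ (φ w) = w := by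
    intro w hw
    rw [← him] at hw
    obtain ⟨z, hz, rfl⟩ := hw
    rw [hl z hz]
  have hder : ∀ z ∈ Ω, HasDerivAt φ (deriv ψ z)⁻¹ (ψ z) := by
    intro z hz
    have h1 : HasDerivAt ψ (deriv ψ z) (φ (ψ z)) := by
      rw [hl z hz]; exact (hψ.diff.differentiableAt (hO.mem_nhds hz)).hasDerivAt
    refine h1.of_local_left_inverse (hcont z hz) (hψ.dne z hz) ?_
    filter_upwards [Metric.isOpen_ball.mem_nhds (hψ.maps hz)] with w hw using hright w hw
  have h00 : φ 0 = 0 := by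
    have := hl 0 h0
    rwa [hψ.zero] at this
  refine ⟨φ, ?_, ?_, ?_, h00, ?_⟩
  · intro w hw
    rw [← him] at hw
    obtain ⟨z, hz, rfl⟩ := hw
    exact (hder z hz).differentiableAt.differentiableWithinAt
  · intro w hw w' hw' h
    rw [← hright w hw, h, hright w' hw']
  · rw [← him, image_image]
    ext z
    constructor
    · rintro ⟨w, hw, rfl⟩
      show φ (ψ w) ∈ Ω
      rw [hl w hw]; exact hw
    · intro hz; exact ⟨z, hz, hl z hz⟩
  · have := hder 0 h0
    rw [hψ.zero] at this
    rw [this.deriv]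
    exact inv_ne_zero (hψ.dne 0 h0)
end

section
open Set Topology unitInterval

/-- Exterior Riemann map of a closed disc in the plane. -/
theorem ext_riemann {h : ℂ → ℂ} (hc : ContinuousOn h (Metric.closedBall 0 1))
    (hi : InjOn h (Metric.closedBall 0 1)) (h00 : h 0 = 0) :
    ∃ (a : ℂ) (m : ℂ → ℂ), a ≠ 0 ∧ DifferentiableOn ℂ m (Metric.ball 0 1) ∧
      InjOn (fun z => a * z + m z⁻¹) {z : ℂ | 1 < ‖z‖} ∧
      (fun z => a * z + m z⁻¹) '' {z : ℂ | 1 < ‖z‖} = (h '' Metric.closedBall 0 1)ᶜ ∧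
      ∀ R : ℝ, ∃ Q : ℝ, ∀ z : ℂ, 1 < ‖z‖ → ‖z‖ ≤ R → ‖a * z + m z⁻¹‖ ≤ Q := by
  set B := h '' Metric.closedBall 0 1 with hB
  have hBc : IsCompact B := (isCompact_closedBall (0:ℂ) 1).image_of_continuousOn hc
  have h0B : (0:ℂ) ∈ B := ⟨0, by simp, h00⟩
  have hBn : B ∈ 𝓝 (0:ℂ) := by
    refine Filter.mem_of_superset ((disc_interior_open hc hi).mem_nhds ⟨0, by simp, h00⟩) ?_
    exact image_mono Metric.ball_subset_closedBall
  obtain ⟨r, hr, hrB⟩ := Metric.mem_nhds_iff.1 hBn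
  obtain ⟨R, hR0, hR⟩ := hBc.isBounded.exists_pos_norm_lt
  set Ω : Set ℂ := {w | w = 0 ∨ w⁻¹ ∉ B} with hΩ
  have hBo : IsOpen Bᶜ := hBc.isClosed.isOpen_compl
  have hsmall : Metric.ball (0:ℂ) R⁻¹ ⊆ Ω := by
    intro w hw
    by_cases hw0 : w = 0
    · exact Or.inl hw0
    · refine Or.inr fun hwB => ?_
      have h1 := hR _ hwB
      rw [norm_inv] at h1
      rw [mem_ball_zero_iff] at hw
      have h2 := inv_lt_of_inv_lt₀ (by positivity) h1
      linarith
  have hO : IsOpen Ω := by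
    rw [isOpen_iff_mem_nhds]
    intro w hw
    by_cases hw0 : w = 0
    · rw [hw0]
      exact Filter.mem_of_superset (Metric.ball_mem_nhds _ (by positivity)) hsmall
    · have hw' : w⁻¹ ∈ Bᶜ := by
        rcases hw with hw | hw
        · exact absurd hw hw0
        · exact hw
      have := (continuousAt_inv₀ hw0).preimage_mem_nhds (hBo.mem_nhds hw')
      exact Filter.mem_of_superset this fun v hv => Or.inr hv
  have hbd : Bornology.IsBounded Ω := by
    refine (Metric.isBounded_closedBall (x := (0:ℂ)) (r := r⁻¹)).subset ?_
    rintro w (hw | hw)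
    · rw [hw]; simp; positivity
    · rw [mem_closedBall_zero_iff]
      have : ¬ ‖w⁻¹‖ < r := fun hlt => hw (hrB (by simpa using hlt))
      rw [norm_inv, not_lt] at this
      by_cases hw0 : w = 0
      · rw [hw0]; simp; positivity
      · exact (le_inv_comm₀ hr (by positivity)).1 this
  have h0Ω : (0:ℂ) ∈ Ω := Or.inl rfl
  have hconn : IsPreconnected Ω := by
    have h1 : IsPreconnected ((fun z : ℂ => z⁻¹) '' Bᶜ) := by
      refine (disc_compl_preconn hc hi).image _ ?_
      intro z hz
      refine (continuousAt_inv₀ ?_).continuousWithinAt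
      rintro rfl
      exact hz h0B
    refine h1.subset_closure ?_ ?_
    · rintro _ ⟨z, hz, rfl⟩
      exact Or.inr (by simpa using hz)
    · rintro w (hw | hw)
      · rw [hw, Metric.mem_closure_iff]
        intro ε hε
        have hpos : 0 < max R (2/ε) := lt_max_of_lt_left hR0
        refine ⟨_, ⟨((max R (2/ε) : ℝ) : ℂ), ?_, rfl⟩, ?_⟩
        · intro hmem
          have := hR _ hmem
          rw [Complex.norm_real, Real.norm_of_nonneg hpos.le] at this
          exact absurd this (not_lt.2 (le_max_left _ _))
        · simp only [dist_zero_left, norm_inv]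
          rw [Complex.norm_real, Real.norm_of_nonneg hpos.le]
          rw [inv_lt_comm₀ hpos hε]
          refine lt_of_lt_of_le ?_ (le_max_right _ _)
          rw [inv_eq_one_div]
          gcongr; norm_num
      · exact subset_closure ⟨w⁻¹, hw, by simp⟩
  have hcc : IsPreconnected Ωᶜ := by
    have h1 : IsPreconnected {z : ℂ | ‖z‖ ∈ Ioc (0:ℝ) 1} :=
      annulus_preconn ordConnected_Ioc (fun x hx => hx.1)
    have hsub : {z : ℂ | ‖z‖ ∈ Ioc (0:ℝ) 1} ⊆ Metric.closedBall 0 1 := by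
      intro z hz; rw [mem_closedBall_zero_iff]; exact hz.2
    have hne : ∀ z ∈ {z : ℂ | ‖z‖ ∈ Ioc (0:ℝ) 1}, h z ≠ 0 := by
      intro z hz hzz
      have := hi (hsub hz) (show (0:ℂ) ∈ Metric.closedBall 0 1 by simp) (by rw [hzz, h00])
      rw [this] at hz
      simp at hz
    have h2 := h1.image (fun z => (h z)⁻¹) ((hc.mono hsub).inv₀ hne)
    convert h2 using 1
    ext w
    constructor
    · intro hw
      rw [mem_compl_iff, hΩ, mem_ofPred_eq, not_or, not_not] at hw
      obtain ⟨hw0, z, hz, hzw⟩ := hw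
      refine ⟨z, ⟨?_, by simpa using hz⟩, ?_⟩
      · rw [norm_pos_iff]
        rintro rfl
        rw [h00] at hzw
        exact hw0 (inv_eq_zero.1 hzw.symm)
      · show (h z)⁻¹ = w
        rw [hzw, inv_inv]
    · rintro ⟨z, hz, rfl⟩
      rw [mem_compl_iff, hΩ, mem_ofPred_eq, not_or, not_not]
      refine ⟨inv_ne_zero (hne z hz), ?_⟩
      show ((h z)⁻¹)⁻¹ ∈ B
      rw [inv_inv]
      exact ⟨z, hsub hz, rfl⟩
  obtain ⟨φ, hφd, hφi, hφim, hφ0, hφ'⟩ := riemann_mapping' hO hconn hbd h0Ω hcc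
  have hbn : Metric.ball (0:ℂ) 1 ∈ 𝓝 (0:ℂ) := Metric.ball_mem_nhds _ one_pos
  have hb0 : (0:ℂ) ∈ Metric.ball (0:ℂ) 1 := by simp
  set k := dslope φ 0 with hk
  have hkd : DifferentiableOn ℂ k (Metric.ball 0 1) := (Complex.differentiableOn_dslope hbn).2 hφd
  have hφk : ∀ w, φ w = w * k w := by
    intro w
    have := sub_smul_dslope φ 0 w
    rw [hφ0, sub_zero, sub_zero, smul_eq_mul] at this
    exact this.symm
  have hk0 : ∀ w ∈ Metric.ball (0:ℂ) 1, k w ≠ 0 := by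
    intro w hw
    by_cases hw0 : w = 0
    · rw [hw0, hk, dslope_same]; exact hφ'
    · intro hkw
      apply hw0
      apply hφi hw hb0
      rw [hφk w, hkw, hφ0, mul_zero]
  have hkid : DifferentiableOn ℂ (fun w => (k w)⁻¹) (Metric.ball 0 1) := hkd.inv hk0
  set m := dslope (fun w => (k w)⁻¹) 0 with hm
  have hmd : DifferentiableOn ℂ m (Metric.ball 0 1) := (Complex.differentiableOn_dslope hbn).2 hkid
  have hkm : ∀ w, (k w)⁻¹ = (k 0)⁻¹ + w * m w := by
    intro w
    have := sub_smul_dslope (fun w => (k w)⁻¹) 0 w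
    rw [sub_zero, smul_eq_mul] at this
    rw [hm, this]; ring
  have hball : ∀ z : ℂ, 1 < ‖z‖ → z⁻¹ ∈ Metric.ball (0:ℂ) 1 ∧ z ≠ 0 := by
    intro z hz
    refine ⟨?_, ?_⟩
    · rw [mem_ball_zero_iff, norm_inv]
      exact inv_lt_one_of_one_lt₀ hz
    · rintro rfl; simp at hz; linarith
  have hF : ∀ z : ℂ, 1 < ‖z‖ → (k 0)⁻¹ * z + m z⁻¹ = (φ z⁻¹)⁻¹ := by
    intro z hz
    have hz0 := (hball z hz).2
    rw [hφk, mul_inv, inv_inv, hkm z⁻¹]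
    field_simp
  refine ⟨(k 0)⁻¹, m, inv_ne_zero (hk0 0 hb0), hmd, ?_, ?_, ?_⟩
  · intro z hz z' hz' h
    simp only at h
    rw [hF z hz, hF z' hz'] at h
    have := hφi (hball z hz).1 (hball z' hz').1 (inv_injective h)
    exact inv_injective this
  · ext v
    constructor
    · rintro ⟨z, hz, rfl⟩
      simp only
      rw [hF z hz]
      have h1 : φ z⁻¹ ∈ Ω := hφim ▸ mem_image_of_mem _ (hball z hz).1
      rcases h1 with h1 | h1
      · rw [← hφ0] at h1
        exact absurd (hφi (hball z hz).1 hb0 h1) (inv_ne_zero (hball z hz).2)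
      · exact h1
    · intro hv
      have hv0 : v ≠ 0 := by rintro rfl; exact hv h0B
      have h1 : v⁻¹ ∈ Ω := Or.inr (by rw [inv_inv]; exact hv)
      rw [← hφim] at h1
      obtain ⟨w, hw, hwv⟩ := h1
      have hw0 : w ≠ 0 := by
        rintro rfl
        rw [hφ0] at hwv
        exact hv0 (inv_eq_zero.1 hwv.symm)
      have hw1 : 1 < ‖w⁻¹‖ := by
        rw [norm_inv]
        exact (one_lt_inv₀ (norm_pos_iff.2 hw0)).2 (by simpa using hw)
      refine ⟨w⁻¹, hw1, ?_⟩
      simp only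
      rw [hF _ hw1, inv_inv, hwv, inv_inv]
  · intro R'
    by_cases hR1 : 1 < R'
    · have hsub : Metric.ball (0:ℂ) R'⁻¹ ⊆ Metric.ball 0 1 :=
        Metric.ball_subset_ball (inv_le_one_of_one_le₀ hR1.le)
      have ho := invariance_of_domain (Metric.isOpen_ball (x := (0:ℂ)) (ε := R'⁻¹))
        (hφd.continuousOn.mono hsub) (hφi.mono hsub)
      obtain ⟨q, hq, hqs⟩ := Metric.isOpen_iff.1 ho 0 ⟨0, by simp; linarith, hφ0⟩
      refine ⟨q⁻¹, fun z hz hzR => ?_⟩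
      rw [hF z hz, norm_inv]
      apply inv_anti₀ hq
      by_contra hlt
      push Not at hlt
      obtain ⟨w, hw, hwz⟩ := hqs (show φ z⁻¹ ∈ Metric.ball 0 q by simpa using hlt)
      have := hφi (hsub hw) (hball z hz).1 hwz
      rw [this, mem_ball_zero_iff, norm_inv] at hw
      have := (inv_lt_inv₀ (by linarith) (by linarith)).1 hw
      linarith
    · exact ⟨0, fun z hz hzR => absurd (lt_of_lt_of_le hz hzR) hR1⟩
end

section
open Set Topology unitInterval

open MeasureTheory in
theorem length_area_fin {s0 c : ℝ} {g : ℂ → ℂ}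
    (hd : DifferentiableOn ℂ g {w | w.re < s0 ∧ w.im ∈ Ioo (-c) c})
    (hi : InjOn g {w | w.re < s0 ∧ w.im ∈ Ioo (-c) c})
    (hb : Bornology.IsBounded (g '' {w | w.re < s0 ∧ w.im ∈ Ioo (-c) c})) :
    ∫⁻ s in Iio s0, ∫⁻ t in Ioo (-c) c, ENNReal.ofReal (‖deriv g (⟨s, t⟩ : ℂ)‖ ^ 2) ≠ ⊤ := by
  set T : Set ℂ := {w | w.re < s0 ∧ w.im ∈ Ioo (-c) c} with hT
  have hTo : IsOpen T := by
    apply IsOpen.inter (isOpen_Iio.preimage Complex.continuous_re)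
      (isOpen_Ioo.preimage Complex.continuous_im)
  have h1 := lintegral_abs_det_fderiv_eq_addHaar_image (volume : Measure ℂ) (f := g)
    (f' := fun w => (ContinuousLinearMap.toSpanSingleton ℂ (deriv g w)).restrictScalars ℝ)
    hTo.measurableSet (fun w hw => ((hd.differentiableAt (hTo.mem_nhds hw)).hasDerivAt.hasFDerivAt.restrictScalars ℝ).hasFDerivWithinAt) hi
  have hdet : ∀ w : ℂ, |((ContinuousLinearMap.toSpanSingleton ℂ w).restrictScalars ℝ).det| = ‖w‖ ^ 2 := by
    intro w
    rw [ContinuousLinearMap.det]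
    have : (((ContinuousLinearMap.toSpanSingleton ℂ w).restrictScalars ℝ : ℂ →L[ℝ] ℂ) : ℂ →ₗ[ℝ] ℂ) = ((ContinuousLinearMap.toSpanSingleton ℂ w : ℂ →L[ℂ] ℂ) : ℂ →ₗ[ℂ] ℂ).restrictScalars ℝ := rfl
    rw [this, LinearMap.det_restrictScalars, Algebra.norm_complex_apply]
    simp [Complex.normSq_eq_norm_sq]
  simp only [hdet] at h1
  have h2 : volume (g '' T) ≠ ⊤ := hb.measure_lt_top.ne
  rw [← h1, ← Complex.volume_preserving_equiv_real_prod.symm.setLIntegral_comp_preimage_emb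
    Complex.measurableEquivRealProd.symm.measurableEmbedding] at h2
  have h3 : (Complex.measurableEquivRealProd.symm ⁻¹' T) = Iio s0 ×ˢ Ioo (-c) c := by
    ext p
    simp [hT, Complex.measurableEquivRealProd_symm_apply]
  rw [h3, Measure.volume_eq_prod, ← Measure.prod_restrict, lintegral_prod] at h2
  · exact h2
  · have hm : Measurable fun w : ℂ => ENNReal.ofReal (‖deriv g w‖ ^ 2) :=
      ((measurable_deriv g).norm.pow_const 2).ennreal_ofReal
    exact (hm.comp Complex.measurableEquivRealProd.symm.measurable).aemeasurable

open MeasureTheory in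
theorem length_area {s0 c : ℝ} (hc : 0 < c) {g : ℂ → ℂ}
    (hd : DifferentiableOn ℂ g {w | w.re < s0 ∧ w.im ∈ Ioo (-c) c})
    (hi : InjOn g {w | w.re < s0 ∧ w.im ∈ Ioo (-c) c})
    (hb : Bornology.IsBounded (g '' {w | w.re < s0 ∧ w.im ∈ Ioo (-c) c}))
    {ε : ℝ} (hε : 0 < ε) :
    ∃ s < s0, ∀ t ∈ Ioo (-c) c, ∀ t' ∈ Ioo (-c) c, ‖g ⟨s, t'⟩ - g ⟨s, t⟩‖ ≤ ε := by
  have hfin := length_area_fin hd hi hb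
  set T : Set ℂ := {w | w.re < s0 ∧ w.im ∈ Ioo (-c) c} with hT
  have hTo : IsOpen T := by
    apply IsOpen.inter (isOpen_Iio.preimage Complex.continuous_re)
      (isOpen_Ioo.preimage Complex.continuous_im)
  set η := ε / (4 * c) with hη
  have hη0 : 0 < η := by positivity
  set J : ℝ → ENNReal := fun s => ∫⁻ t in Ioo (-c) c, ENNReal.ofReal (‖deriv g (⟨s, t⟩ : ℂ)‖ ^ 2) with hJ
  obtain ⟨s, hs, hsJ⟩ : ∃ s < s0, J s ≤ ENNReal.ofReal (η * (ε / 2)) := by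
    by_contra hcon
    push Not at hcon
    apply hfin
    rw [eq_top_iff]
    calc (⊤ : ENNReal) = ∫⁻ s in Iio s0, ENNReal.ofReal (η * (ε / 2)) := by
          rw [setLIntegral_const, Real.volume_Iio, ENNReal.mul_top]
          rw [Ne, ENNReal.ofReal_eq_zero, not_le]
          positivity
      _ ≤ _ := by
          refine setLIntegral_mono' measurableSet_Iio fun s hs => (hcon s hs).le
  refine ⟨s, hs, ?_⟩
  have key : ∀ t ∈ Ioo (-c) c, ∀ t' ∈ Ioo (-c) c, t ≤ t' → ‖g ⟨s, t'⟩ - g ⟨s, t⟩‖ ≤ ε := by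
    intro t ht t' ht' htt
    have hsub : ∀ u ∈ Icc t t', (⟨s, u⟩ : ℂ) ∈ T := fun u hu =>
      ⟨hs, lt_of_lt_of_le ht.1 hu.1, lt_of_le_of_lt hu.2 ht'.2⟩
    have hmk : ∀ u : ℝ, HasDerivAt (fun u : ℝ => (⟨s, u⟩ : ℂ)) Complex.I u := by
      intro u
      have h1 : HasDerivAt (fun u : ℝ => (s : ℂ) + (u : ℂ) * Complex.I) (1 * Complex.I) u :=
        ((Complex.ofRealCLM.hasDerivAt (x := u)).mul_const Complex.I).const_add _
      rw [one_mul] at h1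
      refine h1.congr_of_eventuallyEq (Filter.Eventually.of_forall fun u => ?_)
      apply Complex.ext <;> simp
    have hder : ∀ u ∈ uIcc t t', HasDerivAt (fun u : ℝ => g ⟨s, u⟩) (deriv g ⟨s, u⟩ * Complex.I) u := by
      intro u hu
      rw [uIcc_of_le htt] at hu
      have h1 := (hd.differentiableAt (hTo.mem_nhds (hsub u hu))).hasDerivAt
      exact HasDerivAt.comp (h₂ := g) (h := fun u : ℝ => (⟨s, u⟩ : ℂ)) u h1 (hmk u)
    have hcont : ContinuousOn (fun u : ℝ => deriv g ⟨s, u⟩ * Complex.I) (uIcc t t') := by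
      rw [uIcc_of_le htt]
      refine ContinuousOn.mul ?_ continuousOn_const
      exact (hd.deriv hTo).continuousOn.comp (fun u _ => (hmk u).continuousAt.continuousWithinAt) hsub
    have hFTC := intervalIntegral.integral_eq_sub_of_hasDerivAt hder hcont.intervalIntegrable
    rw [← hFTC, intervalIntegral.integral_of_le htt]
    have h1 : ‖∫ u in Ioc t t', deriv g ⟨s, u⟩ * Complex.I‖ₑ ≤ ENNReal.ofReal ε := by
      calc _ ≤ ∫⁻ u in Ioc t t', ‖deriv g ⟨s, u⟩ * Complex.I‖ₑ := enorm_integral_le_lintegral_enorm _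
        _ ≤ ∫⁻ u in Ioo (-c) c, ‖deriv g ⟨s, u⟩ * Complex.I‖ₑ := by
            apply lintegral_mono_set
            exact fun u hu => ⟨lt_trans ht.1 hu.1, lt_of_le_of_lt hu.2 ht'.2⟩
        _ ≤ ∫⁻ u in Ioo (-c) c, (ENNReal.ofReal η + ENNReal.ofReal η⁻¹ * ENNReal.ofReal (‖deriv g (⟨s, u⟩ : ℂ)‖ ^ 2)) := by
            refine lintegral_mono fun u => ?_
            simp only
            rw [← ENNReal.ofReal_mul (by positivity), ← ENNReal.ofReal_add (by positivity) (by positivity),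
              ← ofReal_norm_eq_enorm]
            apply ENNReal.ofReal_le_ofReal
            rw [norm_mul, Complex.norm_I, mul_one]
            set x := ‖deriv g (⟨s, u⟩ : ℂ)‖
            have : 0 ≤ η⁻¹ * ((η - x) ^ 2 + η * x) := by positivity
            have h2 : η⁻¹ * ((η - x) ^ 2 + η * x) = η + η⁻¹ * x ^ 2 - x := by
              field_simp; ring
            linarith
        _ = ENNReal.ofReal (η * (2 * c)) + ENNReal.ofReal η⁻¹ * J s := by
            rw [lintegral_add_left measurable_const, lintegral_const_mul' _ _ ENNReal.ofReal_ne_top]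
            rw [setLIntegral_const, Real.volume_Ioo, ← ENNReal.ofReal_mul hη0.le]
            congr 2
            ring_nf
        _ ≤ ENNReal.ofReal (η * (2 * c)) + ENNReal.ofReal η⁻¹ * ENNReal.ofReal (η * (ε / 2)) := by
            gcongr
        _ = ENNReal.ofReal ε := by
            rw [← ENNReal.ofReal_mul (by positivity), ← ENNReal.ofReal_add (by positivity) (by positivity)]
            congr 1
            rw [hη]; field_simp; norm_num
    rw [← ofReal_norm_eq_enorm] at h1
    exact (ENNReal.ofReal_le_ofReal_iff hε.le).1 h1
  intro t ht t' ht'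
  rcases le_total t t' with h | h
  · exact key t ht t' ht' h
  · rw [norm_sub_rev]; exact key t' ht' t ht h
end

section
open Set Topology unitInterval

theorem sep_lemma {B Y E0 : Set ℂ} (hB : IsCompact B) (hBc : IsPreconnected Bᶜ) (hY : IsCompact Y)
    (hE : IsCompact E0) (hEc : IsPreconnected E0) (hEB : E0 ⊆ B) (hYE : Y ∩ B ⊆ E0) {v : ℂ}
    (hv : v ∉ B) (hvY : v ∉ Y) (hlog : HasLog (fun z => z - v) (Y ∪ E0)) :
    ¬ Bornology.IsBounded (connectedComponentIn (Y ∪ B)ᶜ v) := by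
  have h1 : (Y ∪ E0) ∩ B = E0 := by
    ext z
    constructor
    · rintro ⟨h | h, hz⟩
      · exact hYE ⟨h, hz⟩
      · exact h
    · intro h; exact ⟨Or.inr h, hEB h⟩
  have h2 : (Y ∪ E0) ∪ B = Y ∪ B := by
    rw [union_assoc, union_eq_self_of_subset_left hEB]
  have h3 := HasLog.union (hY.union hE).isClosed hB.isClosed (by rw [h1]; exact hEc) hlog
    (borsuk_hasLog_of_conn hB hBc hv)
  rw [h2] at h3
  exact borsuk_unbounded (hY.union hB).isClosed (by rintro (h | h); exacts [hvY h, hv h]) h3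

theorem small_conn {h : ℂ → ℂ} (hc : ContinuousOn h (Metric.closedBall 0 1))
    (hi : InjOn h (Metric.closedBall 0 1)) {ε : ℝ} (hε : 0 < ε) :
    ∃ δ > 0, ∀ (S : Set ℂ) (p : ℂ), S ⊆ h '' Metric.closedBall 0 1 → S ⊆ Metric.closedBall p δ →
      ∃ E0, S ⊆ E0 ∧ E0 ⊆ h '' Metric.closedBall 0 1 ∧ IsCompact E0 ∧ IsPreconnected E0 ∧
        E0 ⊆ Metric.closedBall p ε := by
  have hDc := isCompact_closedBall (0:ℂ) 1
  obtain ⟨k, hk, hkh⟩ := exists_cont_inv hDc hc hi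
  have hu1 := hDc.uniformContinuousOn_of_continuous hc
  have hu2 := (hDc.image_of_continuousOn hc).uniformContinuousOn_of_continuous hk
  rw [Metric.uniformContinuousOn_iff_le] at hu1 hu2
  obtain ⟨η, hη, hη'⟩ := hu1 (ε / 2) (by positivity)
  obtain ⟨δ, hδ, hδ'⟩ := hu2 η hη
  refine ⟨min (δ/2) (ε/2), by positivity, fun S p hSB hSp => ?_⟩
  rcases S.eq_empty_or_nonempty with rfl | ⟨v0, hv0⟩
  · exact ⟨∅, by simp, by simp, isCompact_empty, isPreconnected_empty, by simp⟩
  set C := closure (convexHull ℝ (k '' S)) with hC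
  obtain ⟨x0, hx0, rfl⟩ := hSB hv0
  have hkS : k '' S ⊆ Metric.closedBall 0 1 ∩ Metric.closedBall x0 η := by
    rintro _ ⟨v, hv, rfl⟩
    obtain ⟨x, hx, rfl⟩ := hSB hv
    rw [hkh x hx]
    refine ⟨hx, ?_⟩
    have := hδ' (h x) ⟨x, hx, rfl⟩ (h x0) ⟨x0, hx0, rfl⟩ ?_
    · rwa [hkh x hx, hkh x0 hx0] at this
    · have h1 := hSp hv
      have h2 := hSp hv0
      rw [Metric.mem_closedBall] at h1 h2
      have := dist_triangle_right (h x) (h x0) p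
      have := min_le_left (δ/2) (ε/2)
      linarith
  have hCs : C ⊆ Metric.closedBall 0 1 ∩ Metric.closedBall x0 η :=
    closure_minimal (convexHull_min hkS ((convex_closedBall _ _).inter (convex_closedBall _ _)))
      (Metric.isClosed_closedBall.inter Metric.isClosed_closedBall)
  have hCD : C ⊆ Metric.closedBall 0 1 := hCs.trans inter_subset_left
  refine ⟨h '' C, ?_, image_mono hCD, ?_, ?_, ?_⟩
  · intro v hv
    obtain ⟨x, hx, rfl⟩ := hSB hv
    refine ⟨x, subset_closure (subset_convexHull ℝ _ ⟨h x, hv, hkh x hx⟩), rfl⟩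
  · exact (hDc.of_isClosed_subset isClosed_closure hCD).image_of_continuousOn (hc.mono hCD)
  · exact ((convex_convexHull ℝ (k '' S)).closure.isPreconnected).image _ (hc.mono hCD)
  · rintro _ ⟨x, hx, rfl⟩
    have h1 := hη' x (hCD hx) x0 hx0 (hCs hx).2
    have h2 := hSp hv0
    rw [Metric.mem_closedBall] at h2 ⊢
    have := dist_triangle (h x) (h x0) p
    have := min_le_right (δ/2) (ε/2)
    linarith

/-- Data of an exterior conformal map onto the complement of a disc. -/
structure ExtMap (h F : ℂ → ℂ) : Prop where
  hc : ContinuousOn h (Metric.closedBall 0 1)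
  hi : InjOn h (Metric.closedBall 0 1)
  diff : DifferentiableOn ℂ F {z : ℂ | 1 < ‖z‖}
  inj : InjOn F {z : ℂ | 1 < ‖z‖}
  im : F '' {z : ℂ | 1 < ‖z‖} = (h '' Metric.closedBall 0 1)ᶜ
  bd : ∀ R : ℝ, ∃ Q : ℝ, ∀ z : ℂ, 1 < ‖z‖ → ‖z‖ ≤ R → ‖F z‖ ≤ Q

theorem ext_open : IsOpen {z : ℂ | 1 < ‖z‖} := isOpen_lt continuous_const continuous_norm

theorem ExtMap.open_image {h F : ℂ → ℂ} (H : ExtMap h F) {U : Set ℂ} (hU : IsOpen U)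
    (hUs : U ⊆ {z : ℂ | 1 < ‖z‖}) : IsOpen (F '' U) :=
  invariance_of_domain hU (H.diff.continuousOn.mono hUs) (H.inj.mono hUs)

/-- separation by a relatively closed crosscut `γ` with sides `C` and `C'`. -/
theorem ExtMap.cut {h F : ℂ → ℂ} (H : ExtMap h F) {C C' γ : Set ℂ}
    (hC : IsOpen C) (hC' : IsOpen C') (hCE : C ⊆ {z : ℂ | 1 < ‖z‖}) (hCE' : C' ⊆ {z : ℂ | 1 < ‖z‖})
    (hd : Disjoint C C') (hcov : {z : ℂ | 1 < ‖z‖} \ γ ⊆ C ∪ C') {z : ℂ} (hz : z ∈ C)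
    {Y : Set ℂ} (hY : F '' γ ⊆ Y) (hzY : F z ∉ Y) :
    connectedComponentIn (Y ∪ h '' Metric.closedBall 0 1)ᶜ (F z) ⊆ F '' C := by
  set B := h '' Metric.closedBall 0 1
  have hzB : F z ∉ B := by
    have : F z ∈ Bᶜ := H.im ▸ mem_image_of_mem _ (hCE hz)
    exact this
  have hmem : F z ∈ (Y ∪ B)ᶜ := by rintro (h | h); exacts [hzY h, hzB h]
  refine isPreconnected_connectedComponentIn.subset_left_of_subset_union (H.open_image hC hCE)
    (H.open_image hC' hCE') ?_ ?_ ⟨F z, mem_connectedComponentIn hmem, z, hz, rfl⟩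
  · rw [Set.disjoint_left]
    rintro _ ⟨x, hx, rfl⟩ ⟨y, hy, hxy⟩
    have := H.inj (hCE' hy) (hCE hx) hxy
    exact Set.disjoint_left.1 hd hx (this ▸ hy)
  · intro v hv
    have hv' := connectedComponentIn_subset _ _ hv
    rw [mem_compl_iff, mem_union, not_or] at hv'
    have : v ∈ F '' {z : ℂ | 1 < ‖z‖} := by rw [H.im]; exact hv'.2
    obtain ⟨x, hx, rfl⟩ := this
    have hxγ : x ∉ γ := fun hxγ => hv'.1 (hY (mem_image_of_mem _ hxγ))
    rw [← image_union]
    exact mem_image_of_mem _ (hcov ⟨hx, hxγ⟩)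

theorem re_cayley_pos {z ζ : ℂ} (hζ : ‖ζ‖ = 1) (hz : 1 < ‖z‖) : 0 < ((z - ζ) / (z + ζ)).re := by
  have hne : z + ζ ≠ 0 := by
    intro h
    rw [eq_neg_of_add_eq_zero_left h, norm_neg, hζ] at hz
    exact lt_irrefl _ hz
  have h2 : ((z - ζ) / (z + ζ)).re = (‖z‖^2 - ‖ζ‖^2) / Complex.normSq (z + ζ) := by
    rw [← Complex.normSq_eq_norm_sq, ← Complex.normSq_eq_norm_sq, Complex.div_re]
    simp only [Complex.normSq_apply, Complex.add_re, Complex.add_im, Complex.sub_re, Complex.sub_im]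
    ring
  rw [h2, hζ]
  have : 0 < Complex.normSq (z + ζ) := Complex.normSq_pos.2 hne
  have : 0 < ‖z‖^2 - 1^2 := by nlinarith
  positivity

theorem cayley_norm {u ζ : ℂ} (hζ : ‖ζ‖ = 1) (hu : 0 < u.re) (hu1 : u ≠ 1) :
    1 < ‖ζ * (1 + u) / (1 - u)‖ := by
  have hne : 1 - u ≠ 0 := sub_ne_zero.2 (Ne.symm hu1)
  rw [norm_div, norm_mul, hζ, one_mul, one_lt_div (norm_pos_iff.2 hne)]
  rw [← sq_lt_sq₀ (norm_nonneg _) (norm_nonneg _), ← Complex.normSq_eq_norm_sq, ← Complex.normSq_eq_norm_sq]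
  simp only [Complex.normSq_apply, Complex.add_re, Complex.add_im, Complex.sub_re, Complex.sub_im,
    Complex.one_re, Complex.one_im]
  nlinarith
end

section
open Set Topology unitInterval

/-- small crosscuts -/
theorem ExtMap.small_cut {h F : ℂ → ℂ} (H : ExtMap h F) {ζ : ℂ} (hζ : ‖ζ‖ = 1) {ε : ℝ} (hε : 0 < ε) :
    ∃ r > 0, r < 1/2 ∧ ∀ z z' : ℂ, 1 < ‖z‖ → 1 < ‖z'‖ → ‖z - ζ‖ = r * ‖z + ζ‖ →
      ‖z' - ζ‖ = r * ‖z' + ζ‖ → ‖F z - F z'‖ ≤ ε := by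
  have hpi := Real.pi_pos
  set s0 : ℝ := Real.log (1/2) with hs0
  set T : Set ℂ := {w | w.re < s0 ∧ w.im ∈ Ioo (-(Real.pi/2)) (Real.pi/2)} with hT
  have hexp : ∀ w ∈ T, 0 < (Complex.exp w).re ∧ ‖Complex.exp w‖ < 1/2 := by
    intro w hw
    constructor
    · rw [Complex.exp_re]
      exact mul_pos (Real.exp_pos _) (Real.cos_pos_of_mem_Ioo hw.2)
    · rw [Complex.norm_exp]
      calc Real.exp w.re < Real.exp s0 := Real.exp_lt_exp.2 hw.1
        _ = 1/2 := Real.exp_log (by norm_num)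
  have hne1 : ∀ w ∈ T, Complex.exp w ≠ 1 := by
    intro w hw h1
    have := (hexp w hw).2
    rw [h1, norm_one] at this
    norm_num at this
  set M : ℂ → ℂ := fun u => ζ * (1 + u) / (1 - u) with hM
  have hMn : ∀ w ∈ T, 1 < ‖M (Complex.exp w)‖ := fun w hw => cayley_norm hζ (hexp w hw).1 (hne1 w hw)
  have hζ0 : ζ ≠ 0 := by rw [← norm_pos_iff, hζ]; norm_num
  have hMi : ∀ z : ℂ, z + ζ ≠ 0 → M ((z - ζ) / (z + ζ)) = z := by
    intro z hz
    simp only [hM]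
    have h1 : 1 + (z - ζ) / (z + ζ) = 2 * z / (z + ζ) := by field_simp; ring
    have h2 : 1 - (z - ζ) / (z + ζ) = 2 * ζ / (z + ζ) := by field_simp; ring
    rw [h1, h2]; field_simp
  have hMinj : ∀ u u' : ℂ, u ≠ 1 → u' ≠ 1 → M u = M u' → u = u' := by
    intro u u' hu hu' h
    have a1 : 1 - u ≠ 0 := sub_ne_zero.2 (Ne.symm hu)
    have a2 : 1 - u' ≠ 0 := sub_ne_zero.2 (Ne.symm hu')
    simp only [hM] at h
    rw [div_eq_div_iff a1 a2, mul_assoc, mul_assoc] at h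
    have h := mul_left_cancel₀ hζ0 h
    linear_combination h / 2
  obtain ⟨Q, hQ⟩ := H.bd 3
  have hMb : ∀ w ∈ T, ‖M (Complex.exp w)‖ ≤ 3 := by
    intro w hw
    obtain ⟨h1, h2⟩ := hexp w hw
    simp only [hM]
    set u := Complex.exp w
    have h3 : 1/2 ≤ ‖1 - u‖ := by
      have := norm_sub_norm_le 1 u
      rw [norm_one] at this; linarith
    have h4 : ‖1 + u‖ ≤ 3/2 := by
      have := norm_add_le 1 u
      rw [norm_one] at this; linarith
    rw [norm_div, norm_mul, hζ, one_mul, div_le_iff₀ (by linarith)]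
    linarith
  have hLA : ∃ s < s0, ∀ t ∈ Ioo (-(Real.pi/2)) (Real.pi/2), ∀ t' ∈ Ioo (-(Real.pi/2)) (Real.pi/2),
      ‖F (M (Complex.exp ⟨s, t'⟩)) - F (M (Complex.exp ⟨s, t⟩))‖ ≤ ε := by
    refine length_area (g := fun w => F (M (Complex.exp w))) (s0 := s0)
      (c := Real.pi/2) (by positivity) ?_ ?_ ?_ hε
    · have : DifferentiableOn ℂ (fun w => M (Complex.exp w)) T := by
        intro w hw
        have : 1 - Complex.exp w ≠ 0 := sub_ne_zero.2 (Ne.symm (hne1 w hw))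
        have hE : DifferentiableAt ℂ Complex.exp w := Complex.differentiableAt_exp
        exact (((hE.const_add 1).const_mul ζ).div (hE.const_sub 1) this).differentiableWithinAt
      exact H.diff.comp this hMn
    · intro w hw w' hw' h
      have h1 := H.inj (hMn w hw) (hMn w' hw') h
      have h2 := hMinj _ _ (hne1 w hw) (hne1 w' hw') h1
      have h3 := congrArg Complex.log h2
      obtain ⟨-, a1, a2⟩ := hw
      obtain ⟨-, b1, b2⟩ := hw'
      rwa [Complex.log_exp (by linarith) (by linarith), Complex.log_exp (by linarith) (by linarith)] at h3
    · refine (Metric.isBounded_closedBall (x := (0:ℂ)) (r := Q)).subset ?_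
      rintro _ ⟨w, hw, rfl⟩
      rw [mem_closedBall_zero_iff]
      exact hQ _ (hMn w hw) (hMb w hw)
  obtain ⟨s, hs, hst⟩ := hLA
  · refine ⟨Real.exp s, Real.exp_pos _, ?_, ?_⟩
    · calc Real.exp s < Real.exp s0 := Real.exp_lt_exp.2 hs
        _ = 1/2 := Real.exp_log (by norm_num)
    · have hrep : ∀ z : ℂ, 1 < ‖z‖ → ‖z - ζ‖ = Real.exp s * ‖z + ζ‖ →
          ∃ t ∈ Ioo (-(Real.pi/2)) (Real.pi/2), F z = F (M (Complex.exp ⟨s, t⟩)) := by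
        intro z hz hzs
        have hzz : z + ζ ≠ 0 := by
          intro h
          rw [eq_neg_of_add_eq_zero_left h, norm_neg, hζ] at hz
          exact lt_irrefl _ hz
        have hre := re_cayley_pos hζ hz
        set u := (z - ζ) / (z + ζ) with hu
        have hu0 : u ≠ 0 := by intro h; rw [h] at hre; simp at hre
        have hun : ‖u‖ = Real.exp s := by
          rw [hu, norm_div, hzs]
          field_simp [norm_ne_zero_iff.2 hzz]
        refine ⟨u.arg, abs_lt.1 (Complex.abs_arg_lt_pi_div_two_iff.2 (Or.inl hre)), ?_⟩
        have hw : (⟨s, u.arg⟩ : ℂ) = Complex.log u := by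
          apply Complex.ext
          · simp [Complex.log_re, hun]
          · simp [Complex.log_im]
        rw [hw, Complex.exp_log hu0, hMi z hzz]
      intro z z' hz hz' h1 h2
      obtain ⟨t, ht, e1⟩ := hrep z hz h1
      obtain ⟨t', ht', e2⟩ := hrep z' hz' h2
      rw [e1, e2]
      exact hst t' ht' t ht

theorem ExtMap.small_cap {h F : ℂ → ℂ} (H : ExtMap h F) {ζ : ℂ} (hζ : ‖ζ‖ = 1) {ε : ℝ} (hε : 0 < ε) :
    ∃ δ > 0, ∃ p : ℂ, ∀ z, 1 < ‖z‖ → ‖z - ζ‖ < δ → ‖F z - p‖ ≤ ε := by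
  set B := h '' Metric.closedBall 0 1 with hB
  have hBc : IsCompact B := (isCompact_closedBall (0:ℂ) 1).image_of_continuousOn H.hc
  obtain ⟨η, hη, hsm⟩ := small_conn H.hc H.hi hε
  obtain ⟨r, hr, hr2, hrs⟩ := H.small_cut hζ (lt_min hη hε)
  set γ := {z : ℂ | 1 < ‖z‖ ∧ ‖z - ζ‖ = r * ‖z + ζ‖} with hγ
  set C := {z : ℂ | 1 < ‖z‖ ∧ ‖z - ζ‖ < r * ‖z + ζ‖} with hC
  set C' := {z : ℂ | 1 < ‖z‖ ∧ r * ‖z + ζ‖ < ‖z - ζ‖} with hC'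
  have hCo : IsOpen C := by
    refine ext_open.inter (isOpen_lt (f := fun z : ℂ => ‖z - ζ‖) (g := fun z : ℂ => r * ‖z + ζ‖) (by fun_prop) (by fun_prop))
  have hCo' : IsOpen C' := by
    refine ext_open.inter (isOpen_lt (f := fun z : ℂ => r * ‖z + ζ‖) (g := fun z : ℂ => ‖z - ζ‖) (by fun_prop) (by fun_prop))
  have hCE : C ⊆ {z : ℂ | 1 < ‖z‖} := fun z hz => hz.1
  have hCE' : C' ⊆ {z : ℂ | 1 < ‖z‖} := fun z hz => hz.1
  have hγE : γ ⊆ {z : ℂ | 1 < ‖z‖} := fun z hz => hz.1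
  have hCb : ∀ z ∈ C, ‖z‖ ≤ 3 := by
    rintro z ⟨hz, hz'⟩
    have h1 := norm_add_le z ζ
    have h2 := norm_sub_norm_le z ζ
    rw [hζ] at h1 h2
    have : r * ‖z + ζ‖ ≤ 1/2 * (‖z‖ + 1) := by
      apply mul_le_mul hr2.le h1 (norm_nonneg _) (by norm_num)
    linarith
  have hdisj : Disjoint C C' := by
    rw [Set.disjoint_left]; rintro z ⟨_, h1⟩ ⟨_, h2⟩; exact lt_asymm h1 h2
  have hcov : {z : ℂ | 1 < ‖z‖} \ γ ⊆ C ∪ C' := by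
    rintro z ⟨h1, h2⟩
    rcases lt_trichotomy ‖z - ζ‖ (r * ‖z + ζ‖) with h | h | h
    · exact Or.inl ⟨h1, h⟩
    · exact absurd ⟨h1, h⟩ h2
    · exact Or.inr ⟨h1, h⟩
  set Y := closure (F '' γ) with hY
  -- choose p
  obtain ⟨p, hp⟩ : ∃ p, F '' γ ⊆ Metric.closedBall p (min η ε) := by
    rcases γ.eq_empty_or_nonempty with h0 | ⟨z0, hz0⟩
    · exact ⟨0, by rw [h0]; simp⟩
    · refine ⟨F z0, ?_⟩
      rintro _ ⟨z, hz, rfl⟩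
      rw [Metric.mem_closedBall, dist_eq_norm]
      exact hrs z z0 hz.1 hz0.1 hz.2 hz0.2
  have hYp : Y ⊆ Metric.closedBall p (min η ε) := closure_minimal hp Metric.isClosed_closedBall
  have hYc : IsCompact Y := (isCompact_closedBall p _).of_isClosed_subset isClosed_closure hYp
  have hYs : Y ∩ B ⊆ Metric.closedBall p η :=
    (inter_subset_left.trans hYp).trans (Metric.closedBall_subset_closedBall (min_le_left _ _))
  obtain ⟨E0, hE1, hE2, hE3, hE4, hE5⟩ := hsm (Y ∩ B) p inter_subset_right hYs
  have hX : Y ∪ E0 ⊆ Metric.closedBall p ε :=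
    union_subset (hYp.trans (Metric.closedBall_subset_closedBall (min_le_right _ _))) hE5
  have hmain : ∀ z ∈ C, ‖F z - p‖ ≤ ε := by
    intro z hz
    by_contra hlt
    push Not at hlt
    have hzX : F z ∉ Metric.closedBall p ε := by
      rw [Metric.mem_closedBall, dist_eq_norm]; exact not_le.2 hlt
    have hzY : F z ∉ Y := fun h => hzX (hX (Or.inl h))
    have hzB : F z ∉ B := by
      have : F z ∈ Bᶜ := H.im ▸ mem_image_of_mem _ (hCE hz)
      exact this
    have h1 := H.cut hCo hCo' hCE hCE' hdisj hcov hz subset_closure hzY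
    refine sep_lemma hBc (disc_compl_preconn H.hc H.hi) hYc hE3 hE4 hE2 hE1 hzB hzY ?_ ?_
    · refine hasLog_of_ball (c := p - F z) (by fun_prop) fun x hx => ?_
      have := hX hx
      rw [Metric.mem_closedBall, dist_eq_norm] at this
      rw [show x - F z - (p - F z) = x - p by ring, norm_sub_rev p]
      linarith
    · obtain ⟨Q, hQ⟩ := H.bd 3
      refine (Metric.isBounded_closedBall (x := (0:ℂ)) (r := Q)).subset (h1.trans ?_)
      rintro _ ⟨w, hw, rfl⟩
      rw [mem_closedBall_zero_iff]
      exact hQ _ hw.1 (hCb w hw)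
  refine ⟨r, hr, p, fun z hz hzr => hmain z ⟨hz, ?_⟩⟩
  have h3 : ‖(2:ℂ) * ζ‖ = 2 := by rw [norm_mul, hζ]; norm_num
  have h4 : ‖(2:ℂ) * ζ‖ ≤ ‖z + ζ‖ + ‖z - ζ‖ := by
    rw [show (2:ℂ) * ζ = (z + ζ) - (z - ζ) by ring]; exact norm_sub_le _ _
  nlinarith
end

section
open Set Topology unitInterval

theorem closure_ext : {z : ℂ | 1 ≤ ‖z‖} ⊆ closure {z : ℂ | 1 < ‖z‖} := by
  intro z hz
  have hz' : (1:ℝ) ≤ ‖z‖ := hz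
  rw [Metric.mem_closure_iff]
  intro ε hε
  have hpos : 0 < ‖z‖ := by linarith
  set t : ℝ := ε / (2 * ‖z‖) with ht
  have ht0 : 0 < t := by positivity
  refine ⟨(1 + t : ℝ) • z, ?_, ?_⟩
  · show 1 < ‖(1 + t : ℝ) • z‖
    rw [norm_smul, Real.norm_of_nonneg (by positivity)]
    nlinarith
  · rw [dist_eq_norm, show z - (1 + t : ℝ) • z = (-t) • z by module, norm_smul, norm_neg,
      Real.norm_of_nonneg ht0.le, ht]
    field_simp
    norm_num

theorem ExtMap.extend {h F : ℂ → ℂ} (H : ExtMap h F) :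
    ∃ Fb : ℂ → ℂ, ContinuousOn Fb {z : ℂ | 1 ≤ ‖z‖} ∧ (∀ z, 1 < ‖z‖ → Fb z = F z) ∧
      ∀ z, ‖z‖ = 1 → Fb z ∈ h '' Metric.sphere 0 1 := by
  have hlim : ∀ z ∈ {z : ℂ | 1 ≤ ‖z‖}, ∃ y, Filter.Tendsto F (𝓝[{z : ℂ | 1 < ‖z‖}] z) (𝓝 y) := by
    intro z hz
    rcases eq_or_lt_of_le (show (1:ℝ) ≤ ‖z‖ from hz) with h1 | h1
    · have hne : (𝓝[{z : ℂ | 1 < ‖z‖}] z).NeBot := mem_closure_iff_nhdsWithin_neBot.1 (closure_ext hz)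
      apply cauchy_iff_exists_le_nhds.1
      rw [Metric.cauchy_iff]
      refine ⟨hne.map _, fun ε hε => ?_⟩
      obtain ⟨δ, hδ, p, hp⟩ := H.small_cap h1.symm (show 0 < ε / 3 by positivity)
      refine ⟨F '' ({z : ℂ | 1 < ‖z‖} ∩ Metric.ball z δ), ?_, ?_⟩
      · rw [Filter.mem_map]
        refine Filter.mem_of_superset ?_ (subset_preimage_image _ _)
        exact inter_mem_nhdsWithin _ (Metric.ball_mem_nhds _ hδ)
      · rintro _ ⟨x, hx, rfl⟩ _ ⟨y, hy, rfl⟩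
        have a1 := hp x hx.1 (by rw [← dist_eq_norm]; exact hx.2)
        have a2 := hp y hy.1 (by rw [← dist_eq_norm]; exact hy.2)
        rw [← dist_eq_norm] at a1 a2
        have := dist_triangle_right (F x) (F y) p
        linarith
    · exact ⟨F z, (H.diff.continuousOn z h1)⟩
  have hcont : ContinuousOn (extendFrom {z : ℂ | 1 < ‖z‖} F) {z : ℂ | 1 ≤ ‖z‖} :=
    continuousOn_extendFrom closure_ext hlim
  have heq : ∀ z, 1 < ‖z‖ → extendFrom {z : ℂ | 1 < ‖z‖} F z = F z := fun z hz =>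
    extendFrom_eq (subset_closure hz) (H.diff.continuousOn z hz)
  refine ⟨extendFrom {z : ℂ | 1 < ‖z‖} F, hcont, heq, ?_⟩
  intro ζ hζ
  have hζc : ζ ∈ {z : ℂ | 1 ≤ ‖z‖} := hζ.ge
  set a := extendFrom {z : ℂ | 1 < ‖z‖} F ζ with ha
  have htend : Filter.Tendsto F (𝓝[{z : ℂ | 1 < ‖z‖}] ζ) (𝓝 a) := tendsto_extendFrom (hlim ζ hζc)
  have hne : (𝓝[{z : ℂ | 1 < ‖z‖}] ζ).NeBot := mem_closure_iff_nhdsWithin_neBot.1 (closure_ext hζc)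
  have haB : a ∈ h '' Metric.closedBall 0 1 := by
    by_contra hcon
    have : a ∈ F '' {z : ℂ | 1 < ‖z‖} := by rw [H.im]; exact hcon
    obtain ⟨z0, hz0, hz0a⟩ := this
    have hne0 : z0 ≠ ζ := by rintro rfl; exact absurd hζ (ne_of_gt hz0)
    obtain ⟨U, V, hU, hV, hzU, hζV, hUV⟩ := t2_separation hne0
    have ho := H.open_image (hU.inter ext_open) inter_subset_right
    have h1 := htend (ho.mem_nhds ⟨z0, ⟨hzU, hz0⟩, hz0a⟩)
    rw [Filter.mem_map] at h1
    have h2 : V ∩ {z : ℂ | 1 < ‖z‖} ∈ 𝓝[{z : ℂ | 1 < ‖z‖}] ζ := by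
      rw [inter_comm]; exact inter_mem_nhdsWithin _ (hV.mem_nhds hζV)
    obtain ⟨x, ⟨y, hy, hyx⟩, hx2⟩ := hne.nonempty_of_mem (Filter.inter_mem h1 h2)
    have := H.inj hy.2 hx2.2 hyx
    exact Set.disjoint_left.1 hUV hy.1 (this ▸ hx2.1)
  obtain ⟨x, hx, hxa⟩ := haB
  refine ⟨x, ?_, hxa⟩
  rw [mem_sphere_zero_iff_norm]
  rw [mem_closedBall_zero_iff] at hx
  by_contra hx1
  have hxl : x ∈ Metric.ball (0:ℂ) 1 := by rw [mem_ball_zero_iff]; exact lt_of_le_of_ne hx hx1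
  have h1 := htend ((disc_interior_open H.hc H.hi).mem_nhds ⟨x, hxl, hxa⟩)
  rw [Filter.mem_map] at h1
  obtain ⟨z, hz1, hz2⟩ := hne.nonempty_of_mem (Filter.inter_mem h1 self_mem_nhdsWithin)
  have : F z ∈ (h '' Metric.closedBall 0 1)ᶜ := H.im ▸ mem_image_of_mem _ hz2
  exact this (image_mono Metric.ball_subset_closedBall hz1)
end

section
open Set Topology unitInterval

theorem ExtMap.const_arc {h F Fb : ℂ → ℂ} (H : ExtMap h F)
    (hunb : ∀ Q : ℝ, ∃ R : ℝ, ∀ z : ℂ, R < ‖z‖ → Q < ‖F z‖)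
    (hFc : ContinuousOn Fb {z : ℂ | 1 ≤ ‖z‖}) (hFe : ∀ z, 1 < ‖z‖ → Fb z = F z)
    (hFs : ∀ z, ‖z‖ = 1 → Fb z ∈ h '' Metric.sphere 0 1) {ζ₁ ζ₂ : ℂ} (h1 : ‖ζ₁‖ = 1) (h2 : ‖ζ₂‖ = 1)
    (hne : ζ₁ ≠ ζ₂) (heq : Fb ζ₁ = Fb ζ₂) :
    ∃ U : Set ℂ, IsOpen U ∧ (∃ ζ ∈ U, ‖ζ‖ = 1) ∧ ∀ ζ ∈ U, ‖ζ‖ = 1 → Fb ζ = Fb ζ₁ := by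
  set B := h '' Metric.closedBall 0 1 with hB
  have hBc : IsCompact B := (isCompact_closedBall (0:ℂ) 1).image_of_continuousOn H.hc
  set a := Fb ζ₁ with ha
  -- the normal direction
  set d := ζ₁ - ζ₂ with hd
  have hd0 : d ≠ 0 := sub_ne_zero.2 hne
  obtain ⟨n, hn1, hnd⟩ : ∃ n : ℂ, ‖n‖ = 1 ∧ (d * (starRingEnd ℂ) n).re = 0 := by
    refine ⟨Complex.I * d / (‖d‖ : ℂ), ?_, ?_⟩
    · rw [norm_div, norm_mul, Complex.norm_I, one_mul, Complex.norm_real, norm_norm]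
      exact div_self (norm_ne_zero_iff.2 hd0)
    · rw [map_div₀, map_mul, Complex.conj_I, Complex.conj_ofReal]
      have : d * (-Complex.I * (starRingEnd ℂ) d / (‖d‖:ℂ)) = (d * (starRingEnd ℂ) d) * (-Complex.I) / (‖d‖:ℂ) := by ring
      rw [this, Complex.mul_conj, Complex.div_ofReal_re]
      simp
  set L : ℂ → ℝ := fun z => (z * (starRingEnd ℂ) n).re with hL
  have hLc : Continuous L := by fun_prop
  have hL12 : L ζ₁ = L ζ₂ := by
    have : L ζ₁ - L ζ₂ = (d * (starRingEnd ℂ) n).re := by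
      simp only [hL, hd, sub_mul, Complex.sub_re]
    linarith
  set κ := L ζ₁ with hκ
  have hLle : ∀ z, |L z| ≤ ‖z‖ := by
    intro z
    have := Complex.abs_re_le_norm (z * (starRingEnd ℂ) n)
    rwa [norm_mul, Complex.norm_conj, hn1, mul_one] at this
  have hunit : ∀ z : ℂ, ‖z‖ = 1 → (z * (starRingEnd ℂ) n).re^2 + (z * (starRingEnd ℂ) n).im^2 = 1 := by
    intro z hz
    have : Complex.normSq (z * (starRingEnd ℂ) n) = 1 := by
      rw [Complex.normSq_eq_norm_sq, norm_mul, Complex.norm_conj, hn1, hz]; norm_num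
    rw [Complex.normSq_apply] at this
    linarith
  have hn0 : (starRingEnd ℂ) n ≠ 0 := by
    rw [← norm_pos_iff, Complex.norm_conj, hn1]; norm_num
  have hinj : ∀ z w : ℂ, (z * (starRingEnd ℂ) n).re = (w * (starRingEnd ℂ) n).re →
      (z * (starRingEnd ℂ) n).im = (w * (starRingEnd ℂ) n).im → z = w :=
    fun z w e1 e2 => mul_right_cancel₀ hn0 (Complex.ext e1 e2)
  have honly : ∀ z, ‖z‖ = 1 → L z = κ → z = ζ₁ ∨ z = ζ₂ := by
    intro z hz hzκ
    have e1 := hunit z hz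
    have e2 := hunit ζ₁ h1
    have e3 := hunit ζ₂ h2
    have r1 : (z * (starRingEnd ℂ) n).re = (ζ₁ * (starRingEnd ℂ) n).re := hzκ
    have r2 : (ζ₁ * (starRingEnd ℂ) n).re = (ζ₂ * (starRingEnd ℂ) n).re := hL12
    have i12 : (ζ₁ * (starRingEnd ℂ) n).im ≠ (ζ₂ * (starRingEnd ℂ) n).im :=
      fun e => hne (hinj _ _ r2 e)
    by_cases hz1 : (z * (starRingEnd ℂ) n).im = (ζ₁ * (starRingEnd ℂ) n).im
    · exact Or.inl (hinj _ _ r1 hz1)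
    · right
      refine hinj _ _ (r1.trans r2) ?_
      rw [r1] at e1
      rw [← r2] at e3
      have q1 : ((z * (starRingEnd ℂ) n).im - (ζ₁ * (starRingEnd ℂ) n).im) * ((z * (starRingEnd ℂ) n).im + (ζ₁ * (starRingEnd ℂ) n).im) = 0 := by linear_combination e1 - e2
      have q2 : ((ζ₁ * (starRingEnd ℂ) n).im - (ζ₂ * (starRingEnd ℂ) n).im) * ((ζ₁ * (starRingEnd ℂ) n).im + (ζ₂ * (starRingEnd ℂ) n).im) = 0 := by linear_combination e2 - e3
      have q1' := (mul_eq_zero.1 q1).resolve_left (sub_ne_zero.2 hz1)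
      have q2' := (mul_eq_zero.1 q2).resolve_left (sub_ne_zero.2 i12)
      linarith
  have hLn : L n = 1 := by
    simp only [hL]; rw [Complex.mul_conj, Complex.normSq_eq_norm_sq, hn1]; norm_num
  have hLn' : L (-n) = -1 := by
    have : L (-n) = - L n := by simp only [hL, neg_mul, Complex.neg_re]
    rw [this, hLn]
  have hκ1 : κ < 1 ∧ -1 < κ := by
    have b := abs_le.1 (hLle ζ₁)
    rw [h1] at b
    constructor
    · refine lt_of_le_of_ne b.2 fun e => ?_
      have p1 := hunit ζ₁ h1
      have p2 := hunit ζ₂ h2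
      have r1 : (ζ₁ * (starRingEnd ℂ) n).re = 1 := e
      have r2 : (ζ₂ * (starRingEnd ℂ) n).re = 1 := by rw [← e]; exact hL12.symm
      rw [r1] at p1; rw [r2] at p2
      exact hne (hinj _ _ (r1.trans r2.symm) (by
        rw [pow_eq_zero_iff two_ne_zero |>.1 (show (ζ₁ * (starRingEnd ℂ) n).im^2 = 0 by linarith),
          pow_eq_zero_iff two_ne_zero |>.1 (show (ζ₂ * (starRingEnd ℂ) n).im^2 = 0 by linarith)]))
    · refine lt_of_le_of_ne b.1 fun e => ?_
      have p1 := hunit ζ₁ h1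
      have p2 := hunit ζ₂ h2
      have r1 : (ζ₁ * (starRingEnd ℂ) n).re = -1 := e.symm
      have r2 : (ζ₂ * (starRingEnd ℂ) n).re = -1 := by rw [e]; exact hL12.symm
      rw [r1] at p1; rw [r2] at p2
      exact hne (hinj _ _ (r1.trans r2.symm) (by
        rw [pow_eq_zero_iff two_ne_zero |>.1 (show (ζ₁ * (starRingEnd ℂ) n).im^2 = 0 by linarith),
          pow_eq_zero_iff two_ne_zero |>.1 (show (ζ₂ * (starRingEnd ℂ) n).im^2 = 0 by linarith)]))
  by_cases hI : ∀ ζ, κ < L ζ → ‖ζ‖ = 1 → Fb ζ = a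
  · exact ⟨{z | κ < L z}, isOpen_lt continuous_const hLc, ⟨n, by rw [mem_ofPred_eq, hLn]; exact hκ1.1, hn1⟩, hI⟩
  by_cases hI' : ∀ ζ, L ζ < κ → ‖ζ‖ = 1 → Fb ζ = a
  · exact ⟨{z | L z < κ}, isOpen_lt hLc continuous_const, ⟨-n, by rw [mem_ofPred_eq, hLn']; exact hκ1.2, by rw [norm_neg, hn1]⟩, hI'⟩
  exfalso
  push Not at hI hI'
  obtain ⟨ζ, hζκ, hζ1, hζa⟩ := hI
  obtain ⟨ζ', hζκ', hζ1', hζa'⟩ := hI'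
  set ℓ : ℂ → ℝ := fun z => ‖z‖^2 - 1 - 2 * (L z - κ) with hℓ
  have hℓc : Continuous ℓ := by fun_prop
  set γ := {z : ℂ | 1 < ‖z‖ ∧ ℓ z = 0} with hγ
  set γb := {z : ℂ | 1 ≤ ‖z‖ ∧ ℓ z = 0} with hγb
  set C := {z : ℂ | 1 < ‖z‖ ∧ ℓ z < 0} with hC
  set C' := {z : ℂ | 1 < ‖z‖ ∧ 0 < ℓ z} with hC'
  have hCo : IsOpen C := ext_open.inter (isOpen_lt hℓc continuous_const)
  have hCo' : IsOpen C' := ext_open.inter (isOpen_lt continuous_const hℓc)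
  have hCE : C ⊆ {z : ℂ | 1 < ‖z‖} := fun z hz => hz.1
  have hCE' : C' ⊆ {z : ℂ | 1 < ‖z‖} := fun z hz => hz.1
  have hbound : ∀ z, 1 ≤ ‖z‖ → ℓ z ≤ 0 → ‖z‖ ≤ 5 := by
    intro z hz hz'
    have b := (abs_le.1 (hLle z)).2
    have : ‖z‖^2 - 1 - 2 * (L z - κ) ≤ 0 := hz'
    nlinarith [hκ1.1, hκ1.2]
  have hγc : IsCompact γb := by
    refine (isCompact_closedBall (0:ℂ) 5).of_isClosed_subset ?_ ?_
    · exact (isClosed_le continuous_const continuous_norm).inter (isClosed_eq hℓc continuous_const)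
    · intro z hz; rw [mem_closedBall_zero_iff]; exact hbound z hz.1 hz.2.le
  set Y := Fb '' γb with hY
  have hγbs : γb ⊆ {z : ℂ | 1 ≤ ‖z‖} := fun z hz => hz.1
  have hYc : IsCompact Y := hγc.image_of_continuousOn (hFc.mono hγbs)
  have hmB : ∀ z, 1 < ‖z‖ → Fb z ∉ B := by
    intro z hz
    have : F z ∈ Bᶜ := H.im ▸ mem_image_of_mem F hz
    rw [hFe z hz]; exact this
  have hsB : ∀ z, ‖z‖ = 1 → Fb z ∈ B := fun z hz => image_mono Metric.sphere_subset_closedBall (hFs z hz)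
  have hγ1 : ∀ z ∈ γb, ‖z‖ = 1 → Fb z = a := by
    intro z hz hz1
    have : L z = κ := by
      have := hz.2
      simp only [hℓ, hz1] at this
      linarith
    rcases honly z hz1 this with rfl | rfl
    · rfl
    · exact heq.symm
  have hYB : Y ∩ B ⊆ {a} := by
    rintro _ ⟨⟨z, hz, rfl⟩, hzB⟩
    rcases eq_or_lt_of_le (show (1:ℝ) ≤ ‖z‖ from hz.1) with e | e
    · exact hγ1 z hz e.symm
    · exact absurd hzB (hmB z e)
  have haY : a ∈ Y := ⟨ζ₁, ⟨h1.ge, by simp [hℓ, h1, hκ]⟩, rfl⟩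
  have hFγ : F '' γ ⊆ Y := by
    rintro _ ⟨z, hz, rfl⟩
    exact ⟨z, ⟨hz.1.le, hz.2⟩, hFe z hz.1⟩
  have hdisj : Disjoint C C' := by
    rw [Set.disjoint_left]; rintro z ⟨_, e1⟩ ⟨_, e2⟩; exact lt_asymm e1 e2
  have hcov : {z : ℂ | 1 < ‖z‖} \ γ ⊆ C ∪ C' := by
    rintro z ⟨e1, e2⟩
    rcases lt_trichotomy (ℓ z) 0 with h | h | h
    · exact Or.inl ⟨e1, h⟩
    · exact absurd ⟨e1, h⟩ e2
    · exact Or.inr ⟨e1, h⟩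
  have hnotY : ∀ z, 1 < ‖z‖ → ℓ z ≠ 0 → Fb z ∉ Y := by
    rintro z hz hzl ⟨w, hw, hwz⟩
    rcases eq_or_lt_of_le (show (1:ℝ) ≤ ‖w‖ from hw.1) with e | e
    · exact hmB z hz (hwz ▸ hsB w e.symm)
    · rw [hFe z hz, hFe w e] at hwz
      have := H.inj e hz hwz
      exact hzl (this ▸ hw.2)
  -- bounded side
  have hbdd : ∀ z ∈ C, Bornology.IsBounded (connectedComponentIn Yᶜ (Fb z)) := by
    intro z hz
    by_contra hcon
    have hlog := borsuk_hasLog hYc hcon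
    have hzY := hnotY z hz.1 hz.2.ne
    refine sep_lemma hBc (disc_compl_preconn H.hc H.hi) hYc (isCompact_singleton (x := a))
      isPreconnected_singleton (by rw [singleton_subset_iff]; exact hsB ζ₁ h1) hYB (hmB z hz.1) hzY ?_ ?_
    · rwa [union_eq_self_of_subset_right (singleton_subset_iff.2 haY)]
    · rw [hFe z hz.1] at hzY ⊢
      have h1 := H.cut hCo hCo' hCE hCE' hdisj hcov hz hFγ hzY
      obtain ⟨Q, hQ⟩ := H.bd 5
      refine (Metric.isBounded_closedBall (x := (0:ℂ)) (r := Q)).subset (h1.trans ?_)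
      rintro _ ⟨w, hw, rfl⟩
      rw [mem_closedBall_zero_iff]
      exact hQ _ hw.1 (hbound w hw.1.le hw.2.le)
  have hBaY : B \ {a} ⊆ Yᶜ := fun v hv hvY => hv.2 (hYB ⟨hvY, hv.1⟩)
  have hBac : IsPreconnected (B \ {a}) := by
    obtain ⟨x, hx, hxa⟩ := hFs ζ₁ h1
    have e : B \ {a} = h '' (Metric.closedBall 0 1 \ {x}) := by
      rw [H.hi.image_sdiff_subset (by rw [singleton_subset_iff]; exact Metric.sphere_subset_closedBall hx), image_singleton, hxa]
    rw [e]
    refine IsPreconnected.image ?_ _ (H.hc.mono sdiff_subset)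
    refine (convex_ball (0:ℂ) 1).isPreconnected.subset_closure ?_ ?_
    · intro y hy
      refine ⟨Metric.ball_subset_closedBall hy, ?_⟩
      rintro rfl
      rw [mem_sphere_zero_iff_norm] at hx
      rw [mem_ball_zero_iff] at hy
      linarith
    · rw [closure_ball _ one_ne_zero]; exact sdiff_subset
  have hζB : Fb ζ ∈ B \ {a} := ⟨hsB ζ hζ1, hζa⟩
  have hζB' : Fb ζ' ∈ B \ {a} := ⟨hsB ζ' hζ1', hζa'⟩
  have hsame : connectedComponentIn Yᶜ (Fb ζ) = connectedComponentIn Yᶜ (Fb ζ') :=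
    connectedComponentIn_eq (hBac.subset_connectedComponentIn hζB hBaY hζB')
  have hb1 : Bornology.IsBounded (connectedComponentIn Yᶜ (Fb ζ)) := by
    have hVo : IsOpen (connectedComponentIn Yᶜ (Fb ζ)) := hYc.isClosed.isOpen_compl.connectedComponentIn
    have hmem := hFc ζ hζ1.ge (hVo.mem_nhds (mem_connectedComponentIn (hBaY hζB)))
    have hneb : (𝓝[{z : ℂ | 1 < ‖z‖}] ζ).NeBot := mem_closure_iff_nhdsWithin_neBot.1 (closure_ext hζ1.ge)
    have hmem2 := nhdsWithin_mono ζ (show {z : ℂ | 1 < ‖z‖} ⊆ {z : ℂ | 1 ≤ ‖z‖} from fun z hz => (show (1:ℝ) ≤ ‖z‖ from le_of_lt hz)) hmem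
    have hℓζ : ℓ ζ < 0 := by simp only [hℓ, hζ1]; linarith
    have hmem3 : {z | ℓ z < 0} ∈ 𝓝[{z : ℂ | 1 < ‖z‖}] ζ :=
      mem_nhdsWithin_of_mem_nhds ((isOpen_lt hℓc continuous_const).mem_nhds hℓζ)
    obtain ⟨z, ⟨hz1, hz2⟩, hz3⟩ := hneb.nonempty_of_mem
      (Filter.inter_mem (Filter.inter_mem hmem2 hmem3) self_mem_nhdsWithin)
    rw [connectedComponentIn_eq hz1]
    exact hbdd z ⟨hz3, hz2⟩
  rw [hsame] at hb1
  -- unbounded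
  obtain ⟨Q, hQ0, hQ⟩ := hb1.exists_pos_norm_lt
  obtain ⟨R, hR⟩ := hunb Q
  have hray : IsPreconnected ((fun t : ℝ => Fb ((t:ℂ) * ζ')) '' Ici 1) := by
    refine isPreconnected_Ici.image _ (hFc.comp (by fun_prop) ?_)
    intro t ht
    show 1 ≤ ‖(t:ℂ) * ζ'‖
    rw [norm_mul, hζ1', mul_one, Complex.norm_real]
    exact le_trans ht (le_abs_self t)
  have hrayY : (fun t : ℝ => Fb ((t:ℂ) * ζ')) '' Ici 1 ⊆ Yᶜ := by
    rintro _ ⟨t, ht, rfl⟩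
    have ht1 : (1:ℝ) ≤ t := ht
    rcases eq_or_lt_of_le ht1 with e | e
    · rw [← e]
      simpa using hBaY hζB'
    · have hn : ‖(t:ℂ) * ζ'‖ = t := by
        rw [norm_mul, hζ1', mul_one, Complex.norm_real, Real.norm_of_nonneg (by linarith)]
      refine hnotY _ (by rw [hn]; exact e) (ne_of_gt ?_)
      have hLt : L ((t:ℂ) * ζ') = t * L ζ' := by
        simp only [hL]; rw [mul_assoc, Complex.re_ofReal_mul]
      simp only [hℓ, hn, hLt]
      have := (abs_le.1 (hLle ζ')).2
      rw [hζ1'] at this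
      nlinarith
  have hsub := hray.subset_connectedComponentIn (x := Fb ζ') ⟨1, self_mem_Ici, by simp⟩ hrayY
  have ht := hsub ⟨max 2 (R+1), by simp, rfl⟩
  have h3 := hQ _ ht
  have hpos : (0:ℝ) < max 2 (R+1) := by positivity
  have hn : ‖((max 2 (R+1) : ℝ):ℂ) * ζ'‖ = max 2 (R+1) := by
    rw [norm_mul, hζ1', mul_one, Complex.norm_real, Real.norm_of_nonneg hpos.le]
  have h4 := hR (((max 2 (R+1) : ℝ):ℂ) * ζ') (by rw [hn]; have := le_max_right 2 (R+1); linarith)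
  rw [← hFe _ (by rw [hn]; have := le_max_left 2 (R+1); linarith)] at h4
  exact lt_asymm h3 h4
end

section
open Set Topology unitInterval

theorem no_const_arc {p : ℂ → ℂ} (hd : DifferentiableOn ℂ p (Metric.ball 0 1))
    (hc : ContinuousOn p (Metric.closedBall 0 1)) {c : ℂ} (h0 : p 0 ≠ c) {U : Set ℂ} (hU : IsOpen U)
    (hUs : ∃ ζ ∈ U, ‖ζ‖ = 1) (hconst : ∀ ζ ∈ U, ‖ζ‖ = 1 → p ζ = c) : False := by
  obtain ⟨ζ0, hζ0, hn0⟩ := hUs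
  have hcov : Metric.sphere (0:ℂ) 1 ⊆ ⋃ ω : Metric.sphere (0:ℂ) 1, (fun z => z * (ω:ℂ)) ⁻¹' U := by
    intro ζ hζ
    rw [mem_sphere_zero_iff_norm] at hζ
    have hne : ζ ≠ 0 := by rw [← norm_pos_iff, hζ]; norm_num
    refine mem_iUnion.2 ⟨⟨ζ0 / ζ, by rw [mem_sphere_zero_iff_norm, norm_div, hζ, hn0, div_one]⟩, ?_⟩
    show ζ * (ζ0 / ζ) ∈ U
    rw [mul_div_cancel₀ _ hne]; exact hζ0
  obtain ⟨t, ht⟩ := (isCompact_sphere (0:ℂ) 1).elim_finite_subcover _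
    (fun ω => hU.preimage (continuous_id.mul continuous_const)) hcov
  set P : ℂ → ℂ := fun z => ∏ ω ∈ t, (p (z * (ω:ℂ)) - c) with hP
  have hωn : ∀ ω : Metric.sphere (0:ℂ) 1, ‖(ω:ℂ)‖ = 1 := fun ω => mem_sphere_zero_iff_norm.1 ω.2
  have hdiff : DiffContOnCl ℂ P (Metric.ball 0 1) := by
    refine ⟨?_, ?_⟩
    · have : ∀ ω ∈ t, DifferentiableOn ℂ (fun z => p (z * ((ω : Metric.sphere (0:ℂ) 1):ℂ)) - c) (Metric.ball 0 1) := by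
        intro ω _
        refine DifferentiableOn.sub_const ?_ c
        refine hd.comp (differentiableOn_id.mul_const _) ?_
        intro z hz
        simpa [hωn ω] using hz
      exact DifferentiableOn.fun_finsetProd this
    · rw [closure_ball _ one_ne_zero]
      refine continuousOn_finsetProd _ fun ω _ => ?_
      refine ContinuousOn.sub ?_ continuousOn_const
      refine hc.comp (by fun_prop) ?_
      intro z hz
      simpa [hωn ω] using hz
  have hle := Complex.norm_le_of_forall_mem_frontier_norm_le (Metric.isBounded_ball) hdiff (C := 0) ?_
    (z := 0) (subset_closure (by simp))
  · have h1 : P 0 = 0 := norm_le_zero_iff.1 hle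
    rw [hP] at h1
    simp only [zero_mul] at h1
    rw [Finset.prod_const] at h1
    exact sub_ne_zero.2 h0 (eq_zero_of_pow_eq_zero h1)
  · intro z hz
    rw [frontier_ball _ one_ne_zero] at hz
    obtain ⟨ω, hω, hzω⟩ := mem_iUnion₂.1 (ht hz)
    have : P z = 0 := by
      apply Finset.prod_eq_zero hω
      rw [sub_eq_zero]
      refine hconst (z * (ω:ℂ)) hzω ?_
      rw [norm_mul, hωn ω, mul_one]; simpa using hz
    rw [this, norm_zero]

theorem carath {h : ℂ → ℂ} (hc : ContinuousOn h (Metric.closedBall 0 1))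
    (hi : InjOn h (Metric.closedBall 0 1)) (h00 : h 0 = 0) :
    ∃ (a : ℂ) (m Fb : ℂ → ℂ), a ≠ 0 ∧ DifferentiableOn ℂ m (Metric.ball 0 1) ∧
      (∀ z, 1 < ‖z‖ → Fb z = a * z + m z⁻¹) ∧ ContinuousOn Fb {z : ℂ | 1 ≤ ‖z‖} ∧
      InjOn Fb {z : ℂ | 1 ≤ ‖z‖} ∧ (∀ z, ‖z‖ = 1 → Fb z ∈ h '' Metric.sphere 0 1) ∧
      Fb '' {z : ℂ | 1 < ‖z‖} = (h '' Metric.closedBall 0 1)ᶜ := by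
  obtain ⟨a, m, ha, hm, hFi, hFim, hFb⟩ := ext_riemann hc hi h00
  set F : ℂ → ℂ := fun z => a * z + m z⁻¹ with hF
  have hball : ∀ z : ℂ, 1 < ‖z‖ → z⁻¹ ∈ Metric.ball (0:ℂ) 1 ∧ z ≠ 0 := by
    intro z hz
    refine ⟨?_, ?_⟩
    · rw [mem_ball_zero_iff, norm_inv]
      exact inv_lt_one_of_one_lt₀ hz
    · rintro rfl; simp at hz; linarith
  have H : ExtMap h F := by
    refine ⟨hc, hi, ?_, hFi, hFim, hFb⟩
    refine (differentiableOn_id.const_mul a).add ?_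
    refine hm.comp (fun z hz => (differentiableAt_inv (hball z hz).2).differentiableWithinAt) ?_
    intro z hz; exact (hball z hz).1
  obtain ⟨Fb, hFc, hFe, hFs⟩ := H.extend
  obtain ⟨Mb, hMb⟩ : ∃ Mb : ℝ, ∀ w ∈ Metric.closedBall (0:ℂ) (1/2), ‖m w‖ ≤ Mb :=
    (isCompact_closedBall (0:ℂ) (1/2)).exists_bound_of_continuousOn
      (hm.continuousOn.mono (Metric.closedBall_subset_ball (by norm_num)))
  have hapos : 0 < ‖a‖ := norm_pos_iff.2 ha
  have hunb : ∀ Q : ℝ, ∃ R : ℝ, ∀ z : ℂ, R < ‖z‖ → Q < ‖F z‖ := by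
    intro Q
    refine ⟨max 2 ((Q + Mb) / ‖a‖), fun z hz => ?_⟩
    have z2 : 2 < ‖z‖ := lt_of_le_of_lt (le_max_left _ _) hz
    have z3 : (Q + Mb) / ‖a‖ < ‖z‖ := lt_of_le_of_lt (le_max_right _ _) hz
    rw [div_lt_iff₀ hapos] at z3
    have b1 : ‖m z⁻¹‖ ≤ Mb := by
      apply hMb
      rw [mem_closedBall_zero_iff, norm_inv, inv_eq_one_div]
      gcongr
    have b2 : ‖a * z‖ - ‖m z⁻¹‖ ≤ ‖F z‖ := by
      have := norm_sub_norm_le (a * z) (-(m z⁻¹))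
      rwa [norm_neg, sub_neg_eq_add] at this
    rw [norm_mul] at b2
    nlinarith
  have hFbne : ∀ z, 1 ≤ ‖z‖ → Fb z ≠ 0 := by
    intro z hz hz0
    rcases eq_or_lt_of_le hz with e | e
    · obtain ⟨x, hx, hxz⟩ := hFs z e.symm
      rw [hz0, ← h00] at hxz
      have := hi (Metric.sphere_subset_closedBall hx) (by simp) hxz
      rw [this] at hx; simp at hx
    · have : F z ∈ (h '' Metric.closedBall 0 1)ᶜ := hFim ▸ mem_image_of_mem _ e
      rw [← hFe z e, hz0] at this
      exact this ⟨0, by simp, h00⟩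
  -- the interior function
  set p : ℂ → ℂ := fun w => if w = 0 then 0 else (Fb w⁻¹)⁻¹ with hp
  have hpd : DifferentiableOn ℂ p (Metric.ball 0 1) := by
    have hden : ∀ w ∈ Metric.ball (0:ℂ) 1, w ≠ 0 → w * Fb w⁻¹ = a + w * m w := by
      intro w hw hw0
      have : 1 < ‖w⁻¹‖ := by
        rw [norm_inv]
        exact (one_lt_inv₀ (norm_pos_iff.2 hw0)).2 (by simpa using hw)
      rw [hFe _ this]
      simp only [hF, inv_inv]
      field_simp
    have : DifferentiableOn ℂ (fun w => w / (a + w * m w)) (Metric.ball 0 1) := by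
      refine differentiableOn_id.div ((differentiableOn_const a).add (differentiableOn_id.mul hm)) ?_
      intro w hw
      by_cases hw0 : w = 0
      · rw [hw0]; simpa using ha
      · rw [← hden w hw hw0]
        refine mul_ne_zero hw0 (hFbne _ ?_)
        rw [norm_inv]
        exact (one_le_inv₀ (norm_pos_iff.2 hw0)).2 (by simpa using (mem_ball_zero_iff.1 hw).le)
    refine this.congr fun w hw => ?_
    simp only [hp]
    split_ifs with hw0
    · rw [hw0]; simp
    · rw [← hden w hw hw0]
      field_simp
  have hpc : ContinuousOn p (Metric.closedBall 0 1) := by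
    intro w hw
    rw [mem_closedBall_zero_iff] at hw
    rcases eq_or_lt_of_le hw with e | e
    · have hw0 : w ≠ 0 := by rw [← norm_pos_iff, e]; norm_num
      have h1 : ContinuousWithinAt (fun w => (Fb w⁻¹)⁻¹) (Metric.closedBall 0 1 \ {0}) w := by
        refine ContinuousWithinAt.inv₀ ?_ (hFbne _ (by rw [norm_inv, e, inv_one]))
        refine ContinuousWithinAt.comp (t := {z : ℂ | 1 ≤ ‖z‖}) (hFc _ (by
          show (1:ℝ) ≤ ‖w⁻¹‖
          rw [norm_inv, e, inv_one])) (continuousAt_inv₀ hw0).continuousWithinAt ?_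
        intro v hv
        show (1:ℝ) ≤ ‖v⁻¹‖
        rw [norm_inv]
        exact (one_le_inv₀ (norm_pos_iff.2 hv.2)).2 (by simpa using hv.1)
      have h2 : ContinuousWithinAt p (Metric.closedBall 0 1 \ {0}) w := by
        refine h1.congr (fun v hv => ?_) ?_
        · have hv0 : v ≠ 0 := hv.2
          simp only [hp]; rw [if_neg hv0]
        · simp only [hp]; rw [if_neg hw0]
      refine h2.mono_of_mem_nhdsWithin ?_
      rw [Set.sdiff_eq]
      exact inter_mem_nhdsWithin _ (isOpen_compl_singleton.mem_nhds hw0)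
    · exact ((hpd.differentiableAt (Metric.isOpen_ball.mem_nhds (by simpa using e))).continuousAt).continuousWithinAt
  refine ⟨a, m, Fb, ha, hm, hFe, hFc, ?_, hFs, ?_⟩
  · -- injectivity
    have hmB : ∀ z, 1 < ‖z‖ → Fb z ∉ h '' Metric.closedBall 0 1 := by
      intro z hz
      have : F z ∈ (h '' Metric.closedBall 0 1)ᶜ := H.im ▸ mem_image_of_mem F hz
      rw [hFe z hz]; exact this
    have hsB : ∀ z, ‖z‖ = 1 → Fb z ∈ h '' Metric.closedBall 0 1 :=
      fun z hz => image_mono Metric.sphere_subset_closedBall (hFs z hz)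
    intro z hz w hw hzw
    rcases eq_or_lt_of_le (show (1:ℝ) ≤ ‖z‖ from hz) with e | e <;>
      rcases eq_or_lt_of_le (show (1:ℝ) ≤ ‖w‖ from hw) with e' | e'
    · by_contra hne
      obtain ⟨U, hU, ⟨ζ0, hζ0, hn0⟩, hUc⟩ := H.const_arc hunb hFc hFe hFs e.symm e'.symm hne hzw
      refine no_const_arc (U := (starRingEnd ℂ) ⁻¹' U) hpd hpc (c := (Fb z)⁻¹) ?_
        (hU.preimage Complex.continuous_conj) ⟨(starRingEnd ℂ) ζ0, by simpa using hζ0, by simpa using hn0⟩ ?_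
      · simp only [hp, if_true]
        exact (inv_ne_zero (hFbne z hz)).symm
      · intro ζ hζ hζ1
        have hζ0 : ζ ≠ 0 := by rw [← norm_pos_iff, hζ1]; norm_num
        have hinv : ζ⁻¹ = (starRingEnd ℂ) ζ := by
          rw [Complex.inv_def, Complex.normSq_eq_norm_sq, hζ1]; simp
        simp only [hp]
        rw [if_neg hζ0, hinv, hUc _ hζ (by simpa using hζ1)]
    · exact absurd (hzw ▸ hsB z e.symm) (hmB w e')
    · exact absurd (hzw.symm ▸ hsB w e'.symm) (hmB z e)
    · rw [hFe z e, hFe w e'] at hzw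
      exact H.inj e e' hzw
  · rw [← hFim]
    exact image_congr fun z hz => hFe z hz
end

section
open Set Topology unitInterval

theorem plane_homeo {Φ : ℂ → ℂ} (hc : Continuous Φ) (hi : Function.Injective Φ) {R : ℝ}
    (hR : ∀ z, R ≤ ‖z‖ → Φ z = z) : ∃ e : ℂ ≃ₜ ℂ, ∀ z, e z = Φ z := by
  have hopen : IsOpenMap Φ := fun U hU => invariance_of_domain hU hc.continuousOn hi.injOn
  have hrange : range Φ = Φ '' Metric.closedBall 0 R ∪ {z | R ≤ ‖z‖} := by
    ext v
    constructor
    · rintro ⟨z, rfl⟩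
      by_cases hz : ‖z‖ ≤ R
      · exact Or.inl ⟨z, by simpa using hz, rfl⟩
      · right
        rw [hR z (le_of_not_ge hz)]; exact le_of_not_ge hz
    · rintro (⟨z, -, rfl⟩ | hv)
      · exact ⟨z, rfl⟩
      · exact ⟨v, hR v hv⟩
  have hclosed : IsClosed (range Φ) := by
    rw [hrange]
    exact ((isCompact_closedBall (0:ℂ) R).image hc).isClosed.union
      (isClosed_le continuous_const continuous_norm)
  have hsurj : Function.Surjective Φ := by
    rw [← range_eq_univ]
    exact IsClopen.eq_univ ⟨hclosed, hopen.isOpen_range⟩ ⟨Φ 0, 0, rfl⟩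
  exact ⟨(Equiv.ofBijective Φ ⟨hi, hsurj⟩).toHomeomorphOfContinuousOpen hc hopen, fun z => rfl⟩

theorem cone_map {k : ℂ → ℂ} (hk : ContinuousOn k (Metric.sphere 0 1))
    (hk1 : ∀ z, ‖z‖ = 1 → ‖k z‖ = 1) (hki : InjOn k (Metric.sphere 0 1)) :
    ∃ c : ℂ → ℂ, Continuous c ∧ Function.Injective c ∧ (∀ z, ‖c z‖ = ‖z‖) ∧ ∀ z, ‖z‖ = 1 → c z = k z := by
  set c : ℂ → ℂ := fun z => (‖z‖ : ℂ) * k (z / ‖z‖) with hcdef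
  have hu : ∀ z : ℂ, z ≠ 0 → ‖z / (‖z‖:ℂ)‖ = 1 := by
    intro z hz
    rw [norm_div, Complex.norm_real, norm_norm, div_self (norm_ne_zero_iff.2 hz)]
  have hn : ∀ z, ‖c z‖ = ‖z‖ := by
    intro z
    by_cases hz : z = 0
    · simp [hcdef, hz]
    · simp only [hcdef]
      rw [norm_mul, hk1 _ (hu z hz), mul_one, Complex.norm_real, norm_norm]
  refine ⟨c, ?_, ?_, hn, ?_⟩
  · rw [continuous_iff_continuousAt]
    intro z
    by_cases hz : z = 0
    · rw [hz]
      have h0 : c 0 = 0 := norm_eq_zero.1 (by rw [hn, norm_zero])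
      rw [ContinuousAt, h0]
      apply tendsto_zero_iff_norm_tendsto_zero.2
      simp only [hn]
      have := (continuous_norm (E := ℂ)).tendsto 0
      simpa using this
    · refine ContinuousAt.mul (by fun_prop) ?_
      have h1 : ContinuousOn (fun z : ℂ => k (z / (‖z‖:ℂ))) {0}ᶜ := by
        refine hk.comp ?_ ?_
        · refine continuousOn_id.div (by fun_prop) ?_
          intro w hw
          rw [Ne, Complex.ofReal_eq_zero, norm_eq_zero]; exact hw
        · intro w hw
          rw [mem_sphere_zero_iff_norm]; exact hu w hw
      exact h1.continuousAt (isOpen_compl_singleton.mem_nhds hz)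
  · intro z w hzw
    have hnn : ‖z‖ = ‖w‖ := by rw [← hn z, hzw, hn w]
    by_cases hz : z = 0
    · rw [hz, norm_zero] at hnn
      rw [hz, norm_eq_zero.1 hnn.symm]
    · have hw : w ≠ 0 := by rw [← norm_pos_iff, ← hnn, norm_pos_iff]; exact hz
      simp only [hcdef] at hzw
      have hw0 : (‖w‖ : ℂ) ≠ 0 := by rw [Ne, Complex.ofReal_eq_zero, norm_eq_zero]; exact hw
      rw [hnn] at hzw
      have h2 := mul_left_cancel₀ hw0 hzw
      have h3 := hki (by rw [mem_sphere_zero_iff_norm, ← hnn]; exact hu z hz)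
        (by rw [mem_sphere_zero_iff_norm]; exact hu w hw) h2
      field_simp at h3
      exact h3
  · intro z hz
    simp [hcdef, hz]

theorem schoenflies0 {h : ℂ → ℂ} (hc : ContinuousOn h (Metric.closedBall 0 1))
    (hi : InjOn h (Metric.closedBall 0 1)) (h00 : h 0 = 0) :
    ∃ (ρ R : ℝ) (Φ : ℂ ≃ₜ ℂ), 0 < ρ ∧ (∀ z, R ≤ ‖z‖ → Φ z = z) ∧
      Φ '' Metric.closedBall 0 ρ = h '' Metric.closedBall 0 1 := by
  obtain ⟨a, m, Fb, ha, hm, hFe, hFc, hFi, hFs, hFim⟩ := carath hc hi h00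
  obtain ⟨hv, hvc, hvh⟩ := exists_cont_inv (isCompact_closedBall (0:ℂ) 1) hc hi
  have hsph : ∀ z, ‖z‖ = 1 → ‖hv (Fb z)‖ = 1 ∧ h (hv (Fb z)) = Fb z := by
    intro z hz
    obtain ⟨x, hx, hxz⟩ := hFs z hz
    rw [← hxz, hvh x (Metric.sphere_subset_closedBall hx)]
    exact ⟨by simpa using hx, rfl⟩
  have hs1 : Metric.sphere (0:ℂ) 1 ⊆ {z : ℂ | 1 ≤ ‖z‖} := by
    intro z hz; rw [mem_sphere_zero_iff_norm] at hz; exact hz.ge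
  obtain ⟨c, hcc, hci, hcn, hck⟩ := cone_map (k := fun z => hv (Fb z))
    (hvc.comp (hFc.mono hs1) (fun z hz => image_mono Metric.sphere_subset_closedBall
      (hFs z (by simpa using hz)))) (fun z hz => (hsph z hz).1) (by
      intro z hz w hw hzw
      rw [mem_sphere_zero_iff_norm] at hz hw
      have : Fb z = Fb w := by rw [← (hsph z hz).2, ← (hsph w hw).2]; exact congrArg h hzw
      exact hFi hz.ge hw.ge this)
  set G : ℂ → ℂ := fun z => if ‖z‖ ≤ 1 then h (c z) else Fb z with hG
  have hGc : Continuous G := by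
    refine continuous_if_le continuous_norm continuous_const ?_ hFc ?_
    · refine hc.comp hcc.continuousOn ?_
      intro z hz
      rw [mem_closedBall_zero_iff, hcn]; exact hz
    · intro z hz
      rw [hck z hz]; exact (hsph z hz).2
  have hGin : ∀ z, ‖z‖ ≤ 1 → G z ∈ h '' Metric.closedBall 0 1 := by
    intro z hz
    simp only [hG]; rw [if_pos hz]
    exact ⟨c z, by rw [mem_closedBall_zero_iff, hcn]; exact hz, rfl⟩
  have hGout : ∀ z, 1 < ‖z‖ → G z = a * z + m z⁻¹ := by
    intro z hz
    simp only [hG]; rw [if_neg (not_le.2 hz), hFe z hz]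
  have hGout' : ∀ z, 1 < ‖z‖ → G z ∉ h '' Metric.closedBall 0 1 := by
    intro z hz
    have : Fb z ∈ (h '' Metric.closedBall 0 1)ᶜ := hFim ▸ mem_image_of_mem _ hz
    simp only [hG]; rw [if_neg (not_le.2 hz)]; exact this
  have hGi : Function.Injective G := by
    intro z w hzw
    rcases le_or_gt ‖z‖ 1 with e | e <;> rcases le_or_gt ‖w‖ 1 with e' | e'
    · simp only [hG] at hzw
      rw [if_pos e, if_pos e'] at hzw
      exact hci (hi (by rw [mem_closedBall_zero_iff, hcn]; exact e)
        (by rw [mem_closedBall_zero_iff, hcn]; exact e') hzw)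
    · exact absurd (hzw ▸ hGin z e) (hGout' w e')
    · exact absurd (hzw.symm ▸ hGin w e') (hGout' z e)
    · simp only [hG] at hzw
      rw [if_neg (not_le.2 e), if_neg (not_le.2 e')] at hzw
      exact hFi e.le e'.le hzw
  -- bounds
  have hsub : Metric.closedBall (0:ℂ) (1/2) ⊆ Metric.ball 0 1 := Metric.closedBall_subset_ball (by norm_num)
  obtain ⟨Mb', hMb'⟩ := (isCompact_closedBall (0:ℂ) (1/2)).exists_bound_of_continuousOn
      (hm.continuousOn.mono hsub)
  obtain ⟨L', hL'⟩ := (isCompact_closedBall (0:ℂ) (1/2)).exists_bound_of_continuousOn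
      ((hm.deriv Metric.isOpen_ball).continuousOn.mono hsub)
  set Mb := max Mb' 0
  set L := max L' 0
  have hMb0 : 0 ≤ Mb := le_max_right _ _
  have hL0 : 0 ≤ L := le_max_right _ _
  have hinv : ∀ z : ℂ, 2 ≤ ‖z‖ → z⁻¹ ∈ Metric.closedBall (0:ℂ) (1/2) := by
    intro z hz
    rw [mem_closedBall_zero_iff, norm_inv, inv_eq_one_div]
    gcongr
  have hMb : ∀ z : ℂ, 2 ≤ ‖z‖ → ‖m z⁻¹‖ ≤ Mb := fun z hz => (hMb' _ (hinv z hz)).trans (le_max_left _ _)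
  have hLip : ∀ z w : ℂ, 2 ≤ ‖z‖ → 2 ≤ ‖w‖ → ‖m z⁻¹ - m w⁻¹‖ ≤ L * (‖z - w‖ / (‖z‖ * ‖w‖)) := by
    intro z w hz hw
    have h1 := (convex_closedBall (0:ℂ) (1/2)).norm_image_sub_le_of_norm_deriv_le (f := m) (C := L)
      (fun x hx => hm.differentiableAt (Metric.isOpen_ball.mem_nhds (hsub hx)))
      (fun x hx => (hL' x hx).trans (le_max_left _ _)) (hinv w hw) (hinv z hz)
    have hz0 : z ≠ 0 := by rw [← norm_pos_iff]; linarith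
    have hw0 : w ≠ 0 := by rw [← norm_pos_iff]; linarith
    have h2 : z⁻¹ - w⁻¹ = (w - z) / (z * w) := by field_simp
    rwa [h2, norm_div, norm_mul, norm_sub_rev w z] at h1
  have hapos : 0 < ‖a‖ := norm_pos_iff.2 ha
  set R0 : ℝ := max 2 (4 * L / ‖a‖) with hR0
  have hR02 : 2 ≤ R0 := le_max_left _ _
  have hR0L : 4 * L ≤ R0 * ‖a‖ := by
    have : 4 * L / ‖a‖ ≤ R0 := le_max_right _ _
    rwa [div_le_iff₀ hapos] at this
  obtain ⟨Q1, hQ1⟩ := (isCompact_closedBall (0:ℂ) R0).exists_bound_of_continuousOn hGc.continuousOn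
  obtain ⟨Q2, hQ2⟩ := (isCompact_closedBall (0:ℂ) 1).exists_bound_of_continuousOn hc
  obtain ⟨Q, hQdef⟩ : ∃ Q, Q = max Q1 Q2 := ⟨_, rfl⟩
  have hQ : ∀ z ∈ Metric.closedBall (0:ℂ) R0, ‖G z‖ ≤ Q := fun z hz =>
    (hQ1 z hz).trans (hQdef ▸ le_max_left _ _)
  have hQB : ∀ z ∈ Metric.closedBall (0:ℂ) 1, ‖h z‖ ≤ Q := fun z hz =>
    (hQ2 z hz).trans (hQdef ▸ le_max_right _ _)
  set R : ℝ := max R0 (max (4 * Mb / ‖a‖) ((Q + Mb + 1) / ‖a‖)) with hR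
  have hRR0 : R0 ≤ R := le_max_left _ _
  have hRpos : 0 < R := by linarith
  have hRM : 4 * Mb ≤ R * ‖a‖ := by
    have : 4 * Mb / ‖a‖ ≤ R := (le_max_left _ _).trans (le_max_right _ _)
    rwa [div_le_iff₀ hapos] at this
  have hRQ : Q + Mb + 1 ≤ R * ‖a‖ := by
    have : (Q + Mb + 1) / ‖a‖ ≤ R := (le_max_right _ _).trans (le_max_right _ _)
    rwa [div_le_iff₀ hapos] at this
  set χ : ℝ → ℝ := fun t => min 1 (max 0 (2 - t / R)) with hχ
  have hχc : Continuous χ := by fun_prop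
  have hχ0 : ∀ t, 0 ≤ χ t := fun t => le_min zero_le_one (le_max_left _ _)
  have hχ1 : ∀ t, χ t ≤ 1 := fun t => min_le_left _ _
  have hχR : ∀ t, t ≤ R → χ t = 1 := by
    intro t ht
    have : t / R ≤ 1 := (div_le_one hRpos).2 ht
    exact min_eq_left ((by linarith : (1:ℝ) ≤ 2 - t/R).trans (le_max_right _ _))
  have hχ2R : ∀ t, 2 * R ≤ t → χ t = 0 := by
    intro t ht
    have : 2 ≤ t / R := (le_div_iff₀ hRpos).2 ht
    simp only [hχ]
    rw [max_eq_left (by linarith)]; norm_num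
  have hχL : ∀ s t, |χ s - χ t| ≤ |s - t| / R := by
    intro s t
    have h1 := abs_min_sub_min_le_max 1 (max 0 (2 - s / R)) 1 (max 0 (2 - t / R))
    have h2 := abs_max_sub_max_le_max 0 (2 - s / R) 0 (2 - t / R)
    have h3 : |2 - s / R - (2 - t / R)| = |s - t| / R := by
      rw [show 2 - s / R - (2 - t / R) = -((s - t) / R) by ring, abs_neg, abs_div, abs_of_pos hRpos]
    have h4 : 0 ≤ |s - t| / R := by positivity
    rw [sub_self, abs_zero] at h1 h2
    rw [h3, max_eq_right h4] at h2
    refine h1.trans (max_le h4 h2)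
  set Φ : ℂ → ℂ := fun z => if ‖z‖ ≤ R0 then G z else a * z + (χ ‖z‖ : ℂ) * m z⁻¹ with hΦ
  have hΦG : ∀ z, ‖z‖ ≤ R → Φ z = G z := by
    intro z hz
    simp only [hΦ]
    split_ifs with hz0
    · rfl
    · rw [hχR _ hz, hGout z (by linarith)]; simp
  have hΦE : ∀ z, R0 ≤ ‖z‖ → Φ z = a * z + (χ ‖z‖ : ℂ) * m z⁻¹ := by
    intro z hz
    rcases eq_or_lt_of_le hz with e | e
    · rw [hΦG z (by rw [← e]; exact hRR0), hGout z (by linarith), hχR _ (by rw [← e]; exact hRR0)]; simp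
    · simp only [hΦ]; rw [if_neg (not_le.2 e)]
  have hΦc : Continuous Φ := by
    refine continuous_if_le continuous_norm continuous_const hGc.continuousOn ?_ ?_
    · refine (by fun_prop : Continuous fun z : ℂ => a * z).continuousOn.add
        (ContinuousOn.mul (by fun_prop) ?_)
      refine (hm.continuousOn.mono hsub).comp ?_ (fun z hz => hinv z (hR02.trans hz))
      intro z hz
      have hz' : R0 ≤ ‖z‖ := hz
      exact (continuousAt_inv₀ (by rw [← norm_pos_iff]; linarith)).continuousWithinAt
    · intro z hz
      rw [hGout z (by linarith), hχR _ (by rw [hz]; exact hRR0)]; simp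
  have hsep0 : ∀ w, R < ‖w‖ → Q < ‖Φ w‖ := by
    intro w hw
    by_contra h1
    rw [not_lt, hΦE w (by linarith)] at h1
    have h2 := norm_sub_norm_le (a * w) (-((χ ‖w‖ : ℂ) * m w⁻¹))
    rw [norm_neg, sub_neg_eq_add, norm_mul, norm_mul, Complex.norm_real, Real.norm_of_nonneg (hχ0 _)] at h2
    have h3 : χ ‖w‖ * ‖m w⁻¹‖ ≤ 1 * Mb :=
      mul_le_mul (hχ1 _) (hMb w (by linarith)) (norm_nonneg _) zero_le_one
    nlinarith
  have hsep : ∀ z w, ‖z‖ < R0 → R < ‖w‖ → Φ z ≠ Φ w := by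
    intro z w hz hw hzw
    rw [hΦG z (by linarith)] at hzw
    have h1 := hQ z (by simpa using hz.le)
    rw [hzw] at h1
    exact absurd (hsep0 w hw) (not_lt.2 h1)
  have hbig : ∀ z w, R0 ≤ ‖z‖ → R0 ≤ ‖w‖ → Φ z = Φ w → z = w := by
    intro z w hz hw hzw
    rw [hΦE z hz, hΦE w hw] at hzw
    have e1 : a * (z - w) = -(((χ ‖z‖ - χ ‖w‖ : ℝ) : ℂ) * m z⁻¹ + (χ ‖w‖ : ℂ) * (m z⁻¹ - m w⁻¹)) := by
      push_cast
      linear_combination hzw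
    have e2 := congrArg norm e1
    rw [norm_neg, norm_mul] at e2
    have e3 := norm_add_le (((χ ‖z‖ - χ ‖w‖ : ℝ) : ℂ) * m z⁻¹) ((χ ‖w‖ : ℂ) * (m z⁻¹ - m w⁻¹))
    rw [← e2, norm_mul, norm_mul, Complex.norm_real, Complex.norm_real, Real.norm_of_nonneg (hχ0 _), Real.norm_eq_abs] at e3
    set D := ‖z - w‖ with hD
    have hD0 : 0 ≤ D := norm_nonneg _
    have b1 : |χ ‖z‖ - χ ‖w‖| ≤ D / R := by
      refine (hχL _ _).trans ?_
      gcongr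
      exact abs_norm_sub_norm_le z w
    have b2 : |χ ‖z‖ - χ ‖w‖| * ‖m z⁻¹‖ ≤ D / R * Mb :=
      mul_le_mul b1 (hMb z (by linarith)) (norm_nonneg _) (by positivity)
    have b3 : D / R * Mb ≤ D * ‖a‖ / 4 := by
      rw [div_mul_eq_mul_div, div_le_iff₀ hRpos]
      nlinarith
    have b4 : χ ‖w‖ * ‖m z⁻¹ - m w⁻¹‖ ≤ 1 * (L * (D / (‖z‖ * ‖w‖))) :=
      mul_le_mul (hχ1 _) (hLip z w (by linarith) (by linarith)) (norm_nonneg _) zero_le_one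
    have b5 : L * (D / (‖z‖ * ‖w‖)) ≤ D * ‖a‖ / 4 := by
      have hzp : 0 < ‖z‖ := by linarith
      have hwp : 0 < ‖w‖ := by linarith
      have : R0 ≤ ‖z‖ * ‖w‖ := by nlinarith
      rw [mul_div_assoc', div_le_iff₀ (by positivity)]
      have : R0 * ‖a‖ ≤ (‖z‖ * ‖w‖) * ‖a‖ := by gcongr
      nlinarith
    have : ‖a‖ * D ≤ D * ‖a‖ / 4 + D * ‖a‖ / 4 := by linarith
    have hDz : D = 0 := by
      by_contra hne
      have : 0 < D := lt_of_le_of_ne hD0 (Ne.symm hne)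
      have := mul_pos this hapos
      linarith
    exact sub_eq_zero.1 (norm_eq_zero.1 hDz)
  have hΦi : Function.Injective Φ := by
    intro z w hzw
    rcases le_or_gt R0 ‖z‖ with e | e <;> rcases le_or_gt R0 ‖w‖ with e' | e'
    · exact hbig z w e e' hzw
    · rcases le_or_gt ‖z‖ R with e2 | e2
      · rw [hΦG z e2, hΦG w (by linarith)] at hzw
        exact hGi hzw
      · exact absurd hzw.symm (hsep w z e' e2)
    · rcases le_or_gt ‖w‖ R with e2 | e2
      · rw [hΦG w e2, hΦG z (by linarith)] at hzw
        exact hGi hzw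
      · exact absurd hzw (hsep z w e e2)
    · rw [hΦG w (by linarith), hΦG z (by linarith)] at hzw
      exact hGi hzw
  -- rescale
  obtain ⟨e, he⟩ := plane_homeo (Φ := fun z => Φ (z / a)) (R := 2 * R * ‖a‖)
    (hΦc.comp (by fun_prop)) (fun z w hzw => by
      have := hΦi hzw
      field_simp at this
      exact this) (by
      intro z hz
      have h1 : 2 * R ≤ ‖z / a‖ := by rw [norm_div, le_div_iff₀ hapos]; exact hz
      show Φ (z / a) = z
      rw [hΦE _ (by linarith), hχ2R _ h1]
      simp; field_simp)
  refine ⟨‖a‖, 2 * R * ‖a‖, e, hapos, ?_, ?_⟩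
  · intro z hz
    have h1 : 2 * R ≤ ‖z / a‖ := by rw [norm_div, le_div_iff₀ hapos]; exact hz
    rw [he, hΦE _ (by linarith), hχ2R _ h1]
    simp; field_simp
  · have hmem : ∀ z, ‖z / a‖ ≤ 1 ↔ ‖z‖ ≤ ‖a‖ := by
      intro z; rw [norm_div, div_le_one hapos]
    ext v
    constructor
    · rintro ⟨z, hz, rfl⟩
      rw [mem_closedBall_zero_iff, ← hmem] at hz
      rw [he, hΦG _ (by linarith)]
      exact hGin _ hz
    · intro hvB
      obtain ⟨z, rfl⟩ := e.surjective v
      refine ⟨z, ?_, rfl⟩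
      rw [mem_closedBall_zero_iff, ← hmem]
      by_contra hlt
      rw [not_le] at hlt
      rw [he] at hvB
      rcases le_or_gt ‖z / a‖ R with e2 | e2
      · rw [hΦG _ e2] at hvB
        exact hGout' _ hlt hvB
      · obtain ⟨x, hx, hxe⟩ := hvB
        have h1 := hQB x hx
        rw [hxe] at h1
        exact absurd (hsep0 _ e2) (not_lt.2 h1)
end

section
open Set Topology unitInterval

/-- Extension of a compactly supported plane homeomorphism through a chart. -/
theorem ext_homeo {X : Type} [TopologicalSpace X] [T2Space X] {j : ℂ → X} (hj : IsOpenEmbedding j)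
    {R : ℝ} (Φ : ℂ ≃ₜ ℂ) (hR : ∀ z, R ≤ ‖z‖ → Φ z = z) :
    ∃ E : X ≃ₜ X, ∀ z, E (j z) = j (Φ z) := by
  classical
  have key : ∀ (Ψ : ℂ ≃ₜ ℂ), (∀ z, R ≤ ‖z‖ → Ψ z = z) → ∃ f : X → X, Continuous f ∧
      (∀ z, f (j z) = j (Ψ z)) ∧ ∀ x, x ∉ range j → f x = x := by
    intro Ψ hΨ
    set inv := Function.invFun j with hinv
    have hl : ∀ z, inv (j z) = z := Function.leftInverse_invFun hj.injective
    refine ⟨fun x => if x ∈ range j then j (Ψ (inv x)) else x, ?_, ?_, ?_⟩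
    · rw [continuous_iff_continuousAt]
      intro x
      by_cases hx : x ∈ range j
      · obtain ⟨z, rfl⟩ := hx
        rw [← hj.continuousAt_iff]
        have : (fun x => if x ∈ range j then j (Ψ (inv x)) else x) ∘ j = fun z => j (Ψ z) := by
          funext w; simp [hl]
        rw [this]
        exact (hj.continuous.comp Ψ.continuous).continuousAt
      · have hcl : IsClosed (j '' Metric.closedBall 0 R) :=
          ((isCompact_closedBall _ _).image hj.continuous).isClosed
        have hm : (j '' Metric.closedBall 0 R)ᶜ ∈ 𝓝 x :=
          hcl.isOpen_compl.mem_nhds (fun h => hx (image_subset_range _ _ h))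
        refine continuousAt_id.congr ?_
        filter_upwards [hm] with y hy
        by_cases hyr : y ∈ range j
        · obtain ⟨w, rfl⟩ := hyr
          have : R ≤ ‖w‖ := by
            by_contra hlt
            exact hy ⟨w, by simpa using (not_le.1 hlt).le, rfl⟩
          simp [hl, hΨ w this]
        · simp only [if_neg hyr, id]
    · intro z; simp [hl]
    · intro x hx; simp only [if_neg hx]
  obtain ⟨f, hf, hf1, hf2⟩ := key Φ hR
  obtain ⟨g, hg, hg1, hg2⟩ := key Φ.symm (fun z hz => by rw [Homeomorph.symm_apply_eq, hR z hz])
  refine ⟨⟨⟨f, g, ?_, ?_⟩, hf, hg⟩, hf1⟩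
  · intro x
    by_cases hx : x ∈ range j
    · obtain ⟨z, rfl⟩ := hx; rw [hf1, hg1]; simp
    · rw [hf2 x hx, hg2 x hx]
  · intro x
    by_cases hx : x ∈ range j
    · obtain ⟨z, rfl⟩ := hx; rw [hg1, hf1]; simp
    · rw [hg2 x hx, hf2 x hx]

/-- Radial compactly supported homeomorphism moving the ball of radius `r` to that of radius `s`. -/
theorem radial_homeo {r s : ℝ} (hr : 0 < r) (hs : 0 < s) :
    ∃ (R : ℝ) (Φ : ℂ ≃ₜ ℂ), (∀ z, R ≤ ‖z‖ → Φ z = z) ∧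
      Φ '' Metric.closedBall 0 r = Metric.closedBall 0 s := by
  -- multiplier
  set R : ℝ := r + s with hR
  set b : ℝ := (R - s) / (R - r) with hb
  have hRr : R - r = s := by rw [hR]; ring
  have hRs : R - s = r := by rw [hR]; ring
  set φ : ℝ → ℝ := fun t => if t ≤ r then t * (s / r) else if t ≤ R then s + (t - r) * (r / s) else t with hφ
  have hφc : Continuous φ := by
    refine Continuous.if_le (by fun_prop) (Continuous.if_le (by fun_prop) (by fun_prop) (by fun_prop) (by fun_prop) ?_) (by fun_prop) (by fun_prop) ?_
    · intro t ht; rw [ht, hRr]; field_simp; rw [hR]; ring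
    · intro t ht
      rw [ht, if_pos (by linarith : r ≤ R)]; field_simp; simp
  have hφm : StrictMono φ := by
    have c1 : 0 < s / r := by positivity
    have c2 : 0 < r / s := by positivity
    have e1 : r * (s / r) = s := by field_simp
    have e2 : s * (r / s) = r := by field_simp
    intro x y hxy
    simp only [hφ]
    split_ifs <;> nlinarith
  have hφ0 : φ 0 = 0 := by simp [hφ, hr.le]
  have hφr : φ r = s := by simp [hφ]; field_simp
  have hφR : ∀ t, R ≤ t → φ t = t := by
    intro t ht
    have : ¬ t ≤ r := by linarith
    simp only [hφ, if_neg this]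
    split_ifs with h1
    · have : t = R := le_antisymm h1 ht
      rw [this, hRr]; field_simp; rw [hR]; ring
    · rfl
  have hφp : ∀ t, 0 < t → 0 < φ t := fun t ht => by simpa [hφ0] using hφm ht
  set F : ℂ → ℂ := fun z => ((φ ‖z‖ / ‖z‖ : ℝ) : ℂ) * z with hF
  have hFn : ∀ z, ‖F z‖ = φ ‖z‖ := by
    intro z
    rcases eq_or_ne z 0 with rfl | hz
    · simp [hF, hφ0]
    · have : 0 < ‖z‖ := norm_pos_iff.2 hz
      simp only [hF]
      rw [norm_mul, Complex.norm_real, Real.norm_of_nonneg (by have := hφp _ this; positivity)]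
      field_simp
  have hFc : Continuous F := by
    rw [continuous_iff_continuousAt]
    intro z
    rcases eq_or_ne z 0 with rfl | hz
    · rw [ContinuousAt, show F 0 = 0 by simp [hF], tendsto_zero_iff_norm_tendsto_zero]
      simp only [hFn]
      have : Filter.Tendsto (fun z : ℂ => φ ‖z‖) (𝓝 0) (𝓝 (φ ‖(0:ℂ)‖)) := (hφc.comp continuous_norm).continuousAt
      simpa [hφ0] using this
    · have : ‖z‖ ≠ 0 := norm_ne_zero_iff.2 hz
      refine ContinuousAt.mul (Complex.continuous_ofReal.continuousAt.comp ?_) continuousAt_id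
      exact ContinuousAt.div (hφc.comp continuous_norm).continuousAt continuous_norm.continuousAt this
  have hFi : Function.Injective F := by
    intro z w h
    have h1 : ‖z‖ = ‖w‖ := by
      have := congrArg norm h
      rw [hFn, hFn] at this
      exact hφm.injective this
    rcases eq_or_ne w 0 with rfl | hw
    · simpa using h1
    have hwp : 0 < ‖w‖ := norm_pos_iff.2 hw
    simp only [hF, h1] at h
    refine mul_left_cancel₀ ?_ h
    have := hφp _ hwp
    exact_mod_cast (by positivity : φ ‖w‖ / ‖w‖ ≠ 0)
  have hFR : ∀ z, R ≤ ‖z‖ → F z = z := by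
    intro z hz
    have : 0 < ‖z‖ := by linarith
    simp only [hF, hφR _ hz]
    rw [div_self this.ne']; simp
  obtain ⟨e, he⟩ := plane_homeo hFc hFi hFR
  refine ⟨R, e, fun z hz => by rw [he, hFR z hz], ?_⟩
  ext v
  constructor
  · rintro ⟨z, hz, rfl⟩
    rw [mem_closedBall_zero_iff] at hz ⊢
    rw [he, hFn, ← hφr]
    exact hφm.monotone hz
  · intro hv
    obtain ⟨z, rfl⟩ := e.surjective v
    refine ⟨z, ?_, rfl⟩
    rw [mem_closedBall_zero_iff] at hv ⊢
    rw [he, hFn, ← hφr] at hv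
    exact hφm.le_iff_le.1 hv

/-- Every point has a neighbourhood homeomorphic to the plane. -/
def LocPlane (X : Type) [TopologicalSpace X] : Prop :=
  ∀ x : X, ∃ j : ℂ → X, IsOpenEmbedding j ∧ j 0 = x

theorem LocPlane.open_map {X : Type} [TopologicalSpace X] (hX : LocPlane X) {U : Set ℂ}
    (hU : IsOpen U) {f : ℂ → X} (hc : ContinuousOn f U) (hi : InjOn f U) : IsOpen (f '' U) := by
  rw [isOpen_iff_mem_nhds]
  rintro _ ⟨z, hz, rfl⟩
  obtain ⟨j, hj, hj0⟩ := hX (f z)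
  set V := U ∩ f ⁻¹' range j with hV
  have hVo : IsOpen V := hc.isOpen_inter_preimage hU hj.isOpen_range
  set inv := Function.invFun j with hinv
  have hl : ∀ z, inv (j z) = z := Function.leftInverse_invFun hj.injective
  have hr : ∀ w ∈ V, j (inv (f w)) = f w := by
    rintro w ⟨_, y, hy⟩; rw [← hy, hl]
  have hgc : ContinuousOn (fun w => inv (f w)) V := by
    intro w hw
    rw [ContinuousWithinAt, hj.toIsInducing.tendsto_nhds_iff]
    have h1 : ContinuousWithinAt f V w := (hc w hw.1).mono inter_subset_left
    rw [hr w hw]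
    refine Filter.Tendsto.congr' ?_ h1
    filter_upwards [self_mem_nhdsWithin] with y hy
    exact (hr y hy).symm
  have hgi : InjOn (fun w => inv (f w)) V := by
    intro w hw w' hw' h
    refine hi hw.1 hw'.1 ?_
    rw [← hr w hw, ← hr w' hw']
    exact congrArg j h
  have hop := invariance_of_domain hVo hgc hgi
  have hop2 := hj.isOpenMap _ hop
  refine Filter.mem_of_superset (hop2.mem_nhds ?_) ?_
  · exact ⟨_, ⟨z, ⟨hz, ⟨0, hj0⟩⟩, rfl⟩, hr z ⟨hz, ⟨0, hj0⟩⟩⟩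
  · rintro _ ⟨_, ⟨w, hw, rfl⟩, rfl⟩
    exact ⟨w, hw.1, (hr w hw).symm⟩

theorem LocPlane.openEmbedding {X : Type} [TopologicalSpace X] (hX : LocPlane X) {f : ℂ → X}
    (hc : Continuous f) (hi : Function.Injective f) : IsOpenEmbedding f :=
  IsOpenEmbedding.of_continuous_injective_isOpenMap hc hi
    (fun _ hU => hX.open_map hU hc.continuousOn hi.injOn)

/-- open embedding of the plane onto a ball -/
theorem plane_ball {r : ℝ} (hr : 0 < r) (c : ℂ) : ∃ b : ℂ → ℂ, IsOpenEmbedding b ∧ b 0 = c ∧ range b = Metric.ball c r ∧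
    (∀ z w, ‖z‖ ≤ ‖w‖ ↔ ‖b z - c‖ ≤ ‖b w - c‖) := by
  have hlp : LocPlane ℂ := fun x => ⟨fun z => z + x, (Homeomorph.addRight x).isOpenEmbedding, by simp⟩
  set b0 : ℂ → ℂ := fun z => ((r / (1 + ‖z‖) : ℝ) : ℂ) * z with hb0
  have hp : ∀ z : ℂ, 0 < 1 + ‖z‖ := fun z => by positivity
  have hn : ∀ z, ‖b0 z‖ = r * (‖z‖ / (1 + ‖z‖)) := by
    intro z
    have := hp z
    simp only [hb0]
    rw [norm_mul, Complex.norm_real, Real.norm_of_nonneg (by positivity)]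
    field_simp
  have hle : ∀ z w, ‖z‖ ≤ ‖w‖ ↔ ‖b0 z‖ ≤ ‖b0 w‖ := by
    intro z w
    rw [hn, hn, mul_le_mul_iff_right₀ hr, div_le_div_iff₀ (hp z) (hp w)]
    constructor <;> intro h <;> nlinarith
  have hc : Continuous b0 := by
    refine Continuous.mul (Complex.continuous_ofReal.comp (Continuous.div (by fun_prop) (by fun_prop) fun z => (hp z).ne')) continuous_id
  have hi : Function.Injective b0 := by
    intro z w h
    have h1 : ‖z‖ = ‖w‖ := le_antisymm ((hle _ _).2 (by rw [h])) ((hle _ _).2 (by rw [h]))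
    simp only [hb0, h1] at h
    refine mul_left_cancel₀ ?_ h
    have := hp w
    exact_mod_cast (by positivity : r / (1 + ‖w‖) ≠ 0)
  refine ⟨fun z => c + b0 z, ?_, by simp [hb0], ?_, by simpa using hle⟩
  · exact hlp.openEmbedding (by fun_prop) (fun z w h => hi (by simpa using h))
  · ext v
    rw [Metric.mem_ball, dist_eq_norm]
    constructor
    · rintro ⟨z, rfl⟩
      rw [add_sub_cancel_left, hn]
      have : ‖z‖ / (1 + ‖z‖) < 1 := by rw [div_lt_one (hp z)]; linarith
      nlinarith
    · intro hv
      have hd : 0 < r - ‖v - c‖ := by linarith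
      refine ⟨((1 / (r - ‖v - c‖) : ℝ) : ℂ) * (v - c), ?_⟩
      simp only [hb0]
      rw [norm_mul, Complex.norm_real, Real.norm_of_nonneg (by positivity), ← mul_assoc, ← Complex.ofReal_mul]
      have : r / (1 + 1 / (r - ‖v - c‖) * ‖v - c‖) * (1 / (r - ‖v - c‖)) = 1 := by
        field_simp; ring_nf
      rw [this]; simp
end

section
open Set Topology unitInterval

abbrev S2 := Metric.sphere (0 : EuclSp (2+1)) 1
/-- quotient map onto the projective plane -/
def qRP (x : S2) : RP 2 := Quot.mk _ x

theorem qRP_cont : Continuous qRP := continuous_quot_mk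
theorem qRP_surj : Function.Surjective qRP := Quot.mk_surjective

theorem S2_sum (x : S2) : x.1 0 ^ 2 + x.1 1 ^ 2 + x.1 2 ^ 2 = 1 := by
  have h := x.2
  rw [mem_sphere_zero_iff_norm, EuclideanSpace.norm_eq, Real.sqrt_eq_one, Fin.sum_univ_three] at h
  simpa using h

theorem S2_ext {x y : EuclSp (2+1)} (h0 : x 0 = y 0) (h1 : x 1 = y 1) (h2 : x 2 = y 2) : x = y := by
  ext i; fin_cases i <;> assumption

/-- Veronese map -/
def vero : RP 2 → (Fin 3 → Fin 3 → ℝ) :=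
  Quot.lift (fun x i j => x.1 i * x.1 j) (by
    intro x y h
    have h' : (y : EuclSp (2+1)) = -(x : EuclSp (2+1)) := h
    funext i j
    show x.1 i * x.1 j = y.1 i * y.1 j
    rw [h']; simp)

theorem vero_cont : Continuous vero := by
  refine continuous_quot_lift _ ?_
  fun_prop

theorem vero_aux {x y : S2} (h1 : ∀ i j, x.1 i * x.1 j = y.1 i * y.1 j) : y.1 = x.1 ∨ y.1 = -x.1 := by
  have hx := S2_sum x
  have hy := S2_sum y
  -- inner product
  set t : ℝ := x.1 0 * y.1 0 + x.1 1 * y.1 1 + x.1 2 * y.1 2 with ht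
  have ht2 : t ^ 2 = 1 := by
    have : t ^ 2 = (x.1 0 ^ 2 + x.1 1 ^ 2 + x.1 2 ^ 2) * (x.1 0 ^ 2 + x.1 1 ^ 2 + x.1 2 ^ 2) := by
      rw [ht]
      linear_combination (-(x.1 0 * x.1 0)) * h1 0 0 - 2 * (x.1 0 * x.1 1) * h1 0 1 - 2 * (x.1 0 * x.1 2) * h1 0 2
        - (x.1 1 * x.1 1) * h1 1 1 - 2 * (x.1 1 * x.1 2) * h1 1 2 - (x.1 2 * x.1 2) * h1 2 2
    rw [this, hx]; norm_num
  have hyt : ∀ i, y.1 i = t * x.1 i := by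
    intro i
    have e : t * x.1 i = (y.1 0 ^ 2 + y.1 1 ^ 2 + y.1 2 ^ 2) * y.1 i := by
      rw [ht]
      linear_combination y.1 0 * h1 0 i + y.1 1 * h1 1 i + y.1 2 * h1 2 i
    rw [e, hy, one_mul]
  rcases (show t = 1 ∨ t = -1 from by simpa using ht2) with e | e
  · left; ext i; rw [hyt i, e, one_mul]
  · right; ext i; rw [hyt i, e]; simp

theorem qRP_eq {x y : S2} : qRP x = qRP y ↔ y.1 = x.1 ∨ y.1 = -x.1 := by
  constructor
  · intro h
    exact vero_aux fun i j => congrFun (congrFun (congrArg vero h) i) j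
  · rintro (h | h)
    · rw [Subtype.ext h]
    · exact Quot.sound h

instance : T2Space (RP 2) := by
  refine T2Space.of_injective_continuous (f := vero) ?_ vero_cont
  intro p p' h
  obtain ⟨x, rfl⟩ := qRP_surj p
  obtain ⟨y, rfl⟩ := qRP_surj p'
  exact qRP_eq.2 (vero_aux (fun i j => congrFun (congrFun h i) j))

instance : CompactSpace (RP 2) := inferInstance

theorem qRP_open : IsOpenMap qRP := by
  intro U hU
  have : IsOpen (qRP ⁻¹' (qRP '' U)) := by
    have e : qRP ⁻¹' (qRP '' U) = U ∪ (fun x => -x) ⁻¹' U := by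
      ext x
      constructor
      · rintro ⟨y, hy, hyx⟩
        rcases qRP_eq.1 hyx with h | h
        · left; rwa [Subtype.ext h]
        · right
          have : -x = y := by apply Subtype.ext; simp [h]
          rw [mem_preimage, this]; exact hy
      · rintro (h | h)
        · exact ⟨x, h, rfl⟩
        · exact ⟨-x, h, qRP_eq.2 (Or.inr (by simp))⟩
    rw [e]
    exact hU.union (hU.preimage continuous_neg)
  exact isQuotientMap_quot_mk.isOpen_preimage.1 this

theorem qRP_locHomeo : IsLocalHomeomorph qRP := by
  rw [isLocalHomeomorph_iff_isOpenEmbedding_restrict]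
  intro x
  refine ⟨Metric.ball x 1, Metric.ball_mem_nhds _ one_pos, ?_⟩
  refine IsOpenEmbedding.of_continuous_injective_isOpenMap
    (qRP_cont.comp continuous_subtype_val) ?_ (qRP_open.comp Metric.isOpen_ball.isOpenMap_subtype_val)
  rintro ⟨y, hy⟩ ⟨z, hz⟩ h
  rcases qRP_eq.1 h with h | h
  · exact Subtype.ext (Subtype.ext h.symm)
  · exfalso
    have h1 : dist y z < 2 := by
      have := dist_triangle_right y z x
      rw [Metric.mem_ball] at hy hz
      linarith
    rw [Subtype.dist_eq, h, dist_eq_norm, sub_neg_eq_add, ← two_smul ℝ, norm_smul,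
      mem_sphere_zero_iff_norm.1 y.2] at h1
    norm_num at h1

theorem qRP_covering : IsCoveringMap qRP := isLocalHomeomorph_iff_isCoveringMap.1 qRP_locHomeo

/-- lifting of maps from the plane -/
theorem qRP_lift (f : ℂ → RP 2) (hf : Continuous f) (x0 : S2) (h0 : qRP x0 = f 0) :
    ∃ F : ℂ → S2, Continuous F ∧ F 0 = x0 ∧ ∀ z, qRP (F z) = f z := by
  obtain ⟨F, ⟨hF, hF'⟩, _⟩ := qRP_covering.existsUnique_continuousMap_lifts ⟨f, hf⟩ 0 x0 h0
  exact ⟨F, F.continuous, hF, fun z => congrFun hF' z⟩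

/-- explicit vectors -/
def vec3 (a b c : ℝ) : EuclSp (2+1) := WithLp.toLp 2 ![a, b, c]
@[simp] theorem vec3_0 (a b c : ℝ) : vec3 a b c 0 = a := rfl
@[simp] theorem vec3_1 (a b c : ℝ) : vec3 a b c 1 = b := rfl
@[simp] theorem vec3_2 (a b c : ℝ) : vec3 a b c 2 = c := rfl

theorem vec3_cont {α : Type} [TopologicalSpace α] {a b c : α → ℝ} (ha : Continuous a) (hb : Continuous b)
    (hc : Continuous c) : Continuous fun x => vec3 (a x) (b x) (c x) := by
  refine (PiLp.continuous_toLp 2 _).comp (continuous_pi fun i => ?_)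
  fin_cases i <;> assumption

theorem vec3_eq_zero {a b c : ℝ} (h : vec3 a b c = 0) : a = 0 ∧ b = 0 ∧ c = 0 :=
  ⟨congrFun (congrArg (fun v : EuclSp (2+1) => (v : Fin 3 → ℝ)) h) 0,
   congrFun (congrArg (fun v : EuclSp (2+1) => (v : Fin 3 → ℝ)) h) 1,
   congrFun (congrArg (fun v : EuclSp (2+1) => (v : Fin 3 → ℝ)) h) 2⟩

theorem vec3_norm (a b c : ℝ) : ‖vec3 a b c‖ = √(a^2+b^2+c^2) := by
  rw [EuclideanSpace.norm_eq, Fin.sum_univ_three]; simp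

theorem nrm_mem {v : EuclSp (2+1)} (hv : v ≠ 0) : ‖v‖⁻¹ • v ∈ Metric.sphere (0 : EuclSp (2+1)) 1 := by
  rw [mem_sphere_zero_iff_norm, norm_smul, norm_inv, norm_norm, inv_mul_cancel₀ (norm_ne_zero_iff.2 hv)]

def e0S : S2 := ⟨vec3 1 0 0, by rw [mem_sphere_zero_iff_norm, vec3_norm]; norm_num⟩

open Classical in
/-- point of the projective plane with given homogeneous coordinates -/
noncomputable def pj (v : EuclSp (2+1)) : RP 2 :=
  if h : v ≠ 0 then qRP ⟨‖v‖⁻¹ • v, nrm_mem h⟩ else qRP e0S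

theorem pj_of {v : EuclSp (2+1)} (h : v ≠ 0) : pj v = qRP ⟨‖v‖⁻¹ • v, nrm_mem h⟩ := dif_pos h

theorem S2_ne (x : S2) : x.1 ≠ 0 := by
  intro h
  have := x.2
  rw [h] at this
  simp at this

theorem pj_S2 (x : S2) : pj x.1 = qRP x := by
  rw [pj_of (S2_ne x)]
  congr 1
  apply Subtype.ext
  simp [mem_sphere_zero_iff_norm.1 x.2]

theorem pj_eq {v w : EuclSp (2+1)} (hv : v ≠ 0) (hw : w ≠ 0) : pj v = pj w ↔ ∃ t : ℝ, t ≠ 0 ∧ w = t • v := by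
  have hv' := norm_pos_iff.2 hv
  have hw' := norm_pos_iff.2 hw
  rw [pj_of hv, pj_of hw, qRP_eq]
  constructor
  · intro h
    simp only at h
    rcases h with h | h
    · refine ⟨‖w‖ * ‖v‖⁻¹, by positivity, ?_⟩
      rw [mul_smul, ← h, smul_smul, mul_inv_cancel₀ hw'.ne', one_smul]
    · refine ⟨-(‖w‖ * ‖v‖⁻¹), by simp; exact ⟨hw, hv⟩, ?_⟩
      rw [neg_smul, mul_smul, ← smul_neg, ← h, smul_smul, mul_inv_cancel₀ hw'.ne', one_smul]
  · rintro ⟨t, ht, rfl⟩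
    simp only [norm_smul, Real.norm_eq_abs]
    rcases lt_or_gt_of_ne ht with h | h
    · right; rw [abs_of_neg h, smul_smul, ← neg_smul]; congr 1; field_simp
    · left; rw [abs_of_pos h, smul_smul]; congr 1; field_simp

theorem pj_smul {v : EuclSp (2+1)} (hv : v ≠ 0) {t : ℝ} (ht : t ≠ 0) : pj (t • v) = pj v :=
  ((pj_eq hv (smul_ne_zero ht hv)).2 ⟨t, ht, rfl⟩).symm

theorem pj_cont {α : Type} [TopologicalSpace α] {f : α → EuclSp (2+1)} (hf : Continuous f)
    (h0 : ∀ x, f x ≠ 0) : Continuous fun x => pj (f x) := by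
  have : (fun x => pj (f x)) = fun x => qRP ⟨‖f x‖⁻¹ • f x, nrm_mem (h0 x)⟩ := by
    funext x; exact pj_of (h0 x)
  rw [this]
  refine qRP_cont.comp (Continuous.subtype_mk ?_ _)
  exact (hf.norm.inv₀ fun x => norm_ne_zero_iff.2 (h0 x)).smul hf

theorem pj_surj (p : RP 2) : ∃ v, v ≠ 0 ∧ pj v = p := by
  obtain ⟨x, rfl⟩ := qRP_surj p
  exact ⟨x.1, S2_ne x, pj_S2 x⟩

/-- affine chart -/
noncomputable def aff (z : ℂ) : RP 2 := pj (vec3 1 z.re z.im)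

theorem vec3_ne (a b : ℝ) : vec3 1 a b ≠ 0 := fun h => one_ne_zero (vec3_eq_zero h).1

theorem aff_cont : Continuous aff :=
  pj_cont (vec3_cont continuous_const Complex.continuous_re Complex.continuous_im) (fun _ => vec3_ne _ _)

theorem smul_vec3 (t a b c : ℝ) : t • vec3 a b c = vec3 (t*a) (t*b) (t*c) := by
  apply S2_ext <;> simp

theorem vec3_inj {a b c a' b' c' : ℝ} (h : vec3 a b c = vec3 a' b' c') : a = a' ∧ b = b' ∧ c = c' := by
  have h0 := congrArg (fun v : EuclSp (2+1) => v 0) h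
  have h1 := congrArg (fun v : EuclSp (2+1) => v 1) h
  have h2 := congrArg (fun v : EuclSp (2+1) => v 2) h
  exact ⟨h0, h1, h2⟩

theorem aff_eq {v : EuclSp (2+1)} (hv : v ≠ 0) {z : ℂ} : pj v = aff z ↔ v 0 ≠ 0 ∧ z = ⟨v 1 / v 0, v 2 / v 0⟩ := by
  rw [aff, pj_eq hv (vec3_ne _ _)]
  constructor
  · rintro ⟨t, ht, h⟩
    have h0 := congrArg (fun v : EuclSp (2+1) => v 0) h
    have h1 := congrArg (fun v : EuclSp (2+1) => v 1) h
    have h2 := congrArg (fun v : EuclSp (2+1) => v 2) h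
    simp at h0 h1 h2
    have hv0 : v 0 ≠ 0 := by intro hh; rw [hh] at h0; simp at h0
    refine ⟨hv0, Complex.ext ?_ ?_⟩
    · show z.re = _
      rw [h1]; field_simp; linear_combination (-v 1) * h0
    · show z.im = _
      rw [h2]; field_simp; linear_combination (-v 2) * h0
  · rintro ⟨h0, rfl⟩
    refine ⟨(v 0)⁻¹, inv_ne_zero h0, S2_ext ?_ ?_ ?_⟩
    · simp [h0]
    · simp; field_simp
    · simp; field_simp

theorem aff_inj : Function.Injective aff := by
  intro z w h
  have h' : pj (vec3 1 z.re z.im) = aff w := h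
  rw [aff_eq (vec3_ne _ _)] at h'
  rw [h'.2]; apply Complex.ext <;> simp

theorem aff_openEmb : IsOpenEmbedding aff := by
  refine IsOpenEmbedding.of_continuous_injective_isOpenMap aff_cont aff_inj ?_
  intro U hU
  refine isQuotientMap_quot_mk.isOpen_preimage.1 ?_
  have : (Quot.mk (antipodalRel 2)) ⁻¹' (aff '' U) =
      {x : S2 | x.1 0 ≠ 0} ∩ (fun x : S2 => (⟨x.1 1 / x.1 0, x.1 2 / x.1 0⟩ : ℂ)) ⁻¹' U := by
    ext x
    constructor
    · rintro ⟨z, hz, hzx⟩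
      have h1 : pj x.1 = aff z := by rw [pj_S2]; exact hzx.symm
      rw [aff_eq (S2_ne x)] at h1
      refine ⟨h1.1, ?_⟩
      rw [mem_preimage, ← h1.2]; exact hz
    · rintro ⟨h1, h2⟩
      refine ⟨_, h2, ?_⟩
      have := (aff_eq (S2_ne x)).2 ⟨h1, rfl⟩
      rw [← this, pj_S2]; rfl
  rw [this]
  have ho : IsOpen {x : S2 | x.1 0 ≠ 0} := isOpen_ne_fun (by fun_prop) continuous_const
  refine ContinuousOn.isOpen_inter_preimage ?_ ho hU
  have h1 : ∀ i : Fin 3, ContinuousOn (fun x : S2 => x.1 i / x.1 0) {x : S2 | x.1 0 ≠ 0} := fun i =>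
    ContinuousOn.div (by fun_prop) (by fun_prop) (fun x hx => hx)
  have : (fun x : S2 => (⟨x.1 1 / x.1 0, x.1 2 / x.1 0⟩ : ℂ)) = fun x =>
    ((x.1 1 / x.1 0 : ℝ) : ℂ) + ((x.1 2 / x.1 0 : ℝ):ℂ) * Complex.I := by
    funext x; exact Complex.mk_eq_add_mul_I _ _
  rw [this]
  exact (Complex.continuous_ofReal.comp_continuousOn (h1 1)).add
    ((Complex.continuous_ofReal.comp_continuousOn (h1 2)).mul continuousOn_const)

theorem aff_zero : aff 0 = qRP e0S := by
  rw [← pj_S2]; rfl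

/-- isometries act on the projective plane -/
theorem RP_rot (L : EuclSp (2+1) ≃ₗᵢ[ℝ] EuclSp (2+1)) : ∃ T : RP 2 ≃ₜ RP 2, ∀ v, v ≠ 0 → T (pj v) = pj (L v) := by
  have key : ∀ L : EuclSp (2+1) ≃ₗᵢ[ℝ] EuclSp (2+1), ∃ T : RP 2 → RP 2, Continuous T ∧ ∀ v, v ≠ 0 → T (pj v) = pj (L v) := by
    intro L
    refine ⟨Quot.lift (fun x : S2 => pj (L x.1)) ?_, ?_, ?_⟩
    · intro x y h
      have h' : (y : EuclSp (2+1)) = -(x : EuclSp (2+1)) := h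
      have hne : L x.1 ≠ 0 := by simpa using S2_ne x
      show pj (L x.1) = pj (L y.1)
      rw [h', map_neg, ← neg_one_smul ℝ (L x.1), pj_smul hne (by norm_num)]
    · exact continuous_quot_lift _ (pj_cont (L.continuous.comp continuous_subtype_val)
        (fun x => by simpa using S2_ne x))
    · intro v hv
      rw [pj_of hv]
      show pj (L (‖v‖⁻¹ • v)) = _
      rw [map_smul, pj_smul (by simpa using hv) (by simpa using hv)]
  obtain ⟨f, hf, hf1⟩ := key L
  obtain ⟨g, hg, hg1⟩ := key L.symm
  refine ⟨⟨⟨f, g, ?_, ?_⟩, hf, hg⟩, hf1⟩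
  · intro p
    obtain ⟨v, hv, rfl⟩ := pj_surj p
    rw [hf1 v hv, hg1 _ (by simpa using hv)]; simp
  · intro p
    obtain ⟨v, hv, rfl⟩ := pj_surj p
    rw [hg1 v hv, hf1 _ (by simpa using hv)]; simp

theorem RP_homog (p : RP 2) : ∃ T : RP 2 ≃ₜ RP 2, T p = aff 0 := by
  obtain ⟨x, rfl⟩ := qRP_surj p
  obtain ⟨T, hT⟩ := RP_rot (Submodule.reflection (Submodule.span ℝ {x.1 - e0S.1})ᗮ)
  refine ⟨T, ?_⟩
  rw [← pj_S2, hT _ (S2_ne x), Submodule.reflection_sub, pj_S2, aff_zero]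
  rw [mem_sphere_zero_iff_norm.1 x.2, mem_sphere_zero_iff_norm.1 e0S.2]

theorem RP_locPlane : LocPlane (RP 2) := by
  intro p
  obtain ⟨T, hT⟩ := RP_homog p
  exact ⟨T.symm ∘ aff, T.symm.isOpenEmbedding.comp aff_openEmb, by simp [← hT]⟩
end

section
open Set Topology unitInterval

/-- inverse stereographic projection -/
noncomputable def stv (z : ℂ) : EuclSp (2+1) :=
  vec3 ((1 - ‖z‖^2) / (1 + ‖z‖^2)) (2 * z.re / (1 + ‖z‖^2)) (2 * z.im / (1 + ‖z‖^2))

theorem stv_mem (z : ℂ) : stv z ∈ Metric.sphere (0 : EuclSp (2+1)) 1 := by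
  have hp : (0:ℝ) < 1 + ‖z‖^2 := by positivity
  rw [mem_sphere_zero_iff_norm, stv, vec3_norm, Real.sqrt_eq_one]
  have : ‖z‖^2 = z.re^2 + z.im^2 := by rw [Complex.sq_norm, Complex.normSq_apply]; ring
  field_simp
  rw [this]; ring

noncomputable def st (z : ℂ) : S2 := ⟨stv z, stv_mem z⟩

theorem st_cont : Continuous st := by
  refine Continuous.subtype_mk (vec3_cont ?_ ?_ ?_) _ <;>
  refine Continuous.div (by fun_prop) (by fun_prop) (fun z => by positivity)

theorem st_inj : Function.Injective st := by
  intro z w h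
  have h1 : stv z = stv w := congrArg Subtype.val h
  obtain ⟨h0, h1, h2⟩ := vec3_inj h1
  have hz : (0:ℝ) < 1 + ‖z‖^2 := by positivity
  have hw : (0:ℝ) < 1 + ‖w‖^2 := by positivity
  have e : ‖z‖^2 = ‖w‖^2 := by
    rw [div_eq_div_iff hz.ne' hw.ne'] at h0
    nlinarith
  rw [e] at h1 h2
  apply Complex.ext
  · field_simp at h1; linarith
  · field_simp at h2; linarith

theorem st_surj {x : S2} (h : 1 + x.1 0 ≠ 0) : st ⟨x.1 1 / (1 + x.1 0), x.1 2 / (1 + x.1 0)⟩ = x := by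
  have hs := S2_sum x
  have hle : 0 < 1 + x.1 0 := by
    refine lt_of_le_of_ne ?_ (Ne.symm h)
    nlinarith [sq_nonneg (x.1 1), sq_nonneg (x.1 2)]
  have e : ‖(⟨x.1 1 / (1 + x.1 0), x.1 2 / (1 + x.1 0)⟩ : ℂ)‖^2 = (1 - x.1 0) / (1 + x.1 0) := by
    rw [Complex.sq_norm, Complex.normSq_apply]
    field_simp
    linarith
  have e2 : 1 + (1 - x.1 0) / (1 + x.1 0) = 2 / (1 + x.1 0) := by field_simp; ring
  apply Subtype.ext
  show stv _ = x.1
  rw [stv, e, e2]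
  apply S2_ext
  · simp; field_simp; ring
  · simp; field_simp
  · simp; field_simp

/-- a topological disc in the projective plane has a collar -/
theorem disc_collar {f : ℂ → RP 2} (hf : Continuous f) (hi : InjOn f (Metric.closedBall 0 1)) (h0 : f 0 = aff 0) :
    ∃ (s : ℝ) (k : ℂ → RP 2), 0 < s ∧ IsOpenEmbedding k ∧ k '' Metric.closedBall 0 s = f '' Metric.closedBall 0 1 := by
  obtain ⟨F, hFc, hF0, hFq⟩ := qRP_lift f hf e0S (by rw [h0, aff_zero])
  have hne : ∀ z ∈ Metric.closedBall (0:ℂ) 1, 1 + (F z).1 0 ≠ 0 := by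
    intro z hz h
    have hs := S2_sum (F z)
    have hx0 : (F z).1 0 = -1 := by linarith
    have h12 : (F z).1 1 = 0 ∧ (F z).1 2 = 0 := by
      rw [hx0] at hs
      constructor <;> nlinarith [sq_nonneg ((F z).1 1), sq_nonneg ((F z).1 2)]
    have hE : (F z).1 = -e0S.1 := by
      apply S2_ext
      · rw [hx0]; show _ = -(1:ℝ); rfl
      · rw [h12.1]; show _ = -(0:ℝ); simp
      · rw [h12.2]; show _ = -(0:ℝ); simp
    have : f z = f 0 := by
      rw [← hFq z, h0, aff_zero, eq_comm, qRP_eq]; right; exact hE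
    have hz0 : z = 0 := hi hz (by simp) this
    rw [hz0, hF0] at hx0
    have : (1:ℝ) = -1 := hx0
    norm_num at this
  set H : ℂ → ℂ := fun z => ⟨(F z).1 1 / (1 + (F z).1 0), (F z).1 2 / (1 + (F z).1 0)⟩ with hH
  have hst : ∀ z ∈ Metric.closedBall (0:ℂ) 1, st (H z) = F z := fun z hz => st_surj (hne z hz)
  have hHc : ContinuousOn H (Metric.closedBall 0 1) := by
    have h1 : ∀ i : Fin 3, ContinuousOn (fun z => (F z).1 i / (1 + (F z).1 0)) (Metric.closedBall 0 1) := fun i =>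
      ContinuousOn.div (by fun_prop) (by fun_prop) hne
    have : H = fun x =>
      (((F x).1 1 / (1 + (F x).1 0) : ℝ) : ℂ) + (((F x).1 2 / (1 + (F x).1 0) : ℝ):ℂ) * Complex.I := by
      funext x; exact Complex.mk_eq_add_mul_I _ _
    rw [this]
    exact (Complex.continuous_ofReal.comp_continuousOn (h1 1)).add
      ((Complex.continuous_ofReal.comp_continuousOn (h1 2)).mul continuousOn_const)
  have hqst : ∀ z ∈ Metric.closedBall (0:ℂ) 1, qRP (st (H z)) = f z := fun z hz => by
    rw [hst z hz, hFq]
  have hHi : InjOn H (Metric.closedBall 0 1) := by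
    intro z hz w hw h
    refine hi hz hw ?_
    rw [← hqst z hz, ← hqst w hw, h]
  have hH0 : H 0 = 0 := by
    simp only [hH, hF0]
    apply Complex.ext
    · show (0:ℝ) / _ = 0; simp
    · show (0:ℝ) / _ = 0; simp
  obtain ⟨ρ, R, Φ, hρ, -, hΦ⟩ := schoenflies0 hHc hHi hH0
  set k : ℂ → RP 2 := fun z => qRP (st (Φ z)) with hk
  have hkc : Continuous k := qRP_cont.comp (st_cont.comp Φ.continuous)
  have hex : ∀ z ∈ Metric.closedBall (0:ℂ) ρ, ∃ u ∈ Metric.closedBall (0:ℂ) 1, Φ z = H u ∧ k z = f u := by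
    intro z hz
    have : Φ z ∈ H '' Metric.closedBall 0 1 := by rw [← hΦ]; exact mem_image_of_mem _ hz
    obtain ⟨u, hu, hu'⟩ := this
    exact ⟨u, hu, hu'.symm, by simp only [hk]; rw [← hu', hqst u hu]⟩
  have hki : InjOn k (Metric.closedBall 0 ρ) := by
    intro z hz w hw h
    obtain ⟨u, hu, e1, e2⟩ := hex z hz
    obtain ⟨u', hu', e1', e2'⟩ := hex w hw
    have : u = u' := hi hu hu' (by rw [← e2, ← e2', h])
    exact Φ.injective (by rw [e1, e1', this])
  have hkim : k '' Metric.closedBall 0 ρ = f '' Metric.closedBall 0 1 := by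
    ext p
    constructor
    · rintro ⟨z, hz, rfl⟩
      obtain ⟨u, hu, e1, e2⟩ := hex z hz
      exact ⟨u, hu, e2.symm⟩
    · rintro ⟨u, hu, rfl⟩
      have : H u ∈ Φ '' Metric.closedBall 0 ρ := by rw [hΦ]; exact mem_image_of_mem _ hu
      obtain ⟨z, hz, hz'⟩ := this
      exact ⟨z, hz, by simp only [hk]; rw [hz', hqst u hu]⟩
  have hloc : ∀ z ∈ Metric.closedBall (0:ℂ) ρ, ∃ u ∈ 𝓝 z, InjOn k u := by
    intro z _
    obtain ⟨U, hU, hUe⟩ := (isLocalHomeomorph_iff_isOpenEmbedding_restrict.1 qRP_locHomeo) (st (Φ z))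
    refine ⟨(fun z => st (Φ z)) ⁻¹' U, (st_cont.comp Φ.continuous).continuousAt hU, ?_⟩
    intro a ha b hb hab
    have := injOn_iff_injective.2 hUe.injective ha hb hab
    exact Φ.injective (st_inj this)
  obtain ⟨t, ht, hti⟩ := hki.exists_mem_nhdsSet (isCompact_closedBall _ _) (fun z _ => hkc.continuousAt) hloc
  obtain ⟨V, hVo, hVs, hVt⟩ := mem_nhdsSet_iff_exists.1 ht
  obtain ⟨δ, hδ, hδV⟩ := (isCompact_closedBall (0:ℂ) ρ).exists_thickening_subset_open hVo hVs
  rw [thickening_closedBall hδ hρ.le] at hδV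
  obtain ⟨b, hb, hb0, hbr, hble⟩ := plane_ball (add_pos hδ hρ) 0
  have hbt : ∀ z, b z ∈ t := fun z => hVt (hδV (hbr ▸ mem_range_self z))
  obtain ⟨w0, hw0⟩ : (ρ:ℂ) ∈ range b := by
    rw [hbr, mem_ball_zero_iff, Complex.norm_real, Real.norm_of_nonneg hρ.le]; linarith
  have hs : 0 < ‖w0‖ := by
    rw [norm_pos_iff]; rintro rfl
    rw [hb0] at hw0
    exact hρ.ne (by exact_mod_cast hw0)
  refine ⟨‖w0‖, k ∘ b, hs, RP_locPlane.openEmbedding (hkc.comp hb.continuous)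
    (fun z w h => hb.injective (hti (hbt z) (hbt w) h)), ?_⟩
  rw [image_comp, ← hkim]
  congr 1
  ext v
  constructor
  · rintro ⟨z, hz, rfl⟩
    rw [mem_closedBall_zero_iff, hble, hw0, sub_zero, sub_zero, Complex.norm_real, Real.norm_of_nonneg hρ.le] at hz
    simpa using hz
  · intro hv
    rw [mem_closedBall_zero_iff] at hv
    obtain ⟨z, rfl⟩ : v ∈ range b := by rw [hbr, mem_ball_zero_iff]; linarith
    refine ⟨z, ?_, rfl⟩
    rw [mem_closedBall_zero_iff, hble, hw0, sub_zero, sub_zero, Complex.norm_real, Real.norm_of_nonneg hρ.le]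
    exact hv

theorem std_disc {h : ℂ → RP 2} (hc : ContinuousOn h (Metric.closedBall 0 1))
    (hi : InjOn h (Metric.closedBall 0 1)) :
    ∃ T : RP 2 ≃ₜ RP 2, T '' (h '' Metric.closedBall 0 1) = aff '' Metric.closedBall 0 1 := by
  obtain ⟨T0, hT0⟩ := RP_homog (h 0)
  obtain ⟨s, k0, hs, hk0, hk0im⟩ := disc_collar (f := fun z => T0 (h (retr z)))
    (T0.continuous.comp (hc.comp_continuous retr_cont (fun z => by simpa using retr_norm z)))
    (fun z hz w hw hzw => by
      have := T0.injective hzw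
      rw [retr_eq (by simpa using hz), retr_eq (by simpa using hw)] at this
      exact hi hz hw this)
    (by rw [retr_eq (by simp)]; exact hT0)
  have him0 : (fun z => T0 (h (retr z))) '' Metric.closedBall 0 1 = T0 '' (h '' Metric.closedBall 0 1) := by
    rw [← image_comp]
    refine image_congr fun z hz => ?_
    simp only [Function.comp]
    rw [retr_eq (by simpa using hz)]
  rw [him0] at hk0im
  obtain ⟨T1, hT1⟩ := RP_homog (k0 0)
  set k : ℂ → RP 2 := T1 ∘ k0 with hkdef
  have hk : IsOpenEmbedding k := T1.isOpenEmbedding.comp hk0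
  have hk00 : k 0 = aff 0 := hT1
  have hnh : k ⁻¹' range aff ∈ 𝓝 (0:ℂ) :=
    (aff_openEmb.isOpen_range.preimage hk.continuous).mem_nhds ⟨0, hk00.symm⟩
  obtain ⟨ε, hε, hεs⟩ := Metric.nhds_basis_closedBall.mem_iff.1 hnh
  set inv := Function.invFun aff with hinv
  have hl : ∀ z, inv (aff z) = z := Function.leftInverse_invFun aff_inj
  have hsc : ∀ u ∈ Metric.closedBall (0:ℂ) 1, (ε:ℂ) * u ∈ Metric.closedBall (0:ℂ) ε := by
    intro u hu
    rw [mem_closedBall_zero_iff] at hu ⊢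
    rw [norm_mul, Complex.norm_real, Real.norm_of_nonneg hε.le]
    nlinarith
  have hr : ∀ u ∈ Metric.closedBall (0:ℂ) 1, aff (inv (k (ε * u))) = k (ε * u) := by
    intro u hu
    obtain ⟨y, hy⟩ := hεs (hsc u hu)
    rw [← hy, hl]
  obtain ⟨ρ, R, Φ, hρ, hΦR, hΦ⟩ := schoenflies0 (h := fun u => inv (k (ε * u))) (by
      intro u hu
      rw [ContinuousWithinAt, aff_openEmb.toIsInducing.tendsto_nhds_iff, hr u hu]
      have h1 : ContinuousWithinAt (fun u : ℂ => k (ε * u)) (Metric.closedBall 0 1) u :=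
        (hk.continuous.comp (by fun_prop)).continuousWithinAt
      refine Filter.Tendsto.congr' ?_ h1
      filter_upwards [self_mem_nhdsWithin] with y hy
      exact (hr y hy).symm)
    (by
      intro u hu w hw h
      have h2 : k (ε * u) = k (ε * w) := by rw [← hr u hu, ← hr w hw]; exact congrArg aff h
      have h3 := hk.injective h2
      exact mul_left_cancel₀ (by exact_mod_cast hε.ne') h3)
    (by simp only [mul_zero]; rw [hk00, hl])
  have hΦ' : aff '' (Φ '' Metric.closedBall 0 ρ) = k '' Metric.closedBall 0 ε := by
    rw [hΦ]
    ext p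
    constructor
    · rintro ⟨_, ⟨u, hu, rfl⟩, rfl⟩
      exact ⟨_, hsc u hu, (hr u hu).symm⟩
    · rintro ⟨z, hz, rfl⟩
      have hu : z / ε ∈ Metric.closedBall (0:ℂ) 1 := by
        rw [mem_closedBall_zero_iff] at hz ⊢
        rw [norm_div, Complex.norm_real, Real.norm_of_nonneg hε.le, div_le_one hε]; exact hz
      have hz' : (ε:ℂ) * (z / ε) = z := by
        have : (ε:ℂ) ≠ 0 := by exact_mod_cast hε.ne'
        field_simp
      refine ⟨_, ⟨z / ε, hu, rfl⟩, ?_⟩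
      have := hr _ hu
      rw [hz'] at this
      simp only [hz']; exact this
  obtain ⟨R1, Φ1, hR1, hΦ1⟩ := radial_homeo hs hε
  obtain ⟨R2, Φ2, hR2, hΦ2⟩ := radial_homeo hρ one_pos
  obtain ⟨E1, hE1⟩ := ext_homeo hk Φ1 hR1
  obtain ⟨E2, hE2⟩ := ext_homeo aff_openEmb Φ hΦR
  obtain ⟨E3, hE3⟩ := ext_homeo aff_openEmb Φ2 hR2
  have eqs : ∀ {j : ℂ → RP 2} {E : RP 2 ≃ₜ RP 2} {Ψ : ℂ ≃ₜ ℂ} (_ : ∀ z, E (j z) = j (Ψ z)) (A : Set ℂ),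
      E '' (j '' A) = j '' (Ψ '' A) := by
    intro j E Ψ h A
    rw [image_image, image_image]; exact image_congr fun z _ => h z
  refine ⟨(((T0.trans T1).trans E1).trans E2.symm).trans E3, ?_⟩
  have c1 : (((T0.trans T1).trans E1).trans E2.symm).trans E3 '' (h '' Metric.closedBall 0 1)
      = E3 '' (E2.symm '' (E1 '' (T1 '' (T0 '' (h '' Metric.closedBall 0 1))))) := by
    simp only [image_image]; rfl
  rw [c1, ← hk0im, ← image_comp T1 k0, ← hkdef, eqs hE1, hΦ1, ← hΦ', ← eqs hE2, ← image_comp E2.symm E2]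
  have : (E2.symm ∘ E2) = id := by funext x; simp
  rw [this, image_id, eqs hE3, hΦ2]
end

section
open Set Topology unitInterval

/-- parametrisation of the projective plane minus a point -/
noncomputable def mobp (p : ℝ × ℝ) : RP 2 :=
  pj (vec3 p.2 (Real.cos (p.1 * Real.pi)) (Real.sin (p.1 * Real.pi)))

theorem mobp_ne (y t : ℝ) : vec3 y (Real.cos t) (Real.sin t) ≠ 0 := by
  intro h
  obtain ⟨-, h1, h2⟩ := vec3_eq_zero h
  have := Real.sin_sq_add_cos_sq t
  rw [h1, h2] at this; norm_num at this

theorem mobp_cont : Continuous mobp :=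
  pj_cont (vec3_cont (by fun_prop) (by fun_prop) (by fun_prop)) (fun _ => mobp_ne _ _)

theorem cos_sin_eq {s t : ℝ} (hc : Real.cos s = Real.cos t) (hs : Real.sin s = Real.sin t) :
    ∃ n : ℤ, s = t + n * (2 * Real.pi) := by
  have : Complex.exp (s * Complex.I) = Complex.exp (t * Complex.I) := by
    rw [Complex.exp_mul_I, Complex.exp_mul_I, ← Complex.ofReal_cos, ← Complex.ofReal_cos,
      ← Complex.ofReal_sin, ← Complex.ofReal_sin, hc, hs]
  obtain ⟨n, hn⟩ := Complex.exp_eq_exp_iff_exists_int.1 this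
  refine ⟨n, ?_⟩
  have h2 : (s:ℂ) * Complex.I = ((t + n * (2 * Real.pi) : ℝ) : ℂ) * Complex.I := by
    rw [hn]; push_cast; ring
  exact_mod_cast mul_right_cancel₀ Complex.I_ne_zero h2

theorem mobp_eq (x y x' y' : ℝ) : mobp (x, y) = mobp (x', y') ↔ ∃ n : ℤ, x' = x + n ∧ y' = (-1 : ℝ) ^ n * y := by
  have hpi := Real.pi_pos
  rw [mobp, mobp, pj_eq (mobp_ne _ _) (mobp_ne _ _)]
  constructor
  · rintro ⟨t, ht, h⟩
    rw [smul_vec3] at h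
    obtain ⟨h0, h1, h2⟩ := vec3_inj h
    simp only at h0 h1 h2
    have ht2 : t = 1 ∨ t = -1 := by
      have e1 := Real.sin_sq_add_cos_sq (x' * Real.pi)
      have e2 := Real.sin_sq_add_cos_sq (x * Real.pi)
      rw [h1, h2] at e1
      have : t ^ 2 = 1 := by linear_combination e1 - t^2 * e2
      simpa using this
    rcases ht2 with rfl | rfl
    · rw [one_mul] at h1 h2
      obtain ⟨n, hn⟩ := cos_sin_eq h1 h2
      refine ⟨2 * n, ?_, ?_⟩
      · push_cast
        have : (x' - (x + 2 * n)) * Real.pi = 0 := by linear_combination hn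
        have := (mul_eq_zero.1 this).resolve_right hpi.ne'
        linarith
      · rw [h0, zpow_mul]; norm_num
    · have h1' : Real.cos (x' * Real.pi) = Real.cos (x * Real.pi + Real.pi) := by rw [Real.cos_add_pi, h1]; ring
      have h2' : Real.sin (x' * Real.pi) = Real.sin (x * Real.pi + Real.pi) := by rw [Real.sin_add_pi, h2]; ring
      obtain ⟨n, hn⟩ := cos_sin_eq h1' h2'
      refine ⟨2 * n + 1, ?_, ?_⟩
      · push_cast
        have : (x' - (x + (2 * n + 1))) * Real.pi = 0 := by linear_combination hn
        have := (mul_eq_zero.1 this).resolve_right hpi.ne'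
        linarith
      · rw [h0, zpow_add₀ (by norm_num), zpow_mul]; norm_num
  · rintro ⟨n, rfl, rfl⟩
    refine ⟨(-1) ^ n, zpow_ne_zero _ (by norm_num), ?_⟩
    rw [smul_vec3]
    simp only
    rw [add_mul, Real.cos_add_int_mul_pi, Real.sin_add_int_mul_pi]

theorem mobp_ball (x y : ℝ) : mobp (x, y) ∈ aff '' Metric.ball 0 1 ↔ 1 < |y| := by
  have hkey : y ≠ 0 → ‖(⟨Real.cos (x * Real.pi) / y, Real.sin (x * Real.pi) / y⟩ : ℂ)‖ = 1 / |y| := by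
    intro hy
    have h1 : ‖(⟨Real.cos (x * Real.pi) / y, Real.sin (x * Real.pi) / y⟩ : ℂ)‖ ^ 2 = (1 / |y|)^2 := by
      rw [Complex.sq_norm, Complex.normSq_apply, div_pow, sq_abs]
      have := Real.sin_sq_add_cos_sq (x * Real.pi)
      simp only
      field_simp
      linarith
    exact (sq_eq_sq₀ (norm_nonneg _) (by positivity)).1 h1
  constructor
  · rintro ⟨z, hz, h⟩
    obtain ⟨h0, rfl⟩ := (aff_eq (mobp_ne _ _)).1 h.symm
    simp only [vec3_0, vec3_1, vec3_2] at h0 hz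
    rw [mem_ball_zero_iff, hkey h0] at hz
    have : 0 < |y| := abs_pos.2 h0
    rwa [div_lt_one this] at hz
  · intro hy
    have h0 : y ≠ 0 := by rintro rfl; norm_num at hy
    refine ⟨_, ?_, ((aff_eq (mobp_ne _ _)).2 ⟨h0, rfl⟩).symm⟩
    simp only [vec3_0, vec3_1, vec3_2]
    rw [mem_ball_zero_iff, hkey h0, div_lt_one (by linarith)]; exact hy

theorem mobp_surj {p : RP 2} (hp : p ≠ aff 0) : p ∈ range mobp := by
  obtain ⟨v, hv, rfl⟩ := pj_surj p
  set w : ℂ := ⟨v 1, v 2⟩ with hw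
  have hw0 : w ≠ 0 := by
    intro h
    have h1 : v 1 = 0 := congrArg Complex.re h
    have h2 : v 2 = 0 := congrArg Complex.im h
    have h0 : v 0 ≠ 0 := fun h0 => hv (S2_ext h0 h1 h2)
    exact hp ((aff_eq hv).2 ⟨h0, by rw [h1, h2]; apply Complex.ext <;> simp⟩)
  have hn : 0 < ‖w‖ := norm_pos_iff.2 hw0
  refine ⟨(Complex.arg w / Real.pi, v 0 / ‖w‖), ?_⟩
  rw [mobp, pj_eq (mobp_ne _ _) hv]
  refine ⟨‖w‖, hn.ne', ?_⟩
  rw [smul_vec3]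
  simp only [div_mul_cancel₀ _ Real.pi_ne_zero]
  rw [Complex.cos_arg hw0, Complex.sin_arg]
  apply S2_ext
  · simp; field_simp
  · show v 1 = ‖w‖ * (v 1 / ‖w‖); field_simp
  · show v 2 = ‖w‖ * (v 2 / ‖w‖); field_simp

theorem mob_param {B : Set (RP 2)} (e : ↥B ≃ₜ ↥(Metric.closedBall (0 : EuclSp 2) 1)) :
    ∃ p : ℝ × ℝ → RP 2, Continuous p ∧ (∀ x y, p (x, y) ∈ (interior B)ᶜ ↔ |y| ≤ 1) ∧
      (interior B)ᶜ ⊆ range p ∧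
      ∀ x y x' y', p (x, y) = p (x', y') ↔ ∃ n : ℤ, x' = x + n ∧ y' = (-1 : ℝ) ^ n * y := by
  classical
  obtain ⟨L, -⟩ : ∃ L : ℂ ≃ₗᵢ[ℝ] EuclSp 2, True := ⟨Complex.orthonormalBasisOneI.repr, trivial⟩
  have hLm : ∀ z ∈ Metric.closedBall (0:ℂ) 1, L z ∈ Metric.closedBall (0 : EuclSp 2) 1 := by
    intro z hz
    rw [mem_closedBall_zero_iff] at hz ⊢
    rwa [L.norm_map]
  have hg : ∃ g : ↥(Metric.closedBall (0:ℂ) 1) → RP 2, Continuous g ∧ ∀ z, g z = (e.symm ⟨L z.1, hLm z.1 z.2⟩).1 :=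
    ⟨fun z => (e.symm ⟨L z.1, hLm z.1 z.2⟩).1, continuous_subtype_val.comp (e.symm.continuous.comp
      (Continuous.subtype_mk (L.continuous.comp continuous_subtype_val) _)), fun z => rfl⟩
  obtain ⟨g, hgc, hge⟩ := hg
  obtain ⟨h, hh⟩ : ∃ h : ℂ → RP 2, ∀ z (hz : z ∈ Metric.closedBall (0:ℂ) 1), h z = g ⟨z, hz⟩ :=
    ⟨fun z => if hz : z ∈ Metric.closedBall (0:ℂ) 1 then g ⟨z, hz⟩ else aff 0, fun z hz => dif_pos hz⟩
  have hhe : ∀ z (hz : z ∈ Metric.closedBall (0:ℂ) 1), h z = (e.symm ⟨L z, hLm z hz⟩).1 := by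
    intro z hz; rw [hh z hz, hge]
  have hc : ContinuousOn h (Metric.closedBall 0 1) := by
    rw [continuousOn_iff_continuous_domRestrict]
    have : (Metric.closedBall (0:ℂ) 1).domRestrict h = g := by
      funext z; exact hh z.1 z.2
    rw [this]
    exact hgc
  have hi : InjOn h (Metric.closedBall 0 1) := by
    intro z hz w hw hzw
    rw [hhe z hz, hhe w hw] at hzw
    have := e.symm.injective (Subtype.ext hzw)
    exact L.injective (congrArg Subtype.val this)
  have him : h '' Metric.closedBall 0 1 = B := by
    ext b
    constructor
    · rintro ⟨z, hz, rfl⟩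
      rw [hhe z hz]; exact Subtype.coe_prop _
    · intro hb
      have hz : L.symm (e ⟨b, hb⟩).1 ∈ Metric.closedBall (0:ℂ) 1 := by
        have := (e ⟨b, hb⟩).2
        rw [mem_closedBall_zero_iff] at this ⊢
        rwa [L.symm.norm_map]
      refine ⟨_, hz, ?_⟩
      rw [hhe _ hz]
      simp
  obtain ⟨T, hT⟩ := std_disc hc hi
  rw [him] at hT
  have hintr : interior (aff '' Metric.closedBall 0 1) = aff '' Metric.ball 0 1 := by
    have h1 := aff_openEmb.isOpenMap.preimage_interior_eq_interior_preimage aff_cont (aff '' Metric.closedBall 0 1)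
    rw [preimage_image_eq _ aff_inj, interior_closedBall _ one_ne_zero] at h1
    rw [← h1, image_preimage_eq_of_subset]
    exact interior_subset.trans (image_subset_range _ _)
  have hTi : ∀ p, p ∈ interior B ↔ T p ∈ aff '' Metric.ball 0 1 := by
    intro p
    rw [← hintr, ← hT, ← T.image_interior]
    constructor
    · exact mem_image_of_mem _
    · rintro ⟨p', hp', h⟩; rwa [← T.injective h]
  refine ⟨fun q => T.symm (mobp q), T.symm.continuous.comp mobp_cont, ?_, ?_, ?_⟩
  · intro x y
    rw [mem_compl_iff, hTi, T.apply_symm_apply, mobp_ball, not_lt]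
  · intro p hp
    rw [mem_compl_iff, hTi] at hp
    obtain ⟨q, hq⟩ := mobp_surj (p := T p) (fun h0 => hp ⟨0, by simp, h0.symm⟩)
    exact ⟨q, by show T.symm (mobp q) = p; rw [hq]; simp⟩
  · intro x y x' y'
    rw [← mobp_eq]
    exact T.symm.injective.eq_iff
end

section
open Set Topology unitInterval

theorem locPlane_of_charted (K : Type) [TopologicalSpace K] [ChartedSpace (EuclSp 2) K] : LocPlane K := by
  intro x
  obtain ⟨L, -⟩ : ∃ L : ℂ ≃ₗᵢ[ℝ] EuclSp 2, True := ⟨Complex.orthonormalBasisOneI.repr, trivial⟩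
  set φ := chartAt (EuclSp 2) x with hφ
  set c : ℂ := L.symm (φ x) with hc
  have hx : x ∈ φ.source := mem_chart_source _ _
  have hop : IsOpen (L ⁻¹' φ.target) := φ.open_target.preimage L.continuous
  have hm : c ∈ L ⁻¹' φ.target := by
    rw [mem_preimage, hc, L.apply_symm_apply]; exact φ.map_source hx
  obtain ⟨r, hr, hrs⟩ := Metric.isOpen_iff.1 hop c hm
  obtain ⟨b, hb, hb0, hbr, -⟩ := plane_ball hr c
  have hbt : ∀ z, L (b z) ∈ φ.target := fun z => hrs (hbr ▸ mem_range_self z)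
  refine ⟨fun z => φ.symm (L (b z)), ?_, ?_⟩
  · refine IsOpenEmbedding.of_continuous_injective_isOpenMap ?_ ?_ ?_
    · exact φ.continuousOn_symm.comp_continuous (L.continuous.comp hb.continuous) hbt
    · intro z w h
      exact hb.injective (L.injective (φ.symm.injOn (hbt z) (hbt w) h))
    · intro U hU
      have h1 : IsOpen ((fun z => L (b z)) '' U) := by
        have h0 : (fun z => L (b z)) '' U = L '' (b '' U) := by rw [image_image]
        rw [h0]
        exact L.toHomeomorph.isOpenMap _ (hb.isOpenMap U hU)
      have h2 : (fun z => φ.symm (L (b z))) '' U = φ.symm '' ((fun z => L (b z)) '' U) := by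
        rw [image_image]
      rw [h2]
      refine φ.isOpen_image_symm_of_subset_target h1 ?_
      rintro _ ⟨z, _, rfl⟩; exact hbt z
  · simp only [hb0, hc, L.apply_symm_apply]
    exact φ.left_inv hx

/-- Parametrisation of one half of the connected sum. -/
theorem half_param {K : Type} [TopologicalSpace K] (hK : LocPlane K) {A : Set K} (hA : IsClosed A)
    {B : Set (RP 2)} (e : ↥B ≃ₜ ↥(Metric.closedBall (0 : EuclSp 2) 1))
    (ψ : ↥A ≃ₜ ↥((interior B)ᶜ)) :
    ∃ P : ℝ × ℝ → K, Continuous P ∧ (∀ x y, |y| ≤ 1 → P (x, y) ∈ A) ∧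
      (∀ a ∈ A, ∃ x y, |y| ≤ 1 ∧ P (x, y) = a) ∧
      (∀ x y, |y| ≤ 1 → (P (x, y) ∈ frontier A ↔ |y| = 1)) ∧
      (∀ x y x' y', |y| ≤ 1 → |y'| ≤ 1 →
        (P (x, y) = P (x', y') ↔ ∃ n : ℤ, x' = x + n ∧ y' = (-1 : ℝ) ^ n * y)) := by
  obtain ⟨p, hpc, hpm, hps, hpe⟩ := mob_param e
  set cl : ℝ → ℝ := fun y => max (-1) (min 1 y) with hcl
  have hcl1 : ∀ y, |cl y| ≤ 1 := fun y => abs_le.2 ⟨le_max_left _ _, max_le (by norm_num) (min_le_left _ _)⟩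
  have hcl2 : ∀ y, |y| ≤ 1 → cl y = y := fun y hy => by
    rw [abs_le] at hy
    simp only [hcl]; rw [min_eq_right hy.2, max_eq_right hy.1]
  have hclc : Continuous cl := by fun_prop
  have hex : ∃ P : ℝ × ℝ → K, Continuous P ∧ ∀ x y, ∃ h : P (x, y) ∈ A, (ψ ⟨P (x,y), h⟩).1 = p (x, cl y) := by
    refine ⟨fun q => (ψ.symm ⟨p (q.1, cl q.2), (hpm _ _).2 (hcl1 _)⟩).1, ?_, ?_⟩
    · exact continuous_subtype_val.comp (ψ.symm.continuous.comp
        (Continuous.subtype_mk (hpc.comp (by fun_prop)) _))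
    · intro x y
      refine ⟨Subtype.coe_prop _, ?_⟩
      simp
  obtain ⟨P, hPc, hP⟩ := hex
  have hPA : ∀ x y, P (x, y) ∈ A := fun x y => (hP x y).1
  have hPψ : ∀ x y, |y| ≤ 1 → (ψ ⟨P (x,y), hPA x y⟩).1 = p (x, y) := by
    intro x y hy
    rw [(hP x y).2, hcl2 y hy]
  have hfib : ∀ x y x' y', |y| ≤ 1 → |y'| ≤ 1 →
        (P (x, y) = P (x', y') ↔ ∃ n : ℤ, x' = x + n ∧ y' = (-1 : ℝ) ^ n * y) := by
    intro x y x' y' hy hy'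
    rw [← hpe, ← hPψ x y hy, ← hPψ x' y' hy']
    constructor
    · intro h; congr 3
    · intro h
      have := ψ.injective (Subtype.ext h)
      exact congrArg Subtype.val this
  refine ⟨P, hPc, fun x y _ => hPA x y, ?_, ?_, hfib⟩
  · intro a ha
    obtain ⟨⟨x, y⟩, hxy⟩ := hps (ψ ⟨a, ha⟩).2
    have hy : |y| ≤ 1 := by rw [← hpm x y, hxy]; exact (ψ ⟨a, ha⟩).2
    refine ⟨x, y, hy, ?_⟩
    have := hPψ x y hy
    rw [hxy] at this
    exact congrArg Subtype.val (ψ.injective (Subtype.ext this))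
  · intro x y hy
    rw [hA.frontier_eq]
    constructor
    · rintro ⟨-, hni⟩
      by_contra hne
      have hlt : |y| < 1 := lt_of_le_of_ne hy hne
      apply hni
      set r := min (1 - |y|) (1/2) with hr
      have hrp : 0 < r := lt_min (by linarith) (by norm_num)
      have hb : ∀ z ∈ Metric.ball (0:ℂ) r, |y + z.im| ≤ 1 ∧ |z.re| < 1/2 := by
        intro z hz
        rw [mem_ball_zero_iff] at hz
        have h1 := Complex.abs_im_le_norm z
        have h2 := Complex.abs_re_le_norm z
        have h3 : r ≤ 1 - |y| := min_le_left _ _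
        have h4 : r ≤ 1/2 := min_le_right _ _
        refine ⟨(abs_add_le _ _).trans (by linarith), by linarith⟩
      have hop := hK.open_map (U := Metric.ball 0 r) Metric.isOpen_ball (f := fun z => P (x + z.re, y + z.im))
        (hPc.comp (by fun_prop)).continuousOn (by
          intro z hz w hw h
          obtain ⟨n, h1, h2⟩ := (hfib _ _ _ _ (hb z hz).1 (hb w hw).1).1 h
          have hn : n = 0 := by
            have := (abs_lt.1 (hb z hz).2)
            have := (abs_lt.1 (hb w hw).2)
            have h5 : (n:ℝ) < 1 := by linarith
            have h6 : (-1:ℝ) < n := by linarith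
            have h5' : n < 1 := by exact_mod_cast h5
            have h6' : -1 < n := by exact_mod_cast h6
            omega
          subst hn
          apply Complex.ext
          · simp at h1; exact h1.symm
          · simp at h2; exact h2.symm)
      refine mem_interior.2 ⟨_, ?_, hop, ⟨0, by simpa using hrp, by simp⟩⟩
      rintro _ ⟨z, _, rfl⟩
      exact hPA _ _
    · intro hy1
      refine ⟨hPA x y, fun hin => ?_⟩
      obtain ⟨j, hj, hj0⟩ := hK (P (x, y))
      have hop : IsOpen (j ⁻¹' interior A) := isOpen_interior.preimage hj.continuous
      obtain ⟨r, hr, hrs⟩ := Metric.isOpen_iff.1 hop 0 (by rw [mem_preimage, hj0]; exact hin)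
      obtain ⟨b, hb, hb0, hbr, -⟩ := plane_ball hr 0
      have hbA : ∀ z, j (b z) ∈ A := fun z => interior_subset (hrs (hbr ▸ mem_range_self z))
      have hemb := RP_locPlane.openEmbedding (f := fun z => (ψ ⟨j (b z), hbA z⟩).1)
        (continuous_subtype_val.comp (ψ.continuous.comp (Continuous.subtype_mk (hj.continuous.comp hb.continuous) _)))
        (by
          intro z w h
          have := ψ.injective (Subtype.ext h)
          exact hb.injective (hj.injective (congrArg Subtype.val this)))
      have ho := hemb.isOpen_range
      have hc2 : Continuous fun t : ℝ => p (x, y * (1 + t)) := hpc.comp (by fun_prop)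
      have hmem : (fun t : ℝ => p (x, y * (1 + t))) ⁻¹' (range fun z => (ψ ⟨j (b z), hbA z⟩).1) ∈ 𝓝 (0:ℝ) := by
        refine (ho.preimage hc2).mem_nhds ⟨0, ?_⟩
        simp only [add_zero, mul_one]
        rw [← hPψ x y hy]
        congr 3
        rw [hb0, hj0]
      obtain ⟨ε, hε, hεs⟩ := Metric.mem_nhds_iff.1 hmem
      obtain ⟨z, hz⟩ := hεs (show ε / 2 ∈ Metric.ball (0:ℝ) ε by
        rw [mem_ball_zero_iff, Real.norm_of_nonneg (by linarith)]; linarith)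
      have h1 : p (x, y * (1 + ε / 2)) ∈ (interior B)ᶜ := by
        simp only at hz
        rw [← hz]; exact (ψ ⟨j (b z), hbA z⟩).2
      rw [hpm, abs_mul, hy1, one_mul, abs_of_pos (by linarith)] at h1
      linarith
end

section
open Set Topology unitInterval

theorem even_const {f : ℝ → ℝ} (hf : Continuous f) (h : ∀ x, ∃ n : ℤ, f x = 2 * n) (x y : ℝ) :
    f x = f y := by
  have := log_diff_const (X := (univ : Set ℝ)) (g := fun x => (f x * Real.pi : ℝ) * Complex.I) (g' := fun _ => 0)
    isPreconnected_univ (by fun_prop) (by fun_prop) (fun z _ => by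
      obtain ⟨n, hn⟩ := h z
      rw [hn, Complex.exp_zero, Complex.exp_eq_one_iff]
      exact ⟨n, by push_cast; ring⟩) (mem_univ x) (mem_univ y)
  have h2 := congrArg Complex.im this
  simp at h2
  exact h2

theorem circle_lift0 {K : Type} [TopologicalSpace K] [T2Space K] {c d : ℝ → K}
    (hc : Continuous c) (hd : Continuous d) (hr : ∀ x, ∃ t, d t = c x)
    (hd2 : ∀ x y, d x = d y ↔ ∃ n : ℤ, y = x + 2 * n) :
    ∃ τ : ℝ → ℝ, Continuous τ ∧ ∀ x, d (τ x) = c x := by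
  choose t ht using hr
  set u : ℝ → ℂ := fun x => Complex.exp ((t x * Real.pi : ℝ) * Complex.I) with hu
  have huc : Continuous u := by
    rw [← continuousOn_univ, continuousOn_univ, continuous_iff_isClosed]
    intro C hC
    have : u ⁻¹' C = c ⁻¹' (d '' (Icc 0 2 ∩ (fun s : ℝ => Complex.exp ((s * Real.pi : ℝ) * Complex.I)) ⁻¹' C)) := by
      ext x
      simp only [mem_preimage, mem_image, mem_inter_iff]
      have key : ∀ s s' : ℝ, (∃ n : ℤ, s' = s + 2 * n) →
        Complex.exp ((s' * Real.pi : ℝ) * Complex.I) = Complex.exp ((s * Real.pi : ℝ) * Complex.I) := by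
        rintro s s' ⟨n, rfl⟩
        rw [Complex.exp_eq_exp_iff_exists_int]
        exact ⟨n, by push_cast; ring⟩
      constructor
      · intro hx
        have e : t x = (t x - 2 * (⌊t x / 2⌋ : ℤ)) + 2 * (⌊t x / 2⌋ : ℤ) := by ring
        refine ⟨t x - 2 * (⌊t x / 2⌋ : ℤ), ⟨⟨?_, ?_⟩, ?_⟩, ?_⟩
        · have := Int.floor_le (t x / 2); linarith
        · have := Int.lt_floor_add_one (t x / 2); linarith
        · rw [← key _ _ ⟨_, e⟩]; exact hx
        · rw [← ht, hd2]; exact ⟨_, e⟩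
      · rintro ⟨s, ⟨_, hs⟩, hsx⟩
        rw [← ht, hd2] at hsx
        rw [hu]; simp only
        rw [key _ _ hsx]; exact hs
    rw [this]
    refine IsClosed.preimage hc (IsCompact.isClosed ?_)
    exact ((isCompact_Icc).inter_right (hC.preimage (by fun_prop))).image hd
  obtain ⟨g, hg, hgu⟩ := hasLog_univ huc (fun x => Complex.exp_ne_zero _)
  refine ⟨fun x => (g x).im / Real.pi, ?_, ?_⟩
  · exact (Complex.continuous_im.comp (continuousOn_univ.1 hg)).div_const _
  · intro x
    have := hgu x (mem_univ x)
    rw [hu] at this; simp only at this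
    rw [Complex.exp_eq_exp_iff_exists_int] at this
    obtain ⟨n, hn⟩ := this
    rw [← ht, eq_comm, hd2]
    refine ⟨n, ?_⟩
    have h2 := congrArg Complex.im hn
    simp at h2
    show (g x).im / Real.pi = _
    rw [h2]
    field_simp

theorem circle_lift {K : Type} [TopologicalSpace K] [T2Space K] {c d : ℝ → K}
    (hc : Continuous c) (hd : Continuous d) (hr : ∀ x, ∃ t, d t = c x) (hr' : ∀ x, ∃ t, c t = d x)
    (hc2 : ∀ x y, c x = c y ↔ ∃ n : ℤ, y = x + 2 * n)
    (hd2 : ∀ x y, d x = d y ↔ ∃ n : ℤ, y = x + 2 * n) :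
    ∃ τ : ℝ → ℝ, Continuous τ ∧ StrictMono τ ∧ (∀ x, τ (x + 2) = τ x + 2) ∧
      ((∀ x, d (τ x) = c x) ∨ (∀ x, d (-τ x) = c x)) := by
  obtain ⟨τ, hτ, hτd⟩ := circle_lift0 hc hd hr hd2
  obtain ⟨s, hs, hsd⟩ := circle_lift0 hd hc hr' hc2
  have hst : ∀ x y, s (τ x) - x = s (τ y) - y := by
    intro x y
    refine even_const (f := fun x => s (τ x) - x) (by fun_prop) (fun z => ?_) x y
    have : c z = c (s (τ z)) := by rw [hsd, hτd]
    obtain ⟨n, hn⟩ := (hc2 _ _).1 this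
    exact ⟨n, by linarith⟩
  have hinj : Function.Injective τ := by
    intro x y hxy
    have := hst x y
    rw [hxy] at this; linarith
  have hper : ∀ x, ∃ n : ℤ, τ (x + 2) = τ x + 2 * n := by
    intro x
    rw [← hd2, hτd, hτd, hc2]
    exact ⟨1, by norm_num⟩
  have hbet : ∀ x z, x < z → z < x + 2 → ∀ n : ℤ, τ z ≠ τ x + 2 * n := by
    intro x z h1 h2 n h
    have := (hd2 (τ x) (τ z)).2 ⟨n, h⟩
    rw [hτd, hτd, hc2] at this
    obtain ⟨m, hm⟩ := this
    have a1 : (0 : ℝ) < m := by linarith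
    have a2 : (m : ℝ) < 1 := by linarith
    have b1 : 0 < m := by exact_mod_cast a1
    have b2 : m < 1 := by exact_mod_cast a2
    omega
  rcases hτ.strictMono_of_inj hinj with hm | hm
  · refine ⟨τ, hτ, hm, fun x => ?_, Or.inl hτd⟩
    obtain ⟨n, hn⟩ := hper x
    have h1 : τ x < τ (x + 2) := hm (by linarith)
    have h2 : (0 : ℝ) < n := by linarith
    have h3 : 0 < n := by exact_mod_cast h2
    by_cases h4 : n = 1
    · rw [hn, h4]; norm_num
    · exfalso
      have h5 : (2 : ℝ) ≤ n := by exact_mod_cast (show 2 ≤ n by omega)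
      have := intermediate_value_Ioo (show x ≤ x + 2 by linarith) hτ.continuousOn
      obtain ⟨z, hz, hz2⟩ := this (show τ x + 2 ∈ _ from ⟨by linarith, by linarith⟩)
      exact hbet x z hz.1 hz.2 1 (by rw [hz2]; norm_num)
  · refine ⟨fun x => - τ x, hτ.neg, hm.neg, fun x => ?_, Or.inr fun x => by rw [neg_neg, hτd]⟩
    obtain ⟨n, hn⟩ := hper x
    have h1 : τ (x + 2) < τ x := hm (by linarith)
    have h2 : (n : ℝ) < 0 := by linarith
    have h3 : n < 0 := by exact_mod_cast h2
    by_cases h4 : n = -1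
    · show -τ (x + 2) = -τ x + 2
      rw [hn, h4]; push_cast; ring
    · exfalso
      have h5 : (n : ℝ) ≤ -2 := by exact_mod_cast (show n ≤ -2 by omega)
      have := intermediate_value_Ioo' (show x ≤ x + 2 by linarith) hτ.continuousOn
      obtain ⟨z, hz, hz2⟩ := this (show τ x - 2 ∈ _ from ⟨by linarith, by linarith⟩)
      exact hbet x z hz.1 hz.2 (-1) (by rw [hz2]; push_cast; ring)
end

section
open Set Topology unitInterval

theorem npow_cases (n : ℤ) : (Even n ∧ (-1 : ℝ) ^ n = 1) ∨ (Odd n ∧ (-1 : ℝ) ^ n = -1) := by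
  rcases Int.even_or_odd n with h | h
  · exact Or.inl ⟨h, h.neg_one_zpow⟩
  · exact Or.inr ⟨h, h.neg_one_zpow⟩

/-- The parametrisation data for half. -/
def HalfP {K : Type} [TopologicalSpace K] (A : Set K) (P : ℝ × ℝ → K) : Prop :=
  Continuous P ∧ (∀ x y, |y| ≤ 1 → P (x, y) ∈ A) ∧
      (∀ a ∈ A, ∃ x y, |y| ≤ 1 ∧ P (x, y) = a) ∧
      (∀ x y, |y| ≤ 1 → (P (x, y) ∈ frontier A ↔ |y| = 1)) ∧
      (∀ x y x' y', |y| ≤ 1 → |y'| ≤ 1 →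
        (P (x, y) = P (x', y') ↔ ∃ n : ℤ, x' = x + n ∧ y' = (-1 : ℝ) ^ n * y))

theorem HalfP.flip {K : Type} [TopologicalSpace K] {A : Set K} {P : ℝ × ℝ → K} (h : HalfP A P) :
    HalfP A (fun q => P (-q.1, q.2)) := by
  obtain ⟨h1, h2, h3, h4, h5⟩ := h
  refine ⟨by fun_prop, fun x y hy => h2 _ _ hy, ?_, fun x y hy => h4 _ _ hy, ?_⟩
  · intro a ha
    obtain ⟨x, y, hy, e⟩ := h3 a ha
    exact ⟨-x, y, hy, by simpa using e⟩
  · intro x y x' y' hy hy'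
    rw [h5 _ _ _ _ hy hy']
    constructor
    · rintro ⟨n, e1, e2⟩
      exact ⟨-n, by push_cast; linarith, by rw [zpow_neg]; rcases npow_cases n with h | h <;> rw [h.2] at e2 ⊢ <;> rw [e2] <;> norm_num⟩
    · rintro ⟨n, e1, e2⟩
      exact ⟨-n, by push_cast; linarith, by rw [zpow_neg]; rcases npow_cases n with h | h <;> rw [h.2] at e2 ⊢ <;> rw [e2] <;> norm_num⟩

theorem HalfP.even {K : Type} [TopologicalSpace K] {A : Set K} {P : ℝ × ℝ → K} (h : HalfP A P)
    {w : ℝ} (hw : |w| = 1) (x y : ℝ) : P (x, w) = P (y, w) ↔ ∃ n : ℤ, y = x + 2 * n := by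
  rw [h.2.2.2.2 _ _ _ _ hw.le hw.le]
  constructor
  · rintro ⟨n, e1, e2⟩
    rcases npow_cases n with ⟨⟨m, rfl⟩, hn⟩ | ⟨-, hn⟩
    · exact ⟨m, by rw [e1]; push_cast; ring⟩
    · rw [hn] at e2
      have : w = 0 := by linarith
      rw [this] at hw; norm_num at hw
  · rintro ⟨n, e⟩
    refine ⟨2 * n, by rw [e]; push_cast; ring, ?_⟩
    rw [(even_two_mul n).neg_one_zpow, one_mul]

theorem HalfP.shift {K : Type} [TopologicalSpace K] {A : Set K} {P : ℝ × ℝ → K} (h : HalfP A P)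
    {w : ℝ} (hw : |w| ≤ 1) (x : ℝ) : P (x, w) = P (x + 1, -w) := by
  rw [h.2.2.2.2 _ _ _ _ hw (by rwa [abs_neg])]
  exact ⟨1, by simp⟩

theorem HalfP.range {K : Type} [TopologicalSpace K] {A : Set K} {P : ℝ × ℝ → K} (h : HalfP A P)
    (hA : IsClosed A)
    {w : ℝ} (hw : |w| = 1) {a : K} (ha : a ∈ frontier A) : ∃ x, P (x, w) = a := by
  obtain ⟨x, y, hy, e⟩ := h.2.2.1 a (hA.frontier_subset ha)
  have h1 := (h.2.2.2.1 x y hy).1 (e ▸ ha)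
  have : y = w ∨ y = -w := by
    rcases eq_or_eq_neg_of_abs_eq h1 with h1 | h1 <;> rcases eq_or_eq_neg_of_abs_eq hw with h2 | h2 <;>
      rw [h1, h2] <;> norm_num
  rcases this with rfl | rfl
  · exact ⟨x, e⟩
  · refine ⟨x + 1, ?_⟩
    rw [← e, h.shift hy, neg_neg]

theorem halves_match {K : Type} [TopologicalSpace K] [T2Space K] {A₁ A₂ : Set K} (hA₁ : IsClosed A₁) (hA₂ : IsClosed A₂)
    (hF : frontier A₁ = frontier A₂) {P₁ P₂ : ℝ × ℝ → K} (h₁ : HalfP A₁ P₁) (h₂ : HalfP A₂ P₂) :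
    ∃ Q, HalfP A₂ Q ∧ (∀ x, Q (x, -1) = P₁ (x, 1)) ∧ (∀ x, Q (x, 1) = P₁ (x, -1)) := by
  have i1 : |(1 : ℝ)| = 1 := by norm_num
  have i2 : |(-1 : ℝ)| = 1 := by norm_num
  have hc := h₁.1
  have hd := h₂.1
  obtain ⟨τ, hτ, hm, hτ2, hτd⟩ := circle_lift (c := fun x => P₁ (x, 1)) (d := fun x => P₂ (x, -1))
    (by fun_prop) (by fun_prop)
    (fun x => h₂.range hA₂ i2 (hF ▸ (h₁.2.2.2.1 x 1 i1.le).2 i1))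
    (fun x => h₁.range hA₁ i1 (hF ▸ (h₂.2.2.2.1 x (-1) i2.le).2 i2)) (h₁.even i1) (h₂.even i2)
  obtain ⟨P₂, h₂, hτd⟩ : ∃ P₂, HalfP A₂ P₂ ∧ ∀ x, P₂ (τ x, -1) = P₁ (x, 1) := by
    rcases hτd with h | h
    · exact ⟨P₂, h₂, h⟩
    · exact ⟨_, h₂.flip, h⟩
  have hd := h₂.1
  set Φ : ℝ → ℝ → ℝ := fun x y => ((1 - y) / 2) * τ x + ((1 + y) / 2) * (τ (x - 1) + 1) with hΦ
  have hΦm : ∀ y, |y| ≤ 1 → StrictMono (fun x => Φ x y) := by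
    intro y hy a b hab
    rw [abs_le] at hy
    have e1 := hm hab
    have e2 : τ (a - 1) < τ (b - 1) := hm (by linarith)
    simp only [hΦ]
    have : 0 ≤ (1 - y) / 2 := by linarith
    have : 0 ≤ (1 + y) / 2 := by linarith
    rcases eq_or_lt_of_le hy.2 with rfl | h
    · nlinarith
    · have : 0 < (1 - y) / 2 := by linarith
      nlinarith
  have hΦ1 : ∀ x y, Φ (x + 1) (-y) = Φ x y + 1 := by
    intro x y
    simp only [hΦ]
    have : τ (x + 1) = τ (x - 1) + 2 := by rw [← hτ2]; ring_nf
    rw [this]; ring_nf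
  have hΦ1' : ∀ x y, Φ (x - 1) (-y) = Φ x y - 1 := by
    intro x y
    have := hΦ1 (x - 1) (-y)
    rw [neg_neg, sub_add_cancel] at this
    linarith
  have hΦn : ∀ n : ℤ, ∀ x y, Φ (x + n) ((-1 : ℝ) ^ n * y) = Φ x y + n := by
    intro n
    induction n using Int.induction_on with
    | zero => intro x y; simp
    | succ i ih =>
      intro x y
      have := ih (x + 1) (-y)
      rw [hΦ1] at this
      rw [zpow_add_one₀ (by norm_num)]
      push_cast at this ⊢
      rw [show x + ((i : ℝ) + 1) = x + 1 + i by ring, show ((-1 : ℝ) ^ (i : ℤ) * -1) * y = (-1) ^ (i : ℤ) * -y by ring, this]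
      ring
    | pred i ih =>
      intro x y
      have := ih (x - 1) (-y)
      rw [hΦ1'] at this
      rw [zpow_sub_one₀ (by norm_num)]
      push_cast at this ⊢
      rw [show x + (-(i : ℝ) - 1) = x - 1 + -i by ring, show ((-1 : ℝ) ^ (-i : ℤ) * (-1)⁻¹) * y = (-1) ^ (-i : ℤ) * -y by norm_num, this]
      ring
  have hΦc : Continuous (fun q : ℝ × ℝ => Φ q.1 q.2) := by simp only [hΦ]; fun_prop
  have hΦs : ∀ y t, ∃ x, Φ x y = t := by
    intro y t
    have hh : ∀ n : ℤ, Φ (0 + 2 * n) y = Φ 0 y + 2 * n := by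
      intro n
      have := hΦn (2 * n) 0 y
      rw [(even_two_mul n).neg_one_zpow, one_mul] at this
      push_cast at this; exact this
    have hcy : Continuous (fun x => Φ x y) := by simp only [hΦ]; fun_prop
    refine mem_range_of_exists_le_of_exists_ge hcy ⟨0 + 2 * (⌊(t - Φ 0 y) / 2⌋ : ℤ), ?_⟩ ⟨0 + 2 * (⌈(t - Φ 0 y) / 2⌉ : ℤ), ?_⟩
    · rw [hh]; have := Int.floor_le ((t - Φ 0 y) / 2); linarith
    · rw [hh]; have := Int.le_ceil ((t - Φ 0 y) / 2); linarith
  refine ⟨fun q => P₂ (Φ q.1 q.2, q.2), ⟨?_, ?_, ?_, ?_, ?_⟩, ?_, ?_⟩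
  · exact hd.comp (hΦc.prodMk continuous_snd)
  · exact fun x y hy => h₂.2.1 _ _ hy
  · intro a ha
    obtain ⟨x, y, hy, e⟩ := h₂.2.2.1 a ha
    obtain ⟨x', hx'⟩ := hΦs y x
    exact ⟨x', y, hy, by simp only [hx', e]⟩
  · exact fun x y hy => h₂.2.2.2.1 _ _ hy
  · intro x y x' y' hy hy'
    simp only
    rw [h₂.2.2.2.2 _ _ _ _ hy hy']
    refine exists_congr fun n => ?_
    constructor
    · rintro ⟨e1, e2⟩
      refine ⟨?_, e2⟩
      apply (hΦm y' hy').injective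
      simp only
      rw [e1, ← hΦn n x y, e2]
    · rintro ⟨e1, e2⟩
      exact ⟨by rw [e1, e2, hΦn], e2⟩
  · intro x
    simp only
    have : Φ x (-1) = τ x := by simp only [hΦ]; ring
    rw [this, hτd]
  · intro x
    simp only
    have : Φ x 1 = τ (x - 1) + 1 := by simp only [hΦ]; ring
    rw [this]
    have e1 := h₂.shift i2.le (τ (x - 1))
    have e2 := h₁.shift i1.le (x - 1)
    rw [neg_neg] at e1
    rw [← e1, hτd, e2, sub_add_cancel]
end

section
open Set Topology unitInterval

/-- The Klein bottle parametrisation data. -/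
def KleinP {K : Type} [TopologicalSpace K] (P : ℝ × ℝ → K) : Prop :=
  Continuous P ∧ (∀ a, ∃ x y, 0 ≤ x ∧ x < 1 ∧ |y| ≤ 2 ∧ P (x, y) = a) ∧
      (∀ x y x' y', |y| ≤ 3 → |y'| ≤ 3 →
        (P (x, y) = P (x', y') ↔ ∃ n m : ℤ, x' = x + n ∧ y' = (-1 : ℝ) ^ n * y + 4 * m))

theorem small_int {m : ℤ} {a b : ℝ} (ha : |a| ≤ 1) (hb : |b| ≤ 1) (h : b = a + 4 * m) : m = 0 := by
  rw [abs_le] at ha hb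
  have h1 : (m : ℝ) < 1 := by linarith
  have h2 : (-1 : ℝ) < m := by linarith
  have h1 : m < 1 := by exact_mod_cast h1
  have h2 : -1 < m := by exact_mod_cast h2
  omega

theorem npow_abs (n : ℤ) (y : ℝ) : |(-1 : ℝ) ^ n * y| = |y| := by
  rcases npow_cases n with h | h <;> rw [h.2] <;> simp

theorem klein_glue {K : Type} [TopologicalSpace K] [T2Space K] {A₁ A₂ : Set K} (hA₁ : IsClosed A₁) (hA₂ : IsClosed A₂)
    (hU : A₁ ∪ A₂ = univ) (hF1 : A₁ ∩ A₂ = frontier A₁) (hF2 : A₁ ∩ A₂ = frontier A₂)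
    {P₁ P₂ : ℝ × ℝ → K} (h₁ : HalfP A₁ P₁) (h₂ : HalfP A₂ P₂) : ∃ P : ℝ × ℝ → K, KleinP P := by
  obtain ⟨Q, hQ, hQ1, hQ2⟩ := halves_match hA₁ hA₂ (hF1.symm.trans hF2) h₁ h₂
  have hc1 := h₁.1
  have hc2 := hQ.1
  have hex : ∃ P : ℝ × ℝ → K, Continuous P ∧ (∀ x y, |y| ≤ 1 → P (x, y) = P₁ (x, y)) ∧
      (∀ x y, y ≤ -1 → P (x, y) = Q (x, y + 2)) ∧ (∀ x y, 1 ≤ y → P (x, y) = Q (x, y - 2)) := by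
    refine ⟨fun q => if q.2 ≤ -1 then Q (q.1, q.2 + 2) else if q.2 ≤ 1 then P₁ q else Q (q.1, q.2 - 2), ?_, ?_, ?_, ?_⟩
    · refine Continuous.if_le (by fun_prop) (Continuous.if_le (by fun_prop) (by fun_prop) (by fun_prop) (by fun_prop) ?_)
        (by fun_prop) (by fun_prop) ?_
      · rintro ⟨x, y⟩ e
        simp only at e ⊢
        rw [e, ← hQ1]; norm_num
      · rintro ⟨x, y⟩ e
        simp only at e ⊢
        rw [e, ← hQ2]; norm_num
    · intro x y hy
      rw [abs_le] at hy
      rcases eq_or_lt_of_le hy.1 with rfl | h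
      · simp only [le_refl, if_true]
        rw [← hQ2]; norm_num
      · simp only [not_le.2 h, if_false, hy.2, if_true]
    · intro x y hy
      simp only [hy, if_true]
    · intro x y hy
      rcases eq_or_lt_of_le hy with rfl | h
      · simp only [le_refl, if_true]
        rw [if_neg (by norm_num), ← hQ1]; norm_num
      · simp only [not_le.2 h, if_false]
        rw [if_neg (by linarith)]
  obtain ⟨P, hPc, hP1, hPm, hPp⟩ := hex
  -- rule
  have hout : ∀ y : ℝ, 1 ≤ |y| → |y| ≤ 3 → ∃ e : ℤ, (e = 1 ∨ e = -1) ∧ |y - 2 * e| ≤ 1 ∧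
      ∀ x, P (x, y) = Q (x, y - 2 * e) := by
    intro y h1 h3
    rcases le_abs.1 h1 with h | h
    · rw [abs_of_nonneg (by linarith)] at h3
      refine ⟨1, Or.inl rfl, ?_, ?_⟩
      · push_cast; rw [abs_le]; constructor <;> linarith
      · intro x; rw [hPp x y h]; norm_num
    · rw [abs_of_nonpos (by linarith)] at h3
      refine ⟨-1, Or.inr rfl, ?_, ?_⟩
      · push_cast; rw [abs_le]; constructor <;> linarith
      · intro x; rw [hPm x y (by linarith)]; norm_num
  -- mixed case
  have hmix : ∀ x y x' y', |y| < 1 → 1 ≤ |y'| → |y'| ≤ 3 → P (x, y) ≠ P (x', y') := by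
    intro x y x' y' hy hy' hy3 he
    obtain ⟨e, -, he1, he2⟩ := hout y' hy' hy3
    have m1 : P (x, y) ∈ A₁ := by rw [hP1 _ _ hy.le]; exact h₁.2.1 _ _ hy.le
    have m2 : P (x, y) ∈ A₂ := by rw [he, he2]; exact hQ.2.1 _ _ he1
    have m3 : P (x, y) ∈ frontier A₁ := hF1 ▸ ⟨m1, m2⟩
    rw [hP1 _ _ hy.le, h₁.2.2.2.1 _ _ hy.le] at m3
    linarith
  have hmix2 : ∀ y y' : ℝ, ∀ n m : ℤ, |y| < 1 → 1 ≤ |y'| → |y'| ≤ 3 → y' ≠ (-1 : ℝ) ^ n * y + 4 * m := by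
    intro y y' n m hy h1 h3 he
    have e := npow_abs n y
    set w := (-1 : ℝ) ^ n * y
    rw [← e, abs_lt] at hy
    rw [abs_le] at h3
    have a1 : (m : ℝ) < 1 := by linarith
    have a2 : (-1 : ℝ) < m := by linarith
    have a1 : m < 1 := by exact_mod_cast a1
    have a2 : -1 < m := by exact_mod_cast a2
    have : m = 0 := by omega
    rw [this] at he
    have : |y'| < 1 := by rw [he, abs_lt]; push_cast; constructor <;> linarith
    linarith
  have hrule : ∀ x y x' y', |y| ≤ 3 → |y'| ≤ 3 →
        (P (x, y) = P (x', y') ↔ ∃ n m : ℤ, x' = x + n ∧ y' = (-1 : ℝ) ^ n * y + 4 * m) := by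
    intro x y x' y' hy hy'
    by_cases c1 : |y| < 1 <;> by_cases c2 : |y'| < 1
    · rw [hP1 _ _ c1.le, hP1 _ _ c2.le, h₁.2.2.2.2 _ _ _ _ c1.le c2.le]
      constructor
      · rintro ⟨n, e1, e2⟩; exact ⟨n, 0, e1, by rw [e2]; simp⟩
      · rintro ⟨n, m, e1, e2⟩
        have := small_int (by rw [npow_abs]; exact c1.le) c2.le e2
        exact ⟨n, e1, by rw [e2, this]; simp⟩
    · refine iff_of_false (hmix _ _ _ _ c1 (not_lt.1 c2) hy') ?_
      rintro ⟨n, m, -, e2⟩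
      exact hmix2 _ _ n m c1 (not_lt.1 c2) hy' e2
    · refine iff_of_false (fun h => hmix _ _ _ _ c2 (not_lt.1 c1) hy h.symm) ?_
      rintro ⟨n, m, -, e2⟩
      rcases npow_cases n with h | h
      · exact hmix2 y' y 0 (-m) c2 (not_lt.1 c1) hy (by rw [e2, h.2]; push_cast; ring)
      · exact hmix2 y' y 1 m c2 (not_lt.1 c1) hy (by rw [e2, h.2]; push_cast; ring)
    · obtain ⟨e, he, he1, he2⟩ := hout y (not_lt.1 c1) hy
      obtain ⟨f, hf, hf1, hf2⟩ := hout y' (not_lt.1 c2) hy'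
      rw [he2, hf2, hQ.2.2.2.2 _ _ _ _ he1 hf1]
      obtain ⟨k, hk⟩ : ∃ k : ℤ, e + f = 2 * k := by
        rcases he with rfl | rfl <;> rcases hf with rfl | rfl
        exacts [⟨1, rfl⟩, ⟨0, rfl⟩, ⟨0, rfl⟩, ⟨-1, rfl⟩]
      obtain ⟨l, hl⟩ : ∃ l : ℤ, f - e = 2 * l := ⟨k - e, by linarith⟩
      have hk' : (e : ℝ) + f = 2 * k := by exact_mod_cast hk
      have hl' : (f : ℝ) - e = 2 * l := by exact_mod_cast hl
      constructor
      · rintro ⟨n, e1, e2⟩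
        rcases npow_cases n with h | h
        · exact ⟨n, l, e1, by rw [h.2] at e2 ⊢; linarith⟩
        · exact ⟨n, k, e1, by rw [h.2] at e2 ⊢; linarith⟩
      · rintro ⟨n, m, e1, e2⟩
        rcases npow_cases n with h | h
        · have e3 : y' - 2 * f = (y - 2 * e) + 4 * (m - l : ℤ) := by
            rw [h.2] at e2; push_cast; linarith
          have := small_int he1 hf1 e3
          exact ⟨n, e1, by rw [h.2, e3, this]; simp⟩
        · have e3 : y' - 2 * f = -(y - 2 * e) + 4 * (m - k : ℤ) := by
            rw [h.2] at e2; push_cast; linarith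
          have := small_int (by rwa [abs_neg]) hf1 e3
          exact ⟨n, e1, by rw [h.2, e3, this]; simp⟩
  have hs0 : ∀ a, ∃ x y, |y| ≤ 2 ∧ P (x, y) = a := by
    intro a
    rcases (hU ▸ mem_univ a : a ∈ A₁ ∪ A₂) with h | h
    · obtain ⟨x, y, hy, e⟩ := h₁.2.2.1 a h
      exact ⟨x, y, by linarith, by rw [hP1 _ _ hy, e]⟩
    · obtain ⟨x, y, hy, e⟩ := hQ.2.2.1 a h
      rw [abs_le] at hy
      rcases le_total y 0 with h0 | h0
      · refine ⟨x, y + 2, by rw [abs_le]; constructor <;> linarith, ?_⟩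
        rw [hPp _ _ (by linarith), add_sub_cancel_right, e]
      · refine ⟨x, y - 2, by rw [abs_le]; constructor <;> linarith, ?_⟩
        rw [hPm _ _ (by linarith), sub_add_cancel, e]
  refine ⟨P, hPc, ?_, hrule⟩
  intro a
  obtain ⟨x, y, hy, e⟩ := hs0 a
  refine ⟨Int.fract x, (-1 : ℝ) ^ (-⌊x⌋) * y, Int.fract_nonneg x, Int.fract_lt_one x, by rwa [npow_abs], ?_⟩
  rw [← e, eq_comm, hrule _ _ _ _ (by linarith) (by rw [npow_abs]; linarith)]
  exact ⟨-⌊x⌋, 0, by rw [Int.fract]; push_cast; ring, by simp⟩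

theorem klein_param (K : Type) [TopologicalSpace K] [T2Space K] (hK : LocPlane K)
    (h : IsConnSum2 K (RP 2) (RP 2)) : ∃ P : ℝ × ℝ → K, KleinP P := by
  obtain ⟨B₁, B₂, A₁, A₂, ⟨e₁⟩, ⟨e₂⟩, c₁, c₂, hU, hF1, hF2, -, ⟨ψ₁⟩, ⟨ψ₂⟩⟩ := h
  obtain ⟨P₁, h₁⟩ := half_param hK c₁ e₁ ψ₁
  obtain ⟨P₂, h₂⟩ := half_param hK c₂ e₂ ψ₂
  exact klein_glue c₁ c₂ hU hF1 hF2 h₁ h₂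
end

section
open Set Topology unitInterval

theorem coordLines_one (z : R2) : z ∈ coordLines 1 ↔ z 0 = 0 := by
  simp only [coordLines, mem_ofPred_eq, Fin.exists_fin_two]
  simp

theorem coordLines_two (z : R2) : z ∈ coordLines 2 ↔ z 0 = 0 ∨ z 1 = 0 := by
  simp only [coordLines, mem_ofPred_eq, Fin.exists_fin_two]
  simp

/-- plane identification -/
noncomputable def r2c : R2 ≃ₜ ℂ where
  toFun z := ⟨z 0, z 1⟩
  invFun c := ![c.re, c.im]
  left_inv z := by ext i; fin_cases i <;> rfl
  right_inv c := rfl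
  continuous_toFun := by
    have : (fun z : R2 => (⟨z 0, z 1⟩ : ℂ)) = fun z : R2 => (z 0 : ℂ) + z 1 * Complex.I := by
      ext z; exact (Complex.mk_eq_add_mul_I _ _)
    rw [this]; fun_prop
  continuous_invFun := by
    refine continuous_pi fun i => ?_
    fin_cases i
    · exact Complex.continuous_re
    · exact Complex.continuous_im

theorem LocPlane.emb2 {S : Type} [TopologicalSpace S] (hS : LocPlane S) {j : R2 → S} (hc : Continuous j)
    (hi : Function.Injective j) : IsOpenEmbedding j := by
  have h := hS.openEmbedding (hc.comp r2c.symm.continuous) (hi.comp r2c.symm.injective)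
  have := h.comp r2c.isOpenEmbedding
  convert this using 1
  ext z; simp

theorem strands_of_emb {S : Type} [TopologicalSpace S] (hS : LocPlane S) {j : R2 → S} (hc : Continuous j)
    (hi : Function.Injective j) {G : Set S} {k : ℕ} (hG : ∀ z, j z ∈ G ↔ z ∈ coordLines k) {x : S} (hx : j 0 = x) :
    LocalStrands S G k x := by
  have hj := hS.emb2 hc hi
  refine ⟨range j, hj.isOpen_range, ⟨0, hx⟩, hj.isEmbedding.toHomeomorph.symm, ?_, ?_⟩
  · rw [Homeomorph.symm_apply_eq]
    exact Subtype.ext hx.symm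
  · ext ⟨y, z, rfl⟩
    have : hj.isEmbedding.toHomeomorph.symm ⟨j z, z, rfl⟩ = z := by
      rw [Homeomorph.symm_apply_eq]; rfl
    simp only [mem_preimage, this, hG]

theorem emb_of_strands {S : Type} [TopologicalSpace S] {G : Set S} {k : ℕ} {x : S} (h : LocalStrands S G k x) :
    ∃ j : R2 → S, IsOpenEmbedding j ∧ j 0 = x ∧ ∀ z, j z ∈ G ↔ z ∈ coordLines k := by
  obtain ⟨U, hU, hx, φ, h0, hG⟩ := h
  refine ⟨fun z => (φ.symm z).1, hU.isOpenEmbedding_subtypeVal.comp φ.symm.isOpenEmbedding, ?_, ?_⟩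
  · simp only; rw [← h0, φ.symm_apply_apply]
  · intro z
    have : φ.symm z ∈ (Subtype.val ⁻¹' G : Set U) ↔ φ.symm z ∈ ⇑φ ⁻¹' coordLines k := by rw [hG]
    simpa using this

theorem arms_pos {f g : ℝ → ℝ} {e : ℝ} (he : 0 < e) (hf : ContinuousOn f (Icc 0 e)) (hg : ContinuousOn g (Icc 0 e))
    (f0 : f 0 = 0) (g0 : g 0 = 0) (hfe : 0 < f e) (hge : 0 < g e) : ∃ s ∈ Ioc 0 e, ∃ t ∈ Ioc 0 e, f s = g t := by
  rcases le_total (f e) (g e) with h | h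
  · have := intermediate_value_Ioc he.le hg
    obtain ⟨t, ht, ht2⟩ := this (show f e ∈ _ from ⟨by rwa [g0], h⟩)
    exact ⟨e, ⟨he, le_rfl⟩, t, ht, ht2.symm⟩
  · have := intermediate_value_Ioc he.le hf
    obtain ⟨t, ht, ht2⟩ := this (show g e ∈ _ from ⟨by rwa [f0], h⟩)
    exact ⟨t, ht, e, ⟨he, le_rfl⟩, ht2⟩

theorem arms {f g : ℝ → ℝ} {e : ℝ} (he : 0 < e) (hf : ContinuousOn f (Icc 0 e)) (hg : ContinuousOn g (Icc 0 e))
    (f0 : f 0 = 0) (g0 : g 0 = 0) (h : 0 < f e * g e) : ∃ s ∈ Ioc 0 e, ∃ t ∈ Ioc 0 e, f s = g t := by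
  rcases pos_and_pos_or_neg_and_neg_of_mul_pos h with h | h
  · exact arms_pos he hf hg f0 g0 h.1 h.2
  · obtain ⟨s, hs, t, ht, e⟩ := arms_pos he hf.neg hg.neg (by simp [f0]) (by simp [g0]) (by simpa using h.1) (by simpa using h.2)
    exact ⟨s, hs, t, ht, by simpa using e⟩

theorem strands_incompat {S : Type} [TopologicalSpace S] {G : Set S} {x : S} (h1 : LocalStrands S G 1 x)
    (h2 : LocalStrands S G 2 x) : False := by
  obtain ⟨j, hj, hj0, hjG⟩ := emb_of_strands h1
  obtain ⟨k, hk, hk0, hkG⟩ := emb_of_strands h2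
  have hop : IsOpen (k ⁻¹' range j) := hj.isOpen_range.preimage hk.continuous
  have hm : (0 : R2) ∈ k ⁻¹' range j := ⟨0, by rw [hj0, hk0]⟩
  obtain ⟨e, he, hes⟩ := Metric.isOpen_iff.1 hop 0 hm
  have hem := hj.isEmbedding.toHomeomorph
  -- coordinate on the line
  obtain ⟨L, hLc, hL⟩ : ∃ L : S → R2, ContinuousOn L (range j) ∧ ∀ z, L (j z) = z := by
    refine ⟨Function.invFun j, ?_, Function.leftInverse_invFun hj.injective⟩
    rw [continuousOn_iff_continuous_domRestrict]
    have : (range j).domRestrict (Function.invFun j) = hj.isEmbedding.toHomeomorph.symm := by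
      ext1 ⟨y, z, rfl⟩
      have e1 : hj.isEmbedding.toHomeomorph.symm ⟨j z, z, rfl⟩ = z := by
        rw [Homeomorph.symm_apply_eq]; rfl
      rw [e1]
      exact Function.leftInverse_invFun hj.injective z
    rw [this]; exact Homeomorph.continuous _
  have hinj : ∀ z w : R2, z ∈ Metric.ball 0 e → w ∈ Metric.ball 0 e → z ∈ coordLines 2 → w ∈ coordLines 2 →
      L (k z) 1 = L (k w) 1 → z = w := by
    intro z w hz hw hz2 hw2 h
    obtain ⟨a, ha⟩ := hes hz
    obtain ⟨b, hb⟩ := hes hw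
    have a0 : a 0 = 0 := by rw [← coordLines_one, ← hjG, ha, hkG]; exact hz2
    have b0 : b 0 = 0 := by rw [← coordLines_one, ← hjG, hb, hkG]; exact hw2
    rw [← ha, ← hb, hL, hL] at h
    have : a = b := by ext i; fin_cases i; exacts [a0.trans b0.symm, h]
    apply hk.injective
    rw [← ha, ← hb, this]
  have hcont : ∀ γ : ℝ → R2, Continuous γ → (∀ t ∈ Icc (0 : ℝ) (e / 2), γ t ∈ Metric.ball (0 : R2) e) →
      ContinuousOn (fun t => L (k (γ t)) 1) (Icc 0 (e / 2)) := by
    intro γ hγ hγe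
    exact (continuous_apply 1).comp_continuousOn
      (hLc.comp (hk.continuous.comp hγ).continuousOn fun t ht => hes (hγe t ht))
  set γ : Fin 3 → ℝ → R2 := ![fun t => ![t, 0], fun t => ![-t, 0], fun t => ![0, t]] with hγ
  have hγc : ∀ i, Continuous (γ i) := by
    intro i; fin_cases i <;> (refine continuous_pi fun l => ?_; fin_cases l <;> simp [hγ] <;> fun_prop)
  have hγb : ∀ i, ∀ t ∈ Icc (0 : ℝ) (e / 2), γ i t ∈ Metric.ball (0 : R2) e := by
    intro i t ht
    rw [mem_ball_zero_iff, pi_norm_lt_iff he]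
    intro l
    have : |t| < e := by rw [abs_of_nonneg ht.1]; linarith [ht.2]
    fin_cases i <;> fin_cases l <;> simp [hγ, he, this]
  have hγ2 : ∀ i t, γ i t ∈ coordLines 2 := by
    intro i t
    rw [coordLines_two]
    fin_cases i <;> simp [hγ]
  have hγ0 : ∀ i, γ i 0 = 0 := by
    intro i; ext l; fin_cases i <;> fin_cases l <;> simp [hγ]
  have hγi : ∀ i l, i ≠ l → ∀ s t, 0 < s → 0 < t → γ i s ≠ γ l t := by
    intro i l hil s t hs ht h
    have h0 := congrFun h 0
    have h1 := congrFun h 1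
    fin_cases i <;> fin_cases l <;> simp [hγ] at h0 h1 hil <;> linarith
  have hγne : ∀ i t, 0 < t → γ i t ≠ 0 := by
    intro i t ht h
    have h0 := congrFun h 0
    have h1 := congrFun h 1
    fin_cases i <;> simp [hγ] at h0 h1 <;> linarith
  set F : Fin 3 → ℝ → ℝ := fun i t => L (k (γ i t)) 1 with hF
  have hF0 : ∀ i, F i 0 = 0 := by
    intro i; simp only [hF]; rw [hγ0, hk0, ← hj0, hL]; rfl
  have he2 : 0 < e / 2 := by linarith
  have hFe : ∀ i, F i (e / 2) ≠ 0 := by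
    intro i h
    rw [← hF0 i] at h
    have := hinj _ _ (hγb i _ ⟨he2.le, le_rfl⟩) (hγb i 0 ⟨le_rfl, he2.le⟩) (hγ2 _ _) (hγ2 _ _) h
    rw [hγ0] at this
    exact hγne i _ he2 this
  have hpair : ∀ i l, i ≠ l → ¬ (0 < F i (e / 2) * F l (e / 2)) := by
    intro i l hil hpos
    obtain ⟨s, hs, t, ht, h⟩ := arms he2 (hcont _ (hγc i) (hγb i)) (hcont _ (hγc l) (hγb l)) (hF0 i) (hF0 l) hpos
    have := hinj _ _ (hγb i s ⟨hs.1.le, hs.2⟩) (hγb l t ⟨ht.1.le, ht.2⟩) (hγ2 _ _) (hγ2 _ _) h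
    exact hγi i l hil s t hs.1 ht.1 this
  have p01 := hpair 0 1 (by decide)
  have p02 := hpair 0 2 (by decide)
  have p12 := hpair 1 2 (by decide)
  have n0 := hFe 0
  have n1 := hFe 1
  have n2 := hFe 2
  generalize F 0 (e / 2) = a at *
  generalize F 1 (e / 2) = b at *
  generalize F 2 (e / 2) = c at *
  rcases lt_or_gt_of_ne n0 with n0 | n0 <;> rcases lt_or_gt_of_ne n1 with n1 | n1 <;>
    rcases lt_or_gt_of_ne n2 with n2 | n2 <;> first
    | exact p01 (mul_pos n0 n1)
    | exact p01 (mul_pos_of_neg_of_neg n0 n1)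
    | exact p02 (mul_pos n0 n2)
    | exact p02 (mul_pos_of_neg_of_neg n0 n2)
    | exact p12 (mul_pos n1 n2)
    | exact p12 (mul_pos_of_neg_of_neg n1 n2)

theorem strands_nearby {S : Type} [TopologicalSpace S] (hS : LocPlane S) {G : Set S} {k : ℕ} (hk1 : 1 ≤ k) (hk2 : k ≤ 2)
    {j : R2 → S} (hj : IsOpenEmbedding j) (hG : ∀ z, j z ∈ G ↔ z ∈ coordLines k) {z : R2} (hz : z ∈ coordLines k)
    (hz0 : z ≠ 0) : LocalStrands S G 1 (j z) := by
  have hk : ∀ w : R2, w ∈ coordLines k ↔ w 0 = 0 ∨ (k = 2 ∧ w 1 = 0) := by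
    intro w
    rcases (show k = 1 ∨ k = 2 by omega) with rfl | rfl
    · rw [coordLines_one]; simp
    · rw [coordLines_two]; simp
  by_cases h0 : z 0 = 0
  · have h1 : z 1 ≠ 0 := fun h => hz0 (by ext i; fin_cases i; exacts [h0, h])
    have hcts : Continuous (fun w : R2 => (![w 0, z 1 * Real.exp (w 1)] : R2)) := by
      refine continuous_pi fun i => ?_
      fin_cases i <;> simp <;> fun_prop
    refine strands_of_emb hS (j := fun w => j ![w 0, z 1 * Real.exp (w 1)]) (hj.continuous.comp hcts) ?_ ?_ ?_
    · intro a b h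
      have h := hj.injective h
      have e0 := congrFun h 0
      have e1 := congrFun h 1
      simp [h1] at e0 e1
      ext i; fin_cases i; exacts [e0, e1]
    · intro w
      rw [hG, hk, coordLines_one]
      simp [h1]
    · congr 1; ext i; fin_cases i <;> simp [h0]
  · have hh := (hk z).1 hz
    have h1 : z 1 = 0 := by tauto
    have hk2 : k = 2 := by tauto
    have hcts : Continuous (fun w : R2 => (![z 0 * Real.exp (w 1), w 0] : R2)) := by
      refine continuous_pi fun i => ?_
      fin_cases i <;> simp <;> fun_prop
    refine strands_of_emb hS (j := fun w => j ![z 0 * Real.exp (w 1), w 0]) (hj.continuous.comp hcts) ?_ ?_ ?_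
    · intro a b h
      have h := hj.injective h
      have e0 := congrFun h 0
      have e1 := congrFun h 1
      simp [h0] at e0 e1
      ext i; fin_cases i; exacts [e1, e0]
    · intro w
      rw [hG, hk, coordLines_one]
      simp [h0, hk2]
    · congr 1; ext i; fin_cases i <;> simp [h1]

/-- Crossing points are isolated: a compact surface has either no crossing or finitely many. -/
theorem crossings_finite {S : Type} [TopologicalSpace S] [CompactSpace S] (hS : LocPlane S) {G : Set S}
    (hG : IsDehnLoop S G) : (crossingPoints S G).Finite := by
  by_contra hinf
  obtain ⟨x, hx⟩ := Set.Infinite.exists_accPt_principal hinf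
  have hxG : x ∈ G := by
    have : x ∈ closure (crossingPoints S G) := hx.clusterPt.mem_closure
    exact closure_minimal (fun y hy => hy.1) hG.1 this
  obtain ⟨k, hk1, hk2, hk⟩ := hG.2.2 x hxG
  obtain ⟨j, hj, hj0, hjG⟩ := emb_of_strands hk
  rw [accPt_iff_nhds] at hx
  obtain ⟨y, ⟨⟨z, rfl⟩, hy⟩, hyx⟩ := hx (range j) (hj.isOpen_range.mem_nhds ⟨0, hj0⟩)
  refine strands_incompat (strands_nearby hS hk1 hk2 hj hjG ((hjG z).1 hy.1) ?_) hy.2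
  rintro rfl
  exact hyx hj0

theorem comps_of_disc {S : Type} [TopologicalSpace S] {G : Set S} {j : R2 → S} (hj : IsOpenEmbedding j)
    (hr : range j = Gᶜ) : ComponentsHomeo S Gᶜ R2 := by
  intro x hx
  have h1 : IsPreconnected (Gᶜ : Set S) := by
    rw [← hr]; exact isPreconnected_range hj.continuous
  have h2 : connectedComponentIn Gᶜ x = range j := by rw [h1.connectedComponentIn hx, hr]
  exact ⟨(Homeomorph.setCongr h2).trans hj.isEmbedding.toHomeomorph.symm⟩
end

section
open Set Topology unitInterval

/-- A squeeze of the line onto the interval of radius one half. -/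
noncomputable def sqz (t : ℝ) : ℝ := Real.arctan t / Real.pi

theorem sqz_cont : Continuous sqz := Real.continuous_arctan.div_const _

theorem sqz_zero : sqz 0 = 0 := by simp [sqz]

theorem sqz_inj {s t : ℝ} : sqz s = sqz t ↔ s = t := by
  unfold sqz
  rw [div_left_inj' Real.pi_ne_zero]
  exact Real.arctan_injective.eq_iff

theorem sqz_eq_zero {t : ℝ} : sqz t = 0 ↔ t = 0 := by
  have := sqz_inj (s := t) (t := 0)
  rwa [sqz_zero] at this

theorem sqz_lt (t : ℝ) : |sqz t| < 1 / 2 := by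
  have h1 := Real.arctan_lt_pi_div_two t
  have h2 := Real.neg_pi_div_two_lt_arctan t
  have := Real.pi_pos
  unfold sqz
  rw [abs_lt, lt_div_iff₀ this, div_lt_iff₀ this]
  constructor <;> linarith

theorem sqz_surj {x : ℝ} (hx : |x| < 1 / 2) : ∃ t, sqz t = x := by
  rw [abs_lt] at hx
  have := Real.pi_pos
  refine ⟨Real.tan (x * Real.pi), ?_⟩
  unfold sqz
  rw [Real.arctan_tan (by nlinarith) (by nlinarith)]
  field_simp

theorem lc_RP2 : lc (RP 2) = 0 := by
  have hopen : IsOpenEmbedding (fun z : R2 => aff (r2c z)) := aff_openEmb.comp r2c.isOpenEmbedding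
  have hr : range (fun z : R2 => aff (r2c z)) = ((range aff)ᶜ)ᶜ := by
    rw [compl_compl]
    exact r2c.surjective.range_comp aff
  have hmem : ∀ x y, mobp (x, y) ∈ (range aff)ᶜ ↔ y = 0 := by
    intro x y
    rw [← not_iff_not, mem_compl_iff, not_not]
    constructor
    · rintro ⟨z, hz⟩
      rw [mobp, eq_comm, aff_eq (mobp_ne _ _)] at hz
      exact hz.1
    · intro hy
      exact ⟨_, ((aff_eq (mobp_ne y (x * Real.pi))).2 ⟨hy, rfl⟩).symm⟩
  have hstr : ∀ p ∈ (range aff)ᶜ, LocalStrands (RP 2) (range aff)ᶜ 1 p := by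
    intro p hp
    obtain ⟨⟨x, y⟩, rfl⟩ := mobp_surj (p := p) (by rintro rfl; exact hp ⟨0, rfl⟩)
    have hy := (hmem x y).1 hp
    subst hy
    have hs := sqz_cont
    refine strands_of_emb RP_locPlane (j := fun w => mobp (x + sqz (w 1), w 0)) (mobp_cont.comp (by fun_prop)) ?_ ?_ ?_
    · intro a b h
      rw [mobp_eq] at h
      obtain ⟨n, e1, e2⟩ := h
      have h1 := abs_lt.1 (sqz_lt (a 1))
      have h2 := abs_lt.1 (sqz_lt (b 1))
      have a1 : (n : ℝ) < 1 := by linarith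
      have a2 : (-1 : ℝ) < n := by linarith
      have a1 : n < 1 := by exact_mod_cast a1
      have a2 : -1 < n := by exact_mod_cast a2
      have : n = 0 := by omega
      subst this
      simp at e1 e2
      rw [sqz_inj] at e1
      ext i; fin_cases i; exacts [e2.symm, e1.symm]
    · intro z; rw [hmem, coordLines_one]
    · simp [sqz_zero]
  have h0 : (0 : ℕ) ∈ {n | ∃ G : Set (RP 2), QuasiFillingLoop (RP 2) G ∧ (crossingPoints (RP 2) G).ncard = n} := by
    refine ⟨(range aff)ᶜ, ⟨⟨?_, ?_, fun p hp => ⟨1, le_rfl, by norm_num, hstr p hp⟩⟩, comps_of_disc hopen hr⟩, ?_⟩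
    · exact aff_openEmb.isOpen_range.isClosed_compl
    · exact ⟨mobp (0, 0), (hmem 0 0).2 rfl⟩
    · rw [show crossingPoints (RP 2) (range aff)ᶜ = ∅ from ?_, ncard_empty]
      ext p
      simp only [mem_empty_iff_false, iff_false]
      rintro ⟨h1, h2⟩
      exact strands_incompat (hstr p h1) h2
  exact Nat.sInf_eq_zero.2 (Or.inl h0)

theorem klein_inj {K : Type} [TopologicalSpace K] {P : ℝ × ℝ → K} (hP : KleinP P) {x y x' y' : ℝ}
    (hy : |y| ≤ 3) (hy' : |y'| ≤ 3) (h1 : |x' - x| < 1) (h2 : |y' - y| < 4) (h : P (x, y) = P (x', y')) :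
    x = x' ∧ y = y' := by
  rw [hP.2.2 _ _ _ _ hy hy'] at h
  obtain ⟨n, m, e1, e2⟩ := h
  rw [abs_lt] at h1 h2
  have a1 : (n : ℝ) < 1 := by linarith
  have a2 : (-1 : ℝ) < n := by linarith
  have a1 : n < 1 := by exact_mod_cast a1
  have a2 : -1 < n := by exact_mod_cast a2
  have : n = 0 := by omega
  subst this
  simp at e1 e2
  have a1 : (m : ℝ) < 1 := by linarith
  have a2 : (-1 : ℝ) < m := by linarith
  have a1 : m < 1 := by exact_mod_cast a1
  have a2 : -1 < m := by exact_mod_cast a2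
  have : m = 0 := by omega
  subst this
  simp at e2
  exact ⟨e1.symm, e2.symm⟩

theorem abs_two_of {w : ℝ} {m : ℤ} (hw : |w| ≤ 3) (h : |w + 4 * m| = 2) : |w| = 2 := by
  rw [abs_le] at hw
  have hb : ∀ k : ℤ, w = 2 * (2 * k + 1 : ℤ) → |w| = 2 := by
    intro k hk
    have a1 : ((2 * k + 1 : ℤ) : ℝ) < 2 := by linarith
    have a2 : (-2 : ℝ) < (2 * k + 1 : ℤ) := by linarith
    have a1 : 2 * k + 1 < 2 := by exact_mod_cast a1
    have a2 : -2 < 2 * k + 1 := by exact_mod_cast a2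
    rcases (show k = 0 ∨ k = -1 by omega) with rfl | rfl <;> rw [hk] <;> norm_num
  rcases eq_or_eq_neg_of_abs_eq h with h | h
  · exact hb (-m) (by push_cast; linarith)
  · exact hb (-m - 1) (by push_cast; linarith)

theorem klein_upper {K : Type} [TopologicalSpace K] [T2Space K] (hK : LocPlane K) {P : ℝ × ℝ → K} (hP : KleinP P) :
    ∃ G : Set K, QuasiFillingLoop K G ∧ (crossingPoints K G).ncard = 1 := by
  have hPc := hP.1
  have hs := sqz_cont
  set G : Set K := {k | ∃ x y, |y| ≤ 3 ∧ P (x, y) = k ∧ ((∃ n : ℤ, x = n) ∨ |y| = 2)} with hG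
  have hmem : ∀ x y, |y| ≤ 3 → (P (x, y) ∈ G ↔ ((∃ n : ℤ, x = n) ∨ |y| = 2)) := by
    intro x y hy
    constructor
    · rintro ⟨x', y', hy', e, h⟩
      rw [eq_comm, hP.2.2 _ _ _ _ hy hy'] at e
      obtain ⟨n, m, e1, e2⟩ := e
      rcases h with ⟨l, rfl⟩ | h
      · exact Or.inl ⟨l - n, by push_cast; linarith⟩
      · refine Or.inr ?_
        rw [← npow_abs n]
        exact abs_two_of (m := m) (by rwa [npow_abs]) (by rw [← e2, h])
    · intro h; exact ⟨x, y, hy, rfl, h⟩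
  have hclosed : IsClosed G := by
    have : G = P '' ((Icc 0 1 ×ˢ Icc (-2) 2) ∩ {q | q.1 = 0 ∨ |q.2| = 2}) := by
      ext k
      constructor
      · intro hk
        obtain ⟨x, y, h0, h1, h2, rfl⟩ := hP.2.1 k
        rw [hmem _ _ (by linarith)] at hk
        refine ⟨(x, y), ⟨⟨⟨h0, h1.le⟩, abs_le.1 h2⟩, ?_⟩, rfl⟩
        rcases hk with ⟨n, rfl⟩ | h
        · left
          have a1 : n < 1 := by exact_mod_cast h1
          have a2 : 0 ≤ n := by exact_mod_cast h0
          have : n = 0 := by omega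
          simp [this]
        · exact Or.inr h
      · rintro ⟨⟨x, y⟩, ⟨⟨h1, h2⟩, h3⟩, rfl⟩
        rw [hmem _ _ (by linarith [abs_le.2 h2])]
        rcases h3 with h3 | h3
        · exact Or.inl ⟨0, by simpa using h3⟩
        · exact Or.inr h3
    rw [this]
    refine ((((isCompact_Icc).prod isCompact_Icc).inter_right ?_).image hPc).isClosed
    exact (isClosed_eq continuous_fst continuous_const).union (isClosed_eq (by fun_prop) continuous_const)
  have hintr : ∀ (n : ℤ) (x : ℝ), |x| < 1 → x = n → x = 0 := by
    rintro n x h rfl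
    rw [abs_lt] at h
    have a1 : n < 1 := by exact_mod_cast h.2
    have a2 : -1 < n := by exact_mod_cast h.1
    have : n = 0 := by omega
    simp [this]
  have hst2 : ∀ y : ℝ, |y| = 2 → LocalStrands K G 2 (P (0, y)) := by
    intro y hy
    have hb : ∀ t, |y + sqz t| ≤ 3 := by
      intro t
      have := sqz_lt t
      have := abs_add_le y (sqz t)
      linarith
    refine strands_of_emb hK (j := fun w => P (sqz (w 0), y + sqz (w 1))) (hPc.comp (by fun_prop)) ?_ ?_ ?_
    · intro a b h
      have a0 := abs_lt.1 (sqz_lt (a 0))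
      have a1 := abs_lt.1 (sqz_lt (a 1))
      have b0 := abs_lt.1 (sqz_lt (b 0))
      have b1 := abs_lt.1 (sqz_lt (b 1))
      obtain ⟨e0, e1⟩ := klein_inj hP (hb _) (hb _) (abs_lt.2 ⟨by linarith, by linarith⟩)
        (abs_lt.2 ⟨by linarith, by linarith⟩) h
      rw [add_right_inj] at e1
      rw [sqz_inj] at e0 e1
      ext i; fin_cases i; exacts [e0, e1]
    · intro z
      rw [hmem _ _ (hb _), coordLines_two]
      refine or_congr ?_ ?_
      · constructor
        · rintro ⟨n, hn⟩
          exact sqz_eq_zero.1 (hintr n _ (by linarith [sqz_lt (z 0)]) hn)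
        · intro h; exact ⟨0, by rw [h, sqz_zero]; simp⟩
      · have a1 := abs_lt.1 (sqz_lt (z 1))
        rw [← sqz_eq_zero]
        constructor
        · intro h
          rcases eq_or_eq_neg_of_abs_eq hy with e | e <;> rcases eq_or_eq_neg_of_abs_eq h with e' | e' <;> linarith
        · intro h; rw [h, add_zero, hy]
    · simp [sqz_zero]
  have hst1a : ∀ y : ℝ, |y| < 2 → LocalStrands K G 1 (P (0, y)) := by
    intro y hy
    set d := 2 - |y| with hd
    have hd0 : 0 < d := by linarith
    have hb : ∀ t, |y + d * sqz t| < 2 := by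
      intro t
      have h1 := sqz_lt t
      have h2 := abs_add_le y (d * sqz t)
      rw [abs_mul, abs_of_pos hd0] at h2
      nlinarith
    refine strands_of_emb hK (j := fun w => P (sqz (w 0), y + d * sqz (w 1))) (hPc.comp (by fun_prop)) ?_ ?_ ?_
    · intro a b h
      have a0 := abs_lt.1 (sqz_lt (a 0))
      have a1 := abs_lt.1 (hb (a 1))
      have b0 := abs_lt.1 (sqz_lt (b 0))
      have b1 := abs_lt.1 (hb (b 1))
      obtain ⟨e0, e1⟩ := klein_inj hP (by linarith [hb (a 1)]) (by linarith [hb (b 1)]) (abs_lt.2 ⟨by linarith, by linarith⟩)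
        (abs_lt.2 ⟨by linarith, by linarith⟩) h
      rw [add_right_inj, mul_right_inj' hd0.ne'] at e1
      rw [sqz_inj] at e0 e1
      ext i; fin_cases i; exacts [e0, e1]
    · intro z
      rw [hmem _ _ (by linarith [hb (z 1)]), coordLines_one]
      constructor
      · rintro (⟨n, hn⟩ | h)
        · exact sqz_eq_zero.1 (hintr n _ (by linarith [sqz_lt (z 0)]) hn)
        · linarith [hb (z 1)]
      · intro h; exact Or.inl ⟨0, by rw [h, sqz_zero]; simp⟩
    · simp [sqz_zero]
  have hst1b : ∀ x y : ℝ, 0 < x → x < 1 → |y| = 2 → LocalStrands K G 1 (P (x, y)) := by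
    intro x y hx0 hx1 hy
    obtain ⟨d, hd0, hdx, hdx'⟩ : ∃ d : ℝ, 0 < d ∧ d ≤ x ∧ d ≤ 1 - x :=
      ⟨min x (1 - x), lt_min hx0 (by linarith), min_le_left _ _, min_le_right _ _⟩
    have hb : ∀ t, |y + sqz t| ≤ 3 := by
      intro t
      have := sqz_lt t
      have := abs_add_le y (sqz t)
      linarith
    have hc : ∀ t, 0 < x + d * sqz t ∧ x + d * sqz t < 1 := by
      intro t
      have h := abs_lt.1 (sqz_lt t)
      constructor <;> nlinarith
    refine strands_of_emb hK (j := fun w => P (x + d * sqz (w 1), y + sqz (w 0))) (hPc.comp (by fun_prop)) ?_ ?_ ?_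
    · intro a b h
      have a0 := abs_lt.1 (sqz_lt (a 0))
      have a1 := hc (a 1)
      have b0 := abs_lt.1 (sqz_lt (b 0))
      have b1 := hc (b 1)
      obtain ⟨e0, e1⟩ := klein_inj hP (hb _) (hb _) (abs_lt.2 ⟨by linarith, by linarith⟩)
        (abs_lt.2 ⟨by linarith, by linarith⟩) h
      rw [add_right_inj, mul_right_inj' hd0.ne'] at e0
      rw [add_right_inj] at e1
      rw [sqz_inj] at e0 e1
      ext i; fin_cases i; exacts [e1, e0]
    · intro z
      rw [hmem _ _ (hb _), coordLines_one]
      have a1 := abs_lt.1 (sqz_lt (z 0))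
      rw [← sqz_eq_zero]
      constructor
      · rintro (⟨n, hn⟩ | h)
        · have := hc (z 1)
          have := hintr n _ (abs_lt.2 ⟨by linarith, by linarith⟩) hn
          linarith
        · rcases eq_or_eq_neg_of_abs_eq hy with e | e <;> rcases eq_or_eq_neg_of_abs_eq h with e' | e' <;> linarith
      · intro h; right; rw [h, add_zero, hy]
    · simp [sqz_zero]
  have hv : P (0, -2) = P (0, 2) := by
    rw [hP.2.2 _ _ _ _ (by norm_num) (by norm_num)]
    exact ⟨0, 1, by simp, by norm_num⟩
  have hall : ∀ k ∈ G, LocalStrands K G 1 k ∨ k = P (0, 2) := by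
    intro k hk
    obtain ⟨x, y, h0, h1, h2, rfl⟩ := hP.2.1 k
    rw [hmem _ _ (by linarith)] at hk
    rcases eq_or_lt_of_le h0 with rfl | h0
    · rcases eq_or_lt_of_le h2 with h2 | h2
      · right
        rcases eq_or_eq_neg_of_abs_eq h2 with rfl | rfl
        · rfl
        · exact hv
      · left; exact hst1a y h2
    · left
      refine hst1b x y h0 h1 ?_
      rcases hk with ⟨n, hn⟩ | h
      · have := hintr n x (abs_lt.2 ⟨by linarith, by linarith⟩) hn
        linarith
      · exact h
  have h2v : LocalStrands K G 2 (P (0, 2)) := hst2 2 (by norm_num)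
  have hvG : P (0, 2) ∈ G := (hmem 0 2 (by norm_num)).2 (Or.inl ⟨0, by simp⟩)
  refine ⟨G, ⟨⟨hclosed, ⟨_, hvG⟩, ?_⟩, ?_⟩, ?_⟩
  · intro k hk
    rcases hall k hk with h | rfl
    · exact ⟨1, le_rfl, by norm_num, h⟩
    · exact ⟨2, by norm_num, le_rfl, h2v⟩
  · have hb : ∀ t, |4 * sqz t| < 2 := by
      intro t; have := sqz_lt t; rw [abs_mul]; norm_num; linarith
    refine comps_of_disc (j := fun w => P (1 / 2 + sqz (w 0), 4 * sqz (w 1))) (hK.emb2 (hPc.comp (by fun_prop)) ?_) ?_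
    · intro a b h
      have a0 := abs_lt.1 (sqz_lt (a 0))
      have a1 := abs_lt.1 (hb (a 1))
      have b0 := abs_lt.1 (sqz_lt (b 0))
      have b1 := abs_lt.1 (hb (b 1))
      obtain ⟨e0, e1⟩ := klein_inj hP (by linarith [hb (a 1)]) (by linarith [hb (b 1)]) (abs_lt.2 ⟨by linarith, by linarith⟩)
        (abs_lt.2 ⟨by linarith, by linarith⟩) h
      rw [add_right_inj] at e0
      rw [mul_right_inj' (by norm_num)] at e1
      rw [sqz_inj] at e0 e1
      ext i; fin_cases i; exacts [e0, e1]
    · ext k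
      constructor
      · rintro ⟨w, rfl⟩
        show _ ∉ G
        simp only
        rw [hmem _ _ (by linarith [hb (w 1)])]
        have a0 := abs_lt.1 (sqz_lt (w 0))
        rintro (⟨n, hn⟩ | h)
        · have := hintr n _ (abs_lt.2 ⟨by linarith, by linarith⟩) hn
          linarith
        · linarith [hb (w 1)]
      · intro hk
        obtain ⟨x, y, h0, h1, h2, rfl⟩ := hP.2.1 k
        rw [mem_compl_iff, hmem _ _ (by linarith)] at hk
        push Not at hk
        have hx0 : x ≠ 0 := fun h => hk.1 0 (by simpa using h)
        have hx0 : 0 < x := lt_of_le_of_ne h0 hx0.symm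
        have hy2 := lt_of_le_of_ne h2 hk.2
        obtain ⟨s, hs⟩ := sqz_surj (x := x - 1 / 2) (abs_lt.2 ⟨by linarith, by linarith⟩)
        obtain ⟨t, ht⟩ := sqz_surj (x := y / 4) (by rw [abs_div]; norm_num; linarith)
        refine ⟨![s, t], ?_⟩
        simp only [Matrix.cons_val_zero, Matrix.cons_val_one, hs, ht]
        congr 2 <;> ring
  · rw [show crossingPoints K G = {P (0, 2)} from ?_, ncard_singleton]
    ext k
    rw [mem_singleton_iff]
    constructor
    · rintro ⟨h1, h2⟩
      exact (hall k h1).resolve_left fun h => strands_incompat h h2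
    · rintro rfl
      exact ⟨hvG, h2v⟩
end

section
open Set Topology unitInterval

theorem emb_inv {S : Type} [TopologicalSpace S] {j : R2 → S} (hj : IsEmbedding j) :
    ∃ L : S → R2, ContinuousOn L (range j) ∧ ∀ z, L (j z) = z := by
  refine ⟨Function.invFun j, ?_, Function.leftInverse_invFun hj.injective⟩
  rw [continuousOn_iff_continuous_domRestrict]
  have : (range j).domRestrict (Function.invFun j) = hj.toHomeomorph.symm := by
    ext1 ⟨y, z, rfl⟩
    have e1 : hj.toHomeomorph.symm ⟨j z, z, rfl⟩ = z := by
      rw [Homeomorph.symm_apply_eq]; rfl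
    rw [e1]
    exact Function.leftInverse_invFun hj.injective z
  rw [this]; exact Homeomorph.continuous _

theorem hasLog_range {S : Type} [TopologicalSpace S] {j : R2 → S} (hj : IsEmbedding j) {f : S → ℂ}
    (hf : Continuous f) (h0 : ∀ x, f x ≠ 0) : HasLog f (range j) := by
  obtain ⟨g, hg, hgf⟩ := hasLog_univ (hf.comp hj.continuous) (fun x => h0 (j x))
  obtain ⟨L, hL, hLj⟩ := emb_inv hj
  refine ⟨fun x => g (L x), (continuousOn_univ.1 hg).comp_continuousOn hL, ?_⟩
  rintro _ ⟨z, rfl⟩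
  show Complex.exp (g (L (j z))) = _; rw [hLj]; exact hgf z (mem_univ z)

theorem comp_emb {S : Type} [TopologicalSpace S] (hS : LocPlane S) {G : Set S} (h : ComponentsHomeo S Gᶜ R2)
    {x : S} (hx : x ∈ Gᶜ) : ∃ j : R2 → S, IsOpenEmbedding j ∧ range j = connectedComponentIn Gᶜ x := by
  obtain ⟨φ⟩ := h x hx
  refine ⟨fun z => (φ.symm z).1, hS.emb2 (continuous_subtype_val.comp φ.symm.continuous)
    (Subtype.val_injective.comp φ.symm.injective), ?_⟩
  have := φ.symm.surjective.range_comp (Subtype.val : ↥(connectedComponentIn Gᶜ x) → S)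
  rw [Subtype.range_coe] at this
  exact this

theorem log_off {S : Type} [TopologicalSpace S] (hS : LocPlane S) {G : Set S} (h : ComponentsHomeo S Gᶜ R2)
    {f : S → ℂ} (hf : Continuous f) (h0 : ∀ x, f x ≠ 0) : HasLog f Gᶜ := by
  have hU : ∀ U : Set S, ∃ g : S → ℂ, (∃ x ∈ Gᶜ, U = connectedComponentIn Gᶜ x) → ContinuousOn g U ∧ ∀ y ∈ U, Complex.exp (g y) = f y := by
    intro U
    by_cases hx : ∃ x ∈ Gᶜ, U = connectedComponentIn Gᶜ x
    · obtain ⟨x, hx, rfl⟩ := hx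
      obtain ⟨j, hj, hjr⟩ := comp_emb hS h hx
      obtain ⟨g, hg⟩ := hasLog_range hj.isEmbedding hf h0
      rw [hjr] at hg
      exact ⟨g, fun _ => hg⟩
    · exact ⟨0, fun h => absurd h hx⟩
  choose g hg using hU
  refine ⟨fun y => g (connectedComponentIn Gᶜ y) y, ?_, ?_⟩
  · intro x hx
    refine ContinuousAt.continuousWithinAt ?_
    obtain ⟨j, hj, hjr⟩ := comp_emb hS h hx
    have hop : IsOpen (connectedComponentIn Gᶜ x) := hjr ▸ hj.isOpen_range
    have hm : connectedComponentIn Gᶜ x ∈ 𝓝 x := hop.mem_nhds (mem_connectedComponentIn hx)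
    refine (((hg _ ⟨x, hx, rfl⟩).1).continuousAt hm).congr ?_
    filter_upwards [hm] with y hy
    rw [connectedComponentIn_eq hy]
  · intro x hx
    exact (hg _ ⟨x, hx, rfl⟩).2 x (mem_connectedComponentIn hx)

theorem clusterPt_of_tendsto {α : Type} {l : Filter α} [l.NeBot] {u : α → ℂ} {a : ℂ} (h : Filter.Tendsto u l (𝓝 a)) (v : ℂ) :
    ClusterPt v (Filter.map u l) ↔ v = a := by
  constructor
  · intro hv
    have : ClusterPt v (𝓝 a) := hv.mono h
    exact eq_of_nhds_neBot this
  · rintro rfl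
    exact h.mapClusterPt

theorem half_neBot {w : R2} (hw : w 0 = 0) (e : ℝ) (he : e = 1 ∨ e = -1) : (𝓝[{z : R2 | 0 < e * z 0}] w).NeBot := by
  have h1 : Filter.Tendsto (fun t : ℝ => (![e * t, w 1] : R2)) (𝓝[>] 0) (𝓝[{z : R2 | 0 < e * z 0}] w) := by
    refine tendsto_nhdsWithin_iff.2 ⟨?_, ?_⟩
    · have hc : Continuous (fun t : ℝ => (![e * t, w 1] : R2)) := by
        refine continuous_pi fun i => ?_
        fin_cases i <;> simp <;> fun_prop
      have := hc.tendsto 0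
      have e1 : (![e * 0, w 1] : R2) = w := by ext i; fin_cases i <;> simp [hw]
      rw [e1] at this
      exact this.mono_left nhdsWithin_le_nhds
    · filter_upwards [self_mem_nhdsWithin] with t ht
      have ht : 0 < t := ht
      rcases he with rfl | rfl <;> simp [ht]
  exact h1.neBot

theorem half_convex (e : ℝ) : Convex ℝ {z : R2 | 0 < e * z 0} := by
  intro x hx y hy a b ha hb hab
  simp only [mem_ofPred_eq, Pi.add_apply, Pi.smul_apply, smul_eq_mul] at *
  have : e * (a * x 0 + b * y 0) = a * (e * x 0) + b * (e * y 0) := by ring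
  rw [this]
  rcases eq_or_lt_of_le ha with rfl | ha
  · have : b = 1 := by linarith
    subst this; simpa using hy
  · have := mul_pos ha hx
    have := mul_nonneg hb hy.le
    linarith

/-- local structure at a smooth point -/
theorem local_side {S : Type} [TopologicalSpace S] {G : Set S} {p : S}
    (hp : LocalStrands S G 1 p) {f g : S → ℂ} (hf : Continuous f) (h0 : ∀ x, f x ≠ 0)
    (hg : ContinuousOn g Gᶜ) (hgf : ∀ x ∈ Gᶜ, Complex.exp (g x) = f x) :
    ∃ N : Set S, IsOpen N ∧ p ∈ N ∧ (∃ x₁ ∈ Gᶜ, ∃ x₂ ∈ Gᶜ, N ∩ Gᶜ ⊆ connectedComponentIn Gᶜ x₁ ∪ connectedComponentIn Gᶜ x₂) ∧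
      ∃ m : S → ℂ, ContinuousOn m N ∧ (∀ x ∈ N, Complex.exp (m x) = f x ^ 2) ∧
      ∀ q ∈ N ∩ G, ∃ a b, (∀ v, ClusterPt v (Filter.map g (𝓝[Gᶜ] q)) ↔ v = a ∨ v = b) ∧ m q = a + b := by
  obtain ⟨j, hj, hj0, hjG⟩ := emb_of_strands hp
  obtain ⟨l, hl, hlf⟩ := hasLog_univ (hf.comp hj.continuous) (fun x => h0 (j x))
  have hl := continuousOn_univ.1 hl
  obtain ⟨L, hL, hLj⟩ := emb_inv hj.isEmbedding
  have hjc : ∀ z, j z ∈ Gᶜ ↔ z 0 ≠ 0 := by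
    intro z; rw [mem_compl_iff, hjG, coordLines_one]
  -- one side
  have hside : ∀ e : ℝ, (e = 1 ∨ e = -1) → (∃ x ∈ Gᶜ, ∀ z : R2, 0 < e * z 0 → j z ∈ connectedComponentIn Gᶜ x) ∧
      ∃ c : ℂ, Complex.exp c = 1 ∧ ∀ z : R2, 0 < e * z 0 → g (j z) = l z + c := by
    intro e he
    set H : Set R2 := {z : R2 | 0 < e * z 0} with hH
    have hHG : ∀ z ∈ H, j z ∈ Gᶜ := by
      intro z hz
      rw [hjc]; intro h; simp [hH, h] at hz
    have hHp : IsPreconnected H := (half_convex e).isPreconnected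
    have hz0 : (![e, 0] : R2) ∈ H := by rcases he with rfl | rfl <;> simp [hH]
    refine ⟨⟨j ![e, 0], hHG _ hz0, fun z hz => ?_⟩, ?_⟩
    · have h1 := (hHp.image j hj.continuous.continuousOn).subset_connectedComponentIn (F := Gᶜ)
        (mem_image_of_mem j hz0) (by rintro _ ⟨w, hw, rfl⟩; exact hHG w hw)
      exact h1 (mem_image_of_mem j hz)
    · have hd := fun z (hz : z ∈ H) => log_diff_const (X := H) (g := fun z => g (j z)) (g' := l) hHp
        (hg.comp hj.continuous.continuousOn hHG) hl.continuousOn (fun z hz => by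
          rw [hgf _ (hHG z hz), hlf z (mem_univ z)]; rfl) hz hz0
      refine ⟨g (j ![e, 0]) - l ![e, 0], ?_, fun z hz => ?_⟩
      · rw [Complex.exp_sub, hgf _ (hHG _ hz0), hlf _ (mem_univ _)]
        exact div_self (h0 _)
      · have := hd z hz
        rw [← this]; ring
  obtain ⟨⟨x₁, hx₁, hx₁'⟩, c₁, hc₁, hc₁'⟩ := hside 1 (Or.inl rfl)
  obtain ⟨⟨x₂, hx₂, hx₂'⟩, c₂, hc₂, hc₂'⟩ := hside (-1) (Or.inr rfl)
  refine ⟨range j, hj.isOpen_range, ⟨0, hj0⟩, ⟨x₁, hx₁, x₂, hx₂, ?_⟩, fun x => 2 * l (L x) + c₁ + c₂, ?_, ?_, ?_⟩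
  · rintro _ ⟨⟨z, rfl⟩, hz⟩
    rw [hjc] at hz
    rcases lt_or_gt_of_ne hz with h | h
    · exact Or.inr (hx₂' z (by linarith))
    · exact Or.inl (hx₁' z (by linarith))
  · have := hl.comp_continuousOn hL
    exact ((continuousOn_const.mul this).add continuousOn_const).add continuousOn_const
  · rintro _ ⟨z, rfl⟩
    show Complex.exp (2 * l (L (j z)) + c₁ + c₂) = _
    rw [hLj, Complex.exp_add, Complex.exp_add, hc₁, hc₂, two_mul, Complex.exp_add, hlf z (mem_univ z)]
    simp [sq]
  · rintro _ ⟨⟨z, rfl⟩, hz⟩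
    rw [hjG, coordLines_one] at hz
    refine ⟨l z + c₁, l z + c₂, fun v => ?_, by show 2 * l (L (j z)) + c₁ + c₂ = _; rw [hLj]; ring⟩
    have hpre : j ⁻¹' Gᶜ = {w : R2 | 0 < (1 : ℝ) * w 0} ∪ {w : R2 | 0 < (-1 : ℝ) * w 0} := by
      ext w
      rw [mem_preimage, hjc]
      simp only [mem_union, mem_ofPred_eq, one_mul, neg_mul, Left.neg_pos_iff]
      rw [ne_iff_lt_or_gt]; tauto
    rw [← hj.map_nhdsWithin_preimage_eq, hpre, nhdsWithin_union, Filter.map_map, Filter.map_sup, clusterPt_sup]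
    have hkey : ∀ e c, (e = 1 ∨ e = -1) → (∀ z : R2, 0 < e * z 0 → g (j z) = l z + c) →
        (ClusterPt v (Filter.map (g ∘ j) (𝓝[{w : R2 | 0 < e * w 0}] z)) ↔ v = l z + c) := by
      intro e c he hc
      have := half_neBot hz e he
      refine clusterPt_of_tendsto ?_ v
      have h1 : Filter.Tendsto (fun w => l w + c) (𝓝[{w : R2 | 0 < e * w 0}] z) (𝓝 (l z + c)) :=
        ((hl.tendsto z).mono_left nhdsWithin_le_nhds).add_const c
      refine h1.congr' ?_
      filter_upwards [self_mem_nhdsWithin] with w hw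
      exact (hc w hw).symm
    rw [hkey 1 c₁ (Or.inl rfl) hc₁', hkey (-1) c₂ (Or.inr rfl) hc₂']

theorem pair_sum {a b a' b' : ℂ} (h : ∀ v, (v = a ∨ v = b) ↔ (v = a' ∨ v = b')) : a + b = a' + b' := by
  have h1 := (h a).1 (Or.inl rfl)
  have h2 := (h b).1 (Or.inr rfl)
  have h3 := (h a').2 (Or.inl rfl)
  have h4 := (h b').2 (Or.inr rfl)
  grind

theorem log_sq_on {S : Type} [TopologicalSpace S] {G : Set S}
    (hG : ∀ p ∈ G, LocalStrands S G 1 p) {f g : S → ℂ} (hf : Continuous f) (h0 : ∀ x, f x ≠ 0)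
    (hg : ContinuousOn g Gᶜ) (hgf : ∀ x ∈ Gᶜ, Complex.exp (g x) = f x) : HasLog (fun x => f x ^ 2) G := by
  have hs : ∀ q, ∃ c : ℂ, ∀ a b, (∀ v, ClusterPt v (Filter.map g (𝓝[Gᶜ] q)) ↔ v = a ∨ v = b) → c = a + b := by
    intro q
    by_cases h : ∃ a b, (∀ v, ClusterPt v (Filter.map g (𝓝[Gᶜ] q)) ↔ v = a ∨ v = b)
    · obtain ⟨a, b, hab⟩ := h
      refine ⟨a + b, fun a' b' h' => pair_sum fun v => ?_⟩
      rw [← hab, h']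
    · exact ⟨0, fun a b hab => absurd ⟨a, b, hab⟩ h⟩
  choose s hs using hs
  refine ⟨s, ?_, ?_⟩
  · intro p hp
    obtain ⟨N, hN, hpN, -, m, hm, -, hmq⟩ := local_side (hG p hp) hf h0 hg hgf
    have hN' := hN.mem_nhds hpN
    refine ((hm.continuousAt hN').continuousWithinAt).congr_of_eventuallyEq ?_ ?_
    · filter_upwards [mem_nhdsWithin_of_mem_nhds hN', self_mem_nhdsWithin] with q hq hq'
      obtain ⟨a, b, hab, e⟩ := hmq q ⟨hq, hq'⟩
      rw [e, hs q a b hab]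
    · obtain ⟨a, b, hab, e⟩ := hmq p ⟨hpN, hp⟩
      rw [e, hs p a b hab]
  · intro p hp
    obtain ⟨N, hN, hpN, -, m, hm, hme, hmq⟩ := local_side (hG p hp) hf h0 hg hgf
    obtain ⟨a, b, hab, e⟩ := hmq p ⟨hpN, hp⟩
    rw [hs p a b hab, ← e, hme p hpN]

theorem log_extend {S : Type} [TopologicalSpace S] [NormalSpace S] {G : Set S} (hG : IsClosed G) {f : S → ℂ}
    (hf : Continuous f) (h0 : ∀ x, f x ≠ 0) (h : HasLog f G) : ∃ W, IsOpen W ∧ G ⊆ W ∧ HasLog f W := by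
  obtain ⟨s, hs, hsf⟩ := h
  obtain ⟨F, hF⟩ := ContinuousMap.exists_restrict_eq hG (⟨G.domRestrict s, continuousOn_iff_continuous_domRestrict.1 hs⟩ : C(G, ℂ))
  have hFs : ∀ x ∈ G, F x = s x := fun x hx => congrArg (fun φ : C(G, ℂ) => φ ⟨x, hx⟩) hF
  have hFc : Continuous F := F.continuous
  refine ⟨{x | ‖f x - Complex.exp (F x)‖ < ‖Complex.exp (F x)‖}, ?_, ?_, ?_⟩
  · exact isOpen_lt (by fun_prop) (by fun_prop)
  · intro x hx
    simp [hFs x hx, hsf x hx, h0]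
  · exact hasLog_of_close (f := fun x => Complex.exp (F x)) ⟨F, hFc.continuousOn, fun _ _ => rfl⟩ hf.continuousOn fun x hx => hx

theorem ext_preconn (R : ℝ) (hR : 0 ≤ R) : IsPreconnected {w : R2 | R < ‖w‖} := by
  have h1 : IsPreconnected ({0}ᶜ : Set R2) := by
    refine (isPathConnected_compl_singleton_of_one_lt_rank ?_ 0).isConnected.isPreconnected
    rw [rank_fin_fun]; norm_num
  have h2 : {w : R2 | R < ‖w‖} = (fun w : R2 => (1 + R * ‖w‖⁻¹) • w) '' {0}ᶜ := by
    ext w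
    constructor
    · intro hw
      have hw : R < ‖w‖ := hw
      have hw0 : 0 < ‖w‖ := by linarith
      have hlt : 0 < 1 - R / ‖w‖ := by
        rw [sub_pos, div_lt_one hw0]; exact hw
      refine ⟨(1 - R / ‖w‖) • w, ?_, ?_⟩
      · rw [mem_compl_singleton_iff, ne_eq, smul_eq_zero, not_or]
        exact ⟨hlt.ne', norm_pos_iff.1 hw0⟩
      · simp only
        rw [norm_smul, Real.norm_of_nonneg hlt.le, smul_smul]
        have : (1 + R * ((1 - R / ‖w‖) * ‖w‖)⁻¹) * (1 - R / ‖w‖) = 1 := by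
          have : ‖w‖ - R ≠ 0 := by linarith
          have e : (1 - R / ‖w‖) = (‖w‖ - R) / ‖w‖ := by field_simp
          rw [e]; field_simp; ring
        rw [this, one_smul]
    · rintro ⟨w, hw, rfl⟩
      have hw0 : 0 < ‖w‖ := norm_pos_iff.2 hw
      show R < ‖(1 + R * ‖w‖⁻¹) • w‖
      rw [norm_smul, Real.norm_of_nonneg (by positivity)]
      field_simp; linarith
  rw [h2]
  refine h1.image _ ?_
  have h3 : ContinuousOn (fun w : R2 => ‖w‖⁻¹) {0}ᶜ :=
    (continuous_norm.continuousOn (s := ({0}ᶜ : Set R2))).inv₀ fun x hx => norm_ne_zero_iff.2 hx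
  have h4 : ContinuousOn (fun w : R2 => 1 + R * ‖w‖⁻¹) {0}ᶜ := by fun_prop
  exact h4.smul continuousOn_id
end

section
open Set Topology unitInterval

theorem log_exists {S : Type} [TopologicalSpace S] [T2Space S] [CompactSpace S] [ConnectedSpace S]
    (hS : LocPlane S) {G : Set S} (hGc : IsClosed G) (hG : ∀ p ∈ G, LocalStrands S G 1 p)
    (hC : ComponentsHomeo S Gᶜ R2) {f : S → ℂ} (hf : Continuous f) (h0 : ∀ x, f x ≠ 0) :
    HasLog f univ := by
  obtain ⟨g, hg, hgf⟩ := log_off hS hC hf h0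
  obtain ⟨W, hW, hGW, μ, hμ, hμf⟩ := log_extend hGc (hf.pow 2) (fun x => pow_ne_zero 2 (h0 x))
    (log_sq_on hG hf h0 hg hgf)
  have hμf : ∀ x ∈ W, Complex.exp (μ x) = f x ^ 2 := hμf
  have hopen : ∀ x ∈ Gᶜ, IsOpen (connectedComponentIn Gᶜ x) := by
    intro x hx
    obtain ⟨j, hj, hjr⟩ := comp_emb hS hC hx
    exact hjr ▸ hj.isOpen_range
  have hU : ∀ U : Set S, ∃ (c : ℂ) (C : Set S), (∃ x ∈ Gᶜ, U = connectedComponentIn Gᶜ x) →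
      Complex.exp c = 1 ∧ IsClosed C ∧ C ⊆ U ∧ ∀ y ∈ U, y ∉ C → y ∈ W ∧ μ y = 2 * g y - c := by
    intro U
    by_cases hx : ∃ x ∈ Gᶜ, U = connectedComponentIn Gᶜ x
    swap
    · exact ⟨0, ∅, fun h => absurd h hx⟩
    obtain ⟨x, hx, rfl⟩ := hx
    obtain ⟨j, hj, hjr⟩ := comp_emb hS hC hx
    have hjG : ∀ z, j z ∈ Gᶜ := fun z => connectedComponentIn_subset Gᶜ x (hjr ▸ mem_range_self z)
    -- the part of the component outside `W` is compact
    have hcl : IsClosed (connectedComponentIn Gᶜ x ∩ Wᶜ) := by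
      rw [← isOpen_compl_iff, isOpen_iff_mem_nhds]
      intro y hy
      by_cases hyW : y ∈ W
      · filter_upwards [hW.mem_nhds hyW] with z hz hz'
        exact hz'.2 hz
      · have hyG : y ∈ Gᶜ := fun h => hyW (hGW h)
        filter_upwards [(hopen y hyG).mem_nhds (mem_connectedComponentIn hyG)] with z hz hz'
        refine hy ⟨?_, hyW⟩
        rw [connectedComponentIn_eq hz'.1, ← connectedComponentIn_eq hz]
        exact mem_connectedComponentIn hyG
    have hcp : IsCompact (j ⁻¹' (connectedComponentIn Gᶜ x ∩ Wᶜ)) := by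
      refine hj.isInducing.isCompact_preimage' hcl.isCompact ?_
      rw [hjr]; exact inter_subset_left
    obtain ⟨R, hR0, hR⟩ : ∃ R : ℝ, 0 ≤ R ∧ j ⁻¹' (connectedComponentIn Gᶜ x ∩ Wᶜ) ⊆ Metric.closedBall 0 R := by
      obtain ⟨R, hR⟩ := hcp.isBounded.subset_closedBall 0
      exact ⟨max R 0, le_max_right _ _, hR.trans (Metric.closedBall_subset_closedBall (le_max_left _ _))⟩
    have hext : ∀ w ∈ {w : R2 | R < ‖w‖}, j w ∈ W := by
      intro w hw
      by_contra h
      have := hR (show w ∈ _ from ⟨hjr ▸ mem_range_self w, h⟩)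
      rw [mem_closedBall_zero_iff] at this
      exact absurd this (not_le.2 hw)
    obtain ⟨w₀, hw₀⟩ : ∃ w₀ : R2, R < ‖w₀‖ := NormedSpace.exists_lt_norm ℝ R2 R
    have hd := fun w (hw : w ∈ {w : R2 | R < ‖w‖}) => log_diff_const (X := {w : R2 | R < ‖w‖})
      (g := fun w => 2 * g (j w)) (g' := fun w => μ (j w)) (ext_preconn R hR0)
      (continuousOn_const.mul (hg.comp hj.continuous.continuousOn fun w _ => hjG w))
      (hμ.comp hj.continuous.continuousOn hext) (fun w hw => by
        rw [hμf _ (hext w hw), two_mul, Complex.exp_add, hgf _ (hjG w), sq]) hw hw₀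
    refine ⟨2 * g (j w₀) - μ (j w₀), j '' Metric.closedBall 0 R, fun _ => ⟨?_, ?_, ?_, ?_⟩⟩
    · rw [Complex.exp_sub, hμf _ (hext w₀ hw₀), two_mul, Complex.exp_add, hgf _ (hjG w₀), ← sq]
      exact div_self (pow_ne_zero 2 (h0 _))
    · exact ((isCompact_closedBall 0 R).image hj.continuous).isClosed
    · rw [← hjr]; exact image_subset_range _ _
    · intro y hy hyC
      rw [← hjr] at hy
      obtain ⟨w, rfl⟩ := hy
      have hw : R < ‖w‖ := by
        by_contra h
        exact hyC ⟨w, mem_closedBall_zero_iff.2 (not_lt.1 h), rfl⟩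
      have := hd w hw
      refine ⟨hext w hw, ?_⟩
      rw [← this]; ring
  choose c C hcC using hU
  classical
  set h : S → ℂ := fun y => if y ∈ G then μ y else 2 * g y - c (connectedComponentIn Gᶜ y) with hh
  have hhc : Continuous h := by
    rw [continuous_iff_continuousAt]
    intro p
    by_cases hp : p ∈ G
    · obtain ⟨N, hN, hpN, ⟨x₁, hx₁, x₂, hx₂, hx⟩, -⟩ := local_side (hG p hp) hf h0 hg hgf
      obtain ⟨-, h1c, h1s, h1⟩ := hcC _ ⟨x₁, hx₁, rfl⟩
      obtain ⟨-, h2c, h2s, h2⟩ := hcC _ ⟨x₂, hx₂, rfl⟩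
      refine (hμ.continuousAt (hW.mem_nhds (hGW hp))).congr ?_
      have hp1 : p ∉ C (connectedComponentIn Gᶜ x₁) := fun h' => connectedComponentIn_subset _ _ (h1s h') hp
      have hp2 : p ∉ C (connectedComponentIn Gᶜ x₂) := fun h' => connectedComponentIn_subset _ _ (h2s h') hp
      filter_upwards [hN.mem_nhds hpN, h1c.isOpen_compl.mem_nhds hp1, h2c.isOpen_compl.mem_nhds hp2] with y hyN hy1 hy2
      by_cases hy : y ∈ G
      · simp [hh, hy]
      · simp only [hh, hy, if_false]
        rcases hx ⟨hyN, hy⟩ with h' | h'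
        · rw [← connectedComponentIn_eq h']; exact (h1 y h' hy1).2
        · rw [← connectedComponentIn_eq h']; exact (h2 y h' hy2).2
    · have hm := (hopen p hp).mem_nhds (mem_connectedComponentIn hp)
      have : ContinuousAt (fun y => 2 * g y - c (connectedComponentIn Gᶜ p)) p :=
        (continuousAt_const.mul (hg.continuousAt (hGc.isOpen_compl.mem_nhds hp))).sub continuousAt_const
      refine this.congr ?_
      filter_upwards [hm] with y hy
      have hyG : y ∉ G := connectedComponentIn_subset _ _ hy
      simp only [hh, hyG, if_false]
      rw [connectedComponentIn_eq hy]
  have hhf : ∀ y, Complex.exp (h y) = f y ^ 2 := by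
    intro y
    by_cases hy : y ∈ G
    · simp only [hh, hy, if_true]; exact hμf y (hGW hy)
    · simp only [hh, hy, if_false]
      rw [Complex.exp_sub, (hcC _ ⟨y, hy, rfl⟩).1, two_mul, Complex.exp_add, hgf y hy, div_one, sq]
  -- `f` is plus or minus `exp (h/2)`
  have hsq : ∀ y, Complex.exp (h y / 2) ^ 2 = f y ^ 2 := by
    intro y
    rw [sq, ← Complex.exp_add, add_halves, hhf]
  have hcl1 : IsClosed {y | Complex.exp (h y / 2) = f y} := isClosed_eq (by fun_prop) hf
  have hcl2 : IsClosed {y | Complex.exp (h y / 2) = - f y} := isClosed_eq (by fun_prop) hf.neg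
  have hcompl : {y | Complex.exp (h y / 2) = f y}ᶜ = {y | Complex.exp (h y / 2) = - f y} := by
    ext y
    simp only [mem_compl_iff, mem_ofPred_eq]
    constructor
    · intro hy
      exact (sq_eq_sq_iff_eq_or_eq_neg.1 (hsq y)).resolve_left hy
    · intro hy hy'
      have h0' := h0 y
      rw [hy'] at hy
      exact h0' (self_eq_neg.1 hy)
  have hclop : IsClopen {y | Complex.exp (h y / 2) = f y} :=
    ⟨hcl1, by rw [← isClosed_compl_iff, hcompl]; exact hcl2⟩
  rcases isClopen_iff.1 hclop with he | he
  · refine ⟨fun y => h y / 2 + Real.pi * Complex.I, by fun_prop, fun y _ => ?_⟩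
    have : y ∈ {y | Complex.exp (h y / 2) = f y}ᶜ := by rw [he]; simp
    rw [hcompl] at this
    have this : Complex.exp (h y / 2) = - f y := this
    rw [Complex.exp_add, this, Complex.exp_pi_mul_I]; ring
  · refine ⟨fun y => h y / 2, by fun_prop, fun y _ => ?_⟩
    have : y ∈ {y | Complex.exp (h y / 2) = f y} := by rw [he]; trivial
    exact this

theorem klein_func {K : Type} [TopologicalSpace K] [T2Space K] {P : ℝ × ℝ → K} (hP : KleinP P) :
    ∃ f : K → ℂ, Continuous f ∧ (∀ x, f x ≠ 0) ∧ ¬ HasLog f univ := by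
  obtain ⟨hPc, hPs, hPr⟩ := hP
  have hs := hPs
  choose X Y hX0 hX1 hY hXY using hs
  set e : ℝ → ℂ := fun x => Complex.exp (2 * Real.pi * Complex.I * x) with he
  have hec : Continuous e := by rw [he]; fun_prop
  have hfe : ∀ x y, |y| ≤ 3 → e (X (P (x, y))) = e x := by
    intro x y hy
    obtain ⟨n, m, hn, -⟩ := (hPr _ _ x y ((hY (P (x, y))).trans (by norm_num)) hy).1 (hXY (P (x, y)))
    simp only [he]
    rw [Complex.exp_eq_exp_iff_exists_int]
    refine ⟨-n, ?_⟩
    have hn' : (x : ℂ) = X (P (x, y)) + n := by exact_mod_cast hn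
    rw [hn']; push_cast; ring
  refine ⟨fun k => e (X k), ?_, fun x => Complex.exp_ne_zero _, ?_⟩
  · rw [continuous_iff_isClosed]
    intro D hD
    have : (fun k => e (X k)) ⁻¹' D = P '' ((Icc 0 1 ×ˢ Icc (-2) 2) ∩ (fun q : ℝ × ℝ => e q.1) ⁻¹' D) := by
      ext k
      constructor
      · intro hk
        exact ⟨(X k, Y k), ⟨⟨⟨hX0 k, (hX1 k).le⟩, abs_le.1 (hY k)⟩, hk⟩, hXY k⟩
      · rintro ⟨⟨x, y⟩, ⟨⟨-, hy⟩, hq⟩, rfl⟩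
        show e (X (P (x, y))) ∈ D
        rw [hfe x y ((abs_le.2 hy).trans (by norm_num))]; exact hq
    rw [this]
    refine (IsCompact.image ?_ hPc).isClosed
    exact (isCompact_Icc.prod isCompact_Icc).inter_right (hD.preimage (hec.comp continuous_fst))
  · rintro ⟨g, hg, hgf⟩
    have hg := continuousOn_univ.1 hg
    have := log_diff_const (X := (univ : Set ℝ)) (g := fun x => g (P (x, 0)))
      (g' := fun x : ℝ => 2 * Real.pi * Complex.I * x) isPreconnected_univ
      (hg.comp (hPc.comp (by fun_prop))).continuousOn (by fun_prop) (fun x _ => by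
        rw [hgf _ (mem_univ _)]; exact hfe x 0 (by norm_num)) (mem_univ 0) (mem_univ 1)
    have hp : P (0, 0) = P (1, 0) := (hPr 0 0 1 0 (by norm_num) (by norm_num)).2 ⟨1, 0, by norm_num, by norm_num⟩
    simp [hp] at this
    have h2 := Complex.two_pi_I_ne_zero
    exact h2 (by linear_combination this)

theorem klein_lower {K : Type} [TopologicalSpace K] [T2Space K] [CompactSpace K] [ConnectedSpace K]
    (hK : LocPlane K) {P : ℝ × ℝ → K} (hP : KleinP P) {G : Set K} (hG : QuasiFillingLoop K G) :
    (crossingPoints K G).ncard ≠ 0 := by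
  intro h
  have he : crossingPoints K G = ∅ := (ncard_eq_zero (crossings_finite hK hG.1)).1 h
  have h1 : ∀ p ∈ G, LocalStrands K G 1 p := by
    intro p hp
    obtain ⟨k, hk1, hk2, hk⟩ := hG.1.2.2 p hp
    have : k = 1 ∨ k = 2 := by omega
    rcases this with rfl | rfl
    · exact hk
    · have : p ∈ crossingPoints K G := ⟨hp, hk⟩
      rw [he] at this
      exact absurd this (notMem_empty p)
  obtain ⟨f, hf, h0, hn⟩ := klein_func hP
  exact hn (log_exists hK hG.1.1 h1 hG.2 hf h0)

theorem lc_klein {K : Type} [TopologicalSpace K] [T2Space K] [CompactSpace K] [ConnectedSpace K]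
    (hK : LocPlane K) (h : IsConnSum2 K (RP 2) (RP 2)) : lc K = 1 := by
  obtain ⟨P, hP⟩ := klein_param K hK h
  have h1 : 1 ∈ {n | ∃ G : Set K, QuasiFillingLoop K G ∧ (crossingPoints K G).ncard = n} := klein_upper hK hP
  have h2 : lc K ≤ 1 := Nat.sInf_le h1
  have h3 : lc K ∈ {n | ∃ G : Set K, QuasiFillingLoop K G ∧ (crossingPoints K G).ncard = n} := Nat.sInf_mem ⟨1, h1⟩
  obtain ⟨G, hG, hn⟩ := h3
  have := klein_lower hK hP hG
  omega
end

/-- Loop-complexity is not subadditive under connected sums: the Klein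
bottle `K = ℝP² # ℝP²` has `lc K = 1` while `lc ℝP² = 0`. -/
theorem lc_not_subadditive (K : Type) [tK : TopologicalSpace K] [T2Space K]
    [CompactSpace K] [ConnectedSpace K] [ChartedSpace (EuclSp 2) K]
    (h : IsConnSum2 K (RP 2) (RP 2)) :
    lc K = 1 ∧ lc (RP 2) = 0 ∧ lc (RP 2) + lc (RP 2) < lc K := by
  have h1 : lc K = 1 := lc_klein (locPlane_of_charted K) h
  have h2 : lc (RP 2) = 0 := lc_RP2
  exact ⟨h1, h2, by rw [h1, h2]; norm_num⟩
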